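/- Let ω be uniformly distributed on (0,1), and let δ₁,…,δ_m be distinct numbers in [0,1]. Then the random vector ( ((1/2) log log t)^{−1/2} · log |ζ(1/2 + i ω t + i (log t)^{−δ_k})| )_{1≤k≤m} converges in distribution, as t → ∞, to a centered real Gaussian vector (X_{δ₁},…,X_{δ_m}) with covariance E(X_γ X_δ) = min(γ,δ) for γ ≠ δ and E(X_δ²) = 1. -/

import Mathlib

open MeasureTheory Filter
open scoped Topology

attribute [local instance] Classical.propDecidable

/-- `log ζ(σ + it)` for `σ > 1/2`: `-∫_σ^∞ (ζ'/ζ)(s+it) ds` when `ζ` has no zero of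
ordinate `t`, and the limit `lim_{η→0+} log ζ(σ + i(t+η))` otherwise. -/
noncomputable def logZetaAux (σ t : ℝ) : ℂ :=
  if ∀ ρ : ℂ, riemannZeta ρ = 0 → ρ.im ≠ t then
    -∫ x in Set.Ioi σ, deriv riemannZeta (x + t * Complex.I) / riemannZeta (x + t * Complex.I)
  else limUnder (nhdsWithin (0 : ℝ) (Set.Ioi 0)) (fun η : ℝ =>
    -∫ x in Set.Ioi σ, deriv riemannZeta (x + (t + η) * Complex.I) /
      riemannZeta (x + (t + η) * Complex.I))

/-- `log ζ(σ + it)`, extended to `σ = 1/2` as the limit from `σ > 1/2`. -/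
noncomputable def logZeta (σ t : ℝ) : ℂ :=
  if 1/2 < σ then logZetaAux σ t
  else limUnder (nhdsWithin (1/2 : ℝ) (Set.Ioi (1/2))) (fun σ' => logZetaAux σ' t)

/-- `γ` is the law of a centered real Gaussian vector with covariance matrix `C`:
every linear combination `∑ μ i * x i` is a centered real normal with
variance `∑ᵢⱼ μ i μ j C i j`. -/
def IsCenteredRealGaussianVector {m : ℕ} (γ : Measure (Fin m → ℝ))
    (C : Fin m → Fin m → ℝ) : Prop :=
  IsProbabilityMeasure γ ∧
  ∀ μ : Fin m → ℝ, γ.map (fun x => ∑ i, μ i * x i)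
      = ProbabilityTheory.gaussianReal 0 (∑ i, ∑ j, μ i * μ j * C i j).toNNReal

theorem integral_exp_mul_gaussian (ε : ℝ) (hε : 0 < ε) (x : ℝ) :
    ∫ t : ℝ, Complex.exp (-(Complex.I * t * x)) * (Real.exp (-ε * t ^ 2) : ℂ) =
      ((√(Real.pi / ε) * Real.exp (-(1 / (4 * ε)) * x ^ 2) : ℝ) : ℂ) := by
  have h := fourierIntegral_gaussian (b := (ε : ℂ)) (by simpa using hε) (-(x : ℂ))
  have h1 : ∀ t : ℝ, Complex.exp (-(Complex.I * t * x)) * (Real.exp (-ε * t ^ 2) : ℂ) =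
      Complex.exp (Complex.I * (-(x : ℂ)) * t) * Complex.exp (-(ε : ℂ) * (t : ℂ) ^ 2) := by
    intro t
    push_cast
    congr 2
    ring
  simp_rw [h1, h]
  push_cast
  congr 1
  · rw [Real.sqrt_eq_rpow, Complex.ofReal_cpow (by positivity)]
    push_cast
    rfl
  · congr 1
    field_simp

theorem integral_normSq_fourier_mul_gaussian_le (g : ℝ → ℝ) (hg : Integrable g)
    (hg2 : Integrable (fun v => g v ^ 2)) {ε : ℝ} (hε : 0 < ε) :
    ∫ t : ℝ, ‖∫ v : ℝ, Complex.exp (-(Complex.I * t * v)) * g v‖ ^ 2 * Real.exp (-ε * t ^ 2) ≤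
      2 * Real.pi * ∫ v, g v ^ 2 := by
  set k : ℝ → ℝ := fun x => √(Real.pi / ε) * Real.exp (-(1 / (4 * ε)) * x ^ 2) with hk
  have hkpos : ∀ x, 0 ≤ k x := fun x => by positivity
  have hb : 0 < 1 / (4 * ε) := by positivity
  have hkint : Integrable k := (integrable_exp_neg_mul_sq hb).const_mul _
  have hk1 : ∫ x, k x = 2 * Real.pi := by
    rw [hk, integral_const_mul, integral_gaussian, ← Real.sqrt_mul (by positivity)]
    rw [show Real.pi / ε * (Real.pi / (1 / (4 * ε))) = (2 * Real.pi) ^ 2 by field_simp; ring]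
    exact Real.sqrt_sq (by positivity)
  -- the double integral representation of the squared norm
  have hrep : ∀ t : ℝ, ((‖∫ v : ℝ, Complex.exp (-(Complex.I * t * v)) * g v‖ ^ 2 *
        Real.exp (-ε * t ^ 2) : ℝ) : ℂ) =
      ∫ z : ℝ × ℝ, (Complex.exp (-(Complex.I * t * (z.1 - z.2 : ℝ))) * (Real.exp (-ε * t ^ 2) : ℂ))
        * (g z.1 * g z.2 : ℂ) := by
    intro t
    have hconj : (starRingEnd ℂ) (∫ v : ℝ, Complex.exp (-(Complex.I * t * v)) * g v) =
        ∫ v : ℝ, Complex.exp (Complex.I * t * v) * g v := by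
      rw [← integral_conj]
      congr 1
      ext v
      simp [← Complex.exp_conj]
    push_cast
    rw [← Complex.mul_conj', hconj, ← integral_prod_mul, ← integral_mul_const]
    congr 1
    ext z
    rw [show Complex.exp (-(Complex.I * t * (z.1 - z.2 : ℂ))) =
      Complex.exp (-(Complex.I * t * z.1)) * Complex.exp (Complex.I * t * z.2) by
        rw [← Complex.exp_add]; congr 1; ring]
    ring
  have hgg : Integrable (fun z : ℝ × ℝ => (g z.1 * g z.2 : ℂ)) :=
    hg.ofReal.mul_prod hg.ofReal
  have hgauss : Integrable (fun t : ℝ => (Real.exp (-ε * t ^ 2) : ℂ)) :=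
    (integrable_exp_neg_mul_sq hε).ofReal
  have hswapint : Integrable (Function.uncurry (fun (t : ℝ) (z : ℝ × ℝ) =>
      (Complex.exp (-(Complex.I * t * (z.1 - z.2 : ℝ))) * (Real.exp (-ε * t ^ 2) : ℂ))
        * (g z.1 * g z.2 : ℂ))) (volume.prod volume) := by
    have h0 := hgauss.mul_prod hgg
    rw [← Measure.volume_eq_prod] at h0
    have h1 : Function.uncurry (fun (t : ℝ) (z : ℝ × ℝ) =>
      (Complex.exp (-(Complex.I * t * (z.1 - z.2 : ℝ))) * (Real.exp (-ε * t ^ 2) : ℂ))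
        * (g z.1 * g z.2 : ℂ)) = fun w : ℝ × (ℝ × ℝ) =>
        Complex.exp (-(Complex.I * w.1 * (w.2.1 - w.2.2 : ℝ))) *
        ((Real.exp (-ε * w.1 ^ 2) : ℂ) * (g w.2.1 * g w.2.2 : ℂ)) := by
      ext w
      simp only [Function.uncurry]
      ring
    rw [h1]
    refine h0.bdd_mul (c := 1) ?_ ?_
    · apply Continuous.aestronglyMeasurable
      fun_prop
    · refine Eventually.of_forall fun w => ?_
      rw [Complex.norm_exp]
      simp
  have hmain : ((∫ t : ℝ, ‖∫ v : ℝ, Complex.exp (-(Complex.I * t * v)) * g v‖ ^ 2 *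
        Real.exp (-ε * t ^ 2) : ℝ) : ℂ) =
      ((∫ z : ℝ × ℝ, k (z.1 - z.2) * (g z.1 * g z.2) : ℝ) : ℂ) := by
    rw [← integral_complex_ofReal]
    simp_rw [hrep]
    rw [integral_integral_swap hswapint, ← integral_complex_ofReal]
    congr 1
    ext z
    rw [integral_mul_const, integral_exp_mul_gaussian ε hε]
    push_cast [hk]
    ring
  have hmain' := Complex.ofReal_injective hmain
  rw [hmain']
  have e1 : Integrable (fun z : ℝ × ℝ => g z.2 ^ 2 * k (z.1 - z.2)) (volume.prod volume) := by
    have := Integrable.convolution_integrand (ContinuousLinearMap.mul ℝ ℝ)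
      (μ := volume) (ν := volume) hg2 hkint
    simpa using this
  have ksymm : ∀ x y, k (x - y) = k (y - x) := fun x y => by
    simp only [hk]; congr 3; ring
  have e2 : Integrable (fun z : ℝ × ℝ => g z.1 ^ 2 * k (z.1 - z.2)) (volume.prod volume) := by
    have := e1.swap
    refine this.congr (Eventually.of_forall fun z => ?_)
    simp only [Function.comp, Prod.fst_swap, Prod.snd_swap]
    rw [ksymm]
  have v1 : ∫ z : ℝ × ℝ, g z.1 ^ 2 * k (z.1 - z.2) = 2 * Real.pi * ∫ v, g v ^ 2 := by
    rw [Measure.volume_eq_prod, integral_prod _ e2]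
    simp_rw [integral_const_mul]
    have : ∀ x, ∫ y, k (x - y) = 2 * Real.pi := fun x => by
      rw [integral_sub_left_eq_self k volume x, hk1]
    simp_rw [this]
    rw [integral_mul_const]
    ring
  have v2 : ∫ z : ℝ × ℝ, g z.2 ^ 2 * k (z.1 - z.2) = 2 * Real.pi * ∫ v, g v ^ 2 := by
    rw [Measure.volume_eq_prod, integral_prod_symm _ e1]
    simp_rw [integral_const_mul]
    have : ∀ y, ∫ x, k (x - y) = 2 * Real.pi := fun y => by
      rw [integral_sub_right_eq_self k y, hk1]
    simp_rw [this]
    rw [integral_mul_const]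
    ring
  calc ∫ z : ℝ × ℝ, k (z.1 - z.2) * (g z.1 * g z.2)
      ≤ ∫ z : ℝ × ℝ, (1 / 2) * (g z.1 ^ 2 * k (z.1 - z.2) + g z.2 ^ 2 * k (z.1 - z.2)) := by
        rw [Measure.volume_eq_prod]
        have e3 : Integrable (fun z : ℝ × ℝ =>
            (1 / 2) * (g z.1 ^ 2 * k (z.1 - z.2) + g z.2 ^ 2 * k (z.1 - z.2)))
            (volume.prod volume) := (e2.add e1).const_mul _
        have e4 : Integrable (fun z : ℝ × ℝ => k (z.1 - z.2) * (g z.1 * g z.2))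
            (volume.prod volume) := by
          refine (hg.mul_prod hg).bdd_mul (c := √(Real.pi / ε)) ?_ ?_
          · apply Continuous.aestronglyMeasurable
            fun_prop
          · refine Eventually.of_forall fun z => ?_
            rw [Real.norm_of_nonneg (hkpos _)]
            refine mul_le_of_le_one_right (by positivity) (Real.exp_le_one_iff.2 ?_)
            have := sq_nonneg (z.1 - z.2)
            have h2 : 0 ≤ 1 / (4 * ε) * (z.1 - z.2) ^ 2 := by positivity
            linarith
        refine integral_mono e4 e3 fun z => ?_
        have h1 := mul_nonneg (hkpos (z.1 - z.2)) (sq_nonneg (g z.1 - g z.2))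
        dsimp only
        nlinarith [h1]
    _ = 2 * Real.pi * ∫ v, g v ^ 2 := by
        rw [integral_const_mul]
        rw [Measure.volume_eq_prod] at v1 v2 ⊢
        rw [integral_add e2 e1, v1, v2]
        ring

/-- Bessel's inequality for the Fourier integral of a function in `L¹ ∩ L²`. -/
theorem lintegral_normSq_fourier_le (g : ℝ → ℝ) (hg : Integrable g)
    (hg2 : Integrable (fun v => g v ^ 2)) :
    ∫⁻ t : ℝ, ENNReal.ofReal (‖∫ v : ℝ, Complex.exp (-(Complex.I * t * v)) * g v‖ ^ 2) ≤
      ENNReal.ofReal (2 * Real.pi * ∫ v, g v ^ 2) := by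
  set G : ℝ → ℂ := fun t => ∫ v : ℝ, Complex.exp (-(Complex.I * t * v)) * g v with hG
  have hnorm : ∀ t v : ℝ, ‖Complex.exp (-(Complex.I * t * v)) * g v‖ = ‖g v‖ := by
    intro t v
    rw [norm_mul, Complex.norm_exp]
    simp
  have hGcont : Continuous G := by
    refine continuous_of_dominated (bound := fun v => ‖g v‖) ?_ ?_ hg.norm ?_
    · intro t
      refine AEStronglyMeasurable.mul ?_ hg.ofReal.aestronglyMeasurable
      apply Continuous.aestronglyMeasurable
      fun_prop
    · exact fun t => Eventually.of_forall fun v => (hnorm t v).le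
    · refine Eventually.of_forall fun v => ?_
      fun_prop
  have hGbd : ∀ t, ‖G t‖ ≤ ∫ v, ‖g v‖ := fun t => by
    refine (norm_integral_le_integral_norm _).trans_eq ?_
    simp_rw [hnorm]
  have hstep : ∀ n : ℕ, ∫⁻ t : ℝ, ENNReal.ofReal (‖G t‖ ^ 2 *
      Real.exp (-(1 / ((n : ℝ) + 1)) * t ^ 2)) ≤ ENNReal.ofReal (2 * Real.pi * ∫ v, g v ^ 2) := by
    intro n
    have hpos : 0 < 1 / ((n : ℝ) + 1) := by positivity
    rw [← ofReal_integral_eq_lintegral_ofReal]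
    · exact ENNReal.ofReal_le_ofReal (integral_normSq_fourier_mul_gaussian_le g hg hg2 hpos)
    · refine (integrable_exp_neg_mul_sq hpos).bdd_mul (c := (∫ v, ‖g v‖) ^ 2) ?_ ?_
      · exact (hGcont.norm.pow 2).aestronglyMeasurable
      · refine Eventually.of_forall fun t => ?_
        rw [norm_pow, norm_norm]
        exact pow_le_pow_left₀ (norm_nonneg _) (hGbd t) 2
    · exact Eventually.of_forall fun t => by positivity
  calc ∫⁻ t : ℝ, ENNReal.ofReal (‖G t‖ ^ 2)
      = ∫⁻ t : ℝ, liminf (fun n : ℕ => ENNReal.ofReal (‖G t‖ ^ 2 *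
          Real.exp (-(1 / ((n : ℝ) + 1)) * t ^ 2))) atTop := by
        congr 1
        ext t
        refine (Tendsto.liminf_eq ?_).symm
        refine ENNReal.tendsto_ofReal ?_
        have h1 : Tendsto (fun n : ℕ => -(1 / ((n : ℝ) + 1)) * t ^ 2) atTop (𝓝 (-0 * t ^ 2)) :=
          tendsto_one_div_add_atTop_nhds_zero_nat.neg.mul_const _
        have h2 := ((Real.continuous_exp.tendsto _).comp h1).const_mul (‖G t‖ ^ 2)
        simpa using h2
    _ ≤ liminf (fun n : ℕ => ∫⁻ t : ℝ, ENNReal.ofReal (‖G t‖ ^ 2 *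
          Real.exp (-(1 / ((n : ℝ) + 1)) * t ^ 2))) atTop := by
        refine lintegral_liminf_le fun n => ?_
        apply Measurable.ennreal_ofReal
        exact ((hGcont.norm.pow 2).mul (by fun_prop)).measurable
    _ ≤ ENNReal.ofReal (2 * Real.pi * ∫ v, g v ^ 2) := by
        refine liminf_le_of_frequently_le' (Frequently.of_forall hstep)

theorem integrableOn_fract_mul_cpow {s : ℂ} (hs : 0 < s.re) :
    IntegrableOn (fun t : ℝ => ((Int.fract t : ℝ) : ℂ) * (t : ℂ) ^ (-(s + 1))) (Set.Ioi 1) := by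
  have h1 : IntegrableOn (fun t : ℝ => (t : ℂ) ^ (-(s + 1))) (Set.Ioi 1) :=
    integrableOn_Ioi_cpow_of_lt (by simpa using hs) one_pos
  refine h1.bdd_mul (c := 1) ?_ ?_
  · exact (Complex.measurable_ofReal.comp measurable_fract).aestronglyMeasurable
  · refine Eventually.of_forall fun t => ?_
    rw [Complex.norm_real, Real.norm_of_nonneg (Int.fract_nonneg t)]
    exact (Int.fract_lt_one t).le

theorem norm_integral_fract_mul_cpow_le {s : ℂ} (hs : 1 / 2 ≤ s.re) :
    ‖∫ t in Set.Ioi (1 : ℝ), ((Int.fract t : ℝ) : ℂ) * (t : ℂ) ^ (-(s + 1))‖ ≤ 2 := by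
  have h2 : ∫ t in Set.Ioi (1 : ℝ), t ^ (-(3 / 2) : ℝ) = 2 := by
    rw [integral_Ioi_rpow_of_lt (by norm_num) one_pos]
    norm_num
  rw [← h2]
  refine norm_integral_le_of_norm_le (integrableOn_Ioi_rpow_of_lt (by norm_num) one_pos) ?_
  refine (ae_restrict_iff' measurableSet_Ioi).2 (Eventually.of_forall fun t ht => ?_)
  have ht1 : (1 : ℝ) < t := ht
  rw [norm_mul, Complex.norm_real, Real.norm_of_nonneg (Int.fract_nonneg t),
    Complex.norm_cpow_eq_rpow_re_of_pos (by linarith)]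
  calc Int.fract t * t ^ (-(s + 1)).re ≤ 1 * t ^ (-(s + 1)).re := by
        gcongr
        exact (Int.fract_lt_one t).le
    _ ≤ t ^ (-(3 / 2) : ℝ) := by
        rw [one_mul]
        refine Real.rpow_le_rpow_of_exponent_le ht1.le ?_
        simp
        linarith

theorem riemannZeta_eq_of_one_lt_re {s : ℂ} (hs : 1 < s.re) :
    riemannZeta s = s / (s - 1) -
      s * ∫ t in Set.Ioi (1 : ℝ), ((Int.fract t : ℝ) : ℂ) * (t : ℂ) ^ (-(s + 1)) := by
  have hs1 : s - 1 ≠ 0 := by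
    intro h
    have : s = 1 := by linear_combination h
    simp [this] at hs
  have hO : (fun n : ℕ => ∑ k ∈ Finset.Icc 1 n, ‖(1 : ℕ → ℂ) k‖) =O[atTop]
      fun n => (n : ℝ) ^ (1 : ℝ) := by
    simp only [Pi.one_apply, norm_one, Finset.sum_const, Nat.card_Icc, Real.rpow_one]
    simp
    exact Asymptotics.isBigO_refl _ _
  have h := LSeries_eq_mul_integral' (1 : ℕ → ℂ) zero_le_one hs hO
  rw [LSeries_one_eq_riemannZeta hs] at h
  rw [h]
  have hInt : IntegrableOn (fun t : ℝ => (t : ℂ) ^ (-s)) (Set.Ioi 1) :=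
    integrableOn_Ioi_cpow_of_lt (by simpa using hs) one_pos
  have h3 : ∫ t in Set.Ioi (1 : ℝ), (t : ℂ) ^ (-s) = 1 / (s - 1) := by
    rw [integral_Ioi_cpow_of_lt (by simpa using hs) one_pos]
    rw [Complex.ofReal_one, Complex.one_cpow, show -s + 1 = -(s - 1) by ring, neg_div_neg_eq]
  have h4 : ∫ t in Set.Ioi (1 : ℝ), (∑ k ∈ Finset.Icc 1 ⌊t⌋₊, (1 : ℕ → ℂ) k) *
      (t : ℂ) ^ (-(s + 1)) = ∫ t in Set.Ioi (1 : ℝ), ((t : ℂ) ^ (-s) -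
        ((Int.fract t : ℝ) : ℂ) * (t : ℂ) ^ (-(s + 1))) := by
    refine setIntegral_congr_fun measurableSet_Ioi fun t ht => ?_
    have ht1 : (1 : ℝ) < t := ht
    have ht0 : (t : ℂ) ≠ 0 := by
      exact_mod_cast (by linarith : t ≠ 0)
    simp only [Pi.one_apply, Finset.sum_const, Nat.card_Icc, add_tsub_cancel_right, nsmul_eq_mul,
      mul_one]
    have e1 : (t : ℂ) ^ (-s) = t * (t : ℂ) ^ (-(s + 1)) := by
      rw [show -s = 1 + -(s + 1) by ring, Complex.cpow_add _ _ ht0, Complex.cpow_one]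
    have e2 : ((⌊t⌋₊ : ℝ) : ℂ) = ((t - Int.fract t : ℝ) : ℂ) := by
      congr 1
      rw [Int.self_sub_fract, natCast_floor_eq_intCast_floor (by linarith)]
    push_cast at e2
    rw [e1, e2]
    ring
  rw [h4, integral_sub hInt (integrableOn_fract_mul_cpow (by linarith)), h3]
  ring

theorem differentiableAt_integral_fract_mul_cpow {s : ℂ} (hs : 0 < s.re) :
    DifferentiableAt ℂ
      (fun s : ℂ => ∫ t in Set.Ioi (1 : ℝ), ((Int.fract t : ℝ) : ℂ) * (t : ℂ) ^ (-(s + 1))) s := by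
  set f : ℝ → ℂ := (Set.Ioi (1 : ℝ)).indicator (fun t => ((Int.fract t : ℝ) : ℂ)) with hf
  have hfm : Measurable f :=
    (Complex.measurable_ofReal.comp measurable_fract).indicator measurableSet_Ioi
  have hfb : ∀ t, ‖f t‖ ≤ 1 := by
    intro t
    refine (norm_indicator_le_norm_self _ _).trans ?_
    rw [Complex.norm_real, Real.norm_of_nonneg (Int.fract_nonneg t)]
    exact (Int.fract_lt_one t).le
  have key : DifferentiableAt ℂ (mellin f) (-s) := by
    refine mellin_differentiableAt_of_isBigO_rpow (a := 0) (b := -s.re - 1) ?_ ?_ ?_ ?_ ?_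
    · refine LocallyIntegrable.locallyIntegrableOn ?_ _
      refine (locallyIntegrable_const (1 : ℝ)).mono hfm.aestronglyMeasurable ?_
      exact Eventually.of_forall fun t => by simpa using hfb t
    · simp only [neg_zero, Real.rpow_zero]
      exact Asymptotics.IsBigO.of_bound 1 (Eventually.of_forall fun t => by simpa using hfb t)
    · simpa using hs
    · refine Asymptotics.IsBigO.of_bound 1 ?_
      filter_upwards [Ioo_mem_nhdsGT (zero_lt_one (α := ℝ))] with t ht
      have : f t = 0 := Set.indicator_of_notMem (by simpa using ht.2.le) _
      rw [this, norm_zero]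
      positivity
    · simp
  have : (fun s : ℂ => ∫ t in Set.Ioi (1 : ℝ), ((Int.fract t : ℝ) : ℂ) * (t : ℂ) ^ (-(s + 1))) =
      fun s => mellin f (-s) := by
    ext s
    rw [mellin, ← integral_indicator measurableSet_Ioi, ← integral_indicator measurableSet_Ioi]
    congr 1
    ext t
    by_cases h1 : (1 : ℝ) < t
    · rw [Set.indicator_of_mem (by exact h1), Set.indicator_of_mem (by
        exact lt_trans one_pos h1), hf, Set.indicator_of_mem (by exact h1), smul_eq_mul, mul_comm]
      congr 2
      ring
    · rw [Set.indicator_of_notMem (by exact h1)]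
      by_cases h0 : (0 : ℝ) < t
      · rw [Set.indicator_of_mem (by exact h0), hf, Set.indicator_of_notMem (by exact h1), smul_zero]
      · rw [Set.indicator_of_notMem (by exact h0)]
  rw [this]
  exact key.comp s differentiableAt_id.neg

theorem riemannZeta₁_eq_of_re_pos {s : ℂ} (hs : 0 < s.re) :
    riemannZeta₁ s = s -
      s * (s - 1) * ∫ t in Set.Ioi (1 : ℝ), ((Int.fract t : ℝ) : ℂ) * (t : ℂ) ^ (-(s + 1)) := by
  have hopen : IsOpen {s : ℂ | 0 < s.re} := isOpen_lt continuous_const Complex.continuous_re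
  have hA : AnalyticOnNhd ℂ (fun s : ℂ => s -
      s * (s - 1) * ∫ t in Set.Ioi (1 : ℝ), ((Int.fract t : ℝ) : ℂ) * (t : ℂ) ^ (-(s + 1)))
      {s : ℂ | 0 < s.re} := by
    refine DifferentiableOn.analyticOnNhd ?_ hopen
    intro z hz
    have := differentiableAt_integral_fract_mul_cpow (s := z) hz
    exact (differentiableAt_id.sub ((differentiableAt_id.mul
      (differentiableAt_id.sub_const 1)).mul this)).differentiableWithinAt
  have hB : AnalyticOnNhd ℂ riemannZeta₁ {s : ℂ | 0 < s.re} := fun z _ =>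
    differentiable_riemannZeta₁.analyticAt z
  have hconn : IsPreconnected {s : ℂ | 0 < s.re} := (convex_halfSpace_re_gt 0).isPreconnected
  refine hB.eqOn_of_preconnected_of_eventuallyEq hA hconn (z₀ := 2) (by simp) ?_ hs
  have : {s : ℂ | 1 < s.re} ∈ 𝓝 (2 : ℂ) :=
    (isOpen_lt continuous_const Complex.continuous_re).mem_nhds (by simp)
  filter_upwards [this] with z hz
  have hz1 : z ≠ 1 := by
    rintro rfl
    simp at hz
  have hz1' : z - 1 ≠ 0 := sub_ne_zero.2 hz1
  have h1 := riemannZeta_eq_inv_sub_mul hz1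
  rw [riemannZeta_eq_of_one_lt_re hz] at h1
  have h2 : riemannZeta₁ z = (z - 1) * ((z - 1)⁻¹ * riemannZeta₁ z) := by
    field_simp
  rw [h2, ← h1]
  field_simp

theorem norm_riemannZeta₁_le {s : ℂ} (hs : 1 / 2 ≤ s.re) :
    ‖riemannZeta₁ s‖ ≤ 3 * (1 + ‖s‖) ^ 2 := by
  rw [riemannZeta₁_eq_of_re_pos (by linarith)]
  refine (norm_sub_le _ _).trans ?_
  rw [norm_mul, norm_mul]
  have h1 := norm_integral_fract_mul_cpow_le hs
  have h2 : ‖s - 1‖ ≤ ‖s‖ + 1 := (norm_sub_le _ _).trans_eq (by simp)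
  have h3 := norm_nonneg s
  calc _ ≤ ‖s‖ + ‖s‖ * (‖s‖ + 1) * 2 := by gcongr
    _ ≤ _ := by nlinarith

theorem integrableOn_fract_mul_cpow_Ioi_zero {s : ℂ} (hs : 0 < s.re) (hs1 : s.re < 1) :
    IntegrableOn (fun t : ℝ => ((Int.fract t : ℝ) : ℂ) * (t : ℂ) ^ (-(s + 1))) (Set.Ioi 0) ∧
    ∫ t in Set.Ioi (0 : ℝ), ((Int.fract t : ℝ) : ℂ) * (t : ℂ) ^ (-(s + 1)) = - riemannZeta s / s := by
  have hs0 : s ≠ 0 := by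
    rintro rfl
    simp at hs
  have hs1' : s ≠ 1 := by
    rintro rfl
    simp at hs1
  have hs2 : s - 1 ≠ 0 := sub_ne_zero.2 hs1'
  have hs3 : 1 - s ≠ 0 := sub_ne_zero.2 hs1'.symm
  have hcongr : ∀ᵐ t : ℝ ∂volume.restrict (Set.Ioc 0 1),
      (t : ℂ) ^ (-s) = ((Int.fract t : ℝ) : ℂ) * (t : ℂ) ^ (-(s + 1)) := by
    refine (ae_restrict_iff' measurableSet_Ioc).2 ?_
    filter_upwards [Measure.ae_ne volume (1 : ℝ)] with t ht1 ht
    have ht0 : (t : ℂ) ≠ 0 := by exact_mod_cast ht.1.ne'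
    rw [Int.fract_eq_self.2 ⟨ht.1.le, lt_of_le_of_ne ht.2 ht1⟩,
      show -s = 1 + -(s + 1) by ring, Complex.cpow_add _ _ ht0, Complex.cpow_one]
  have hre : -1 < (-s).re := by simp; linarith
  have hi0 : IntegrableOn (fun t : ℝ => (t : ℂ) ^ (-s)) (Set.Ioc 0 1) :=
    (intervalIntegrable_iff_integrableOn_Ioc_of_le zero_le_one).1
      (intervalIntegral.intervalIntegrable_cpow' hre)
  have hi1 : IntegrableOn (fun t : ℝ => ((Int.fract t : ℝ) : ℂ) * (t : ℂ) ^ (-(s + 1))) (Set.Ioc 0 1) :=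
    Integrable.congr hi0 hcongr
  have hv1 : ∫ t in Set.Ioc (0 : ℝ) 1, ((Int.fract t : ℝ) : ℂ) * (t : ℂ) ^ (-(s + 1)) = 1 / (1 - s) := by
    rw [← integral_congr_ae hcongr, ← intervalIntegral.integral_of_le zero_le_one,
      integral_cpow (Or.inl hre)]
    have : -s + 1 ≠ 0 := by rw [neg_add_eq_sub]; exact hs3
    rw [Complex.ofReal_zero, Complex.zero_cpow this]
    simp [neg_add_eq_sub]
  have hi2 := integrableOn_fract_mul_cpow hs
  have hU : Set.Ioc (0 : ℝ) 1 ∪ Set.Ioi 1 = Set.Ioi 0 := Set.Ioc_union_Ioi_eq_Ioi zero_le_one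
  refine ⟨hU ▸ hi1.union hi2, ?_⟩
  rw [← hU, setIntegral_union (Set.Ioc_disjoint_Ioi le_rfl) measurableSet_Ioi hi1 hi2, hv1]
  have h1 := riemannZeta_eq_inv_sub_mul hs1'
  rw [riemannZeta₁_eq_of_re_pos hs] at h1
  rw [h1]
  field_simp
  ring

/-- Bessel's inequality on the line `Re s = 1/2` for the Mellin transform. -/
theorem lintegral_normSq_mellin_le (Φ : ℝ → ℝ)
    (h1 : IntegrableOn (fun u => Φ u * u ^ (-(3 / 2) : ℝ)) (Set.Ioi 0))
    (h2 : IntegrableOn (fun u => Φ u ^ 2 / u ^ 2) (Set.Ioi 0)) :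
    ∫⁻ t : ℝ, ENNReal.ofReal
      (‖∫ u in Set.Ioi (0 : ℝ), (Φ u : ℂ) * (u : ℂ) ^ (-((1 / 2 + t * Complex.I) + 1))‖ ^ 2) ≤
      ENNReal.ofReal (2 * Real.pi * ∫ u in Set.Ioi (0 : ℝ), Φ u ^ 2 / u ^ 2) := by
  have hd : ∀ x ∈ (Set.univ : Set ℝ), HasDerivWithinAt Real.exp (Real.exp x) Set.univ x :=
    fun x _ => (Real.hasDerivAt_exp x).hasDerivWithinAt
  have him : Real.exp '' Set.univ = Set.Ioi 0 := by rw [Set.image_univ, Real.range_exp]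
  have hinj : Set.InjOn Real.exp Set.univ := Real.exp_injective.injOn
  set g : ℝ → ℝ := fun v => Φ (Real.exp v) * Real.exp (-(v / 2)) with hg
  have e1 : ∀ v : ℝ, |Real.exp v| • (Φ (Real.exp v) * Real.exp v ^ (-(3 / 2) : ℝ)) = g v := by
    intro v
    rw [abs_of_pos (Real.exp_pos v), ← Real.exp_mul, smul_eq_mul]
    change _ = Φ (Real.exp v) * Real.exp (-(v / 2))
    have : Real.exp (-(v / 2)) = Real.exp v * Real.exp (v * -(3 / 2)) := by
      rw [← Real.exp_add]; congr 1; ring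
    rw [this]; ring
  have e2 : ∀ v : ℝ, |Real.exp v| • (Φ (Real.exp v) ^ 2 / Real.exp v ^ 2) = g v ^ 2 := by
    intro v
    rw [abs_of_pos (Real.exp_pos v), smul_eq_mul, hg, mul_pow, ← Real.exp_nat_mul,
      ← Real.exp_nat_mul, div_eq_mul_inv, ← Real.exp_neg]
    have : Real.exp ((2 : ℕ) * -(v / 2)) = Real.exp v * Real.exp (-((2 : ℕ) * v)) := by
      rw [← Real.exp_add]; congr 1; push_cast; ring
    rw [this]; ring
  have i1 : Integrable g := by
    have := (integrableOn_image_iff_integrableOn_abs_deriv_smul MeasurableSet.univ hd hinj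
      (fun u => Φ u * u ^ (-(3 / 2) : ℝ))).1 (by rwa [him])
    simp_rw [e1] at this
    simpa using this
  have i2 : Integrable (fun v => g v ^ 2) := by
    have := (integrableOn_image_iff_integrableOn_abs_deriv_smul MeasurableSet.univ hd hinj
      (fun u => Φ u ^ 2 / u ^ 2)).1 (by rwa [him])
    simp_rw [e2] at this
    simpa using this
  have v2 : ∫ u in Set.Ioi (0 : ℝ), Φ u ^ 2 / u ^ 2 = ∫ v, g v ^ 2 := by
    rw [← him, integral_image_eq_integral_abs_deriv_smul MeasurableSet.univ hd hinj]
    simp_rw [e2]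
    simp
  have v1 : ∀ t : ℝ, ∫ u in Set.Ioi (0 : ℝ), (Φ u : ℂ) * (u : ℂ) ^ (-((1 / 2 + t * Complex.I) + 1))
      = ∫ v : ℝ, Complex.exp (-(Complex.I * t * v)) * g v := by
    intro t
    rw [← him, integral_image_eq_integral_abs_deriv_smul MeasurableSet.univ hd hinj]
    rw [Measure.restrict_univ]
    congr 1
    ext v
    rw [abs_of_pos (Real.exp_pos v), Complex.cpow_def_of_ne_zero (by
      exact_mod_cast (Real.exp_pos v).ne'), ← Complex.ofReal_log (Real.exp_pos v).le, Real.log_exp,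
      hg]
    push_cast
    rw [Complex.real_smul]
    have : Complex.exp (-(Complex.I * t * v)) * Complex.exp (-((v : ℂ) / 2)) =
        Complex.exp v * Complex.exp (v * -(1 / 2 + t * Complex.I + 1)) := by
      rw [← Complex.exp_add, ← Complex.exp_add]; congr 1; ring
    push_cast
    calc _ = (Φ (Real.exp v) : ℂ) * (Complex.exp v * Complex.exp (v * -(1 / 2 + t * Complex.I + 1)))
          := by ring
      _ = _ := by rw [← this]; ring
  simp_rw [v1]
  rw [v2]
  exact lintegral_normSq_fourier_le g i1 i2

/-- The average `∫₀¹ (G(λu) - G(u)) a λ^{a-1} dλ`. -/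
noncomputable def dilationAverage (a : ℝ) (G : ℝ → ℝ) (u : ℝ) : ℝ :=
  ∫ l in Set.Ioc (0 : ℝ) 1, (G (l * u) - G u) * (a * l ^ (a - 1))

section

variable {a : ℝ} {G : ℝ → ℝ}

theorem integrableOn_dilationKernel (ha : 0 < a) :
    IntegrableOn (fun l : ℝ => a * l ^ (a - 1)) (Set.Ioc 0 1) := by
  refine Integrable.const_mul ?_ a
  exact (intervalIntegrable_iff_integrableOn_Ioc_of_le zero_le_one).1
      (intervalIntegral.intervalIntegrable_rpow' (by linarith))

theorem integral_dilationKernel_mul_rpow (ha : 0 < a) {b : ℝ} (hb : 0 ≤ b) :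
    ∫ l in Set.Ioc (0 : ℝ) 1, l ^ b * (a * l ^ (a - 1)) = a / (a + b) := by
  have : ∫ l in Set.Ioc (0 : ℝ) 1, l ^ b * (a * l ^ (a - 1)) =
      ∫ l in Set.Ioc (0 : ℝ) 1, a * l ^ (b + (a - 1)) := by
    refine setIntegral_congr_fun measurableSet_Ioc fun l hl => ?_
    rw [Real.rpow_add hl.1]
    ring
  rw [this, integral_const_mul, ← intervalIntegral.integral_of_le zero_le_one,
    integral_rpow (Or.inl (by linarith))]
  have : b + (a - 1) + 1 = a + b := by ring
  rw [this, Real.zero_rpow (by linarith)]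
  simp
  rfl

theorem integral_dilationKernel (ha : 0 < a) :
    ∫ l in Set.Ioc (0 : ℝ) 1, a * l ^ (a - 1) = 1 := by
  have := integral_dilationKernel_mul_rpow ha le_rfl
  simpa [ha.ne'] using this

theorem integrableOn_dilation_mul_kernel (ha : 0 < a) (hG : Measurable G) {B : ℝ}
    (hB : ∀ u, |G u| ≤ B) (u : ℝ) :
    IntegrableOn (fun l : ℝ => G (l * u) * (a * l ^ (a - 1))) (Set.Ioc 0 1) := by
  refine (integrableOn_dilationKernel ha).bdd_mul (c := B) ?_ ?_
  · exact (hG.comp (by fun_prop)).aestronglyMeasurable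
  · exact Eventually.of_forall fun l => hB _

theorem dilationAverage_eq (ha : 0 < a) (hG : Measurable G) {B : ℝ}
    (hB : ∀ u, |G u| ≤ B) (u : ℝ) :
    dilationAverage a G u =
      (∫ l in Set.Ioc (0 : ℝ) 1, G (l * u) * (a * l ^ (a - 1))) - G u := by
  rw [dilationAverage]
  simp_rw [sub_mul]
  rw [integral_sub (integrableOn_dilation_mul_kernel ha hG hB u)
    ((integrableOn_dilationKernel ha).const_mul _), integral_const_mul,
    integral_dilationKernel ha, mul_one]

theorem measurable_dilationAverage (hG : Measurable G) : Measurable (dilationAverage a G) := by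
  refine (StronglyMeasurable.integral_prod_right (ν := volume.restrict (Set.Ioc (0 : ℝ) 1))
    (f := fun u l => (G (l * u) - G u) * (a * l ^ (a - 1))) ?_).measurable
  apply Measurable.stronglyMeasurable
  unfold Function.uncurry
  fun_prop

theorem abs_dilationAverage_le (ha : 0 < a) {u B : ℝ} (hB : ∀ l ∈ Set.Ioc (0 : ℝ) 1,
    |G (l * u) - G u| ≤ B) : |dilationAverage a G u| ≤ B := by
  rw [← Real.norm_eq_abs, dilationAverage]
  calc _ ≤ ∫ l in Set.Ioc (0 : ℝ) 1, B * (a * l ^ (a - 1)) := by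
        refine norm_integral_le_of_norm_le ((integrableOn_dilationKernel ha).const_mul _) ?_
        refine (ae_restrict_iff' measurableSet_Ioc).2 (Eventually.of_forall fun l hl => ?_)
        have h1 : 0 ≤ a * l ^ (a - 1) := mul_nonneg ha.le (Real.rpow_nonneg hl.1.le _)
        rw [norm_mul, Real.norm_of_nonneg h1]
        exact mul_le_mul_of_nonneg_right (hB l hl) h1
    _ = B := by rw [integral_const_mul, integral_dilationKernel ha, mul_one]

theorem mellin_dilationAverage (ha : 0 < a) (hG : Measurable G) {B : ℝ}
    (hB : ∀ u, |G u| ≤ B) {s : ℂ} (hs : 0 < s.re)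
    (hInt : IntegrableOn (fun u : ℝ => (G u : ℂ) * (u : ℂ) ^ (-(s + 1))) (Set.Ioi 0)) :
    IntegrableOn (fun u : ℝ => (dilationAverage a G u : ℂ) * (u : ℂ) ^ (-(s + 1))) (Set.Ioi 0) ∧
    ∫ u in Set.Ioi (0 : ℝ), (dilationAverage a G u : ℂ) * (u : ℂ) ^ (-(s + 1)) =
      -(s / (s + a)) * ∫ u in Set.Ioi (0 : ℝ), (G u : ℂ) * (u : ℂ) ^ (-(s + 1)) := by
  have hsa : s + a ≠ 0 := by
    intro h
    have := congrArg Complex.re h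
    simp at this
    linarith
  set K : ℝ × ℝ → ℂ := fun p =>
    ((G (p.2 * p.1) : ℂ) * (p.1 : ℂ) ^ (-(s + 1))) * ((a * p.2 ^ (a - 1) : ℝ) : ℂ) with hK
  have hKm : Measurable K := by
    have h0 : Measurable (fun p : ℝ × ℝ => p.2 * p.1) := by fun_prop
    have h1 : Measurable (fun p : ℝ × ℝ => (G (p.2 * p.1) : ℂ)) :=
      Complex.measurable_ofReal.comp (hG.comp h0)
    have h2 : Measurable (fun p : ℝ × ℝ => (p.1 : ℂ) ^ (-(s + 1))) :=
      (Complex.measurable_ofReal.comp measurable_fst).pow_const _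
    have h3 : Measurable (fun p : ℝ × ℝ => ((a * p.2 ^ (a - 1) : ℝ) : ℂ)) := by
      refine Complex.measurable_ofReal.comp ?_
      fun_prop
    exact (h1.mul h2).mul h3
  have hscale : ∀ l ∈ Set.Ioc (0 : ℝ) 1, ∀ u ∈ Set.Ioi (0 : ℝ),
      (G (l * u) : ℂ) * (u : ℂ) ^ (-(s + 1)) =
      (l : ℂ) ^ (s + 1) * ((fun u : ℝ => (G u : ℂ) * (u : ℂ) ^ (-(s + 1))) (l * u)) := by
    intro l hl u hu
    have hl0 : (l : ℂ) ≠ 0 := by exact_mod_cast hl.1.ne'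
    have : (l : ℂ) ^ (s + 1) * (l : ℂ) ^ (-(s + 1)) = 1 := by
      rw [← Complex.cpow_add _ _ hl0]; simp
    dsimp only
    rw [Complex.ofReal_mul, Complex.mul_cpow_ofReal_nonneg hl.1.le (le_of_lt hu)]
    linear_combination -(G (l * u) : ℂ) * (u : ℂ) ^ (-(s + 1)) * this
  have hrow : ∀ l ∈ Set.Ioc (0 : ℝ) 1, IntegrableOn (fun u => K (u, l)) (Set.Ioi 0) := by
    intro l hl
    have : IntegrableOn (fun u : ℝ => (l : ℂ) ^ (s + 1) *
        ((fun u : ℝ => (G u : ℂ) * (u : ℂ) ^ (-(s + 1))) (l * u))) (Set.Ioi 0) := by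
      refine Integrable.const_mul ?_ _
      refine (integrableOn_Ioi_comp_mul_left_iff
        (fun u : ℝ => (G u : ℂ) * (u : ℂ) ^ (-(s + 1))) 0 hl.1).2 ?_
      simpa using hInt
    exact (this.congr_fun (fun u hu => (hscale l hl u hu).symm) measurableSet_Ioi).mul_const
      ((a * l ^ (a - 1) : ℝ) : ℂ)
  have hval : ∀ l ∈ Set.Ioc (0 : ℝ) 1, ∫ u in Set.Ioi (0 : ℝ), K (u, l) =
      ((l : ℂ) ^ s * ((a * l ^ (a - 1) : ℝ) : ℂ)) *
        ∫ u in Set.Ioi (0 : ℝ), (G u : ℂ) * (u : ℂ) ^ (-(s + 1)) := by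
    intro l hl
    have hl0 : (l : ℂ) ≠ 0 := by exact_mod_cast hl.1.ne'
    simp only [hK]
    rw [integral_mul_const, setIntegral_congr_fun measurableSet_Ioi (hscale l hl),
      integral_const_mul, integral_comp_mul_left_Ioi
        (fun u : ℝ => (G u : ℂ) * (u : ℂ) ^ (-(s + 1))) 0 hl.1, mul_zero, Complex.cpow_add _ _ hl0,
      Complex.cpow_one, Complex.real_smul]
    push_cast
    field_simp
  have hnval : ∀ l ∈ Set.Ioc (0 : ℝ) 1, ∫ u in Set.Ioi (0 : ℝ), ‖K (u, l)‖ =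
      (l ^ s.re * (a * l ^ (a - 1))) *
        ∫ u in Set.Ioi (0 : ℝ), ‖(G u : ℂ) * (u : ℂ) ^ (-(s + 1))‖ := by
    intro l hl
    have hk0 : 0 ≤ a * l ^ (a - 1) := mul_nonneg ha.le (Real.rpow_nonneg hl.1.le _)
    have : ∀ u ∈ Set.Ioi (0 : ℝ), ‖K (u, l)‖ = l ^ (s.re + 1) * (a * l ^ (a - 1)) *
        ((fun u : ℝ => ‖(G u : ℂ) * (u : ℂ) ^ (-(s + 1))‖) (l * u)) := by
      intro u hu
      simp only [hK]
      rw [hscale l hl u hu, norm_mul, norm_mul, Complex.norm_real, Real.norm_of_nonneg hk0,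
        Complex.norm_cpow_eq_rpow_re_of_pos hl.1]
      simp
      ring
    rw [setIntegral_congr_fun measurableSet_Ioi this,
      integral_const_mul, integral_comp_mul_left_Ioi
        (fun u : ℝ => ‖(G u : ℂ) * (u : ℂ) ^ (-(s + 1))‖) 0 hl.1, mul_zero, Real.rpow_add hl.1,
      Real.rpow_one, smul_eq_mul]
    have := hl.1.ne'
    field_simp
  have hprod : Integrable K ((volume.restrict (Set.Ioi (0 : ℝ))).prod
      (volume.restrict (Set.Ioc (0 : ℝ) 1))) := by
    rw [integrable_prod_iff' hKm.aestronglyMeasurable]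
    refine ⟨(ae_restrict_iff' measurableSet_Ioc).2 (Eventually.of_forall hrow), ?_⟩
    have h1 : IntegrableOn (fun l : ℝ => (l ^ s.re * (a * l ^ (a - 1))) *
        ∫ u in Set.Ioi (0 : ℝ), ‖(G u : ℂ) * (u : ℂ) ^ (-(s + 1))‖) (Set.Ioc 0 1) := by
      refine Integrable.mul_const ?_ _
      refine (integrableOn_dilationKernel ha).bdd_mul (c := 1) ?_ ?_
      · exact (measurable_id.pow_const _).aestronglyMeasurable
      · refine (ae_restrict_iff' measurableSet_Ioc).2 (Eventually.of_forall fun l hl => ?_)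
        rw [Real.norm_of_nonneg (Real.rpow_nonneg hl.1.le _)]
        exact Real.rpow_le_one hl.1.le hl.2 hs.le
    exact h1.congr_fun (fun l hl => (hnval l hl).symm) measurableSet_Ioc
  have hcol : ∀ u : ℝ, ∫ l in Set.Ioc (0 : ℝ) 1, K (u, l) =
      ((∫ l in Set.Ioc (0 : ℝ) 1, G (l * u) * (a * l ^ (a - 1)) : ℝ) : ℂ) *
        (u : ℂ) ^ (-(s + 1)) := by
    intro u
    rw [← integral_complex_ofReal, ← integral_mul_const]
    congr 1
    ext l
    simp only [hK]
    push_cast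
    ring
  have hkey : ∫ l in Set.Ioc (0 : ℝ) 1, (l : ℂ) ^ s * ((a * l ^ (a - 1) : ℝ) : ℂ) = a / (s + a) := by
    have : ∫ l in Set.Ioc (0 : ℝ) 1, (l : ℂ) ^ s * ((a * l ^ (a - 1) : ℝ) : ℂ) =
        ∫ l in Set.Ioc (0 : ℝ) 1, (a : ℂ) * (l : ℂ) ^ (s + a - 1) := by
      refine setIntegral_congr_fun measurableSet_Ioc fun l hl => ?_
      have hl0 : (l : ℂ) ≠ 0 := by exact_mod_cast hl.1.ne'
      rw [Complex.ofReal_mul, Complex.ofReal_cpow hl.1.le, add_sub_assoc, Complex.cpow_add _ _ hl0]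
      push_cast
      ring
    rw [this, integral_const_mul, ← intervalIntegral.integral_of_le zero_le_one,
      integral_cpow (Or.inl (by simp; linarith))]
    rw [sub_add_cancel, Complex.ofReal_zero, Complex.zero_cpow hsa]
    simp
    rfl
  have hI := hprod.integral_prod_left
  have hV : ∫ u in Set.Ioi (0 : ℝ), ∫ l in Set.Ioc (0 : ℝ) 1, K (u, l) =
      a / (s + a) * ∫ u in Set.Ioi (0 : ℝ), (G u : ℂ) * (u : ℂ) ^ (-(s + 1)) := by
    rw [integral_integral_swap (f := fun u l => K (u, l)) hprod,
      setIntegral_congr_fun measurableSet_Ioc hval, integral_mul_const, hkey]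
  simp_rw [hcol] at hI hV
  have hsplit : ∀ u : ℝ, (dilationAverage a G u : ℂ) * (u : ℂ) ^ (-(s + 1)) =
      ((∫ l in Set.Ioc (0 : ℝ) 1, G (l * u) * (a * l ^ (a - 1)) : ℝ) : ℂ) *
        (u : ℂ) ^ (-(s + 1)) - (G u : ℂ) * (u : ℂ) ^ (-(s + 1)) := by
    intro u
    rw [dilationAverage_eq ha hG hB]
    push_cast
    ring
  simp_rw [hsplit]
  refine ⟨hI.sub hInt, ?_⟩
  rw [integral_sub hI hInt, hV]
  field_simp
  ring

end

theorem sum_range_int_add_ediv {N : ℕ} (hN : 0 < N) (n : ℤ) :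
    ∑ i ∈ Finset.range N, (n + i) / (N : ℤ) = n := by
  have hN' : (N : ℤ) ≠ 0 := by exact_mod_cast hN.ne'
  have hstep : ∀ n : ℤ, ∑ i ∈ Finset.range N, (n + 1 + i) / (N : ℤ) =
      ∑ i ∈ Finset.range N, (n + i) / (N : ℤ) + 1 := by
    intro n
    have h1 := Finset.sum_range_succ (fun i : ℕ => (n + i) / (N : ℤ)) N
    have h2 := Finset.sum_range_succ' (fun i : ℕ => (n + i) / (N : ℤ)) N
    rw [h1] at h2
    have h3 : (n + (N : ℤ)) / (N : ℤ) = n / N + 1 := by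
      rw [Int.add_ediv_of_dvd_right (dvd_refl _), Int.ediv_self hN']
    have h4 : ∀ i : ℕ, (n + ((i + 1 : ℕ) : ℤ)) / (N : ℤ) = (n + 1 + i) / (N : ℤ) := by
      intro i
      congr 1
      push_cast
      ring
    simp only [h4, h3, Nat.cast_zero, add_zero] at h2
    linarith
  have h0 : ∑ i ∈ Finset.range N, ((0 : ℤ) + i) / (N : ℤ) = 0 := by
    refine Finset.sum_eq_zero fun i hi => ?_
    rw [zero_add]
    exact Int.ediv_eq_zero_of_lt (by positivity) (by exact_mod_cast Finset.mem_range.1 hi)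
  induction n using Int.induction_on with
  | zero => exact h0
  | succ k ih => rw [hstep, ih]
  | pred k ih =>
    have := hstep (-(k : ℤ) - 1)
    rw [sub_add_cancel, ih] at this
    linarith

theorem sum_range_fract_add_div {N : ℕ} (hN : 0 < N) (x : ℝ) :
    ∑ i ∈ Finset.range N, Int.fract (x + i / N) = Int.fract (N * x) + (N - 1) / 2 := by
  have hN' : (N : ℝ) ≠ 0 := by exact_mod_cast hN.ne'
  have h1 : ∀ i : ℕ, (⌊x + i / N⌋ : ℤ) = (⌊(N : ℝ) * x⌋ + i) / (N : ℤ) := by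
    intro i
    have : x + i / N = ((N : ℝ) * x + (i : ℤ)) / (N : ℕ) := by
      push_cast
      field_simp
    rw [this, Int.floor_div_natCast, Int.floor_add_intCast]
  have h2 : ∑ i ∈ Finset.range N, (⌊x + i / N⌋ : ℝ) = ⌊(N : ℝ) * x⌋ := by
    have := sum_range_int_add_ediv hN ⌊(N : ℝ) * x⌋
    simp_rw [← h1] at this
    exact_mod_cast this
  have h3 : ∑ i ∈ Finset.range N, (i : ℝ) = N * (N - 1) / 2 := by
    have h := Finset.sum_range_id_mul_two N
    have h' : (∑ i ∈ Finset.range N, (i : ℝ)) * 2 = N * (N - 1) := by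
      have := congrArg (fun n : ℕ => (n : ℝ)) h
      push_cast [Nat.cast_sub (show 1 ≤ N from hN)] at this
      exact this
    linarith
  simp only [Int.fract, Finset.sum_sub_distrib, h2, Finset.sum_add_distrib, Finset.sum_const,
    Finset.card_range, nsmul_eq_mul, ← Finset.sum_div, h3]
  field_simp
  ring

theorem sum_range_mul_of_periodic {k : ℕ} (F : ℕ → ℝ) (hF : ∀ n, F (n + k) = F n) (g : ℕ) :
    ∑ j ∈ Finset.range (g * k), F j = g * ∑ j ∈ Finset.range k, F j := by
  have hF' : ∀ g n, F (g * k + n) = F n := by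
    intro g
    induction g with
    | zero => simp
    | succ g ih => intro n; rw [← ih n, ← hF (g * k + n)]; congr 1; ring
  induction g with
  | zero => simp
  | succ g ih =>
    rw [Nat.succ_mul, Finset.sum_range_add, ih]
    simp_rw [hF']
    push_cast
    ring

theorem sum_range_comp_mul_of_coprime {k h : ℕ} (hk : 0 < k) (hc : Nat.Coprime h k) (F : ℕ → ℝ)
    (hF : ∀ n, F (n % k) = F n) :
    ∑ j ∈ Finset.range k, F (j * h) = ∑ j ∈ Finset.range k, F j := by
  have hmaps : ∀ j ∈ Finset.range k, j * h % k ∈ Finset.range k := fun j _ =>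
    Finset.mem_range.2 (Nat.mod_lt _ hk)
  have hinj : Set.InjOn (fun j => j * h % k) (Finset.range k : Set ℕ) := by
    intro a ha b hb hab
    have h1 : a * h ≡ b * h [MOD k] := hab
    have h2 : a ≡ b [MOD k] := Nat.ModEq.cancel_right_of_coprime (by
      rw [Nat.gcd_comm]; exact hc) h1
    have ha' : a < k := by simpa using ha
    have hb' : b < k := by simpa using hb
    rw [Nat.ModEq, Nat.mod_eq_of_lt ha', Nat.mod_eq_of_lt hb'] at h2
    exact h2
  refine Finset.sum_nbij (fun j => j * h % k) hmaps hinj ?_ fun j _ => (hF _).symm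
  exact (Finset.surjOn_of_injOn_of_card_le _ hmaps hinj le_rfl)

theorem sum_range_fract_add_mul_div {h k : ℕ} (hh : 0 < h) (hk : 0 < k) (v : ℝ) :
    ∑ j ∈ Finset.range k, Int.fract ((v + j * h) / k) =
      Nat.gcd h k * Int.fract (v / Nat.gcd h k) +
        Nat.gcd h k * (((k / Nat.gcd h k : ℕ) : ℝ) - 1) / 2 := by
  obtain ⟨g, h', k', hg, hcop, rfl, rfl⟩ := Nat.exists_coprime' (m := h) (n := k)
    (Nat.gcd_pos_of_pos_left k hh)
  have hk' : 0 < k' := Nat.pos_of_mul_pos_right hk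
  rw [Nat.gcd_mul_right, hcop, one_mul, Nat.mul_div_cancel _ hg]
  have hgR : (g : ℝ) ≠ 0 := by exact_mod_cast hg.ne'
  have hkR : (k' : ℝ) ≠ 0 := by exact_mod_cast hk'.ne'
  set F : ℕ → ℝ := fun n => Int.fract (v / (g * k') + n / k') with hF
  have hper : ∀ n, F (n + k') = F n := by
    intro n
    simp only [hF]
    rw [show v / (g * k') + ((n + k' : ℕ) : ℝ) / k' = v / (g * k') + n / k' + (1 : ℤ) by
      push_cast; field_simp; ring, Int.fract_add_intCast]
  have hper' : ∀ n q, F (n + k' * q) = F n := by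
    intro n q
    induction q with
    | zero => simp
    | succ q ih => rw [← ih, ← hper (n + k' * q)]; congr 1; ring
  have hmod : ∀ n, F (n % k') = F n := by
    intro n
    conv_rhs => rw [← Nat.mod_add_div n k']
    rw [hper']
  have h1 : ∀ j : ℕ, Int.fract ((v + j * ((h' * g : ℕ) : ℝ)) / ((k' * g : ℕ) : ℝ)) = F (j * h') := by
    intro j
    simp only [hF]
    congr 1
    push_cast
    field_simp
  simp_rw [h1]
  rw [mul_comm k' g, sum_range_mul_of_periodic (fun j => F (j * h'))
    (fun n => by rw [add_mul, mul_comm k' h', mul_comm h' k']; exact hper' _ _),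
    sum_range_comp_mul_of_coprime hk' hcop F hmod]
  simp only [hF]
  rw [sum_range_fract_add_div hk']
  rw [show (k' : ℝ) * (v / (g * k')) = v / g by field_simp]
  ring

/-- The increment of the sawtooth of period `h`. -/
noncomputable def sawIncr (h : ℕ) (y u : ℝ) : ℝ := Int.fract (u / h) - Int.fract ((u - y) / h)

theorem measurable_sawIncr (h : ℕ) (y : ℝ) : Measurable (sawIncr h y) := by
  unfold sawIncr
  fun_prop

theorem abs_sawIncr_le (h : ℕ) (y u : ℝ) : |sawIncr h y u| ≤ 1 := by
  unfold sawIncr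
  have h1 := Int.fract_nonneg (u / h)
  have h2 := (Int.fract_lt_one (u / h)).le
  have h3 := Int.fract_nonneg ((u - y) / h)
  have h4 := (Int.fract_lt_one ((u - y) / h)).le
  rw [abs_le]
  constructor <;> linarith

theorem sawIncr_add_nat_mul {h : ℕ} (hh : 0 < h) (y u : ℝ) (n : ℕ) :
    sawIncr h y (u + n * h) = sawIncr h y u := by
  have hR : (h : ℝ) ≠ 0 := by exact_mod_cast hh.ne'
  unfold sawIncr
  rw [show (u + n * h) / h = u / h + n by field_simp, Int.fract_add_natCast,
    show (u + n * h - y) / h = (u - y) / h + n by field_simp; ring, Int.fract_add_natCast]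

theorem sum_range_sawIncr {h k : ℕ} (hh : 0 < h) (hk : 0 < k) (y v : ℝ) :
    ∑ j ∈ Finset.range k, sawIncr k y (v + j * h) = Nat.gcd h k * sawIncr (Nat.gcd h k) y v := by
  unfold sawIncr
  have h1 : ∀ j : ℕ, v + (j : ℝ) * h - y = v - y + j * h := fun j => by ring
  simp_rw [h1]
  rw [Finset.sum_sub_distrib, sum_range_fract_add_mul_div hh hk, sum_range_fract_add_mul_div hh hk]
  ring

theorem intervalIntegrable_of_measurable_of_bounded {f : ℝ → ℝ} (hf : Measurable f) {B : ℝ}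
    (hB : ∀ u, |f u| ≤ B) (x y : ℝ) : IntervalIntegrable f volume x y := by
  refine (intervalIntegrable_const (c := B)).mono_fun hf.aestronglyMeasurable ?_
  refine Eventually.of_forall fun u => ?_
  rw [Real.norm_eq_abs]
  exact (hB u).trans (le_abs_self B)

theorem intervalIntegral_eq_sum_shift {f : ℝ → ℝ} (hf : Measurable f) {B : ℝ}
    (hB : ∀ u, |f u| ≤ B) (h : ℝ) (k : ℕ) :
    ∫ u in (0 : ℝ)..(k * h), f u = ∫ v in (0 : ℝ)..h, ∑ j ∈ Finset.range k, f (v + j * h) := by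
  have hInt : ∀ x y : ℝ, IntervalIntegrable f volume x y :=
    intervalIntegrable_of_measurable_of_bounded hf hB
  rw [intervalIntegral.integral_finsetSum]
  · have := intervalIntegral.sum_integral_adjacent_intervals (f := f) (μ := volume)
      (a := fun j : ℕ => (j : ℝ) * h) (n := k) (fun _ _ => hInt _ _)
    simp only [Nat.cast_zero, zero_mul] at this
    rw [← this]
    refine Finset.sum_congr rfl fun j _ => ?_
    rw [intervalIntegral.integral_comp_add_right]
    congr 1 <;> push_cast <;> ring
  · intro j _
    exact intervalIntegrable_of_measurable_of_bounded (hf.comp (by fun_prop)) (fun u => hB _) _ _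

theorem integral_sq_fract_sub (w : ℝ) :
    ∫ v in (0 : ℝ)..1, (Int.fract v - Int.fract (v - w)) ^ 2 =
      Int.fract w * (1 - Int.fract w) := by
  set r := Int.fract w with hr
  have h0 : 0 ≤ r := Int.fract_nonneg w
  have h1 : r < 1 := Int.fract_lt_one w
  have hm : Measurable (fun v : ℝ => (Int.fract v - Int.fract (v - w)) ^ 2) := by fun_prop
  have hb : ∀ v : ℝ, |(Int.fract v - Int.fract (v - w)) ^ 2| ≤ 1 := by
    intro v
    have h1 := Int.fract_nonneg v
    have h2 := (Int.fract_lt_one v).le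
    have h3 := Int.fract_nonneg (v - w)
    have h4 := (Int.fract_lt_one (v - w)).le
    rw [abs_of_nonneg (sq_nonneg _)]
    nlinarith
  have hInt := intervalIntegrable_of_measurable_of_bounded hm hb
  have hfr : ∀ v : ℝ, Int.fract (v - w) = Int.fract (v - r) := by
    intro v
    rw [show v - r = v - w + (⌊w⌋ : ℤ) by rw [hr, Int.fract]; ring, Int.fract_add_intCast]
  rw [← intervalIntegral.integral_add_adjacent_intervals (hInt 0 r) (hInt r 1)]
  have e1 : ∫ v in (0 : ℝ)..r, (Int.fract v - Int.fract (v - w)) ^ 2 =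
      ∫ v in (0 : ℝ)..r, (1 - r) ^ 2 := by
    refine intervalIntegral.integral_congr_Ioo_of_le h0 fun v hv => ?_
    have e1 : Int.fract v = v := Int.fract_eq_self.2 ⟨hv.1.le, by linarith [hv.2]⟩
    have e2 : Int.fract (v - r) = v - r + 1 := by
      have : Int.fract (v - r + 1) = v - r + 1 :=
        Int.fract_eq_self.2 ⟨by linarith [hv.1], by linarith [hv.2]⟩
      rwa [Int.fract_add_one] at this
    rw [hfr, e1, e2]
    ring
  have e2 : ∫ v in r..1, (Int.fract v - Int.fract (v - w)) ^ 2 = ∫ v in r..1, r ^ 2 := by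
    refine intervalIntegral.integral_congr_Ioo_of_le h1.le fun v hv => ?_
    have e1 : Int.fract v = v := Int.fract_eq_self.2 ⟨by linarith [hv.1], hv.2⟩
    have e2 : Int.fract (v - r) = v - r :=
      Int.fract_eq_self.2 ⟨by linarith [hv.1], by linarith [hv.2]⟩
    rw [hfr, e1, e2]
    ring
  rw [e1, e2, intervalIntegral.integral_const, intervalIntegral.integral_const, smul_eq_mul,
    smul_eq_mul]
  ring

theorem integral_sawIncr_mul_sawIncr {h k : ℕ} (hh : 0 < h) (hk : 0 < k) (y : ℝ) :
    ∫ u in (0 : ℝ)..(k * h), sawIncr h y u * sawIncr k y u =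
      (Nat.gcd h k : ℝ) ^ 2 *
        (Int.fract (y / Nat.gcd h k) * (1 - Int.fract (y / Nat.gcd h k))) := by
  have hbd : ∀ h k : ℕ, ∀ u, |sawIncr h y u * sawIncr k y u| ≤ 1 := by
    intro h k u
    rw [abs_mul]
    exact mul_le_one₀ (abs_sawIncr_le h y u) (abs_nonneg _) (abs_sawIncr_le k y u)
  have hmeas : ∀ h k : ℕ, Measurable (fun u => sawIncr h y u * sawIncr k y u) := fun h k =>
    (measurable_sawIncr h y).mul (measurable_sawIncr k y)
  rw [intervalIntegral_eq_sum_shift (hmeas h k) (hbd h k)]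
  have h1 : ∀ v : ℝ, ∑ j ∈ Finset.range k, sawIncr h y (v + j * h) * sawIncr k y (v + j * h) =
      Nat.gcd h k * (sawIncr h y v * sawIncr (Nat.gcd h k) y v) := by
    intro v
    simp_rw [sawIncr_add_nat_mul hh]
    rw [← Finset.mul_sum, sum_range_sawIncr hh hk]
    ring
  simp_rw [h1]
  rw [intervalIntegral.integral_const_mul]
  obtain ⟨g, h', k', hg, hcop, rfl, rfl⟩ := Nat.exists_coprime' (m := h) (n := k)
    (Nat.gcd_pos_of_pos_left k hh)
  have hh' : 0 < h' := Nat.pos_of_mul_pos_right hh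
  have hgR : (g : ℝ) ≠ 0 := by exact_mod_cast hg.ne'
  rw [Nat.gcd_mul_right, hcop, one_mul]
  have h2 := intervalIntegral_eq_sum_shift (hmeas (h' * g) g) (hbd (h' * g) g) g h'
  have h3 : ∀ v : ℝ, ∑ j ∈ Finset.range h',
      sawIncr (h' * g) y (v + j * g) * sawIncr g y (v + j * g) = sawIncr g y v ^ 2 := by
    intro v
    simp_rw [sawIncr_add_nat_mul hg]
    rw [← Finset.sum_mul]
    -- spacing `g` over the period `h' * g`
    have h5 := sum_range_sawIncr (h := g) (k := h' * g) hg (by positivity) y v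
    rw [Nat.gcd_mul_left_right] at h5
    have h6 := sum_range_mul_of_periodic (k := h') (fun j => sawIncr (h' * g) y (v + j * g))
      (fun n => by
        have := sawIncr_add_nat_mul hh y (v + n * g) 1
        rw [← this]
        congr 1
        push_cast
        ring) g
    rw [mul_comm g h', h5] at h6
    have h7 := mul_left_cancel₀ hgR h6
    rw [← h7]
    ring
  simp_rw [h3] at h2
  rw [show ((h' * g : ℕ) : ℝ) = h' * g by push_cast; ring, h2]
  have h4 : ∫ v in (0 : ℝ)..g, sawIncr g y v ^ 2 =
      g * ∫ v in (0 : ℝ)..1, (Int.fract v - Int.fract (v - y / g)) ^ 2 := by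
    have := intervalIntegral.integral_comp_div (a := 0) (b := (g : ℝ))
      (fun v => (Int.fract v - Int.fract (v - y / g)) ^ 2) hgR
    rw [zero_div, div_self hgR, smul_eq_mul] at this
    rw [← this]
    congr 1
    ext v
    unfold sawIncr
    rw [sub_div]
  rw [h4, integral_sq_fract_sub]
  ring

/-- The exponential weight controlling dilation averages on `(U, 2U]`. -/
noncomputable def blockWeight (a U y : ℝ) : ℝ := a / U * Real.exp (-((a - 1) / (2 * U)) * y)

theorem blockWeight_nonneg {a U : ℝ} (ha : 0 ≤ a) (hU : 0 ≤ U) (y : ℝ) : 0 ≤ blockWeight a U y :=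
  mul_nonneg (div_nonneg ha hU) (Real.exp_pos _).le

theorem integrableOn_blockWeight {a U : ℝ} (ha : 1 < a) (hU : 0 < U) :
    IntegrableOn (blockWeight a U) (Set.Ioi 0) :=
  (exp_neg_integrableOn_Ioi 0 (by have : 0 < a - 1 := by linarith
                                  positivity)).const_mul _

theorem integral_blockWeight {a U : ℝ} (ha : 1 < a) (hU : 0 < U) :
    ∫ y in Set.Ioi (0 : ℝ), blockWeight a U y = 2 * a / (a - 1) := by
  have h1 : 0 < a - 1 := by linarith
  unfold blockWeight
  rw [integral_const_mul, integral_exp_mul_Ioi (by simp; positivity)]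
  field_simp
  simp

theorem integral_blockWeight_mul_id {a U : ℝ} (ha : 1 < a) (hU : 0 < U) :
    IntegrableOn (fun y => blockWeight a U y * y) (Set.Ioi 0) ∧
    ∫ y in Set.Ioi (0 : ℝ), blockWeight a U y * y = 4 * U * a / (a - 1) ^ 2 := by
  have h1 : 0 < a - 1 := by linarith
  have hr : 0 < (a - 1) / (2 * U) := by positivity
  have h2 := Real.integral_rpow_mul_exp_neg_mul_Ioi (a := 2) (r := (a - 1) / (2 * U)) (by norm_num) hr
  have h3 : ∀ y : ℝ, blockWeight a U y * y =
      a / U * (y ^ (2 - 1 : ℝ) * Real.exp (-((a - 1) / (2 * U) * y))) := by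
    intro y
    unfold blockWeight
    norm_num
    ring
  simp_rw [h3]
  constructor
  · refine Integrable.const_mul ?_ _
    by_contra hcon
    rw [integral_undef hcon] at h2
    have : 0 < (1 / ((a - 1) / (2 * U))) ^ (2 : ℝ) * Real.Gamma 2 :=
      mul_pos (Real.rpow_pos_of_pos (by positivity) _) (Real.Gamma_pos_of_pos (by norm_num))
    linarith
  · rw [integral_const_mul, h2, Real.Gamma_two, Real.rpow_two]
    field_simp
    norm_num

theorem dilationAverage_sq_le_integral_kernel {a : ℝ} (ha : 0 < a) {G : ℝ → ℝ} (hG : Measurable G)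
    {B : ℝ} (hB : ∀ u, |G u| ≤ B) (u : ℝ) :
    dilationAverage a G u ^ 2 ≤
      ∫ l in Set.Ioc (0 : ℝ) 1, (G (l * u) - G u) ^ 2 * (a * l ^ (a - 1)) := by
  set c := dilationAverage a G u with hc
  set k : ℝ → ℝ := fun l => a * l ^ (a - 1) with hk
  have hki := integrableOn_dilationKernel ha
  have hb : ∀ l : ℝ, |G (l * u) - G u| ≤ 2 * B := fun l => by
    have h1 := abs_sub (G (l * u)) (G u)
    linarith [hB (l * u), hB u]
  have i1 : IntegrableOn (fun l => (G (l * u) - G u) * k l) (Set.Ioc 0 1) :=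
    hki.bdd_mul (c := 2 * B) (((hG.comp (by fun_prop)).sub measurable_const).aestronglyMeasurable)
      (Eventually.of_forall fun l => hb l)
  have i2 : IntegrableOn (fun l => (G (l * u) - G u) ^ 2 * k l) (Set.Ioc 0 1) :=
    hki.bdd_mul (c := (2 * B) ^ 2)
      ((((hG.comp (by fun_prop)).sub measurable_const).pow_const 2).aestronglyMeasurable)
      (Eventually.of_forall fun l => by
        rw [Real.norm_eq_abs, abs_pow]
        exact pow_le_pow_left₀ (abs_nonneg _) (hb l) 2)
  have h0 : 0 ≤ ∫ l in Set.Ioc (0 : ℝ) 1, (G (l * u) - G u - c) ^ 2 * k l :=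
    setIntegral_nonneg measurableSet_Ioc fun l hl =>
      mul_nonneg (sq_nonneg _) (mul_nonneg ha.le (Real.rpow_nonneg hl.1.le _))
  have h1 : ∀ l, (G (l * u) - G u - c) ^ 2 * k l =
      (G (l * u) - G u) ^ 2 * k l - 2 * c * ((G (l * u) - G u) * k l) + c ^ 2 * k l := by
    intro l
    ring
  simp_rw [h1] at h0
  have i3 : IntegrableOn (fun l => (G (l * u) - G u) ^ 2 * k l -
      2 * c * ((G (l * u) - G u) * k l)) (Set.Ioc 0 1) := i2.sub (i1.const_mul _)
  rw [integral_add i3 (hki.const_mul _), integral_sub i2 (i1.const_mul _), integral_const_mul, integral_const_mul, integral_dilationKernel ha] at h0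
  have h2 : ∫ l in Set.Ioc (0 : ℝ) 1, (G (l * u) - G u) * k l = c := rfl
  rw [h2] at h0
  linarith

theorem dilationAverage_sq_le_integral_blockWeight {a : ℝ} (ha : 1 < a) {G : ℝ → ℝ}
    (hG : Measurable G) {B : ℝ} (hB : ∀ u, |G u| ≤ B) {U u : ℝ} (hU : 0 < U)
    (hu : u ∈ Set.Ioc U (2 * U)) :
    dilationAverage a G u ^ 2 ≤
      ∫ y in Set.Ioi (0 : ℝ), (G u - G (u - y)) ^ 2 * blockWeight a U y := by
  have hu0 : 0 < u := hU.trans hu.1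
  refine (dilationAverage_sq_le_integral_kernel (by linarith) hG hB u).trans ?_
  have h1 := intervalIntegral.integral_comp_sub_div (a := 0) (b := u)
    (fun l => (G (l * u) - G u) ^ 2 * (a * l ^ (a - 1))) hu0.ne' 1
  rw [div_self hu0.ne', sub_self, zero_div, sub_zero, smul_eq_mul] at h1
  have hb : ∀ y : ℝ, |G u - G (u - y)| ≤ 2 * B := fun y => by
    have h1 := abs_sub (G u) (G (u - y))
    linarith [hB (u - y), hB u]
  have hi : IntegrableOn (fun y => (G u - G (u - y)) ^ 2 * blockWeight a U y) (Set.Ioi 0) := by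
    refine (integrableOn_blockWeight ha hU).bdd_mul (c := (2 * B) ^ 2)
      (((measurable_const.sub (hG.comp (by fun_prop))).pow_const 2).aestronglyMeasurable) ?_
    refine Eventually.of_forall fun y => ?_
    rw [Real.norm_eq_abs, abs_pow]
    exact pow_le_pow_left₀ (abs_nonneg _) (hb y) 2
  have h2 : ∫ l in Set.Ioc (0 : ℝ) 1, (G (l * u) - G u) ^ 2 * (a * l ^ (a - 1)) =
      ∫ y in (0 : ℝ)..u, u⁻¹ * ((G ((1 - y / u) * u) - G u) ^ 2 * (a * (1 - y / u) ^ (a - 1))) := by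
    rw [intervalIntegral.integral_const_mul, h1, ← mul_assoc, inv_mul_cancel₀ hu0.ne', one_mul,
      intervalIntegral.integral_of_le zero_le_one]
  rw [h2, intervalIntegral.integral_of_le hu0.le]
  refine le_trans ?_ (setIntegral_mono_set hi (Eventually.of_forall fun y =>
    mul_nonneg (sq_nonneg _) (blockWeight_nonneg (by linarith) hU.le y))
    (Eventually.of_forall (Set.Ioc_subset_Ioi_self : Set.Ioc 0 u ⊆ Set.Ioi 0)))
  refine integral_mono_of_nonneg ?_ (hi.mono_set Set.Ioc_subset_Ioi_self) ?_
  · refine (ae_restrict_iff' measurableSet_Ioc).2 (Eventually.of_forall fun y hy => ?_)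
    have : 0 ≤ 1 - y / u := by rw [sub_nonneg, div_le_one hu0]; exact hy.2
    have h3 := Real.rpow_nonneg this (a - 1)
    simp only [Pi.zero_apply]
    have : 0 < a := by linarith
    positivity
  · refine (ae_restrict_iff' measurableSet_Ioc).2 (Eventually.of_forall fun y hy => ?_)
    have e1 : (1 - y / u) * u = u - y := by field_simp
    have h0 : 0 ≤ 1 - y / u := by rw [sub_nonneg, div_le_one hu0]; exact hy.2
    have e2 : (1 - y / u) ^ (a - 1) ≤ Real.exp (-((a - 1) / (2 * U)) * y) := by
      calc (1 - y / u) ^ (a - 1) ≤ Real.exp (-(y / u)) ^ (a - 1) := by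
            refine Real.rpow_le_rpow h0 ?_ (by linarith)
            have := Real.add_one_le_exp (-(y / u))
            linarith
        _ = Real.exp (-((a - 1) / u) * y) := by
            rw [← Real.exp_mul]
            congr 1
            ring
        _ ≤ _ := by
            apply Real.exp_le_exp.2
            have : (a - 1) / (2 * U) ≤ (a - 1) / u :=
              div_le_div_of_nonneg_left (by linarith) hu0 hu.2
            nlinarith [hy.1]
    have e3 : u⁻¹ * a ≤ a / U := by
      rw [inv_mul_eq_div]
      exact div_le_div_of_nonneg_left (by linarith) hU hu.1.le
    dsimp only
    rw [e1, show (G (u - y) - G u) ^ 2 = (G u - G (u - y)) ^ 2 by ring]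
    have h3 := Real.rpow_nonneg h0 (a - 1)
    calc u⁻¹ * ((G u - G (u - y)) ^ 2 * (a * (1 - y / u) ^ (a - 1)))
        = (G u - G (u - y)) ^ 2 * ((u⁻¹ * a) * (1 - y / u) ^ (a - 1)) := by ring
      _ ≤ _ := by
        refine mul_le_mul_of_nonneg_left ?_ (sq_nonneg _)
        unfold blockWeight
        exact mul_le_mul e3 e2 h3 (div_nonneg (by linarith) hU.le)

/-- The integral of a bounded periodic function over an interval, compared with its mean. -/
theorem abs_integral_sub_mean_le {f : ℝ → ℝ} (hf : Measurable f) (hB : ∀ u, |f u| ≤ 1) {P : ℝ}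
    (hP : 0 < P) (hper : ∀ u, f (u + P) = f u) (x : ℝ) {Y : ℝ} (hY : 0 ≤ Y) :
    |(∫ u in x..(x + Y), f u) - Y / P * ∫ u in (0 : ℝ)..P, f u| ≤ 2 * P := by
  have hInt := intervalIntegrable_of_measurable_of_bounded hf hB
  set n := ⌊Y / P⌋₊ with hn
  have h1 : (n : ℝ) ≤ Y / P := Nat.floor_le (by positivity)
  have h2 : Y / P < n + 1 := Nat.lt_floor_add_one _
  have hper' : Function.Periodic f P := hper
  have e1 : ∫ u in x..(x + n * P), f u = n * ∫ u in (0 : ℝ)..P, f u := by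
    have := hper'.intervalIntegral_add_zsmul_eq n x (hInt)
    simp only [zsmul_eq_mul, Int.cast_natCast] at this
    rw [this, hper'.intervalIntegral_add_eq x 0, zero_add]
  have e2 : ∫ u in x..(x + Y), f u = (∫ u in x..(x + n * P), f u) +
      ∫ u in (x + n * P)..(x + Y), f u :=
    (intervalIntegral.integral_add_adjacent_intervals (hInt _ _) (hInt _ _)).symm
  have e3 : |∫ u in (x + n * P)..(x + Y), f u| ≤ P := by
    have h3 := intervalIntegral.norm_integral_le_of_norm_le_const (C := 1) (f := f)
      (a := x + n * P) (b := x + Y) (fun u _ => hB u)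
    rw [Real.norm_eq_abs, one_mul] at h3
    refine h3.trans ?_
    rw [le_div_iff₀ hP] at h1
    rw [div_lt_iff₀ hP] at h2
    rw [abs_of_nonneg (by linarith)]
    linarith
  have e4 : |∫ u in (0 : ℝ)..P, f u| ≤ P := by
    have h3 := intervalIntegral.norm_integral_le_of_norm_le_const (C := 1) (f := f)
      (a := 0) (b := P) (fun u _ => hB u)
    rwa [Real.norm_eq_abs, one_mul, sub_zero, abs_of_pos hP] at h3
  rw [e2, e1]
  calc |(n * ∫ u in (0 : ℝ)..P, f u) + (∫ u in (x + n * P)..(x + Y), f u)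
        - Y / P * ∫ u in (0 : ℝ)..P, f u|
      = |(∫ u in (x + n * P)..(x + Y), f u) - (Y / P - n) * ∫ u in (0 : ℝ)..P, f u| := by
        congr 1; ring
    _ ≤ |∫ u in (x + n * P)..(x + Y), f u| + |(Y / P - n) * ∫ u in (0 : ℝ)..P, f u| := abs_sub _ _
    _ ≤ P + 1 * P := by
        refine add_le_add e3 ?_
        rw [abs_mul]
        refine mul_le_mul ?_ e4 (abs_nonneg _) zero_le_one
        rw [abs_of_nonneg (by linarith)]
        linarith
    _ = 2 * P := by ring

/-- The main term of the correlation of two sawtooth increments on `(U, 2U]`. -/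
noncomputable def blockGcd (a U : ℝ) (g : ℕ) : ℝ :=
  (g : ℝ) ^ 2 / U * ∫ y in Set.Ioi (0 : ℝ),
    (Int.fract (y / g) * (1 - Int.fract (y / g))) * blockWeight a U y

theorem fract_mul_one_sub_fract_nonneg (x : ℝ) : 0 ≤ Int.fract x * (1 - Int.fract x) :=
  mul_nonneg (Int.fract_nonneg x) (by linarith [Int.fract_lt_one x])

theorem fract_mul_one_sub_fract_le (x : ℝ) : Int.fract x * (1 - Int.fract x) ≤ 1 / 4 := by
  nlinarith [sq_nonneg (Int.fract x - 1 / 2)]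

theorem fract_mul_one_sub_fract_le_self {x : ℝ} (hx : 0 ≤ x) :
    Int.fract x * (1 - Int.fract x) ≤ x := by
  have h1 := Int.fract_nonneg x
  have h2 : Int.fract x ≤ x := by
    rw [Int.fract]
    have : (0 : ℝ) ≤ ⌊x⌋ := by exact_mod_cast Int.floor_nonneg.2 hx
    linarith
  nlinarith

theorem integrableOn_fract_mul_blockWeight {a U : ℝ} (ha : 1 < a) (hU : 0 < U) (g : ℕ) :
    IntegrableOn (fun y : ℝ => (Int.fract (y / g) * (1 - Int.fract (y / g))) * blockWeight a U y)
      (Set.Ioi 0) := by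
  refine (integrableOn_blockWeight ha hU).bdd_mul (c := 1 / 4) ?_ ?_
  · have : Measurable fun y : ℝ => Int.fract (y / g) * (1 - Int.fract (y / g)) := by fun_prop
    exact this.aestronglyMeasurable
  · refine Eventually.of_forall fun y => ?_
    rw [Real.norm_of_nonneg (fract_mul_one_sub_fract_nonneg _)]
    exact fract_mul_one_sub_fract_le _

theorem blockGcd_nonneg {a U : ℝ} (ha : 1 < a) (hU : 0 < U) (g : ℕ) : 0 ≤ blockGcd a U g := by
  refine mul_nonneg (by positivity) (setIntegral_nonneg measurableSet_Ioi fun y _ => ?_)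
  exact mul_nonneg (fract_mul_one_sub_fract_nonneg _)
    (blockWeight_nonneg (by linarith) hU.le y)

theorem blockGcd_le_sq {a U : ℝ} (ha : 1 < a) (hU : 0 < U) (g : ℕ) :
    blockGcd a U g ≤ (g : ℝ) ^ 2 / U * (a / (2 * (a - 1))) := by
  refine mul_le_mul_of_nonneg_left ?_ (by positivity)
  have h1 : 0 < a - 1 := by linarith
  calc _ ≤ ∫ y in Set.Ioi (0 : ℝ), 1 / 4 * blockWeight a U y := by
        refine setIntegral_mono (integrableOn_fract_mul_blockWeight ha hU g)
          ((integrableOn_blockWeight ha hU).const_mul _) fun y => ?_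
        exact mul_le_mul_of_nonneg_right (fract_mul_one_sub_fract_le _)
          (blockWeight_nonneg (by linarith) hU.le y)
    _ = _ := by
        rw [integral_const_mul, integral_blockWeight ha hU]
        field_simp
        norm_num

theorem blockGcd_le_mul {a U : ℝ} (ha : 1 < a) (hU : 0 < U) {g : ℕ} (hg : 0 < g) :
    blockGcd a U g ≤ g * (4 * a / (a - 1) ^ 2) := by
  have h1 : 0 < a - 1 := by linarith
  have hg' : (0 : ℝ) < g := by exact_mod_cast hg
  obtain ⟨hi, he⟩ := integral_blockWeight_mul_id ha hU
  calc blockGcd a U g ≤ (g : ℝ) ^ 2 / U *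
        ∫ y in Set.Ioi (0 : ℝ), (g : ℝ)⁻¹ * (blockWeight a U y * y) := by
        refine mul_le_mul_of_nonneg_left ?_ (by positivity)
        refine setIntegral_mono_on (integrableOn_fract_mul_blockWeight ha hU g)
          (hi.const_mul _) measurableSet_Ioi fun y hy => ?_
        have h2 := mul_le_mul_of_nonneg_right
          (fract_mul_one_sub_fract_le_self (x := y / g) (div_nonneg (le_of_lt hy) hg'.le))
          (blockWeight_nonneg (a := a) (by linarith) hU.le y)
        refine h2.trans (le_of_eq ?_)
        field_simp
    _ = _ := by
        rw [integral_const_mul, he]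
        field_simp

theorem integrable_prod_sawIncr {a U : ℝ} (ha : 1 < a) (hU : 0 < U) (h k : ℕ) :
    Integrable (fun p : ℝ × ℝ => sawIncr h p.2 p.1 * sawIncr k p.2 p.1 * blockWeight a U p.2)
      ((volume.restrict (Set.Ioc U (2 * U))).prod (volume.restrict (Set.Ioi (0 : ℝ)))) := by
  have h0 : Integrable (fun p : ℝ × ℝ => (1 : ℝ) * blockWeight a U p.2)
      ((volume.restrict (Set.Ioc U (2 * U))).prod (volume.restrict (Set.Ioi (0 : ℝ)))) :=
    Integrable.mul_prod (f := fun _ : ℝ => (1 : ℝ)) (integrable_const _)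
      (integrableOn_blockWeight ha hU)
  simp only [one_mul] at h0
  refine h0.bdd_mul (c := 1) ?_ ?_
  · have : Measurable fun p : ℝ × ℝ => sawIncr h p.2 p.1 * sawIncr k p.2 p.1 := by
      unfold sawIncr
      fun_prop
    exact this.aestronglyMeasurable
  · refine Eventually.of_forall fun p => ?_
    rw [Real.norm_eq_abs, abs_mul]
    exact mul_le_one₀ (abs_sawIncr_le _ _ _) (abs_nonneg _) (abs_sawIncr_le _ _ _)

theorem abs_integral_sawIncr_sub_blockGcd_le {a U : ℝ} (ha : 1 < a) (hU : 0 < U) {h k : ℕ}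
    (hh : 0 < h) (hk : 0 < k) :
    |(∫ u in Set.Ioc U (2 * U), ∫ y in Set.Ioi (0 : ℝ),
        sawIncr h y u * sawIncr k y u * blockWeight a U y) -
      U ^ 2 * (blockGcd a U (Nat.gcd h k) / (h * k))| ≤ h * k * (4 * a / (a - 1)) := by
  set g := Nat.gcd h k with hg
  have hh' : (0 : ℝ) < h := by exact_mod_cast hh
  have hk' : (0 : ℝ) < k := by exact_mod_cast hk
  have hI := integrable_prod_sawIncr ha hU h k
  rw [integral_integral_swap hI]
  have hinner : ∀ y : ℝ, ∫ u in Set.Ioc U (2 * U), sawIncr h y u * sawIncr k y u * blockWeight a U y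
      = (∫ u in U..(U + U), sawIncr h y u * sawIncr k y u) * blockWeight a U y := by
    intro y
    rw [integral_mul_const, intervalIntegral.integral_of_le (by linarith), two_mul]
  have hI2 := hI.integral_prod_right
  simp_rw [hinner] at hI2 ⊢
  have e1 : U ^ 2 * (blockGcd a U g / (h * k)) = ∫ y in Set.Ioi (0 : ℝ), (U / (k * h)) *
      ((g : ℝ) ^ 2 * ((Int.fract (y / g) * (1 - Int.fract (y / g))) * blockWeight a U y)) := by
    rw [integral_const_mul, integral_const_mul, blockGcd]
    field_simp
  rw [e1, ← integral_sub hI2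
    (((integrableOn_fract_mul_blockWeight ha hU g).const_mul _).const_mul _)]
  calc _ ≤ ∫ y in Set.Ioi (0 : ℝ), 2 * (k * h : ℝ) * blockWeight a U y := by
        rw [← Real.norm_eq_abs]
        refine norm_integral_le_of_norm_le ((integrableOn_blockWeight ha hU).const_mul _) ?_
        refine Eventually.of_forall fun y => ?_
        have hw := blockWeight_nonneg (a := a) (by linarith) hU.le y
        have hm := abs_integral_sub_mean_le (f := fun u => sawIncr h y u * sawIncr k y u)
          ((measurable_sawIncr h y).mul (measurable_sawIncr k y)) (fun u => by
            rw [abs_mul]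
            exact mul_le_one₀ (abs_sawIncr_le _ _ _) (abs_nonneg _) (abs_sawIncr_le _ _ _))
          (P := k * h) (by positivity) (fun u => by
            have e1 := sawIncr_add_nat_mul hh y u k
            have e2 := sawIncr_add_nat_mul hk y u h
            rw [mul_comm (h : ℝ)] at e2
            rw [e1, e2]) U hU.le
        rw [integral_sawIncr_mul_sawIncr hh hk] at hm
        rw [Real.norm_eq_abs]
        have e2 : (∫ u in U..(U + U), sawIncr h y u * sawIncr k y u) * blockWeight a U y -
            U / (k * h) * ((g : ℝ) ^ 2 * ((Int.fract (y / g) * (1 - Int.fract (y / g))) *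
              blockWeight a U y)) =
            ((∫ u in U..(U + U), sawIncr h y u * sawIncr k y u) -
            U / (k * h) * ((g : ℝ) ^ 2 * (Int.fract (y / g) * (1 - Int.fract (y / g))))) *
              blockWeight a U y := by ring
        rw [e2, abs_mul, abs_of_nonneg hw]
        exact mul_le_mul_of_nonneg_right hm hw
    _ = _ := by
        rw [integral_const_mul, integral_blockWeight ha hU]
        ring

/-- A finite combination of dilated sawtooth functions. -/
noncomputable def sawSum (D : Finset ℕ) (m : ℕ → ℝ) (u : ℝ) : ℝ :=
  ∑ h ∈ D, m h * Int.fract (u / h)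

theorem measurable_sawSum (D : Finset ℕ) (m : ℕ → ℝ) : Measurable (sawSum D m) := by
  unfold sawSum
  fun_prop

theorem abs_sawSum_le (D : Finset ℕ) (m : ℕ → ℝ) (u : ℝ) : |sawSum D m u| ≤ ∑ h ∈ D, |m h| := by
  refine (Finset.abs_sum_le_sum_abs _ _).trans (Finset.sum_le_sum fun h _ => ?_)
  rw [abs_mul, abs_of_nonneg (Int.fract_nonneg (u / h))]
  exact mul_le_of_le_one_right (abs_nonneg _) (Int.fract_lt_one _).le

theorem sq_sawSum_sub (D : Finset ℕ) (m : ℕ → ℝ) (u y : ℝ) :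
    (sawSum D m u - sawSum D m (u - y)) ^ 2 =
      ∑ h ∈ D, ∑ k ∈ D, m h * m k * (sawIncr h y u * sawIncr k y u) := by
  have : sawSum D m u - sawSum D m (u - y) = ∑ h ∈ D, m h * sawIncr h y u := by
    unfold sawSum sawIncr
    rw [← Finset.sum_sub_distrib]
    exact Finset.sum_congr rfl fun h _ => by ring
  rw [this, sq, Finset.sum_mul_sum]
  exact Finset.sum_congr rfl fun h _ => Finset.sum_congr rfl fun k _ => by ring

theorem integral_sq_dilationAverage_block_le {a U : ℝ} (ha : 1 < a) (hU : 0 < U) (D : Finset ℕ)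
    (hD : ∀ h ∈ D, 0 < h) (m : ℕ → ℝ) :
    ∫ u in Set.Ioc U (2 * U), dilationAverage a (sawSum D m) u ^ 2 / u ^ 2 ≤
      (∑ h ∈ D, ∑ k ∈ D, m h * m k / (h * k) * blockGcd a U (Nat.gcd h k)) +
        (4 * a / (a - 1)) / U ^ 2 * (∑ h ∈ D, |m h| * h) ^ 2 := by
  have hI : ∀ h k : ℕ, Integrable (fun p : ℝ × ℝ => m h * m k *
      (sawIncr h p.2 p.1 * sawIncr k p.2 p.1 * blockWeight a U p.2))
      ((volume.restrict (Set.Ioc U (2 * U))).prod (volume.restrict (Set.Ioi (0 : ℝ)))) :=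
    fun h k => (integrable_prod_sawIncr ha hU h k).const_mul _
  have hsum : Integrable (fun p : ℝ × ℝ => ∑ h ∈ D, ∑ k ∈ D, m h * m k *
      (sawIncr h p.2 p.1 * sawIncr k p.2 p.1 * blockWeight a U p.2))
      ((volume.restrict (Set.Ioc U (2 * U))).prod (volume.restrict (Set.Ioi (0 : ℝ)))) :=
    integrable_finsetSum _ fun h _ => integrable_finsetSum _ fun k _ => hI h k
  have hmeas := measurable_dilationAverage (a := a) (measurable_sawSum D m)
  have step1 : ∫ u in Set.Ioc U (2 * U), dilationAverage a (sawSum D m) u ^ 2 / u ^ 2 ≤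
      ∫ u in Set.Ioc U (2 * U), (U ^ 2)⁻¹ * ∫ y in Set.Ioi (0 : ℝ), ∑ h ∈ D, ∑ k ∈ D, m h * m k *
      (sawIncr h y u * sawIncr k y u * blockWeight a U y) := by
    refine integral_mono_of_nonneg (Eventually.of_forall fun u => by positivity)
      (hsum.integral_prod_left.const_mul _) ?_
    refine (ae_restrict_iff' measurableSet_Ioc).2 (Eventually.of_forall fun u hu => ?_)
    have h1 := dilationAverage_sq_le_integral_blockWeight ha (measurable_sawSum D m)
      (abs_sawSum_le D m) hU hu
    have h2 : ∀ y, (sawSum D m u - sawSum D m (u - y)) ^ 2 * blockWeight a U y =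
      ∑ h ∈ D, ∑ k ∈ D, m h * m k * (sawIncr h y u * sawIncr k y u * blockWeight a U y) := by
      intro y
      rw [sq_sawSum_sub, Finset.sum_mul]
      refine Finset.sum_congr rfl fun h _ => ?_
      rw [Finset.sum_mul]
      exact Finset.sum_congr rfl fun k _ => by ring
    simp_rw [h2] at h1
    dsimp only
    rw [inv_mul_eq_div]
    have hu0 : 0 < u := hU.trans hu.1
    have h3 : U ^ 2 ≤ u ^ 2 := pow_le_pow_left₀ hU.le hu.1.le 2
    exact div_le_div₀ ((sq_nonneg _).trans h1) h1 (by positivity) h3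
  refine step1.trans ?_
  rw [integral_const_mul, integral_integral hsum, integral_finsetSum _
    (fun h _ => integrable_finsetSum _ fun k _ => hI h k)]
  have step2 : ∀ h ∈ D, ∀ k ∈ D, ∫ p, m h * m k *
      (sawIncr h p.2 p.1 * sawIncr k p.2 p.1 * blockWeight a U p.2)
      ∂((volume.restrict (Set.Ioc U (2 * U))).prod (volume.restrict (Set.Ioi (0 : ℝ)))) ≤
      U ^ 2 * (m h * m k / (h * k) * blockGcd a U (Nat.gcd h k)) +
        (4 * a / (a - 1)) * ((|m h| * h) * (|m k| * k)) := by
    intro h hh k hk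
    rw [integral_const_mul, ← integral_integral (f := fun u y =>
      sawIncr h y u * sawIncr k y u * blockWeight a U y) (integrable_prod_sawIncr ha hU h k)]
    have h1 := abs_integral_sawIncr_sub_blockGcd_le ha hU (hD h hh) (hD k hk)
    have h2 := mul_le_mul_of_nonneg_left h1 (abs_nonneg (m h * m k))
    rw [← abs_mul] at h2
    have h3 := (le_abs_self _).trans h2
    rw [abs_mul (m h)] at h3
    rw [mul_sub] at h3
    have e1 : U ^ 2 * (m h * m k / (h * k) * blockGcd a U (Nat.gcd h k)) =
      m h * m k * (U ^ 2 * (blockGcd a U (Nat.gcd h k) / (h * k))) := by ring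
    rw [e1]
    linarith
  have step3 : ∑ h ∈ D, ∫ p, ∑ k ∈ D, m h * m k *
      (sawIncr h p.2 p.1 * sawIncr k p.2 p.1 * blockWeight a U p.2)
      ∂((volume.restrict (Set.Ioc U (2 * U))).prod (volume.restrict (Set.Ioi (0 : ℝ)))) ≤
      U ^ 2 * (∑ h ∈ D, ∑ k ∈ D, m h * m k / (h * k) * blockGcd a U (Nat.gcd h k)) +
        (4 * a / (a - 1)) * (∑ h ∈ D, |m h| * h) ^ 2 := by
    rw [sq (∑ h ∈ D, |m h| * (h : ℝ)), Finset.sum_mul_sum, Finset.mul_sum, Finset.mul_sum,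
      ← Finset.sum_add_distrib]
    refine Finset.sum_le_sum fun h hh => ?_
    rw [integral_finsetSum _ fun k _ => hI h k, Finset.mul_sum, Finset.mul_sum,
      ← Finset.sum_add_distrib]
    exact Finset.sum_le_sum fun k hk => step2 h hh k hk
  have h4 := mul_le_mul_of_nonneg_left step3 (inv_nonneg.2 (sq_nonneg U))
  refine h4.trans (le_of_eq ?_)
  field_simp

theorem sum_sum_mul_gcd_le (D : Finset ℕ) (hD : ∀ h ∈ D, 0 < h)
    (hdvd : ∀ h ∈ D, ∀ d, d ∣ h → d ∈ D) (x κ : ℕ → ℝ) (hκ : ∀ n, 0 ≤ κ n) :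
    ∑ h ∈ D, ∑ k ∈ D, x h * x k * κ (Nat.gcd h k) ≤
      ∑ d ∈ D, (∑ h ∈ D with d ∣ h, x h) ^ 2 * ∑ e ∈ d.divisors, κ e := by
  set f : ℕ → ℝ := fun n => ∑ p ∈ n.divisorsAntidiagonal,
    (ArithmeticFunction.moebius p.1 : ℝ) * κ p.2 with hf
  have h1 : ∀ n > 0, ∑ d ∈ n.divisors, f d = κ n :=
    (ArithmeticFunction.sum_eq_iff_sum_mul_moebius_eq (f := f) (g := κ)).2 fun n _ => rfl
  have h2 : ∀ n, f n ≤ ∑ e ∈ n.divisors, κ e := by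
    intro n
    rw [hf]
    dsimp only
    rw [Nat.sum_divisorsAntidiagonal' (f := fun i j => (ArithmeticFunction.moebius i : ℝ) * κ j)]
    refine Finset.sum_le_sum fun e _ => ?_
    have : ((ArithmeticFunction.moebius (n / e) : ℤ) : ℝ) ≤ 1 := by
      have := (abs_le.1 (ArithmeticFunction.abs_moebius_le_one (n := n / e))).2
      exact_mod_cast this
    exact mul_le_of_le_one_left (hκ e) this
  have h3 : ∀ h ∈ D, ∀ k ∈ D, κ (Nat.gcd h k) =
      ∑ d ∈ D, (if d ∣ h then 1 else 0) * (if d ∣ k then 1 else 0) * f d := by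
    intro h hh k hk
    rw [← h1 _ (Nat.gcd_pos_of_pos_left k (hD h hh))]
    have : (Nat.gcd h k).divisors = D.filter (fun d => d ∣ h ∧ d ∣ k) := by
      ext d
      rw [Nat.mem_divisors, Finset.mem_filter, Nat.dvd_gcd_iff]
      constructor
      · intro h'
        exact ⟨hdvd h hh d h'.1.1, h'.1⟩
      · intro h'
        exact ⟨h'.2, (Nat.gcd_pos_of_pos_left k (hD h hh)).ne'⟩
    rw [this, Finset.sum_filter]
    refine Finset.sum_congr rfl fun d _ => ?_
    by_cases a1 : d ∣ h <;> by_cases a2 : d ∣ k <;> simp [a1, a2]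
  calc ∑ h ∈ D, ∑ k ∈ D, x h * x k * κ (Nat.gcd h k)
      = ∑ h ∈ D, ∑ k ∈ D, ∑ d ∈ D, f d * ((if d ∣ h then x h else 0) *
          (if d ∣ k then x k else 0)) := by
        refine Finset.sum_congr rfl fun h hh => Finset.sum_congr rfl fun k hk => ?_
        rw [h3 h hh k hk, Finset.mul_sum]
        refine Finset.sum_congr rfl fun d _ => ?_
        by_cases a1 : d ∣ h <;> by_cases a2 : d ∣ k <;> simp [a1, a2]
        ring
    _ = ∑ d ∈ D, f d * (∑ h ∈ D with d ∣ h, x h) ^ 2 := by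
        have : ∀ d, (∑ h ∈ D with d ∣ h, x h) ^ 2 = ∑ h ∈ D, ∑ k ∈ D,
            ((if d ∣ h then x h else 0) * (if d ∣ k then x k else 0)) := by
          intro d
          rw [Finset.sum_filter, sq, Finset.sum_mul_sum]
        simp_rw [this, Finset.mul_sum]
        conv_rhs => rw [Finset.sum_comm]
        refine Finset.sum_congr rfl fun h _ => ?_
        exact Finset.sum_comm
    _ ≤ _ := by
        refine Finset.sum_le_sum fun d _ => ?_
        rw [mul_comm]
        exact mul_le_mul_of_nonneg_left (h2 d) (sq_nonneg _)

theorem sum_blockGcd_le {T : ℝ} (hT : 3 ≤ T) {e : ℕ} (he : 0 < e) (J : ℕ) :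
    ∑ j ∈ Finset.range J, blockGcd (T - 1 / 2) (2 ^ j * T) e ≤
      18 / T * (e * (1 + Nat.log 2 e)) := by
  have hT0 : 0 < T := by linarith
  have he' : (0 : ℝ) < e := by exact_mod_cast he
  have ha : 1 < T - 1 / 2 := by linarith
  have hU : ∀ j : ℕ, 0 < (2 : ℝ) ^ j * T := fun j => by positivity
  set l := Nat.log 2 e with hl
  have hle : (e : ℝ) ≤ 2 ^ (l + 1) := by exact_mod_cast (Nat.lt_pow_succ_log_self one_lt_two e).le
  have b1 : ∀ j, blockGcd (T - 1 / 2) (2 ^ j * T) e ≤ 16 * (e / T) := by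
    intro j
    refine (blockGcd_le_mul ha (hU j) he).trans ?_
    have : 4 * (T - 1 / 2) / (T - 1 / 2 - 1) ^ 2 ≤ 16 / T := by
      rw [div_le_div_iff₀ (by nlinarith) hT0]
      nlinarith
    calc _ ≤ (e : ℝ) * (16 / T) := mul_le_mul_of_nonneg_left this he'.le
      _ = _ := by ring
  have b2 : ∀ i : ℕ, blockGcd (T - 1 / 2) (2 ^ (l + 1 + i) * T) e ≤ (e / T) * (1 / 2) ^ i := by
    intro i
    refine (blockGcd_le_sq ha (hU _) e).trans ?_
    have h1 : (T - 1 / 2) / (2 * (T - 1 / 2 - 1)) ≤ 1 := by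
      rw [div_le_one (by linarith)]
      linarith
    calc (e : ℝ) ^ 2 / (2 ^ (l + 1 + i) * T) * ((T - 1 / 2) / (2 * (T - 1 / 2 - 1)))
        ≤ (e : ℝ) ^ 2 / (2 ^ (l + 1 + i) * T) * 1 := mul_le_mul_of_nonneg_left h1 (by positivity)
      _ = (e / 2 ^ (l + 1)) * ((e / T) * (1 / 2) ^ i) := by
          rw [pow_add _ (l + 1) i]
          field_simp
          rw [← mul_pow]
          norm_num
      _ ≤ 1 * ((e / T) * (1 / 2) ^ i) := by
          refine mul_le_mul_of_nonneg_right ?_ (by positivity)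
          rwa [div_le_one (by positivity)]
      _ = _ := one_mul _
  calc ∑ j ∈ Finset.range J, blockGcd (T - 1 / 2) (2 ^ j * T) e
      ≤ ∑ j ∈ Finset.range (l + 1 + J), blockGcd (T - 1 / 2) (2 ^ j * T) e :=
        Finset.sum_le_sum_of_subset_of_nonneg (Finset.range_mono (by omega))
          fun j _ _ => blockGcd_nonneg ha (hU j) e
    _ = ∑ j ∈ Finset.range (l + 1), blockGcd (T - 1 / 2) (2 ^ j * T) e +
        ∑ i ∈ Finset.range J, blockGcd (T - 1 / 2) (2 ^ (l + 1 + i) * T) e :=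
        Finset.sum_range_add _ _ _
    _ ≤ ∑ j ∈ Finset.range (l + 1), 16 * (e / T) +
        ∑ i ∈ Finset.range J, (e / T) * (1 / 2) ^ i :=
        add_le_add (Finset.sum_le_sum fun j _ => b1 j) (Finset.sum_le_sum fun i _ => b2 i)
    _ ≤ (l + 1) * (16 * (e / T)) + (e / T) * 2 := by
        refine add_le_add (le_of_eq ?_) ?_
        · rw [Finset.sum_const, Finset.card_range, nsmul_eq_mul]
          push_cast
          ring
        · rw [← Finset.mul_sum]
          exact mul_le_mul_of_nonneg_left (sum_geometric_two_le J) (by positivity)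
    _ ≤ _ := by
        have : (0 : ℝ) ≤ l := by positivity
        have h2 : 0 ≤ e / T := by positivity
        have e1 : 18 / T * (e * (1 + (l : ℝ))) = (l + 1) * (16 * (e / T)) + (e / T) * 2 +
          2 * l * (e / T) := by ring
        rw [e1]
        have : 0 ≤ 2 * l * (e / T) := by positivity
        linarith

theorem abs_dilationAverage_sawSum_le {a : ℝ} (ha : 0 < a) (D : Finset ℕ) (m : ℕ → ℝ) (u : ℝ) :
    |dilationAverage a (sawSum D m) u| ≤ 2 * ∑ h ∈ D, |m h| := by
  refine abs_dilationAverage_le ha fun l _ => ?_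
  have h1 := abs_sub (sawSum D m (l * u)) (sawSum D m u)
  linarith [abs_sawSum_le D m (l * u), abs_sawSum_le D m u]

theorem integrableOn_dilationAverage_sq_div_sq_Ioi {a : ℝ} (ha : 0 < a) (D : Finset ℕ) (m : ℕ → ℝ)
    {T : ℝ} (hT : 0 < T) :
    IntegrableOn (fun u => dilationAverage a (sawSum D m) u ^ 2 / u ^ 2) (Set.Ioi T) := by
  have h1 : IntegrableOn (fun u : ℝ => u ^ (-2 : ℝ)) (Set.Ioi T) :=
    integrableOn_Ioi_rpow_of_lt (by norm_num) hT
  have h2 : IntegrableOn (fun u : ℝ => dilationAverage a (sawSum D m) u ^ 2 * u ^ (-2 : ℝ))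
      (Set.Ioi T) := by
    refine h1.bdd_mul (c := (2 * ∑ h ∈ D, |m h|) ^ 2)
      ((measurable_dilationAverage (measurable_sawSum D m)).pow_const 2).aestronglyMeasurable ?_
    refine Eventually.of_forall fun u => ?_
    rw [Real.norm_eq_abs, abs_pow]
    exact pow_le_pow_left₀ (abs_nonneg _) (abs_dilationAverage_sawSum_le ha D m u) 2
  refine h2.congr_fun (fun u hu => ?_) measurableSet_Ioi
  have hu0 : 0 < u := hT.trans hu
  dsimp only
  rw [Real.rpow_neg hu0.le, Real.rpow_two]
  rfl

theorem integral_sq_dilationAverage_Ioi_le {T : ℝ} (hT : 3 ≤ T) (D : Finset ℕ)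
    (hD : ∀ h ∈ D, 0 < h) (hdvd : ∀ h ∈ D, ∀ d, d ∣ h → d ∈ D) (m : ℕ → ℝ) :
    ∫ u in Set.Ioi T, dilationAverage (T - 1 / 2) (sawSum D m) u ^ 2 / u ^ 2 ≤
      18 / T * (∑ d ∈ D, (∑ h ∈ D with d ∣ h, m h / h) ^ 2 *
        ∑ e ∈ d.divisors, (e : ℝ) * (1 + Nat.log 2 e)) +
        16 / T ^ 2 * (∑ h ∈ D, |m h| * h) ^ 2 := by
  set Φ := dilationAverage (T - 1 / 2) (sawSum D m) with hΦ
  set S := ∑ h ∈ D, |m h| * (h : ℝ) with hS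
  have hT0 : 0 < T := by linarith
  have ha : 1 < T - 1 / 2 := by linarith
  have hInt := integrableOn_dilationAverage_sq_div_sq_Ioi (by linarith : 0 < T - 1 / 2) D m hT0
  have hlim := intervalIntegral_tendsto_integral_Ioi T hInt
    (Filter.Tendsto.atTop_mul_const hT0 (tendsto_pow_atTop_atTop_of_one_lt (one_lt_two (α := ℝ))))
  refine le_of_tendsto' hlim fun J => ?_
  have hInt' : ∀ j : ℕ, IntervalIntegrable (fun u => Φ u ^ 2 / u ^ 2) volume
      (2 ^ j * T) (2 ^ (j + 1) * T) := by
    intro j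
    have h1 : T ≤ 2 ^ j * T := le_mul_of_one_le_left hT0.le (one_le_pow₀ one_le_two)
    refine (intervalIntegrable_iff_integrableOn_Ioc_of_le ?_).2
      (hInt.mono_set (Set.Ioc_subset_Ioi_self.trans (Set.Ioi_subset_Ioi h1)))
    rw [pow_succ]
    nlinarith
  have hsum := intervalIntegral.sum_integral_adjacent_intervals (f := fun u => Φ u ^ 2 / u ^ 2)
    (μ := volume) (a := fun j : ℕ => 2 ^ j * T) (n := J) (fun j _ => hInt' j)
  simp only [pow_zero, one_mul] at hsum
  rw [← hsum]
  have hblock : ∀ j ∈ Finset.range J, ∫ u in (2 ^ j * T)..(2 ^ (j + 1) * T), Φ u ^ 2 / u ^ 2 ≤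
      (∑ d ∈ D, (∑ h ∈ D with d ∣ h, m h / h) ^ 2 *
        ∑ e ∈ d.divisors, blockGcd (T - 1 / 2) (2 ^ j * T) e) + 8 / T ^ 2 * S ^ 2 * (1 / 2) ^ j := by
    intro j _
    have hU : 0 < (2 : ℝ) ^ j * T := by positivity
    have h1 := integral_sq_dilationAverage_block_le ha hU D hD m
    have h2 := sum_sum_mul_gcd_le D hD hdvd (fun h => m h / h)
      (blockGcd (T - 1 / 2) (2 ^ j * T)) (blockGcd_nonneg ha hU)
    have e1 : ∀ h k : ℕ, m h / h * (m k / k) = m h * m k / (h * k) := fun h k => by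
      rw [div_mul_div_comm]
    simp_rw [e1] at h2
    rw [intervalIntegral.integral_of_le (by rw [pow_succ]; nlinarith),
      show (2 : ℝ) ^ (j + 1) * T = 2 * (2 ^ j * T) by ring]
    refine h1.trans (add_le_add h2 ?_)
    have h3 : 4 * (T - 1 / 2) / (T - 1 / 2 - 1) ≤ 8 := by
      rw [div_le_iff₀ (by linarith)]
      linarith
    have h4 : (1 : ℝ) / (2 ^ j) ^ 2 ≤ (1 / 2) ^ j := by
      rw [one_div_pow]
      refine one_div_le_one_div_of_le (by positivity) ?_
      have : (1 : ℝ) ≤ 2 ^ j := one_le_pow₀ one_le_two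
      nlinarith
    calc 4 * (T - 1 / 2) / (T - 1 / 2 - 1) / (2 ^ j * T) ^ 2 * S ^ 2
        = 4 * (T - 1 / 2) / (T - 1 / 2 - 1) * (1 / T ^ 2 * S ^ 2) * (1 / (2 ^ j) ^ 2) := by
          rw [mul_pow]
          field_simp
      _ ≤ 8 * (1 / T ^ 2 * S ^ 2) * (1 / 2) ^ j := by
          refine mul_le_mul (mul_le_mul_of_nonneg_right h3 (by positivity)) h4 (by positivity)
            (by positivity)
      _ = _ := by ring
  refine (Finset.sum_le_sum hblock).trans ?_
  rw [Finset.sum_add_distrib]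
  refine add_le_add ?_ ?_
  · rw [Finset.sum_comm, Finset.mul_sum]
    refine Finset.sum_le_sum fun d _ => ?_
    rw [← Finset.mul_sum, mul_left_comm]
    refine mul_le_mul_of_nonneg_left ?_ (sq_nonneg _)
    rw [Finset.sum_comm, Finset.mul_sum]
    exact Finset.sum_le_sum fun e he => sum_blockGcd_le hT (Nat.pos_of_mem_divisors he) J
  · rw [← Finset.mul_sum]
    calc 8 / T ^ 2 * S ^ 2 * ∑ i ∈ Finset.range J, (1 / 2 : ℝ) ^ i ≤ 8 / T ^ 2 * S ^ 2 * 2 :=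
          mul_le_mul_of_nonneg_left (sum_geometric_two_le J) (by positivity)
      _ = _ := by ring

theorem floor_mul_eq_sum {l x : ℝ} (hl0 : 0 < l) (hl : l ≤ 1) (hx : 0 ≤ x) :
    ((⌊l * x⌋ : ℤ) : ℝ) = ∑ k ∈ Finset.Icc 1 ⌊x⌋₊, if (k : ℝ) / x ≤ l then (1 : ℝ) else 0 := by
  have h0 : 0 ≤ l * x := mul_nonneg hl0.le hx
  rw [← Finset.sum_filter]
  have : (Finset.Icc 1 ⌊x⌋₊).filter (fun k : ℕ => (k : ℝ) / x ≤ l) = Finset.Icc 1 ⌊l * x⌋₊ := by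
    ext k
    simp only [Finset.mem_filter, Finset.mem_Icc]
    constructor
    · rintro ⟨⟨h1, h2⟩, h3⟩
      refine ⟨h1, Nat.le_floor ?_⟩
      have hk : (1 : ℝ) ≤ k := by exact_mod_cast h1
      have hx' : 0 < x := by
        have : (k : ℝ) ≤ x := (Nat.le_floor_iff hx).1 h2
        linarith
      rwa [div_le_iff₀ hx'] at h3
    · rintro ⟨h1, h2⟩
      have h3 : (k : ℝ) ≤ l * x := (Nat.le_floor_iff h0).1 h2
      have hk : (1 : ℝ) ≤ k := by exact_mod_cast h1
      have hx' : 0 < x := by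
        rcases hx.lt_or_eq with h | h
        · exact h
        · rw [← h] at h3
          linarith
      refine ⟨⟨h1, Nat.le_floor (h3.trans ?_)⟩, ?_⟩
      · nlinarith
      · rwa [div_le_iff₀ hx']
  rw [this, Finset.sum_const, Nat.card_Icc, nsmul_eq_mul, mul_one, Nat.add_sub_cancel,
    natCast_floor_eq_intCast_floor h0]

theorem integral_dilationKernel_ite {a : ℝ} (ha : 0 < a) {r : ℝ} (hr0 : 0 < r) (hr : r ≤ 1) :
    ∫ l in Set.Ioc (0 : ℝ) 1, (if r ≤ l then (1 : ℝ) else 0) * (a * l ^ (a - 1)) = 1 - r ^ a := by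
  have h1 : ∀ l : ℝ, (if r ≤ l then (1 : ℝ) else 0) * (a * l ^ (a - 1)) =
      (Set.Ici r).indicator (fun l => a * l ^ (a - 1)) l := by
    intro l
    by_cases h : r ≤ l <;> simp [Set.indicator, h]
  simp_rw [h1]
  rw [setIntegral_indicator measurableSet_Ici]
  have h2 : Set.Ioc (0 : ℝ) 1 ∩ Set.Ici r = Set.Icc r 1 := by
    ext l
    simp only [Set.mem_inter_iff, Set.mem_Ioc, Set.mem_Ici, Set.mem_Icc]
    constructor
    · rintro ⟨⟨_, h⟩, h'⟩
      exact ⟨h', h⟩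
    · rintro ⟨h, h'⟩
      exact ⟨⟨by linarith, h'⟩, h⟩
  rw [h2, integral_Icc_eq_integral_Ioc, ← intervalIntegral.integral_of_le hr,
    intervalIntegral.integral_const_mul, integral_rpow (Or.inl (by linarith))]
  rw [sub_add_cancel, Real.one_rpow]
  field_simp

theorem dilationAverage_fract {a : ℝ} (ha : 0 < a) {x : ℝ} (hx : 0 ≤ x) :
    dilationAverage a (fun u => Int.fract u) x =
      (∑ k ∈ Finset.Icc 1 ⌊x⌋₊, ((k : ℝ) / x) ^ a) - x / (a + 1) := by
  have hb : ∀ u : ℝ, |Int.fract u| ≤ 1 := fun u => by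
    rw [abs_of_nonneg (Int.fract_nonneg u)]
    exact (Int.fract_lt_one u).le
  rw [dilationAverage_eq ha measurable_fract hb]
  have hki := integrableOn_dilationKernel ha
  have i0 : ∀ k : ℕ, IntegrableOn (fun l : ℝ => (if (k : ℝ) / x ≤ l then (1 : ℝ) else 0) *
      (a * l ^ (a - 1))) (Set.Ioc 0 1) := by
    intro k
    refine hki.bdd_mul (c := 1) ?_ ?_
    · exact (Measurable.ite measurableSet_Ici measurable_const
        measurable_const).aestronglyMeasurable
    · refine Eventually.of_forall fun l => ?_
      split_ifs <;> simp
  have i1 : IntegrableOn (fun l : ℝ => x * (l ^ (1 : ℝ) * (a * l ^ (a - 1)))) (Set.Ioc 0 1) := by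
    refine Integrable.const_mul ?_ _
    by_contra hcon
    have := integral_dilationKernel_mul_rpow ha zero_le_one
    rw [integral_undef hcon] at this
    have : 0 < a / (a + 1) := by positivity
    linarith
  have e1 : ∫ l in Set.Ioc (0 : ℝ) 1, Int.fract (l * x) * (a * l ^ (a - 1)) =
      ∫ l in Set.Ioc (0 : ℝ) 1, (x * (l ^ (1 : ℝ) * (a * l ^ (a - 1))) -
        ∑ k ∈ Finset.Icc 1 ⌊x⌋₊, (if (k : ℝ) / x ≤ l then (1 : ℝ) else 0) *
          (a * l ^ (a - 1))) := by
    refine setIntegral_congr_fun measurableSet_Ioc fun l hl => ?_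
    rw [← Finset.sum_mul, ← floor_mul_eq_sum hl.1 hl.2 hx, Int.fract, Real.rpow_one]
    ring
  have e2 : ∀ k ∈ Finset.Icc 1 ⌊x⌋₊, ∫ l in Set.Ioc (0 : ℝ) 1,
      (if (k : ℝ) / x ≤ l then (1 : ℝ) else 0) * (a * l ^ (a - 1)) = 1 - ((k : ℝ) / x) ^ a := by
    intro k hk
    rw [Finset.mem_Icc] at hk
    have hk1 : (1 : ℝ) ≤ k := by exact_mod_cast hk.1
    have hk2 : (k : ℝ) ≤ x := (Nat.le_floor_iff hx).1 hk.2
    have hx' : 0 < x := by linarith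
    exact integral_dilationKernel_ite ha (by positivity) ((div_le_one hx').2 hk2)
  rw [e1, integral_sub i1 (integrable_finsetSum _ fun k _ => i0 k),
    integral_finsetSum _ fun k _ => i0 k, integral_const_mul,
    integral_dilationKernel_mul_rpow ha zero_le_one, Finset.sum_congr rfl e2,
    Finset.sum_sub_distrib, Finset.sum_const, Nat.card_Icc, nsmul_eq_mul, mul_one,
    Nat.add_sub_cancel, natCast_floor_eq_intCast_floor hx, Int.fract]
  field_simp
  ring

theorem dilationAverage_sawSum_eq_sum {a : ℝ} (ha : 0 < a) (D : Finset ℕ) (m : ℕ → ℝ) (u : ℝ) :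
    dilationAverage a (sawSum D m) u =
      ∑ h ∈ D, m h * dilationAverage a (fun u => Int.fract u) (u / h) := by
  have hb : ∀ u : ℝ, |Int.fract u| ≤ 1 := fun u => by
    rw [abs_of_nonneg (Int.fract_nonneg u)]
    exact (Int.fract_lt_one u).le
  rw [dilationAverage_eq ha (measurable_sawSum D m) (abs_sawSum_le D m)]
  simp_rw [dilationAverage_eq ha measurable_fract hb]
  have e1 : ∀ l : ℝ, sawSum D m (l * u) * (a * l ^ (a - 1)) =
      ∑ h ∈ D, m h * (Int.fract (l * (u / h)) * (a * l ^ (a - 1))) := by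
    intro l
    rw [sawSum, Finset.sum_mul]
    refine Finset.sum_congr rfl fun h _ => ?_
    rw [mul_div_assoc]
    ring
  simp_rw [e1]
  rw [integral_finsetSum]
  · simp_rw [integral_const_mul, mul_sub, Finset.sum_sub_distrib]
    rfl
  · intro h _
    exact (integrableOn_dilation_mul_kernel ha measurable_fract hb (u / h)).const_mul _

theorem sum_Icc_floor_div {h : ℕ} (hh : 0 < h) (u : ℝ) (F : ℕ → ℝ) :
    ∑ k ∈ Finset.Icc 1 ⌊u / h⌋₊, F (k * h) =
      ∑ n ∈ Finset.Icc 1 ⌊u⌋₊, if h ∣ n then F n else 0 := by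
  rw [← Finset.sum_filter, Nat.floor_div_natCast]
  refine Finset.sum_bij (fun k _ => k * h) ?_ ?_ ?_ ?_
  · intro k hk
    rw [Finset.mem_Icc] at hk
    rw [Finset.mem_filter, Finset.mem_Icc]
    exact ⟨⟨Nat.mul_pos hk.1 hh, (Nat.le_div_iff_mul_le hh).1 hk.2⟩, dvd_mul_left _ _⟩
  · intro k _ k' _ he
    exact Nat.eq_of_mul_eq_mul_right hh he
  · intro n hn
    rw [Finset.mem_filter, Finset.mem_Icc] at hn
    obtain ⟨⟨h1, h2⟩, k, rfl⟩ := hn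
    refine ⟨k, ?_, mul_comm _ _⟩
    rw [Finset.mem_Icc]
    refine ⟨Nat.pos_of_mul_pos_left h1, (Nat.le_div_iff_mul_le hh).2 ?_⟩
    rwa [mul_comm]
  · intro k _
    rfl

/-- The Dirichlet convolution of `m` (supported on `D`) with `1`. -/
noncomputable def divisorSum (D : Finset ℕ) (m : ℕ → ℝ) (n : ℕ) : ℝ := ∑ h ∈ D with h ∣ n, m h

theorem dilationAverage_sawSum_eq {a : ℝ} (ha : 0 < a) (D : Finset ℕ) (hD : ∀ h ∈ D, 0 < h)
    (m : ℕ → ℝ) {u : ℝ} (hu : 0 < u) :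
    dilationAverage a (sawSum D m) u =
      (∑ n ∈ Finset.Icc 1 ⌊u⌋₊, divisorSum D m n * ((n : ℝ) / u) ^ a) -
        (∑ h ∈ D, m h / h) * (u / (a + 1)) := by
  rw [dilationAverage_sawSum_eq_sum ha]
  have e1 : ∀ h ∈ D, m h * dilationAverage a (fun u => Int.fract u) (u / h) =
      (∑ n ∈ Finset.Icc 1 ⌊u⌋₊, if h ∣ n then m h * ((n : ℝ) / u) ^ a else 0) -
        m h / h * (u / (a + 1)) := by
    intro h hh
    have hh' : (0 : ℝ) < h := by exact_mod_cast hD h hh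
    rw [dilationAverage_fract ha (by positivity),
      ← sum_Icc_floor_div (hD h hh) u (fun n => m h * ((n : ℝ) / u) ^ a), mul_sub, Finset.mul_sum]
    congr 1
    · refine Finset.sum_congr rfl fun k _ => ?_
      congr 2
      push_cast
      field_simp
    · field_simp
  rw [Finset.sum_congr rfl e1, Finset.sum_sub_distrib, ← Finset.sum_mul, Finset.sum_comm]
  congr 1
  refine Finset.sum_congr rfl fun n _ => ?_
  rw [divisorSum, Finset.sum_mul, Finset.sum_filter]

theorem sum_rpow_div_le {a u : ℝ} (ha : 0 < a) (hu : 0 ≤ u) (hua : u ≤ a + 1) :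
    ∑ n ∈ Finset.Icc 1 ⌊u⌋₊, ((n : ℝ) / u) ^ a ≤ 2 := by
  have h1 := dilationAverage_fract ha hu
  have h2 : |dilationAverage a (fun u => Int.fract u) u| ≤ 1 := by
    refine abs_dilationAverage_le ha fun l _ => abs_le.2 ⟨?_, ?_⟩
    · linarith [Int.fract_nonneg (l * u), Int.fract_lt_one u]
    · linarith [Int.fract_nonneg u, Int.fract_lt_one (l * u)]
  have h3 : u / (a + 1) ≤ 1 := (div_le_one (by linarith)).2 hua
  linarith [le_abs_self (dilationAverage a (fun u => Int.fract u) u)]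

/-- A majorant of `Φ(u)² / u²` on `(0, T]`. -/
noncomputable def lowMajorant (a : ℝ) (D : Finset ℕ) (m : ℕ → ℝ) (N : ℕ) (u : ℝ) : ℝ :=
  2 * (∑ h ∈ D, m h / h) ^ 2 / (a + 1) ^ 2 + ∑ n ∈ Finset.Icc 1 N,
    4 * divisorSum D m n ^ 2 * (Set.Ici (n : ℝ)).indicator
      (fun u : ℝ => (n : ℝ) ^ a * u ^ (-(a + 2))) u

theorem sq_dilationAverage_div_le_lowMajorant {a T : ℝ} (ha : 0 < a) (hT : T ≤ a + 1)
    (D : Finset ℕ) (hD : ∀ h ∈ D, 0 < h) (m : ℕ → ℝ) {u : ℝ} (hu : u ∈ Set.Ioc 0 T) :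
    dilationAverage a (sawSum D m) u ^ 2 / u ^ 2 ≤ lowMajorant a D m ⌊T⌋₊ u := by
  have hu0 : 0 < u := hu.1
  rw [dilationAverage_sawSum_eq ha D hD m hu0]
  set b := divisorSum D m with hb
  set c := ∑ h ∈ D, m h / h
  set w : ℕ → ℝ := fun n => ((n : ℝ) / u) ^ a with hw
  have hw0 : ∀ n, 0 ≤ w n := fun n => Real.rpow_nonneg (by positivity) _
  have h1 : (∑ n ∈ Finset.Icc 1 ⌊u⌋₊, b n * w n) ^ 2 ≤
      2 * ∑ n ∈ Finset.Icc 1 ⌊u⌋₊, b n ^ 2 * w n := by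
    have h2 := Finset.sum_mul_sq_le_sq_mul_sq (Finset.Icc 1 ⌊u⌋₊)
      (fun n => b n * √(w n)) (fun n => √(w n))
    have e1 : ∀ n, b n * √(w n) * √(w n) = b n * w n := fun n => by
      rw [mul_assoc, Real.mul_self_sqrt (hw0 n)]
    have e2 : ∀ n, (b n * √(w n)) ^ 2 = b n ^ 2 * w n := fun n => by
      rw [mul_pow, Real.sq_sqrt (hw0 n)]
    have e3 : ∀ n, (√(w n)) ^ 2 = w n := fun n => Real.sq_sqrt (hw0 n)
    simp_rw [e1, e2, e3] at h2
    have h3 := sum_rpow_div_le ha hu0.le (hu.2.trans hT)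
    have h4 : 0 ≤ ∑ n ∈ Finset.Icc 1 ⌊u⌋₊, b n ^ 2 * w n :=
      Finset.sum_nonneg fun n _ => mul_nonneg (sq_nonneg _) (hw0 n)
    nlinarith
  have h2 : ∑ n ∈ Finset.Icc 1 ⌊u⌋₊, b n ^ 2 * w n / u ^ 2 ≤ ∑ n ∈ Finset.Icc 1 ⌊T⌋₊,
      b n ^ 2 * (Set.Ici (n : ℝ)).indicator (fun u : ℝ => (n : ℝ) ^ a * u ^ (-(a + 2))) u := by
    calc _ = ∑ n ∈ Finset.Icc 1 ⌊u⌋₊,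
        b n ^ 2 * (Set.Ici (n : ℝ)).indicator (fun u : ℝ => (n : ℝ) ^ a * u ^ (-(a + 2))) u := by
          refine Finset.sum_congr rfl fun n hn => ?_
          rw [Finset.mem_Icc] at hn
          have hn2 : (n : ℝ) ≤ u := (Nat.le_floor_iff hu0.le).1 hn.2
          rw [Set.indicator_of_mem (show u ∈ Set.Ici (n : ℝ) from hn2), hw]
          dsimp only
          rw [Real.div_rpow (by positivity) hu0.le, Real.rpow_neg hu0.le, Real.rpow_add hu0,
            Real.rpow_two]
          field_simp
      _ ≤ _ := by
          refine Finset.sum_le_sum_of_subset_of_nonneg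
            (Finset.Icc_subset_Icc le_rfl (Nat.floor_mono hu.2)) fun n _ _ => ?_
          refine mul_nonneg (sq_nonneg _) (Set.indicator_nonneg (fun v hv => ?_) _)
          have : (0 : ℝ) ≤ v := (Nat.cast_nonneg n).trans hv
          positivity
  rw [lowMajorant]
  set S := ∑ n ∈ Finset.Icc 1 ⌊u⌋₊, b n * w n
  rw [div_le_iff₀ (by positivity)]
  have h3 : (S - c * (u / (a + 1))) ^ 2 ≤ 2 * S ^ 2 + 2 * (c * (u / (a + 1))) ^ 2 := by
    nlinarith [sq_nonneg (S + c * (u / (a + 1)))]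
  rw [← Finset.sum_div, div_le_iff₀ (by positivity)] at h2
  have e0 : ∀ n : ℕ, 4 * divisorSum D m n ^ 2 * (Set.Ici (n : ℝ)).indicator
      (fun u : ℝ => (n : ℝ) ^ a * u ^ (-(a + 2))) u = 4 * (b n ^ 2 * (Set.Ici (n : ℝ)).indicator
      (fun u : ℝ => (n : ℝ) ^ a * u ^ (-(a + 2))) u) := fun n => by ring
  simp_rw [e0]
  rw [← Finset.mul_sum, add_mul]
  have e1 : 2 * c ^ 2 / (a + 1) ^ 2 * u ^ 2 = 2 * (c * (u / (a + 1))) ^ 2 := by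
    field_simp
  rw [e1]
  linarith

theorem integral_lowMajorant_le {a T : ℝ} (ha : 0 < a) (hT0 : 0 < T) (hT : T ≤ a + 1)
    (D : Finset ℕ) (m : ℕ → ℝ) :
    IntegrableOn (lowMajorant a D m ⌊T⌋₊) (Set.Ioc 0 T) ∧
    ∫ u in Set.Ioc 0 T, lowMajorant a D m ⌊T⌋₊ u ≤
      2 / T * (∑ h ∈ D, m h / h) ^ 2 +
        4 / T * ∑ n ∈ Finset.Icc 1 ⌊T⌋₊, divisorSum D m n ^ 2 / n := by
  set c := ∑ h ∈ D, m h / h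
  have hi : ∀ n ∈ Finset.Icc 1 ⌊T⌋₊, IntegrableOn ((Set.Ici (n : ℝ)).indicator
      (fun u : ℝ => (n : ℝ) ^ a * u ^ (-(a + 2)))) (Set.Ioi 0) ∧
      ∫ u in Set.Ioi (0 : ℝ), (Set.Ici (n : ℝ)).indicator
        (fun u : ℝ => (n : ℝ) ^ a * u ^ (-(a + 2))) u = 1 / (n * (a + 1)) := by
    intro n hn
    have hn0 : (0 : ℝ) < n := by exact_mod_cast (Finset.mem_Icc.1 hn).1
    have hsub : Set.Ioi (0 : ℝ) ∩ Set.Ici (n : ℝ) = Set.Ici (n : ℝ) :=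
      Set.inter_eq_right.2 fun x hx => lt_of_lt_of_le hn0 hx
    constructor
    · rw [integrableOn_indicator_iff measurableSet_Ici, Set.inter_comm, hsub,
        integrableOn_Ici_iff_integrableOn_Ioi]
      exact (integrableOn_Ioi_rpow_of_lt (by linarith) hn0).const_mul _
    · rw [setIntegral_indicator measurableSet_Ici, hsub, integral_Ici_eq_integral_Ioi,
        integral_const_mul, integral_Ioi_rpow_of_lt (by linarith) hn0]
      rw [show -(a + 2) + 1 = -(a + 1) by ring, Real.rpow_neg hn0.le, Real.rpow_add hn0,
        Real.rpow_one]
      field_simp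
  have hi' : ∀ n ∈ Finset.Icc 1 ⌊T⌋₊, IntegrableOn (fun u => 4 * divisorSum D m n ^ 2 *
      (Set.Ici (n : ℝ)).indicator (fun u : ℝ => (n : ℝ) ^ a * u ^ (-(a + 2))) u)
      (Set.Ioc 0 T) := fun n hn =>
    ((hi n hn).1.mono_set Set.Ioc_subset_Ioi_self).const_mul _
  have hc : IntegrableOn (fun _ : ℝ => 2 * c ^ 2 / (a + 1) ^ 2) (Set.Ioc 0 T) :=
    integrable_const _
  have hs := integrable_finsetSum _ hi'
  refine ⟨hc.add hs, ?_⟩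
  unfold lowMajorant
  rw [integral_add hc hs, integral_finsetSum _ hi']
  refine add_le_add ?_ ?_
  · rw [setIntegral_const, smul_eq_mul, measureReal_def, Real.volume_Ioc, sub_zero,
      ENNReal.toReal_ofReal hT0.le]
    have h1 : T / (a + 1) ^ 2 ≤ 1 / T := by
      rw [div_le_div_iff₀ (by positivity) hT0]
      nlinarith
    calc T * (2 * c ^ 2 / (a + 1) ^ 2) = 2 * c ^ 2 * (T / (a + 1) ^ 2) := by ring
      _ ≤ 2 * c ^ 2 * (1 / T) := mul_le_mul_of_nonneg_left h1 (by positivity)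
      _ = _ := by ring
  · rw [Finset.mul_sum]
    refine Finset.sum_le_sum fun n hn => ?_
    have hn0 : (0 : ℝ) < n := by exact_mod_cast (Finset.mem_Icc.1 hn).1
    rw [integral_const_mul]
    have h1 : ∫ u in Set.Ioc 0 T, (Set.Ici (n : ℝ)).indicator
        (fun u : ℝ => (n : ℝ) ^ a * u ^ (-(a + 2))) u ≤ 1 / (n * (a + 1)) := by
      rw [← (hi n hn).2]
      refine setIntegral_mono_set (hi n hn).1 (Eventually.of_forall fun u => ?_)
        (Eventually.of_forall (Set.Ioc_subset_Ioi_self : Set.Ioc 0 T ⊆ Set.Ioi 0))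
      refine Set.indicator_nonneg (fun v hv => ?_) _
      have : (0 : ℝ) ≤ v := hn0.le.trans hv
      positivity
    have h2 : 1 / (n * (a + 1)) ≤ 1 / (n * T) :=
      one_div_le_one_div_of_le (by positivity) (mul_le_mul_of_nonneg_left hT hn0.le)
    calc _ ≤ 4 * divisorSum D m n ^ 2 * (1 / (n * T)) :=
          mul_le_mul_of_nonneg_left (h1.trans h2) (by positivity)
      _ = _ := by field_simp

theorem integral_sq_dilationAverage_le {T : ℝ} (hT : 3 ≤ T) (D : Finset ℕ)
    (hD : ∀ h ∈ D, 0 < h) (hdvd : ∀ h ∈ D, ∀ d, d ∣ h → d ∈ D) (m : ℕ → ℝ) :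
    IntegrableOn (fun u => dilationAverage (T - 1 / 2) (sawSum D m) u ^ 2 / u ^ 2) (Set.Ioi 0) ∧
    ∫ u in Set.Ioi 0, dilationAverage (T - 1 / 2) (sawSum D m) u ^ 2 / u ^ 2 ≤
      2 / T * (∑ h ∈ D, m h / h) ^ 2 +
        4 / T * ∑ n ∈ Finset.Icc 1 ⌊T⌋₊, divisorSum D m n ^ 2 / n +
      (18 / T * (∑ d ∈ D, (∑ h ∈ D with d ∣ h, m h / h) ^ 2 *
        ∑ e ∈ d.divisors, (e : ℝ) * (1 + Nat.log 2 e)) +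
        16 / T ^ 2 * (∑ h ∈ D, |m h| * h) ^ 2) := by
  have hT0 : 0 < T := by linarith
  have ha : 0 < T - 1 / 2 := by linarith
  have haT : T ≤ T - 1 / 2 + 1 := by linarith
  have h1 := integrableOn_dilationAverage_sq_div_sq_Ioi ha D m hT0
  obtain ⟨h2, h3⟩ := integral_lowMajorant_le ha hT0 haT D m
  have hmeas := measurable_dilationAverage (a := T - 1 / 2) (measurable_sawSum D m)
  have hle : ∀ᵐ u ∂(volume.restrict (Set.Ioc 0 T)),
      dilationAverage (T - 1 / 2) (sawSum D m) u ^ 2 / u ^ 2 ≤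
        lowMajorant (T - 1 / 2) D m ⌊T⌋₊ u :=
    (ae_restrict_iff' measurableSet_Ioc).2 (Eventually.of_forall fun u hu =>
      sq_dilationAverage_div_le_lowMajorant ha haT D hD m hu)
  have h4 : IntegrableOn (fun u => dilationAverage (T - 1 / 2) (sawSum D m) u ^ 2 / u ^ 2)
      (Set.Ioc 0 T) := by
    refine Integrable.mono' h2 ?_ ?_
    · exact ((hmeas.pow_const 2).div (measurable_id.pow_const 2)).aestronglyMeasurable
    · filter_upwards [hle] with u hu
      rwa [Real.norm_of_nonneg (by positivity)]
  rw [← Set.Ioc_union_Ioi_eq_Ioi hT0.le]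
  refine ⟨h4.union h1, ?_⟩
  rw [setIntegral_union Set.Ioc_disjoint_Ioi_same measurableSet_Ioi h4 h1]
  refine add_le_add ((integral_mono_ae h4 h2 hle).trans h3) ?_
  exact integral_sq_dilationAverage_Ioi_le hT D hD hdvd m

/-- The Dirichlet polynomial `∑_{h ∈ D} m(h) h^{-s}`. -/
noncomputable def dirichletPoly (D : Finset ℕ) (m : ℕ → ℝ) (s : ℂ) : ℂ :=
  ∑ h ∈ D, (m h : ℂ) * (h : ℂ) ^ (-s)

theorem integral_fract_div_mul_cpow {s : ℂ} (h0 : 0 < s.re) (h1 : s.re < 1) {h : ℕ} (hh : 0 < h) :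
    IntegrableOn (fun u : ℝ => ((Int.fract (u / h) : ℝ) : ℂ) * (u : ℂ) ^ (-(s + 1))) (Set.Ioi 0) ∧
    ∫ u in Set.Ioi (0 : ℝ), ((Int.fract (u / h) : ℝ) : ℂ) * (u : ℂ) ^ (-(s + 1)) =
      (h : ℂ) ^ (-s) * (-riemannZeta s / s) := by
  have hh' : (0 : ℝ) < h := by exact_mod_cast hh
  have hhC : (h : ℂ) ≠ 0 := by exact_mod_cast hh.ne'
  obtain ⟨i1, e1⟩ := integrableOn_fract_mul_cpow_Ioi_zero h0 h1
  set F : ℝ → ℂ := fun t => ((Int.fract t : ℝ) : ℂ) * (t : ℂ) ^ (-(s + 1)) with hF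
  have hpt : ∀ u ∈ Set.Ioi (0 : ℝ), ((Int.fract (u / h) : ℝ) : ℂ) * (u : ℂ) ^ (-(s + 1)) =
      (h : ℂ) ^ (-(s + 1)) * F ((h : ℝ)⁻¹ * u) := by
    intro u hu
    have hu0 : (0 : ℝ) < u := hu
    have e : (u : ℂ) = ((h : ℝ) : ℂ) * (((h : ℝ)⁻¹ * u : ℝ) : ℂ) := by
      push_cast
      field_simp
    conv_lhs => rw [e]
    rw [Complex.mul_cpow_ofReal_nonneg hh'.le (by positivity), hF]
    dsimp only
    rw [div_eq_inv_mul]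
    push_cast
    ring
  have i2 : IntegrableOn (fun u => F ((h : ℝ)⁻¹ * u)) (Set.Ioi 0) := by
    rw [integrableOn_Ioi_comp_mul_left_iff F 0 (inv_pos.2 hh'), mul_zero]
    exact i1
  refine ⟨IntegrableOn.congr_fun (i2.const_mul ((h : ℂ) ^ (-(s + 1)))) (fun u hu => (hpt u hu).symm)
    measurableSet_Ioi, ?_⟩
  rw [setIntegral_congr_fun measurableSet_Ioi hpt, integral_const_mul,
    integral_comp_mul_left_Ioi F 0 (inv_pos.2 hh'), mul_zero, e1, inv_inv]
  rw [neg_add, Complex.cpow_add _ _ hhC, Complex.cpow_neg_one, Complex.real_smul]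
  push_cast
  field_simp

theorem mellin_dilationAverage_sawSum {a : ℝ} (ha : 0 < a) (D : Finset ℕ) (hD : ∀ h ∈ D, 0 < h)
    (m : ℕ → ℝ) {s : ℂ} (h0 : 0 < s.re) (h1 : s.re < 1) :
    IntegrableOn (fun u : ℝ => (dilationAverage a (sawSum D m) u : ℂ) * (u : ℂ) ^ (-(s + 1)))
      (Set.Ioi 0) ∧
    ∫ u in Set.Ioi (0 : ℝ), (dilationAverage a (sawSum D m) u : ℂ) * (u : ℂ) ^ (-(s + 1)) =
      riemannZeta s * dirichletPoly D m s / (s + a) := by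
  have hs : s ≠ 0 := fun h => by simp [h] at h0
  have e1 : ∀ u : ℝ, (sawSum D m u : ℂ) * (u : ℂ) ^ (-(s + 1)) = ∑ h ∈ D, (m h : ℂ) *
      (((Int.fract (u / h) : ℝ) : ℂ) * (u : ℂ) ^ (-(s + 1))) := by
    intro u
    rw [sawSum]
    push_cast
    rw [Finset.sum_mul]
    exact Finset.sum_congr rfl fun h _ => by ring
  have hi : ∀ h ∈ D, IntegrableOn (fun u : ℝ => (m h : ℂ) *
      (((Int.fract (u / h) : ℝ) : ℂ) * (u : ℂ) ^ (-(s + 1)))) (Set.Ioi 0) := fun h hh =>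
    (integral_fract_div_mul_cpow h0 h1 (hD h hh)).1.const_mul _
  obtain ⟨r1, r2⟩ := mellin_dilationAverage ha (measurable_sawSum D m) (abs_sawSum_le D m) h0
    (by simp_rw [e1]; exact integrable_finsetSum _ hi)
  refine ⟨r1, ?_⟩
  rw [r2]
  simp_rw [e1]
  rw [integral_finsetSum _ hi]
  have e2 : ∀ h ∈ D, ∫ u in Set.Ioi (0 : ℝ), (m h : ℂ) *
      (((Int.fract (u / h) : ℝ) : ℂ) * (u : ℂ) ^ (-(s + 1))) =
      ((m h : ℂ) * (h : ℂ) ^ (-s)) * (-riemannZeta s / s) := by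
    intro h hh
    rw [integral_const_mul, (integral_fract_div_mul_cpow h0 h1 (hD h hh)).2]
    ring
  rw [Finset.sum_congr rfl e2, ← Finset.sum_mul, dirichletPoly]
  field_simp

/-- The second moment of a mollified zeta function against the Cauchy law of scale `T`. -/
theorem lintegral_cauchy_normSq_zeta_mul_dirichletPoly_le {T : ℝ} (hT : 3 ≤ T) (D : Finset ℕ)
    (hD : ∀ h ∈ D, 0 < h) (hdvd : ∀ h ∈ D, ∀ d, d ∣ h → d ∈ D) (m : ℕ → ℝ) :
    ∫⁻ y : ℝ, ENNReal.ofReal (T / (Real.pi * (T ^ 2 + y ^ 2)) *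
        ‖riemannZeta (1 / 2 + y * Complex.I) * dirichletPoly D m (1 / 2 + y * Complex.I)‖ ^ 2) ≤
      ENNReal.ofReal (4 * (∑ h ∈ D, m h / h) ^ 2 +
        8 * ∑ n ∈ Finset.Icc 1 ⌊T⌋₊, divisorSum D m n ^ 2 / n +
        36 * (∑ d ∈ D, (∑ h ∈ D with d ∣ h, m h / h) ^ 2 *
          ∑ e ∈ d.divisors, (e : ℝ) * (1 + Nat.log 2 e)) +
        32 / T * (∑ h ∈ D, |m h| * h) ^ 2) := by
  have hT0 : 0 < T := by linarith
  have ha : 0 < T - 1 / 2 := by linarith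
  obtain ⟨i2, b2⟩ := integral_sq_dilationAverage_le hT D hD hdvd m
  set Φ := dilationAverage (T - 1 / 2) (sawSum D m) with hΦ
  have i1 : IntegrableOn (fun u => Φ u * u ^ (-(3 / 2) : ℝ)) (Set.Ioi 0) := by
    have h := (mellin_dilationAverage_sawSum ha D hD m (s := ((1 / 2 : ℝ) : ℂ))
      (by simp) (by rw [Complex.ofReal_re]; norm_num)).1
    refine IntegrableOn.congr_fun h.re (fun u hu => ?_) measurableSet_Ioi
    have hu0 : (0 : ℝ) < u := hu
    have : (u : ℂ) ^ (-(((1 / 2 : ℝ) : ℂ) + 1)) = ((u ^ (-(3 / 2) : ℝ) : ℝ) : ℂ) := by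
      rw [Complex.ofReal_cpow hu0.le]
      congr 1
      push_cast
      ring
    rw [this, ← Complex.ofReal_mul]
    rfl
  have key := lintegral_normSq_mellin_le Φ i1 i2
  have e1 : ∀ y : ℝ, ‖∫ u in Set.Ioi (0 : ℝ),
      (Φ u : ℂ) * (u : ℂ) ^ (-((1 / 2 + y * Complex.I) + 1))‖ ^ 2 =
      (T ^ 2 + y ^ 2)⁻¹ * ‖riemannZeta (1 / 2 + y * Complex.I) *
        dirichletPoly D m (1 / 2 + y * Complex.I)‖ ^ 2 := by
    intro y
    rw [(mellin_dilationAverage_sawSum ha D hD m (s := 1 / 2 + y * Complex.I) (by simp)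
      (by simp; norm_num)).2, norm_div, div_pow]
    have : ‖(1 / 2 + y * Complex.I + ((T - 1 / 2 : ℝ) : ℂ))‖ ^ 2 = T ^ 2 + y ^ 2 := by
      rw [show (1 / 2 + y * Complex.I + ((T - 1 / 2 : ℝ) : ℂ)) = (T : ℂ) + y * Complex.I by
        push_cast; ring, ← Complex.normSq_eq_norm_sq, Complex.normSq_add_mul_I]
    rw [this]
    ring
  simp_rw [e1] at key
  have e2 : ∀ y : ℝ, ENNReal.ofReal (T / (Real.pi * (T ^ 2 + y ^ 2)) *
        ‖riemannZeta (1 / 2 + y * Complex.I) * dirichletPoly D m (1 / 2 + y * Complex.I)‖ ^ 2) =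
      ENNReal.ofReal (T / Real.pi) * ENNReal.ofReal ((T ^ 2 + y ^ 2)⁻¹ *
        ‖riemannZeta (1 / 2 + y * Complex.I) *
        dirichletPoly D m (1 / 2 + y * Complex.I)‖ ^ 2) := by
    intro y
    rw [← ENNReal.ofReal_mul (by positivity)]
    congr 1
    field_simp
  simp_rw [e2]
  rw [lintegral_const_mul' _ _ ENNReal.ofReal_ne_top]
  refine (mul_le_mul_right key _).trans ?_
  rw [← ENNReal.ofReal_mul (by positivity)]
  refine ENNReal.ofReal_le_ofReal ?_
  have h3 := mul_le_mul_of_nonneg_left b2 (by positivity : 0 ≤ 2 * T)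
  calc T / Real.pi * (2 * Real.pi * ∫ u in Set.Ioi 0, Φ u ^ 2 / u ^ 2)
      = 2 * T * ∫ u in Set.Ioi 0, Φ u ^ 2 / u ^ 2 := by field_simp
    _ ≤ _ := h3
    _ = _ := by
      field_simp
      ring

/-- Products of at most `K` distinct elements of `P`. -/
noncomputable def mollSupport (P : Finset ℕ) (K : ℕ) : Finset ℕ :=
  (P.powerset.filter (fun S => S.card ≤ K)).image (fun S => ∏ p ∈ S, p)

/-- The Möbius function on squarefree numbers. -/
noncomputable def mollCoeff (h : ℕ) : ℝ := (-1) ^ h.primeFactors.card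

section

variable {P : Finset ℕ}

theorem primeFactors_prod_of_subset (hP : ∀ p ∈ P, p.Prime) {S : Finset ℕ} (hS : S ⊆ P) :
    (∏ p ∈ S, p).primeFactors = S :=
  Nat.primeFactors_prod fun p hp => hP p (hS hp)

theorem prod_pos_of_subset (hP : ∀ p ∈ P, p.Prime) {S : Finset ℕ} (hS : S ⊆ P) :
    0 < ∏ p ∈ S, p := Finset.prod_pos fun p hp => (hP p (hS hp)).pos

theorem prod_dvd_iff_subset_primeFactors (hP : ∀ p ∈ P, p.Prime) {S : Finset ℕ} (hS : S ⊆ P)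
    {n : ℕ} (hn : n ≠ 0) : ∏ p ∈ S, p ∣ n ↔ S ⊆ n.primeFactors := by
  constructor
  · intro h p hp
    exact Nat.mem_primeFactors.2 ⟨hP p (hS hp), (Finset.dvd_prod_of_mem _ hp).trans h, hn⟩
  · intro h
    exact (Finset.prod_dvd_prod_of_subset _ _ _ h).trans (Nat.prod_primeFactors_dvd n)

theorem sum_mollSupport (hP : ∀ p ∈ P, p.Prime) (K : ℕ) {E : Type*} [AddCommMonoid E] (F : ℕ → E) :
    ∑ h ∈ mollSupport P K, F h = ∑ S ∈ P.powerset with S.card ≤ K, F (∏ p ∈ S, p) := by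
  refine Finset.sum_image fun S hS S' hS' he => ?_
  have h1 := Finset.mem_powerset.1 (Finset.mem_filter.1 hS).1
  have h2 := Finset.mem_powerset.1 (Finset.mem_filter.1 hS').1
  rw [← primeFactors_prod_of_subset hP h1, he, primeFactors_prod_of_subset hP h2]

theorem mollSupport_pos (hP : ∀ p ∈ P, p.Prime) {K h : ℕ} (hh : h ∈ mollSupport P K) : 0 < h := by
  obtain ⟨S, hS, rfl⟩ := Finset.mem_image.1 hh
  exact prod_pos_of_subset hP (Finset.mem_powerset.1 (Finset.mem_filter.1 hS).1)

theorem mollSupport_dvd (hP : ∀ p ∈ P, p.Prime) {K h d : ℕ} (hh : h ∈ mollSupport P K)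
    (hd : d ∣ h) : d ∈ mollSupport P K := by
  obtain ⟨S, hS, rfl⟩ := Finset.mem_image.1 hh
  rw [Finset.mem_filter, Finset.mem_powerset] at hS
  have h1 := (prod_pos_of_subset hP hS.1).ne'
  have h2 : d.primeFactors ⊆ S := by
    have := Nat.primeFactors_mono hd h1
    rwa [primeFactors_prod_of_subset hP hS.1] at this
  have hsq : Squarefree (∏ p ∈ S, p) := by
    refine Finset.squarefree_prod_of_pairwise_isCoprime ?_ fun p hp => (hP p (hS.1 hp)).squarefree
    intro p hp q hq hpq
    exact Nat.coprime_iff_isRelPrime.1 ((Nat.coprime_primes (hP p (hS.1 hp)) (hP q (hS.1 hq))).2 hpq)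
  refine Finset.mem_image.2 ⟨d.primeFactors, ?_, ?_⟩
  · rw [Finset.mem_filter, Finset.mem_powerset]
    exact ⟨h2.trans hS.1, (Finset.card_le_card h2).trans hS.2⟩
  · exact Nat.prod_primeFactors_of_squarefree (hsq.squarefree_of_dvd hd)

theorem sum_divisors_prod (hP : ∀ p ∈ P, p.Prime) (F : ℕ → ℝ) :
    ∑ d ∈ (∏ p ∈ P, p).divisors, F d = ∑ S ∈ P.powerset, F (∏ p ∈ S, p) := by
  have h1 := sum_mollSupport hP P.card F
  have h2 : P.powerset.filter (fun S => S.card ≤ P.card) = P.powerset :=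
    Finset.filter_true_of_mem fun S hS => Finset.card_le_card (Finset.mem_powerset.1 hS)
  have h0 := prod_pos_of_subset hP (Finset.Subset.refl P)
  have h3 : (∏ p ∈ P, p).divisors = mollSupport P P.card := by
    ext d
    rw [Nat.mem_divisors]
    constructor
    · rintro ⟨hd, -⟩
      refine mollSupport_dvd hP ?_ hd
      exact Finset.mem_image.2 ⟨P, by rw [h2]; exact Finset.mem_powerset_self P, rfl⟩
    · intro hd
      obtain ⟨S, hS, rfl⟩ := Finset.mem_image.1 hd
      rw [h2, Finset.mem_powerset] at hS
      exact ⟨Finset.prod_dvd_prod_of_subset _ _ _ hS, h0.ne'⟩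
  rw [h3, h1, h2]

theorem sum_superset_prod {R : Finset ℕ} (hR : R ⊆ P) (g : ℕ → ℝ) :
    ∑ S ∈ P.powerset with R ⊆ S, ∏ p ∈ S, g p =
      (∏ p ∈ R, g p) * ∏ p ∈ P \ R, (1 + g p) := by
  have h1 := Finset.prod_add g (fun p => if p ∈ R then (0 : ℝ) else 1) P
  have h2 : ∏ p ∈ P, (g p + if p ∈ R then (0 : ℝ) else 1) =
      (∏ p ∈ R, g p) * ∏ p ∈ P \ R, (1 + g p) := by
    rw [← Finset.prod_sdiff hR, mul_comm]
    congr 1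
    · exact Finset.prod_congr rfl fun p hp => by simp [hp]
    · exact Finset.prod_congr rfl fun p hp => by
        rw [if_neg (Finset.mem_sdiff.1 hp).2, add_comm]
  rw [← h2, h1, Finset.sum_filter]
  refine Finset.sum_congr rfl fun S _ => ?_
  by_cases h : R ⊆ S
  · have h3 : ∏ p ∈ P \ S, (if p ∈ R then (0 : ℝ) else 1) = 1 :=
      Finset.prod_eq_one fun p hp => if_neg fun hpR => (Finset.mem_sdiff.1 hp).2 (h hpR)
    rw [if_pos h, h3, mul_one]
  · rw [if_neg h]
    obtain ⟨p, hpR, hpS⟩ := Finset.not_subset.1 h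
    have h3 : ∏ p ∈ P \ S, (if p ∈ R then (0 : ℝ) else 1) = 0 :=
      Finset.prod_eq_zero (Finset.mem_sdiff.2 ⟨hR hpR, hpS⟩) (if_pos hpR)
    rw [h3, mul_zero]

theorem sum_card_le_prod_sub_le {R : Finset ℕ} (hR : R ⊆ P) (K : ℕ) (g : ℕ → ℝ) :
    |(∑ S ∈ P.powerset with S.card ≤ K ∧ R ⊆ S, ∏ p ∈ S, g p) -
      (∏ p ∈ R, g p) * ∏ p ∈ P \ R, (1 + g p)| ≤
      (1 / 3) ^ K * ((∏ p ∈ R, 3 * |g p|) * ∏ p ∈ P \ R, (1 + 3 * |g p|)) := by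
  rw [← sum_superset_prod hR, ← sum_superset_prod hR, Finset.sum_filter, Finset.sum_filter,
    Finset.sum_filter, ← Finset.sum_sub_distrib, Finset.mul_sum]
  refine (Finset.abs_sum_le_sum_abs _ _).trans (Finset.sum_le_sum fun S _ => ?_)
  by_cases h1 : R ⊆ S
  · simp only [h1, and_true, if_true]
    rw [Finset.prod_mul_distrib, Finset.prod_const, ← Finset.abs_prod]
    by_cases h2 : S.card ≤ K
    · rw [if_pos h2, sub_self, abs_zero]
      positivity
    · rw [if_neg h2, zero_sub, abs_neg, ← mul_assoc]
      refine le_mul_of_one_le_left (abs_nonneg _) ?_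
      rw [one_div, inv_pow, inv_mul_eq_div, one_le_div (by positivity)]
      exact pow_le_pow_right₀ (by norm_num) (by omega)
  · simp [h1]

end

section

variable {P : Finset ℕ}

theorem mollCoeff_prod (hP : ∀ p ∈ P, p.Prime) {S : Finset ℕ} (hS : S ⊆ P) :
    mollCoeff (∏ p ∈ S, p) = ∏ _p ∈ S, (-1 : ℝ) := by
  rw [mollCoeff, primeFactors_prod_of_subset hP hS, Finset.prod_const]

theorem sum_mollCoeff_div_of_dvd (hP : ∀ p ∈ P, p.Prime) (K : ℕ) {R : Finset ℕ} (hR : R ⊆ P) :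
    ∑ h ∈ mollSupport P K with (∏ p ∈ R, p) ∣ h, mollCoeff h / h =
      ∑ S ∈ P.powerset with S.card ≤ K ∧ R ⊆ S, ∏ p ∈ S, (-(1 / (p : ℝ))) := by
  rw [Finset.sum_filter, sum_mollSupport hP, Finset.sum_filter, Finset.sum_filter]
  refine Finset.sum_congr rfl fun S hS => ?_
  rw [Finset.mem_powerset] at hS
  have h1 : mollCoeff (∏ p ∈ S, p) / (∏ p ∈ S, p : ℕ) = ∏ p ∈ S, (-(1 / (p : ℝ))) := by
    rw [mollCoeff_prod hP hS, Nat.cast_prod, ← Finset.prod_div_distrib]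
    exact Finset.prod_congr rfl fun p _ => by ring
  simp only [prod_dvd_iff_subset_primeFactors hP hR (prod_pos_of_subset hP hS).ne',
    primeFactors_prod_of_subset hP hS, h1, ite_and]

theorem divisorSum_mollSupport (hP : ∀ p ∈ P, p.Prime) (K : ℕ) {n : ℕ} (hn : n ≠ 0) :
    divisorSum (mollSupport P K) mollCoeff n =
      ∑ S ∈ (P.filter (· ∣ n)).powerset with S.card ≤ K ∧ ∅ ⊆ S, ∏ _p ∈ S, (-1 : ℝ) := by
  have h1 : (P.filter (· ∣ n)).powerset.filter (fun S => S.card ≤ K ∧ ∅ ⊆ S) =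
      (P.powerset.filter (fun S => S.card ≤ K)).filter (fun S => ∏ p ∈ S, p ∣ n) := by
    ext S
    simp only [Finset.mem_filter, Finset.mem_powerset, Finset.empty_subset, and_true]
    constructor
    · rintro ⟨h1, h2⟩
      have h3 := h1.trans (Finset.filter_subset _ _)
      refine ⟨⟨h3, h2⟩, ?_⟩
      rw [prod_dvd_iff_subset_primeFactors hP h3 hn]
      exact fun p hp => Nat.mem_primeFactors.2
        ⟨hP p (h3 hp), (Finset.mem_filter.1 (h1 hp)).2, hn⟩
    · rintro ⟨⟨h1, h2⟩, h3⟩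
      refine ⟨fun p hp => Finset.mem_filter.2 ⟨h1 hp, (Finset.dvd_prod_of_mem _ hp).trans h3⟩, h2⟩
  rw [divisorSum, Finset.sum_filter, sum_mollSupport hP, ← Finset.sum_filter, h1]
  refine Finset.sum_congr rfl fun S hS => mollCoeff_prod hP ?_
  simp only [Finset.mem_filter, Finset.mem_powerset] at hS
  exact hS.1.1

theorem sq_divisorSum_mollSupport_le (hP : ∀ p ∈ P, p.Prime) (K : ℕ) {n : ℕ} (hn : n ≠ 0) :
    divisorSum (mollSupport P K) mollCoeff n ^ 2 ≤
      2 * (if ∀ p ∈ P, ¬ p ∣ n then 1 else 0) +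
        2 * (1 / 9) ^ K * ∏ _p ∈ P.filter (· ∣ n), (16 : ℝ) := by
  have h := sum_card_le_prod_sub_le (P := P.filter (· ∣ n)) (Finset.empty_subset _) K
    (fun _ => (-1 : ℝ))
  rw [← divisorSum_mollSupport hP K hn] at h
  simp only [Finset.prod_empty, one_mul, Finset.sdiff_empty, abs_neg, abs_one, mul_one,
    add_neg_cancel] at h
  norm_num only at h
  set b := divisorSum (mollSupport P K) mollCoeff n
  set q := ∏ p ∈ P.filter (· ∣ n), (4 : ℝ)
  set z := ∏ p ∈ P.filter (· ∣ n), (0 : ℝ) with hz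
  have hz2 : z ^ 2 = if ∀ p ∈ P, ¬ p ∣ n then 1 else 0 := by
    split_ifs with h1
    · rw [hz, Finset.filter_false_of_mem h1]; simp
    · push Not at h1
      obtain ⟨p, hp, hpn⟩ := h1
      rw [hz, Finset.prod_eq_zero (Finset.mem_filter.2 ⟨hp, hpn⟩) rfl]
      norm_num
  have hq2 : ∏ p ∈ P.filter (· ∣ n), (16 : ℝ) = q ^ 2 := by
    rw [← Finset.prod_pow]; norm_num
  rw [hq2, ← hz2]
  have h9 : ((1 : ℝ) / 9) ^ K = ((1 / 3) ^ K) ^ 2 := by rw [← pow_mul, mul_comm, pow_mul]; norm_num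
  rw [h9]
  have h5 := sq_le_sq' (abs_le.1 h).1 (abs_le.1 h).2
  nlinarith [sq_nonneg (b - 2 * z)]

theorem sq_sum_mollCoeff_div_le (hP : ∀ p ∈ P, p.Prime) (K : ℕ) {R : Finset ℕ} (hR : R ⊆ P) :
    (∑ h ∈ mollSupport P K with (∏ p ∈ R, p) ∣ h, mollCoeff h / h) ^ 2 ≤
      2 * (∏ p ∈ P, (1 - 1 / (p : ℝ))) ^ 2 * ∏ p ∈ R, (1 / ((p : ℝ) - 1) ^ 2) +
        2 * (1 / 9) ^ K * (∏ p ∈ P, (1 + 3 / (p : ℝ))) ^ 2 * ∏ p ∈ R, (9 / (p : ℝ) ^ 2) := by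
  have h := sum_card_le_prod_sub_le hR K (fun p : ℕ => (-(1 / (p : ℝ))))
  rw [← sum_mollCoeff_div_of_dvd hP K hR] at h
  set b := ∑ h ∈ mollSupport P K with (∏ p ∈ R, p) ∣ h, mollCoeff h / h
  have hA : ((∏ p ∈ R, (-(1 / (p : ℝ)))) * ∏ p ∈ P \ R, (1 + -(1 / (p : ℝ)))) ^ 2 =
      (∏ p ∈ P, (1 - 1 / (p : ℝ))) ^ 2 * ∏ p ∈ R, (1 / ((p : ℝ) - 1) ^ 2) := by
    rw [← Finset.prod_sdiff hR (f := fun p : ℕ => (1 - 1 / (p : ℝ))), mul_pow, mul_pow,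
      mul_assoc, mul_comm]
    simp only [← sub_eq_add_neg]
    congr 1
    rw [← Finset.prod_pow, ← Finset.prod_pow, ← Finset.prod_mul_distrib]
    refine Finset.prod_congr rfl fun p hp => ?_
    have h2 : (2 : ℝ) ≤ p := by exact_mod_cast (hP p (hR hp)).two_le
    have : (p : ℝ) - 1 ≠ 0 := by linarith
    field_simp
  have hB : ((1 / 3) ^ K * ((∏ p ∈ R, 3 * |(-(1 / (p : ℝ)))|) *
      ∏ p ∈ P \ R, (1 + 3 * |(-(1 / (p : ℝ)))|))) ^ 2 ≤
      (1 / 9) ^ K * (∏ p ∈ P, (1 + 3 / (p : ℝ))) ^ 2 * ∏ p ∈ R, (9 / (p : ℝ) ^ 2) := by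
    have h9 : ((1 : ℝ) / 9) ^ K = ((1 / 3) ^ K) ^ 2 := by
      rw [← pow_mul, mul_comm, pow_mul]; norm_num
    have e1 : ∏ p ∈ R, (9 / (p : ℝ) ^ 2) = (∏ p ∈ R, 3 * |(-(1 / (p : ℝ)))|) ^ 2 := by
      rw [← Finset.prod_pow]
      refine Finset.prod_congr rfl fun p _ => ?_
      rw [mul_pow, sq_abs]; ring
    have e2 : ∏ p ∈ P \ R, (1 + 3 * |(-(1 / (p : ℝ)))|) ≤ ∏ p ∈ P, (1 + 3 / (p : ℝ)) := by
      have : ∀ p : ℕ, 1 + 3 * |(-(1 / (p : ℝ)))| = 1 + 3 / (p : ℝ) := fun p => by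
        rw [abs_neg, abs_of_nonneg (by positivity)]; ring
      simp only [this]
      rw [← Finset.prod_sdiff hR (f := fun p : ℕ => (1 + 3 / (p : ℝ)))]
      refine le_mul_of_one_le_right (Finset.prod_nonneg fun p _ => by positivity) ?_
      refine Finset.one_le_prod fun p _ => ?_
      have : 0 ≤ 3 / (p : ℝ) := by positivity
      linarith
    rw [h9, e1, mul_pow, mul_pow, mul_comm ((∏ p ∈ R, 3 * |(-(1 / (p : ℝ)))|) ^ 2), mul_assoc]
    have e3 : 0 ≤ ∏ p ∈ P \ R, (1 + 3 * |(-(1 / (p : ℝ)))|) :=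
      Finset.prod_nonneg fun p _ => by positivity
    gcongr
  have h5 := sq_le_sq' (abs_le.1 h).1 (abs_le.1 h).2
  have h6 := h5.trans hB
  rw [mul_assoc, ← hA]
  set x := (∏ p ∈ R, (-(1 / (p : ℝ)))) * ∏ p ∈ P \ R, (1 + -(1 / (p : ℝ)))
  nlinarith [sq_nonneg (b - 2 * x)]

end

section

variable {P : Finset ℕ}

theorem sum_divisors_mul_one_add_log_le (hP : ∀ p ∈ P, p.Prime) {R : Finset ℕ} (hR : R ⊆ P)
    {B : ℝ} (hB : 1 + (Nat.log 2 (∏ p ∈ R, p) : ℝ) ≤ B) :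
    ∑ e ∈ (∏ p ∈ R, p).divisors, (e : ℝ) * (1 + Nat.log 2 e) ≤ B * ∏ p ∈ R, (1 + (p : ℝ)) := by
  have hP' : ∀ p ∈ R, p.Prime := fun p hp => hP p (hR hp)
  have h1 : ∑ e ∈ (∏ p ∈ R, p).divisors, (e : ℝ) = ∏ p ∈ R, (1 + (p : ℝ)) := by
    rw [sum_divisors_prod hP' (fun e => (e : ℝ)), Finset.prod_one_add]
    simp
  rw [← h1, Finset.mul_sum]
  refine Finset.sum_le_sum fun e he => ?_
  rw [mul_comm]
  refine mul_le_mul_of_nonneg_right (le_trans ?_ hB) (Nat.cast_nonneg e)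
  have h2 : e ≤ ∏ p ∈ R, p := Nat.divisor_le he
  have h3 : Nat.log 2 e ≤ Nat.log 2 (∏ p ∈ R, p) := Nat.log_mono_right h2
  have : (Nat.log 2 e : ℝ) ≤ Nat.log 2 (∏ p ∈ R, p) := by exact_mod_cast h3
  linarith

theorem sum_mollSupport_sq_mul_le (hP : ∀ p ∈ P, p.Prime) (K : ℕ) {B : ℝ}
    (hB : ∀ d ∈ mollSupport P K, 1 + (Nat.log 2 d : ℝ) ≤ B) :
    ∑ d ∈ mollSupport P K, (∑ h ∈ mollSupport P K with d ∣ h, mollCoeff h / h) ^ 2 *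
        ∑ e ∈ d.divisors, (e : ℝ) * (1 + Nat.log 2 e) ≤
      B * (2 * (∏ p ∈ P, (1 - 1 / (p : ℝ))) ^ 2 *
          ∏ p ∈ P, (1 + (1 / ((p : ℝ) - 1) ^ 2) * (1 + p)) +
        2 * (1 / 9) ^ K * (∏ p ∈ P, (1 + 3 / (p : ℝ))) ^ 2 *
          ∏ p ∈ P, (1 + (9 / (p : ℝ) ^ 2) * (1 + p))) := by
  have hB0 : 0 ≤ B := by
    refine le_trans ?_ (hB 1 ?_)
    · positivity
    · exact Finset.mem_image.2 ⟨∅, by simp, by simp⟩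
  rw [sum_mollSupport hP, Finset.prod_one_add P (f := fun p : ℕ => (1 / ((p : ℝ) - 1) ^ 2) * (1 + p)),
    Finset.prod_one_add P (f := fun p : ℕ => (9 / (p : ℝ) ^ 2) * (1 + p)), Finset.mul_sum,
    Finset.mul_sum, ← Finset.sum_add_distrib, Finset.mul_sum]
  refine (Finset.sum_le_sum fun R hR => ?_).trans
    (Finset.sum_le_sum_of_subset_of_nonneg (Finset.filter_subset _ _) fun R _ _ => ?_)
  · have hR2 := Finset.mem_filter.1 hR
    have hR1 := Finset.mem_powerset.1 hR2.1
    refine (mul_le_mul (sq_sum_mollCoeff_div_le hP K hR1) (sum_divisors_mul_one_add_log_le hP hR1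
      (hB _ (Finset.mem_image_of_mem _ hR))) ?_ ?_).trans_eq ?_
    · exact Finset.sum_nonneg fun e _ => by positivity
    · have := sq_nonneg (∏ p ∈ P, (1 - 1 / (p : ℝ)))
      have h2 : 0 ≤ ∏ p ∈ R, (1 / ((p : ℝ) - 1) ^ 2) := Finset.prod_nonneg fun p _ => by positivity
      positivity
    · rw [Finset.prod_mul_distrib, Finset.prod_mul_distrib]
      ring
  · have := sq_nonneg (∏ p ∈ P, (1 - 1 / (p : ℝ)))
    have h2 : 0 ≤ ∏ p ∈ R, ((1 / ((p : ℝ) - 1) ^ 2) * (1 + p)) :=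
      Finset.prod_nonneg fun p _ => by positivity
    positivity

theorem sum_Icc_dvd_one_div_le {d : ℕ} (hd : 0 < d) (N : ℕ) :
    ∑ n ∈ Finset.Icc 1 N with d ∣ n, 1 / (n : ℝ) ≤ 1 / d * (1 + Real.log N) := by
  rcases Nat.eq_zero_or_pos N with rfl | hN
  · simp
  have h1 : (Finset.Icc 1 N).filter (d ∣ ·) ⊆ (Finset.Icc 1 N).image (d * ·) := by
    intro n hn
    obtain ⟨hn1, k, rfl⟩ := Finset.mem_filter.1 hn
    rw [Finset.mem_Icc] at hn1
    refine Finset.mem_image.2 ⟨k, Finset.mem_Icc.2 ⟨?_, ?_⟩, rfl⟩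
    · exact Nat.pos_of_mul_pos_left hn1.1
    · exact (Nat.le_mul_of_pos_left k hd).trans hn1.2
  refine (Finset.sum_le_sum_of_subset_of_nonneg h1 fun _ _ _ => by positivity).trans ?_
  rw [Finset.sum_image fun a _ b _ h => Nat.eq_of_mul_eq_mul_left hd h]
  have h2 : ∑ k ∈ Finset.Icc 1 N, 1 / ((d * k : ℕ) : ℝ) =
      1 / d * ∑ k ∈ Finset.Icc 1 N, (k : ℝ)⁻¹ := by
    rw [Finset.mul_sum]
    refine Finset.sum_congr rfl fun k _ => ?_
    push_cast
    rw [one_div, mul_inv, one_div]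
  rw [h2]
  gcongr
  have := harmonic_le_one_add_log N
  rw [harmonic_eq_sum_Icc] at this
  push_cast at this
  exact this

theorem sum_Icc_prod_filter_dvd_le (hP : ∀ p ∈ P, p.Prime) (N : ℕ) :
    ∑ n ∈ Finset.Icc 1 N, (∏ _p ∈ P.filter (· ∣ n), (16 : ℝ)) / n ≤
      (∏ p ∈ P, (1 + 15 / (p : ℝ))) * (1 + Real.log N) := by
  have h1 : ∀ n ∈ Finset.Icc 1 N, (∏ _p ∈ P.filter (· ∣ n), (16 : ℝ)) / n =
      ∑ S ∈ P.powerset, if ∏ p ∈ S, p ∣ n then (∏ _p ∈ S, (15 : ℝ)) * (1 / n) else 0 := by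
    intro n hn
    have hn0 : n ≠ 0 := by have := (Finset.mem_Icc.1 hn).1; omega
    have h16 : (16 : ℝ) = 1 + 15 := by norm_num
    rw [h16, Finset.prod_one_add, Finset.sum_div, ← Finset.sum_filter]
    refine (Finset.sum_congr ?_ fun S _ => by rw [mul_one_div])
    ext S
    simp only [Finset.mem_filter, Finset.mem_powerset]
    constructor
    · intro h
      have h3 := h.trans (Finset.filter_subset _ _)
      refine ⟨h3, ?_⟩
      rw [prod_dvd_iff_subset_primeFactors hP h3 hn0]
      exact fun p hp => Nat.mem_primeFactors.2
        ⟨hP p (h3 hp), (Finset.mem_filter.1 (h hp)).2, hn0⟩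
    · rintro ⟨h, h'⟩ p hp
      exact Finset.mem_filter.2 ⟨h hp, (Finset.dvd_prod_of_mem _ hp).trans h'⟩
  rw [Finset.sum_congr rfl h1, Finset.sum_comm, Finset.prod_one_add, Finset.sum_mul]
  refine Finset.sum_le_sum fun S hS => ?_
  rw [← Finset.sum_filter, ← Finset.mul_sum]
  have h2 := sum_Icc_dvd_one_div_le (prod_pos_of_subset hP (Finset.mem_powerset.1 hS)) N
  have h3 : (0 : ℝ) ≤ ∏ _p ∈ S, (15 : ℝ) := Finset.prod_nonneg fun _ _ => by norm_num
  refine (mul_le_mul_of_nonneg_left h2 h3).trans_eq ?_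
  rw [← mul_assoc, Nat.cast_prod, mul_one_div, ← Finset.prod_div_distrib]

theorem sum_Icc_sq_divisorSum_le (hP : ∀ p ∈ P, p.Prime) (K N : ℕ) :
    ∑ n ∈ Finset.Icc 1 N, divisorSum (mollSupport P K) mollCoeff n ^ 2 / n ≤
      2 * (∑ n ∈ Finset.Icc 1 N with ∀ p ∈ P, ¬ p ∣ n, 1 / (n : ℝ)) +
        2 * (1 / 9) ^ K * ((∏ p ∈ P, (1 + 15 / (p : ℝ))) * (1 + Real.log N)) := by
  have h1 := mul_le_mul_of_nonneg_left (sum_Icc_prod_filter_dvd_le hP N)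
    (by positivity : (0 : ℝ) ≤ 2 * (1 / 9) ^ K)
  refine le_trans ?_ (add_le_add_right h1 _)
  rw [Finset.sum_filter, Finset.mul_sum, Finset.mul_sum, ← Finset.sum_add_distrib]
  refine Finset.sum_le_sum fun n hn => ?_
  have hn0 : n ≠ 0 := by have := (Finset.mem_Icc.1 hn).1; omega
  refine (div_le_div_of_nonneg_right (sq_divisorSum_mollSupport_le hP K hn0)
    (Nat.cast_nonneg n)).trans_eq ?_
  rw [add_div, mul_div_assoc, mul_div_assoc]
  congr 2
  split_ifs <;> simp

end

theorem log_mul_sum_rough_le (N X : ℕ) (hX : 1 ≤ X) :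
    Real.log X * (∑ n ∈ Finset.Icc 1 N with ∀ p ∈ Nat.primesLE X, ¬ p ∣ n, 1 / (n : ℝ)) ≤
      1 + Real.log (N * X) := by
  have h0 : Real.log X ≤ ∑ m ∈ Finset.Icc 1 X, 1 / (m : ℝ) := by
    have := log_add_one_le_harmonic X
    rw [harmonic_eq_sum_Icc] at this
    push_cast at this
    simp only [one_div]
    refine le_trans (Real.log_le_log (by exact_mod_cast hX) (by linarith)) this
  set A := (Finset.Icc 1 N).filter (fun n => ∀ p ∈ Nat.primesLE X, ¬ p ∣ n) with hA
  refine (mul_le_mul_of_nonneg_right h0 (Finset.sum_nonneg fun _ _ => by positivity)).trans ?_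
  rw [Finset.sum_mul_sum, ← Finset.sum_product']
  have hcop : ∀ n ∈ A, ∀ m ∈ Finset.Icc 1 X, Nat.Coprime n m := by
    intro n hn m hm
    refine Nat.coprime_of_dvd fun p hp hpn hpm => ?_
    refine (Finset.mem_filter.1 hn).2 p ?_ hpn
    rw [Finset.mem_Icc] at hm
    rw [Nat.mem_primesLE]
    exact ⟨(Nat.le_of_dvd hm.1 hpm).trans hm.2, hp⟩
  have hinj : Set.InjOn (fun q : ℕ × ℕ => q.1 * q.2) ((Finset.Icc 1 X ×ˢ A : Finset (ℕ × ℕ)) : Set (ℕ × ℕ)) := by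
    rintro ⟨m, n⟩ h ⟨m', n'⟩ h' he
    simp only [Finset.coe_product, Set.mem_prod, Finset.mem_coe] at h h' he
    have h1 : n ∣ n' := (hcop n h.2 m' h'.1).dvd_of_dvd_mul_left (he ▸ Dvd.intro_left m rfl)
    have h2 : n' ∣ n := (hcop n' h'.2 m h.1).dvd_of_dvd_mul_left (he.symm ▸ Dvd.intro_left m' rfl)
    have h3 := Nat.dvd_antisymm h1 h2
    subst h3
    have hn : 0 < n := (Finset.mem_Icc.1 (Finset.mem_filter.1 h.2).1).1
    rw [Nat.eq_of_mul_eq_mul_right hn he]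
  have h2 : ∑ q ∈ Finset.Icc 1 X ×ˢ A, 1 / (q.1 : ℝ) * (1 / (q.2 : ℝ)) =
      ∑ k ∈ (Finset.Icc 1 X ×ˢ A).image (fun q : ℕ × ℕ => q.1 * q.2), (k : ℝ)⁻¹ := by
    rw [Finset.sum_image hinj]
    refine Finset.sum_congr rfl fun q _ => ?_
    push_cast
    rw [mul_inv, one_div, one_div]
  rw [h2]
  have h3 : (Finset.Icc 1 X ×ˢ A).image (fun q : ℕ × ℕ => q.1 * q.2) ⊆ Finset.Icc 1 (N * X) := by
    intro k hk
    obtain ⟨q, hq, rfl⟩ := Finset.mem_image.1 hk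
    rw [Finset.mem_product] at hq
    have hq1 := Finset.mem_Icc.1 hq.1
    have hq2 := Finset.mem_Icc.1 (Finset.mem_filter.1 hq.2).1
    rw [Finset.mem_Icc]
    exact ⟨Nat.mul_pos hq1.1 hq2.1, (Nat.mul_le_mul hq1.2 hq2.2).trans_eq (mul_comm _ _)⟩
  refine (Finset.sum_le_sum_of_subset_of_nonneg h3 fun _ _ _ => by positivity).trans ?_
  have := harmonic_le_one_add_log (N * X)
  rw [harmonic_eq_sum_Icc] at this
  push_cast at this
  exact this

theorem norm_prime_cpow_neg (p : Nat.Primes) (s : ℂ) : ‖((p : ℕ) : ℂ) ^ (-s)‖ = (p : ℝ) ^ (-s.re) := by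
  rw [Complex.norm_natCast_cpow_of_pos p.2.pos, Complex.neg_re]

theorem summable_prime_rpow_neg {r : ℝ} (hr : 1 < r) :
    Summable fun p : Nat.Primes => (p : ℝ) ^ (-r) :=
  Nat.Primes.summable_rpow.2 (by linarith)

theorem norm_neg_log_sub_le {z : ℂ} (hz : ‖z‖ ≤ 1 / 2) :
    ‖-Complex.log (1 - z) - z‖ ≤ ‖z‖ ^ 2 := by
  have h1 := Complex.norm_log_one_add_sub_self_le (z := -z) (by rw [norm_neg]; linarith)
  rw [norm_neg] at h1
  have h2 : -Complex.log (1 - z) - z = -(Complex.log (1 + -z) - -z) := by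
    rw [← sub_eq_add_neg]; ring
  rw [h2, norm_neg]
  refine h1.trans ?_
  have h3 : (1 - ‖z‖)⁻¹ ≤ 2 := by
    rw [inv_le_comm₀ (by linarith) (by norm_num)]; linarith
  nlinarith [sq_nonneg ‖z‖]

theorem abs_tsum_prime_cpow_re_sub_log_le {s : ℂ} (hs : 1 < s.re) :
    |(∑' p : Nat.Primes, (((p : ℕ) : ℂ) ^ (-s)).re) - Real.log ‖riemannZeta s‖| ≤
      ∑' p : Nat.Primes, (p : ℝ) ^ (-2 : ℝ) := by
  set z : Nat.Primes → ℂ := fun p => ((p : ℕ) : ℂ) ^ (-s)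
  have hz1 : ∀ p, ‖z p‖ ≤ (p : ℝ) ^ (-1 : ℝ) := fun p => by
    rw [norm_prime_cpow_neg]
    exact Real.rpow_le_rpow_of_exponent_le (by exact_mod_cast p.2.one_lt.le) (by linarith)
  have hz2 : ∀ p, ‖z p‖ ≤ 1 / 2 := fun p => by
    refine (hz1 p).trans ?_
    rw [Real.rpow_neg_one, one_div]
    exact inv_anti₀ (by norm_num) (by exact_mod_cast p.2.two_le)
  have hsz : Summable z := by
    refine Summable.of_norm ?_
    simp only [z, norm_prime_cpow_neg]
    exact summable_prime_rpow_neg hs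
  have hd : ∀ p, ‖-Complex.log (1 - z p) - z p‖ ≤ (p : ℝ) ^ (-2 : ℝ) := fun p => by
    refine (norm_neg_log_sub_le (hz2 p)).trans ?_
    refine (pow_le_pow_left₀ (norm_nonneg _) (hz1 p) 2).trans_eq ?_
    rw [← Real.rpow_natCast, ← Real.rpow_mul (Nat.cast_nonneg _)]
    norm_num
  have hs2 := summable_prime_rpow_neg (r := 2) (by norm_num)
  have hsd : Summable fun p => -Complex.log (1 - z p) - z p := Summable.of_norm_bounded hs2 hd
  have hsl : Summable fun p => -Complex.log (1 - z p) := by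
    simpa using hsd.add hsz
  have hlog : Real.log ‖riemannZeta s‖ = (∑' p, -Complex.log (1 - z p)).re := by
    rw [← riemannZeta_eulerProduct_exp_log hs, Complex.norm_exp, Real.log_exp]
  have h1 : (∑' p, z p).re = ∑' p, (z p).re := Complex.re_tsum hsz
  rw [hlog, abs_sub_comm, ← h1, ← Complex.sub_re, ← hsl.tsum_sub hsz]
  exact (Complex.abs_re_le_norm _).trans (tsum_of_norm_bounded hs2.hasSum hd)

theorem prime_cpow_re (p : ℕ) (hp : 0 < p) (r h : ℝ) :
    ((p : ℂ) ^ (-((r : ℂ) + h * Complex.I))).re = (p : ℝ) ^ (-r) * Real.cos (h * Real.log p) := by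
  have hp' : (p : ℂ) ≠ 0 := by exact_mod_cast hp.ne'
  have h1 : ((Real.log p : ℝ) : ℂ) * -((r : ℂ) + h * Complex.I) =
      ((Real.log p * -r : ℝ) : ℂ) + ((-(h * Real.log p) : ℝ) : ℂ) * Complex.I := by
    rw [Complex.ofReal_mul, Complex.ofReal_neg, Complex.ofReal_neg, Complex.ofReal_mul]; ring
  rw [Complex.cpow_def_of_ne_zero hp', ← Complex.natCast_log, h1, Complex.exp_re,
    Real.rpow_def_of_pos (by exact_mod_cast hp)]
  rw [Complex.add_re, Complex.add_im, Complex.ofReal_re, Complex.ofReal_im,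
    Complex.re_ofReal_mul, Complex.im_ofReal_mul, Complex.I_re, Complex.I_im, mul_zero, add_zero,
    zero_add, mul_one, Real.cos_neg]

theorem exists_abs_log_norm_riemannZeta₁_le :
    ∃ C : ℝ, ∀ x ∈ Set.Icc (0 : ℝ) 1, ∀ y ∈ Set.Icc (-1 : ℝ) 1,
      |Real.log ‖riemannZeta₁ ((1 + x : ℝ) + y * Complex.I)‖| ≤ C := by
  have hne : ∀ x ∈ Set.Icc (0 : ℝ) 1, ∀ y : ℝ, riemannZeta₁ ((1 + x : ℝ) + y * Complex.I) ≠ 0 := by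
    intro x hx y
    set s : ℂ := (1 + x : ℝ) + y * Complex.I with hs
    by_cases h1 : s = 1
    · rw [h1, riemannZeta₁_one]; exact one_ne_zero
    · have h2 : riemannZeta s ≠ 0 := riemannZeta_ne_zero_of_one_le_re (by simp [hs]; exact hx.1)
      rw [riemannZeta_eq_inv_sub_mul h1] at h2
      exact right_ne_zero_of_mul h2
  have hcont : ContinuousOn (fun q : ℝ × ℝ =>
      Real.log ‖riemannZeta₁ ((1 + q.1 : ℝ) + q.2 * Complex.I)‖) (Set.Icc 0 1 ×ˢ Set.Icc (-1) 1) := by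
    refine ContinuousOn.log (Continuous.continuousOn ?_) fun q hq =>
      norm_ne_zero_iff.2 (hne q.1 hq.1 q.2)
    refine (differentiable_riemannZeta₁.continuous.comp ?_).norm
    fun_prop
  obtain ⟨C, hC⟩ := (isCompact_Icc.prod isCompact_Icc).exists_bound_of_continuousOn hcont
  exact ⟨C, fun x hx y hy => hC (x, y) ⟨hx, hy⟩⟩

theorem exists_abs_tsum_prime_cos_add_log_le :
    ∃ C : ℝ, ∀ ε : ℝ, 0 < ε → ε ≤ 1 → ∀ h ∈ Set.Icc (-1 : ℝ) 1,
      |(∑' p : Nat.Primes, (p : ℝ) ^ (-(1 + ε)) * Real.cos (h * Real.log p)) +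
        Real.log ‖(ε : ℂ) + h * Complex.I‖| ≤ C := by
  obtain ⟨C, hC⟩ := exists_abs_log_norm_riemannZeta₁_le
  refine ⟨(∑' p : Nat.Primes, (p : ℝ) ^ (-2 : ℝ)) + C, fun ε hε hε1 h hh => ?_⟩
  set s : ℂ := ((1 + ε : ℝ) : ℂ) + h * Complex.I with hs
  have hre : s.re = 1 + ε := by simp [hs]
  have hs1 : s ≠ 1 := fun h1 => by rw [h1] at hre; simp at hre; linarith
  have h1 := abs_tsum_prime_cpow_re_sub_log_le (s := s) (by rw [hre]; linarith)
  have h2 : ∀ p : Nat.Primes, (((p : ℕ) : ℂ) ^ (-s)).re =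
      (p : ℝ) ^ (-(1 + ε)) * Real.cos (h * Real.log p) := fun p => prime_cpow_re p p.2.pos _ _
  simp only [h2] at h1
  have h3 : s - 1 = (ε : ℂ) + h * Complex.I := by rw [hs]; push_cast; ring
  have hz0 : riemannZeta s ≠ 0 := riemannZeta_ne_zero_of_one_le_re (by rw [hre]; linarith)
  have h4 : Real.log ‖riemannZeta s‖ =
      -Real.log ‖(ε : ℂ) + h * Complex.I‖ + Real.log ‖riemannZeta₁ s‖ := by
    rw [riemannZeta_eq_inv_sub_mul hs1] at hz0 ⊢
    rw [norm_mul, norm_inv, Real.log_mul, Real.log_inv, h3]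
    · exact inv_ne_zero (norm_ne_zero_iff.2 (sub_ne_zero.2 hs1))
    · exact norm_ne_zero_iff.2 (right_ne_zero_of_mul hz0)
  rw [h4] at h1
  have h5 := hC ε ⟨hε.le, hε1⟩ h hh
  rw [← hs] at h5
  rw [abs_le] at *
  constructor <;> linarith [h1.1, h1.2, h5.1, h5.2]

/-- The primes up to `X`, as elements of the subtype of primes. -/
def primesFinset (X : ℕ) : Finset Nat.Primes := (Nat.primesLE X).subtype Nat.Prime

theorem mem_primesFinset {X : ℕ} {p : Nat.Primes} : p ∈ primesFinset X ↔ (p : ℕ) ≤ X :=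
  Finset.mem_subtype.trans (Nat.mem_primesLE.trans (and_iff_left p.2))

theorem sum_primesLE_eq_sum_primesFinset (X : ℕ) (f : ℕ → ℝ) :
    ∑ p ∈ Nat.primesLE X, f p = ∑ p ∈ primesFinset X, f p :=
  (Finset.sum_subtype_of_mem f fun _ hp => (Nat.mem_primesLE.1 hp).2).symm

theorem sum_primesLE_le_tsum (X : ℕ) {f : ℕ → ℝ} (hf : ∀ p, 0 ≤ f p)
    (hs : Summable fun p : Nat.Primes => f p) :
    ∑ p ∈ Nat.primesLE X, f p ≤ ∑' p : Nat.Primes, f p := by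
  rw [sum_primesLE_eq_sum_primesFinset]
  exact hs.sum_le_tsum _ fun p _ => hf p

theorem exists_abs_tsum_prime_rpow_add_log_le :
    ∃ C : ℝ, 0 ≤ C ∧ ∀ ε : ℝ, 0 < ε → ε ≤ 1 →
      |(∑' p : Nat.Primes, (p : ℝ) ^ (-(1 + ε))) + Real.log ε| ≤ C := by
  obtain ⟨C, hC⟩ := exists_abs_tsum_prime_cos_add_log_le
  have h1 : ∀ ε : ℝ, 0 < ε → ε ≤ 1 →
      |(∑' p : Nat.Primes, (p : ℝ) ^ (-(1 + ε))) + Real.log ε| ≤ C := by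
    intro ε hε hε1
    have := hC ε hε hε1 0 (by norm_num)
    simpa [abs_of_pos hε] using this
  exact ⟨C, (abs_nonneg _).trans (h1 1 one_pos le_rfl), h1⟩

theorem exists_sum_primesLE_one_div_le :
    ∃ C : ℝ, 0 ≤ C ∧ ∀ X : ℕ, 3 ≤ X →
      ∑ p ∈ Nat.primesLE X, 1 / (p : ℝ) ≤ 3 * (Real.log (Real.log X) + C) := by
  obtain ⟨C, hC0, hC⟩ := exists_abs_tsum_prime_rpow_add_log_le
  refine ⟨C, hC0, fun X hX => ?_⟩
  have hX3 : (3 : ℝ) ≤ X := by exact_mod_cast hX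
  have hlog : 1 ≤ Real.log X := by
    rw [Real.le_log_iff_exp_le (by linarith)]
    exact (Real.exp_one_lt_d9.le.trans (by norm_num)).trans hX3
  set ε := 1 / Real.log X with hε
  have hε0 : 0 < ε := by positivity
  have hε1 : ε ≤ 1 := by rw [hε, div_le_one (by linarith)]; exact hlog
  have h1 := (abs_le.1 (hC ε hε0 hε1)).2
  have h2 : Real.log ε = -Real.log (Real.log X) := by rw [hε, one_div, Real.log_inv]
  have h3 := sum_primesLE_le_tsum X (f := fun p : ℕ => (p : ℝ) ^ (-(1 + ε)))
    (fun p => by positivity) (summable_prime_rpow_neg (by linarith))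
  have h4 : ∑ p ∈ Nat.primesLE X, 1 / (p : ℝ) ≤
      Real.exp 1 * ∑ p ∈ Nat.primesLE X, (p : ℝ) ^ (-(1 + ε)) := by
    rw [Finset.mul_sum]
    refine Finset.sum_le_sum fun p hp => ?_
    obtain ⟨hpX, hpp⟩ := Nat.mem_primesLE.1 hp
    have hp0 : (0 : ℝ) < p := by exact_mod_cast hpp.pos
    have e1 : 1 / (p : ℝ) = (p : ℝ) ^ ε * (p : ℝ) ^ (-(1 + ε)) := by
      rw [← Real.rpow_add hp0, one_div, ← Real.rpow_neg_one]
      congr 1; ring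
    rw [e1]
    refine mul_le_mul_of_nonneg_right ?_ (by positivity)
    rw [Real.rpow_def_of_pos hp0]
    refine Real.exp_le_exp.2 ?_
    rw [hε, mul_one_div, div_le_one (by linarith)]
    exact Real.log_le_log hp0 (by exact_mod_cast hpX)
  have h5 : Real.exp 1 ≤ 3 := Real.exp_one_lt_d9.le.trans (by norm_num)
  have h6 : 0 ≤ ∑ p ∈ Nat.primesLE X, (p : ℝ) ^ (-(1 + ε)) :=
    Finset.sum_nonneg fun p _ => by positivity
  refine h4.trans ((mul_le_mul_of_nonneg_right h5 h6).trans ?_)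
  linarith

theorem tsum_prime_sub_sum_primesLE_eq (X : ℕ) {f : ℕ → ℝ}
    (hs : Summable fun p : Nat.Primes => f p) :
    (∑' p : Nat.Primes, f p) - ∑ p ∈ Nat.primesLE X, f p =
      ∑' p : Nat.Primes, if X < (p : ℕ) then f p else 0 := by
  rw [sum_primesLE_eq_sum_primesFinset, ← hs.sum_add_tsum_compl (s := primesFinset X),
    add_sub_cancel_left, tsum_subtype (((primesFinset X : Set Nat.Primes))ᶜ) (fun p => f p)]
  refine tsum_congr fun p => ?_
  by_cases h : X < (p : ℕ)
  · rw [if_pos h, Set.indicator_of_mem]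
    rw [Set.mem_compl_iff, Finset.mem_coe, mem_primesFinset]
    omega
  · rw [if_neg h, Set.indicator_of_notMem]
    rw [Set.mem_compl_iff, Finset.mem_coe, mem_primesFinset, not_not]
    omega

theorem exists_tsum_prime_gt_rpow_le :
    ∃ C : ℝ, 0 ≤ C ∧ ∀ (X : ℕ) (r : ℝ), 3 ≤ X → 1 ≤ r → r ≤ Real.log X →
      Real.log (Real.log X) ≤ r →
      ∑' p : Nat.Primes, (if X < (p : ℕ) then (p : ℝ) ^ (-(1 + 1 / (r * Real.log X))) else 0) ≤
        C + 2 * Real.log r := by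
  obtain ⟨C, hC0, hC⟩ := exists_abs_tsum_prime_rpow_add_log_le
  refine ⟨2 * C + 2 * (2 + C), by positivity, fun X r hX hr hrX hlr => ?_⟩
  set u := Real.log X with hu
  have hu1 : 1 ≤ u := hr.trans hrX
  set ε₁ := 1 / (r * u) with hε₁
  set ε₂ := r / u with hε₂
  have h10 : 0 < ε₁ := by positivity
  have h11 : ε₁ ≤ 1 := by
    rw [hε₁, div_le_one (by positivity)]; nlinarith
  have h20 : 0 < ε₂ := by positivity
  have h21 : ε₂ ≤ 1 := by rw [hε₂, div_le_one (by linarith)]; exact hrX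
  have h12 : ε₁ ≤ ε₂ := by
    rw [hε₁, hε₂, div_le_div_iff₀ (by positivity) (by positivity)]
    have : 1 ≤ r * r := by nlinarith
    nlinarith
  have s1 := summable_prime_rpow_neg (r := 1 + ε₁) (by linarith)
  have s2 := summable_prime_rpow_neg (r := 1 + ε₂) (by linarith)
  have s3 := summable_prime_rpow_neg (r := 1 + ε₂ / 2) (by linarith)
  have e1 := tsum_prime_sub_sum_primesLE_eq X (f := fun p : ℕ => (p : ℝ) ^ (-(1 + ε₁))) s1
  have e2 := tsum_prime_sub_sum_primesLE_eq X (f := fun p : ℕ => (p : ℝ) ^ (-(1 + ε₂))) s2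
  rw [← e1]
  have m1 : ∑ p ∈ Nat.primesLE X, (p : ℝ) ^ (-(1 + ε₂)) ≤
      ∑ p ∈ Nat.primesLE X, (p : ℝ) ^ (-(1 + ε₁)) := by
    refine Finset.sum_le_sum fun p hp => ?_
    refine Real.rpow_le_rpow_of_exponent_le ?_ (by linarith)
    exact_mod_cast (Nat.mem_primesLE.1 hp).2.one_lt.le
  have t2 : ∑' p : Nat.Primes, (if X < (p : ℕ) then (p : ℝ) ^ (-(1 + ε₂)) else 0) ≤
      Real.exp (-(r / 2)) * ∑' p : Nat.Primes, (p : ℝ) ^ (-(1 + ε₂ / 2)) := by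
    rw [← tsum_mul_left]
    refine Summable.tsum_le_tsum (fun p => ?_) ?_ (s3.mul_left _)
    · split_ifs with h
      · have hp0 : (0 : ℝ) < (p : ℕ) := by exact_mod_cast p.2.pos
        have h1 : ((p : ℕ) : ℝ) ^ (-(1 + ε₂)) =
            ((p : ℕ) : ℝ) ^ (-(ε₂ / 2)) * ((p : ℕ) : ℝ) ^ (-(1 + ε₂ / 2)) := by
          rw [← Real.rpow_add hp0]; congr 1; ring
        rw [h1]
        refine mul_le_mul_of_nonneg_right ?_ (by positivity)
        rw [Real.rpow_def_of_pos hp0]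
        refine Real.exp_le_exp.2 ?_
        have h2 : u ≤ Real.log (p : ℕ) := Real.log_le_log (by positivity) (by exact_mod_cast h.le)
        have h3 : r / 2 = u * (ε₂ / 2) := by rw [hε₂]; field_simp
        rw [h3, mul_neg, neg_le_neg_iff]
        exact mul_le_mul_of_nonneg_right h2 (by positivity)
      · positivity
    · refine Summable.of_nonneg_of_le (fun p => ?_) (fun p => ?_) s2
      · split_ifs <;> positivity
      · split_ifs
        · exact le_rfl
        · positivity
  have b1 := (abs_le.1 (hC ε₁ h10 h11)).2
  have b2 := (abs_le.1 (hC ε₂ h20 h21)).1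
  have b3 := (abs_le.1 (hC (ε₂ / 2) (by positivity) (by linarith))).2
  have l1 : Real.log ε₁ = -(Real.log r + Real.log u) := by
    rw [hε₁, one_div, Real.log_inv, Real.log_mul (by linarith) (by linarith)]
  have l2 : Real.log ε₂ = Real.log r - Real.log u := by
    rw [hε₂, Real.log_div (by linarith) (by linarith)]
  have l3 : Real.log (ε₂ / 2) = Real.log r - Real.log u - Real.log 2 := by
    rw [Real.log_div h20.ne' (by norm_num), l2]
  have hlogr : 0 ≤ Real.log r := Real.log_nonneg hr
  have hlog2 : Real.log 2 ≤ 1 := by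
    have := Real.log_two_lt_d9; linarith
  have hexp : Real.exp (-(r / 2)) ≤ 2 / r := by
    rw [Real.exp_neg, inv_le_comm₀ (Real.exp_pos _) (by positivity), inv_div]
    have := Real.add_one_le_exp (r / 2)
    linarith
  have t3 : Real.exp (-(r / 2)) * ∑' p : Nat.Primes, (p : ℝ) ^ (-(1 + ε₂ / 2)) ≤ 2 * (2 + C) := by
    have h1 : ∑' p : Nat.Primes, (p : ℝ) ^ (-(1 + ε₂ / 2)) ≤ r * (2 + C) := by
      nlinarith
    refine (mul_le_mul hexp h1 (tsum_nonneg fun p => by positivity) (by positivity)).trans_eq ?_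
    field_simp
  linarith

theorem exists_abs_sum_primesLE_cos_add_log_le :
    ∃ C : ℝ, 0 ≤ C ∧ ∀ (X : ℕ) (r : ℝ), 3 ≤ X → 1 ≤ r → r ≤ Real.log X →
      Real.log (Real.log X) ≤ r → ∀ h ∈ Set.Icc (-1 : ℝ) 1,
      |(∑ p ∈ Nat.primesLE X, Real.cos (h * Real.log p) / p) +
        Real.log ‖((1 / (r * Real.log X) : ℝ) : ℂ) + h * Complex.I‖| ≤ C + 2 * Real.log r := by
  obtain ⟨C₁, hC₁⟩ := exists_abs_tsum_prime_cos_add_log_le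
  obtain ⟨C₂, hC₂0, hC₂⟩ := exists_sum_primesLE_one_div_le
  obtain ⟨C₃, hC₃0, hC₃⟩ := exists_tsum_prime_gt_rpow_le
  refine ⟨|C₁| + 3 * (1 + C₂) + C₃, by positivity, fun X r hX hr hrX hlr h hh => ?_⟩
  have b3 := hC₃ X r hX hr hrX hlr
  have b2 := hC₂ X hX
  set u := Real.log X with hu
  have hu1 : 1 ≤ u := hr.trans hrX
  set ε := 1 / (r * u) with hε
  have hε0 : 0 < ε := by positivity
  have hε1 : ε ≤ 1 := by
    rw [hε, div_le_one (by positivity)]; nlinarith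
  have b1 := (hC₁ ε hε0 hε1 h hh).trans (le_abs_self _)
  have s1 := summable_prime_rpow_neg (r := 1 + ε) (by linarith)
  have s2 : Summable fun p : Nat.Primes => (p : ℝ) ^ (-(1 + ε)) * Real.cos (h * Real.log p) := by
    refine Summable.of_norm_bounded s1 fun p => ?_
    rw [norm_mul, Real.norm_of_nonneg (by positivity)]
    exact mul_le_of_le_one_right (by positivity) (Real.abs_cos_le_one _)
  have e1 := tsum_prime_sub_sum_primesLE_eq X
    (f := fun p : ℕ => (p : ℝ) ^ (-(1 + ε)) * Real.cos (h * Real.log p)) s2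
  have s3 : Summable fun p : Nat.Primes => if X < (p : ℕ) then (p : ℝ) ^ (-(1 + ε)) else 0 := by
    refine Summable.of_nonneg_of_le (fun p => ?_) (fun p => ?_) s1
    · split_ifs <;> positivity
    · split_ifs
      · exact le_rfl
      · positivity
  have d1 : |∑' p : Nat.Primes, (if X < (p : ℕ) then
      (p : ℝ) ^ (-(1 + ε)) * Real.cos (h * Real.log p) else 0)| ≤ C₃ + 2 * Real.log r := by
    rw [← Real.norm_eq_abs]
    refine le_trans (tsum_of_norm_bounded s3.hasSum fun p => ?_) b3
    split_ifs
    · rw [norm_mul, Real.norm_of_nonneg (by positivity)]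
      exact mul_le_of_le_one_right (by positivity) (Real.abs_cos_le_one _)
    · simp
  have d2 : |(∑ p ∈ Nat.primesLE X, Real.cos (h * Real.log p) / p) -
      ∑ p ∈ Nat.primesLE X, (p : ℝ) ^ (-(1 + ε)) * Real.cos (h * Real.log p)| ≤ 3 * (1 + C₂) := by
    have h1 : |(∑ p ∈ Nat.primesLE X, Real.cos (h * Real.log p) / p) -
        ∑ p ∈ Nat.primesLE X, (p : ℝ) ^ (-(1 + ε)) * Real.cos (h * Real.log p)| ≤
        1 / r * ∑ p ∈ Nat.primesLE X, 1 / (p : ℝ) := by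
      rw [← Finset.sum_sub_distrib, Finset.mul_sum]
      refine (Finset.abs_sum_le_sum_abs _ _).trans (Finset.sum_le_sum fun p hp => ?_)
      obtain ⟨hpX, hpp⟩ := Nat.mem_primesLE.1 hp
      have hp0 : (0 : ℝ) < p := by exact_mod_cast hpp.pos
      have hp1 : (1 : ℝ) ≤ p := by exact_mod_cast hpp.one_lt.le
      have e2 : (p : ℝ) ^ (-(1 + ε)) = Real.exp (-(ε * Real.log p)) / p := by
        rw [neg_add, Real.rpow_add hp0, Real.rpow_neg_one, Real.rpow_def_of_pos hp0]
        rw [mul_neg, mul_comm ε, div_eq_inv_mul]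
      have e3 : ε * Real.log p ≤ 1 / r := by
        have := Real.log_le_log hp0 (by exact_mod_cast hpX : (p : ℝ) ≤ X)
        rw [hε, div_mul_eq_mul_div, one_mul, div_le_div_iff₀ (by positivity) (by positivity)]
        nlinarith
      have e4 := Real.add_one_le_exp (-(ε * Real.log p))
      have e5 : Real.exp (-(ε * Real.log p)) ≤ 1 := by
        rw [Real.exp_le_one_iff, neg_nonpos]
        have := Real.log_nonneg hp1
        positivity
      have e6 : Real.cos (h * Real.log p) / p - (p : ℝ) ^ (-(1 + ε)) * Real.cos (h * Real.log p) =
          Real.cos (h * Real.log p) * (1 - Real.exp (-(ε * Real.log p))) * (1 / p) := by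
        rw [e2]; ring
      rw [e6, abs_mul, abs_mul, abs_of_nonneg (by positivity : 0 ≤ 1 / (p : ℝ)),
        abs_of_nonneg (by linarith : 0 ≤ 1 - Real.exp (-(ε * Real.log p)))]
      refine mul_le_mul_of_nonneg_right ?_ (by positivity)
      have := Real.abs_cos_le_one (h * Real.log p)
      have := abs_nonneg (Real.cos (h * Real.log p))
      nlinarith
    refine h1.trans ?_
    rw [one_div, inv_mul_le_iff₀ (by linarith)]
    nlinarith
  rw [← e1] at d1
  have hA : (∑ p ∈ Nat.primesLE X, Real.cos (h * Real.log p) / p) +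
      Real.log ‖((1 / (r * Real.log X) : ℝ) : ℂ) + h * Complex.I‖ =
      ((∑ p ∈ Nat.primesLE X, Real.cos (h * Real.log p) / p) -
      ∑ p ∈ Nat.primesLE X, (p : ℝ) ^ (-(1 + ε)) * Real.cos (h * Real.log p)) -
      ((∑' p : Nat.Primes, (p : ℝ) ^ (-(1 + ε)) * Real.cos (h * Real.log p)) -
        ∑ p ∈ Nat.primesLE X, (p : ℝ) ^ (-(1 + ε)) * Real.cos (h * Real.log p)) +
      ((∑' p : Nat.Primes, (p : ℝ) ^ (-(1 + ε)) * Real.cos (h * Real.log p)) +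
        Real.log ‖(ε : ℂ) + h * Complex.I‖) := by
    rw [← hu]
    ring
  rw [hA]
  rw [abs_le] at *
  constructor <;> linarith [d1.1, d1.2, d2.1, d2.2, b1.1, b1.2]

theorem prod_primesLE_one_sub_le {X : ℕ} (hX : 3 ≤ X) :
    ∏ p ∈ Nat.primesLE X, (1 - 1 / (p : ℝ)) ≤ 1 / Real.log X := by
  let f : ℕ →* ℝ := ⟨⟨fun n => (n : ℝ)⁻¹, by simp⟩, fun a b => by push_cast; rw [mul_inv]⟩
  have hf : ∀ n : ℕ, f n = (n : ℝ)⁻¹ := fun n => rfl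
  have h1 := (EulerProduct.summable_and_hasSum_factoredNumbers_prod_filter_prime_geometric (f := f)
    (fun {p} hp => by
      rw [hf, Real.norm_of_nonneg (by positivity)]
      exact inv_lt_one_of_one_lt₀ (by exact_mod_cast hp.one_lt)) (Nat.primesLE X)).2
  have hfil : (Nat.primesLE X).filter Nat.Prime = Nat.primesLE X :=
    Finset.filter_true_of_mem fun p hp => (Nat.mem_primesLE.1 hp).2
  rw [hfil] at h1
  have h2 : ∑ n ∈ Finset.Icc 1 X, (n : ℝ)⁻¹ ≤ ∏ p ∈ Nat.primesLE X, (1 - f p)⁻¹ := by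
    rw [← Finset.sum_subtype_of_mem (p := (· ∈ Nat.factoredNumbers (Nat.primesLE X)))
      (fun n : ℕ => (n : ℝ)⁻¹)]
    · exact sum_le_hasSum _ (fun n _ => inv_nonneg.2 (Nat.cast_nonneg _)) h1
    · intro n hn
      rw [Finset.mem_Icc] at hn
      refine Nat.mem_factoredNumbers'.2 fun p hp hpn => ?_
      exact Nat.mem_primesLE.2 ⟨(Nat.le_of_dvd hn.1 hpn).trans hn.2, hp⟩
  have h3 : Real.log X ≤ ∑ n ∈ Finset.Icc 1 X, (n : ℝ)⁻¹ := by
    have := log_add_one_le_harmonic X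
    rw [harmonic_eq_sum_Icc] at this
    push_cast at this
    refine le_trans (Real.log_le_log ?_ (by linarith)) this
    have : (0 : ℝ) < X := by exact_mod_cast (by omega : 0 < X)
    exact this
  have h4 := h3.trans h2
  rw [Finset.prod_inv_distrib] at h4
  have h5 : 0 < Real.log X := Real.log_pos (by exact_mod_cast (by omega : 1 < X))
  have h6 : 0 < (∏ p ∈ Nat.primesLE X, (1 - f p))⁻¹ := h5.trans_le h4
  rw [one_div]
  simp only [hf, ← one_div] at h4 h6
  rw [one_div] at h4 h6
  exact (le_inv_comm₀ h5 (inv_pos.1 h6)).1 h4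

theorem prod_primesLE_nonneg (X : ℕ) : 0 ≤ ∏ p ∈ Nat.primesLE X, (1 - 1 / (p : ℝ)) := by
  refine Finset.prod_nonneg fun p hp => ?_
  have : (1 : ℝ) < p := by exact_mod_cast (Nat.mem_primesLE.1 hp).2.one_lt
  rw [sub_nonneg, div_le_one (by linarith)]
  exact this.le

theorem prod_one_add_le_exp_sum {P : Finset ℕ} {g : ℕ → ℝ} (hg : ∀ p ∈ P, 0 ≤ g p) :
    ∏ p ∈ P, (1 + g p) ≤ Real.exp (∑ p ∈ P, g p) := by
  rw [Real.exp_sum]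
  refine Finset.prod_le_prod (fun p hp => by linarith [hg p hp]) fun p hp => ?_
  rw [add_comm]
  exact Real.add_one_le_exp _

theorem sum_primesLE_two_div_le (X : ℕ) :
    ∑ p ∈ Nat.primesLE X, 2 / ((p : ℝ) * (p - 1)) ≤ 2 := by
  have h1 : ∀ N : ℕ, ∑ n ∈ Finset.range N, 2 / (((n : ℝ) + 2) * (n + 1)) = 2 - 2 / (N + 1) := by
    intro N
    induction N with
    | zero => simp
    | succ N ih =>
      rw [Finset.sum_range_succ, ih]
      push_cast
      field_simp
      ring
  have h2 : Nat.primesLE X ⊆ (Finset.range X).image (fun n : ℕ => n + 2) := by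
    intro p hp
    obtain ⟨hpX, hpp⟩ := Nat.mem_primesLE.1 hp
    have := hpp.two_le
    exact Finset.mem_image.2 ⟨p - 2, Finset.mem_range.2 (by omega), by omega⟩
  have h3 : ∑ p ∈ (Finset.range X).image (fun n : ℕ => n + 2), 2 / ((p : ℝ) * (p - 1)) =
      ∑ n ∈ Finset.range X, 2 / (((n : ℝ) + 2) * (n + 1)) := by
    rw [Finset.sum_image fun a _ b _ h => Nat.add_right_cancel h]
    refine Finset.sum_congr rfl fun n _ => ?_
    push_cast
    congr 2
    ring
  refine (Finset.sum_le_sum_of_subset_of_nonneg h2 fun p hp _ => ?_).trans ?_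
  · obtain ⟨n, _, rfl⟩ := Finset.mem_image.1 hp
    push_cast
    have : (0 : ℝ) ≤ (n : ℝ) + 2 - 1 := by linarith [(Nat.cast_nonneg n : (0 : ℝ) ≤ n)]
    positivity
  · rw [h3, h1]
    have : (0 : ℝ) ≤ 2 / (X + 1) := by positivity
    linarith

theorem prod_primesLE_sq_mul_prod_le {X : ℕ} (hX : 3 ≤ X) :
    (∏ p ∈ Nat.primesLE X, (1 - 1 / (p : ℝ))) ^ 2 *
      ∏ p ∈ Nat.primesLE X, (1 + (1 / ((p : ℝ) - 1) ^ 2) * (1 + p)) ≤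
      1 / Real.log X * Real.exp 2 := by
  have h1 : (∏ p ∈ Nat.primesLE X, (1 - 1 / (p : ℝ))) *
      ∏ p ∈ Nat.primesLE X, (1 + (1 / ((p : ℝ) - 1) ^ 2) * (1 + p)) =
      ∏ p ∈ Nat.primesLE X, (1 + 2 / ((p : ℝ) * (p - 1))) := by
    rw [← Finset.prod_mul_distrib]
    refine Finset.prod_congr rfl fun p hp => ?_
    have h2 : (1 : ℝ) < p := by exact_mod_cast (Nat.mem_primesLE.1 hp).2.one_lt
    have h3 : (p : ℝ) - 1 ≠ 0 := by linarith
    have h4 : (p : ℝ) ≠ 0 := by linarith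
    field_simp
    ring
  rw [sq, mul_assoc, h1]
  have hnn : ∀ p ∈ Nat.primesLE X, 0 ≤ 2 / ((p : ℝ) * (p - 1)) := fun p hp => by
    have h2 : (1 : ℝ) < p := by exact_mod_cast (Nat.mem_primesLE.1 hp).2.one_lt
    have : 0 < (p : ℝ) - 1 := by linarith
    positivity
  refine mul_le_mul (prod_primesLE_one_sub_le hX) ?_ ?_ ?_
  · exact (prod_one_add_le_exp_sum hnn).trans (Real.exp_le_exp.2 (sum_primesLE_two_div_le X))
  · exact Finset.prod_nonneg fun p hp => by linarith [hnn p hp]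
  · have : 0 < Real.log X := Real.log_pos (by exact_mod_cast (by omega : 1 < X))
    positivity

theorem mollSupport_le_pow {X K d : ℕ} (hd : d ∈ mollSupport (Nat.primesLE X) K) (hX : 1 ≤ X) :
    d ≤ X ^ K := by
  obtain ⟨S, hS, rfl⟩ := Finset.mem_image.1 hd
  rw [Finset.mem_filter, Finset.mem_powerset] at hS
  calc ∏ p ∈ S, p ≤ ∏ _p ∈ S, X :=
        Finset.prod_le_prod' fun p hp => (Nat.mem_primesLE.1 (hS.1 hp)).1
    _ = X ^ S.card := by rw [Finset.prod_const]
    _ ≤ X ^ K := Nat.pow_le_pow_right hX hS.2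

theorem one_add_log_mollSupport_le {X K d : ℕ} (hd : d ∈ mollSupport (Nat.primesLE X) K)
    (hX : 3 ≤ X) : 1 + (Nat.log 2 d : ℝ) ≤ 1 + 2 * K * Real.log X := by
  have hd0 : 0 < d := mollSupport_pos (fun p hp => (Nat.mem_primesLE.1 hp).2) hd
  have h1 : (2 : ℝ) ^ Nat.log 2 d ≤ (X : ℝ) ^ K := by
    exact_mod_cast (Nat.pow_log_le_self 2 hd0.ne').trans (mollSupport_le_pow hd (by omega))
  have h2 := Real.log_le_log (by positivity) h1
  rw [Real.log_pow, Real.log_pow] at h2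
  have h3 := Real.log_two_gt_d9
  have h4 : (0 : ℝ) ≤ Nat.log 2 d := Nat.cast_nonneg _
  nlinarith

theorem sum_abs_mollCoeff_mul_le {X K : ℕ} (hX : 1 ≤ X) :
    ∑ h ∈ mollSupport (Nat.primesLE X) K, |mollCoeff h| * h ≤ (X : ℝ) ^ (2 * K) := by
  have h1 : ∀ h ∈ mollSupport (Nat.primesLE X) K, |mollCoeff h| * h ≤ (X : ℝ) ^ K := by
    intro h hh
    rw [mollCoeff, abs_pow, abs_neg, abs_one, one_pow, one_mul]
    exact_mod_cast mollSupport_le_pow hh hX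
  refine (Finset.sum_le_card_nsmul _ _ _ h1).trans ?_
  rw [nsmul_eq_mul, two_mul, pow_add]
  refine mul_le_mul_of_nonneg_right ?_ (by positivity)
  have h2 : mollSupport (Nat.primesLE X) K ⊆ Finset.Icc 1 (X ^ K) := fun h hh =>
    Finset.mem_Icc.2 ⟨mollSupport_pos (fun p hp => (Nat.mem_primesLE.1 hp).2) hh,
      mollSupport_le_pow hh hX⟩
  have h3 := Finset.card_le_card h2
  rw [Nat.card_Icc, Nat.add_sub_cancel] at h3
  exact_mod_cast h3

/-- The bound for the mollified second moment, in terms of the sum of reciprocal primes. -/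
theorem mollified_quadratic_forms_le {X K : ℕ} (hX : 3 ≤ X) {T : ℝ} (hT : 3 ≤ T) :
    4 * (∑ h ∈ mollSupport (Nat.primesLE X) K, mollCoeff h / h) ^ 2 +
      8 * ∑ n ∈ Finset.Icc 1 ⌊T⌋₊,
        divisorSum (mollSupport (Nat.primesLE X) K) mollCoeff n ^ 2 / n +
      36 * (∑ d ∈ mollSupport (Nat.primesLE X) K,
        (∑ h ∈ mollSupport (Nat.primesLE X) K with d ∣ h, mollCoeff h / h) ^ 2 *
          ∑ e ∈ d.divisors, (e : ℝ) * (1 + Nat.log 2 e)) +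
      32 / T * (∑ h ∈ mollSupport (Nat.primesLE X) K, |mollCoeff h| * h) ^ 2 ≤
    (8 + 16 * (1 + Real.log T + Real.log X) / Real.log X +
        72 * Real.exp 2 * (1 + 2 * K * Real.log X) / Real.log X) +
      100 * (1 / 9) ^ K * Real.exp (20 * ∑ p ∈ Nat.primesLE X, 1 / (p : ℝ)) *
        (2 + Real.log T + 2 * K * Real.log X) +
      32 / T * (X : ℝ) ^ (4 * K) := by
  have hP : ∀ p ∈ Nat.primesLE X, p.Prime := fun p hp => (Nat.mem_primesLE.1 hp).2
  set W := ∑ p ∈ Nat.primesLE X, 1 / (p : ℝ) with hW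
  set V := ∏ p ∈ Nat.primesLE X, (1 - 1 / (p : ℝ)) with hV
  set U := ∏ p ∈ Nat.primesLE X, (1 + 3 / (p : ℝ)) with hU
  have hX3 : (3 : ℝ) ≤ X := by exact_mod_cast hX
  have hlogX : 1 ≤ Real.log X := by
    rw [Real.le_log_iff_exp_le (by linarith)]
    exact (Real.exp_one_lt_d9.le.trans (by norm_num)).trans hX3
  have hlogT : 0 ≤ Real.log T := Real.log_nonneg (by linarith)
  have hW0 : 0 ≤ W := Finset.sum_nonneg fun p _ => by positivity
  have hUexp : U ≤ Real.exp (3 * W) := by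
    refine (prod_one_add_le_exp_sum fun p _ => by positivity).trans_eq ?_
    rw [hW, Finset.mul_sum]
    congr 1
    exact Finset.sum_congr rfl fun p _ => by ring
  have hU0 : 0 ≤ U := Finset.prod_nonneg fun p _ => by positivity
  have hU2 : U ^ 2 ≤ Real.exp (6 * W) := by
    refine (pow_le_pow_left₀ hU0 hUexp 2).trans_eq ?_
    rw [← Real.exp_nat_mul]; congr 1; push_cast; ring
  have h15 : ∏ p ∈ Nat.primesLE X, (1 + 15 / (p : ℝ)) ≤ Real.exp (20 * W) := by
    refine (prod_one_add_le_exp_sum fun p _ => by positivity).trans (Real.exp_le_exp.2 ?_)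
    rw [hW, Finset.mul_sum]
    refine Finset.sum_le_sum fun p _ => ?_
    rw [mul_one_div]
    gcongr
    norm_num
  have h14 : ∏ p ∈ Nat.primesLE X, (1 + (9 / (p : ℝ) ^ 2) * (1 + p)) ≤ Real.exp (14 * W) := by
    refine (prod_one_add_le_exp_sum fun p _ => by positivity).trans (Real.exp_le_exp.2 ?_)
    rw [hW, Finset.mul_sum]
    refine Finset.sum_le_sum fun p hp => ?_
    have h2 : (2 : ℝ) ≤ p := by exact_mod_cast (hP p hp).two_le
    rw [mul_one_div, div_mul_eq_mul_div, div_le_div_iff₀ (by positivity) (by positivity)]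
    nlinarith
  have hV0 : 0 ≤ V := prod_primesLE_nonneg X
  have hV1 : V ≤ 1 := by
    refine (prod_primesLE_one_sub_le hX).trans ?_
    rw [div_le_one (by linarith)]; exact hlogX
  have hexp : Real.exp (6 * W) ≤ Real.exp (20 * W) := Real.exp_le_exp.2 (by linarith)
  have hexp2 : Real.exp (6 * W) * Real.exp (14 * W) = Real.exp (20 * W) := by
    rw [← Real.exp_add]; congr 1; ring
  set q : ℝ := (1 / 9) ^ K with hq
  have hq0 : 0 ≤ q := by positivity
  have t1 : (∑ h ∈ mollSupport (Nat.primesLE X) K, mollCoeff h / h) ^ 2 ≤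
      2 + 2 * q * Real.exp (20 * W) := by
    have := sq_sum_mollCoeff_div_le hP K (Finset.empty_subset _)
    simp only [Finset.prod_empty, one_dvd, Finset.filter_true, mul_one] at this
    refine this.trans (add_le_add ?_ ?_)
    · nlinarith
    · exact mul_le_mul_of_nonneg_left (hU2.trans hexp) (by positivity)
  have t2 : ∑ n ∈ Finset.Icc 1 ⌊T⌋₊,
        divisorSum (mollSupport (Nat.primesLE X) K) mollCoeff n ^ 2 / n ≤
      2 * ((1 + Real.log T + Real.log X) / Real.log X) +
        2 * q * (Real.exp (20 * W) * (1 + Real.log T)) := by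
    have hN : 1 ≤ ⌊T⌋₊ := Nat.le_floor (by push_cast; linarith)
    have hNT : Real.log ⌊T⌋₊ ≤ Real.log T :=
      Real.log_le_log (by exact_mod_cast hN) (Nat.floor_le (by linarith))
    have hN0 : 0 ≤ Real.log ⌊T⌋₊ := Real.log_natCast_nonneg _
    refine (sum_Icc_sq_divisorSum_le hP K ⌊T⌋₊).trans (add_le_add ?_ ?_)
    · have := log_mul_sum_rough_le ⌊T⌋₊ X (by omega)
      rw [Real.log_mul (by positivity) (by positivity)] at this
      refine mul_le_mul_of_nonneg_left ?_ (by norm_num)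
      rw [le_div_iff₀ (by linarith), mul_comm]
      linarith
    · refine mul_le_mul_of_nonneg_left ?_ (by positivity)
      exact mul_le_mul h15 (by linarith) (by linarith) (Real.exp_pos _).le
  have t3 : ∑ d ∈ mollSupport (Nat.primesLE X) K,
        (∑ h ∈ mollSupport (Nat.primesLE X) K with d ∣ h, mollCoeff h / h) ^ 2 *
          ∑ e ∈ d.divisors, (e : ℝ) * (1 + Nat.log 2 e) ≤
      (1 + 2 * K * Real.log X) * (2 * (1 / Real.log X * Real.exp 2) +
        2 * q * Real.exp (20 * W)) := by
    refine (sum_mollSupport_sq_mul_le hP K fun d hd => one_add_log_mollSupport_le hd hX).trans ?_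
    refine mul_le_mul_of_nonneg_left (add_le_add ?_ ?_) (by positivity)
    · rw [mul_assoc]
      exact mul_le_mul_of_nonneg_left (prod_primesLE_sq_mul_prod_le hX) (by norm_num)
    · rw [mul_assoc, ← hexp2]
      refine mul_le_mul_of_nonneg_left ?_ (by positivity)
      exact mul_le_mul hU2 h14 (Finset.prod_nonneg fun p _ => by positivity) (Real.exp_pos _).le
  have t4 : (∑ h ∈ mollSupport (Nat.primesLE X) K, |mollCoeff h| * h) ^ 2 ≤ (X : ℝ) ^ (4 * K) := by
    refine (pow_le_pow_left₀ (Finset.sum_nonneg fun _ _ => by positivity)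
      (sum_abs_mollCoeff_mul_le (by omega)) 2).trans_eq ?_
    rw [← pow_mul]; congr 1; ring
  have t4' := mul_le_mul_of_nonneg_left t4 (by positivity : 0 ≤ 32 / T)
  set E := Real.exp (20 * W)
  have hqE : 0 ≤ q * E := by positivity
  have hKX : 0 ≤ 2 * K * Real.log X := by positivity
  have hqT : 0 ≤ q * E * Real.log T := by positivity
  have hqK : 0 ≤ q * E * (2 * K * Real.log X) := by positivity
  have e3 : 72 * Real.exp 2 * (1 + 2 * K * Real.log X) / Real.log X =
      36 * ((1 + 2 * K * Real.log X) * (2 * (1 / Real.log X * Real.exp 2))) := by ring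
  have e2 : 16 * (1 + Real.log T + Real.log X) / Real.log X =
      8 * (2 * ((1 + Real.log T + Real.log X) / Real.log X)) := by ring
  rw [e3, e2]
  linarith

/-- The length of the prime sums at height `T`: `exp (log T / (log log T)^3)`. -/
noncomputable def mollX (T : ℝ) : ℕ := ⌊Real.exp (Real.log T / Real.log (Real.log T) ^ 3)⌋₊

/-- The number of prime factors allowed in the mollifier at height `T`. -/
noncomputable def mollK (T : ℝ) : ℕ := ⌊Real.log (Real.log T) ^ 2⌋₊

/-- The mollifier at height `T`. -/
noncomputable def moll (T : ℝ) (s : ℂ) : ℂ :=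
  dirichletPoly (mollSupport (Nat.primesLE (mollX T)) (mollK T)) mollCoeff s

theorem tendsto_log_log : Tendsto (fun T : ℝ => Real.log (Real.log T)) atTop atTop :=
  Real.tendsto_log_atTop.comp Real.tendsto_log_atTop

theorem eventually_mul_pow_le_exp (c : ℝ) (n : ℕ) : ∀ᶠ x : ℝ in atTop, c * x ^ n ≤ Real.exp x := by
  have h1 := (Real.tendsto_exp_div_pow_atTop n).eventually_ge_atTop c
  filter_upwards [h1, eventually_gt_atTop 0] with x hx hx0
  rwa [le_div_iff₀ (by positivity)] at hx

/-- Elementary inequalities between the parameters, valid for all large `T`. -/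
structure ParamBounds (c T : ℝ) : Prop where
  three_le : 3 ≤ T
  log_pos : 1 ≤ Real.log T
  exp_loglog : Real.exp (Real.log (Real.log T)) = Real.log T
  le_loglog : c ≤ Real.log (Real.log T)
  one_le_loglog : 1 ≤ Real.log (Real.log T)
  three_le_X : 3 ≤ mollX T
  le_logX : Real.log T / (2 * Real.log (Real.log T) ^ 3) ≤ Real.log (mollX T)
  logX_le : Real.log (mollX T) ≤ Real.log T / Real.log (Real.log T) ^ 3
  loglog_le_logX : Real.log (Real.log T) ≤ Real.log (mollX T)
  loglogX_le : Real.log (Real.log (mollX T)) ≤ Real.log (Real.log T)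
  K_le : (mollK T : ℝ) ≤ Real.log (Real.log T) ^ 2
  le_K : Real.log (Real.log T) ^ 2 - 1 ≤ mollK T

theorem eventually_paramBounds (c : ℝ) : ∀ᶠ T : ℝ in atTop, ParamBounds c T := by
  have h0 := Real.tendsto_log_atTop.eventually_ge_atTop 1
  have h1 := tendsto_log_log.eventually_ge_atTop (max c 2)
  have h2 := tendsto_log_log.eventually (eventually_mul_pow_le_exp 2 4)
  filter_upwards [eventually_ge_atTop 3, h0, h1, h2] with T hT hL hl h4
  set L := Real.log T with hLdef
  set l := Real.log L with hldef
  have hl2 : 2 ≤ l := (le_max_right _ _).trans hl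
  have hexp : Real.exp l = L := Real.exp_log (by linarith)
  rw [hexp] at h4
  set v := L / l ^ 3 with hv
  have hv2 : 2 * l ≤ v := by
    rw [hv, le_div_iff₀ (by positivity)]
    nlinarith
  have hX : (mollX T : ℝ) ≤ Real.exp v := Nat.floor_le (Real.exp_pos _).le
  have hX2 : Real.exp (v / 2) ≤ mollX T := by
    have h5 : Real.exp v < mollX T + 1 := Nat.lt_floor_add_one _
    have h6 : Real.exp v = Real.exp (v / 2) * Real.exp (v / 2) := by
      rw [← Real.exp_add]; congr 1; ring
    have h7 := Real.add_one_le_exp (v / 2)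
    nlinarith
  have hX0 : (0 : ℝ) < mollX T := (Real.exp_pos _).trans_le hX2
  have hlogX : Real.log (mollX T) ≤ v := (Real.log_le_iff_le_exp hX0).2 hX
  have hlogX2 : v / 2 ≤ Real.log (mollX T) := (Real.le_log_iff_exp_le hX0).2 hX2
  have hvL : v ≤ L := div_le_self (by linarith) (one_le_pow₀ (by linarith))
  refine ⟨hT, hL, hexp, (le_max_left _ _).trans hl, by linarith, ?_, ?_, hlogX, by linarith, ?_,
    Nat.floor_le (by positivity), ?_⟩
  · have h7 := Real.add_one_le_exp (v / 2)
    have : (3 : ℝ) ≤ mollX T := by linarith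
    exact_mod_cast this
  · refine le_trans (le_of_eq ?_) hlogX2
    rw [hv, div_div, mul_comm]
  · exact Real.log_le_log (by linarith) (by linarith)
  · have := Nat.lt_floor_add_one (l ^ 2)
    rw [sub_le_iff_le_add]
    exact this.le

theorem eventually_lintegral_cauchy_moll_le :
    ∀ᶠ T : ℝ in atTop, ∫⁻ y : ℝ, ENNReal.ofReal (T / (Real.pi * (T ^ 2 + y ^ 2)) *
      ‖riemannZeta (1 / 2 + y * Complex.I) * moll T (1 / 2 + y * Complex.I)‖ ^ 2) ≤
      ENNReal.ofReal (Real.log (Real.log T) ^ 4) := by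
  obtain ⟨C, hC0, hC⟩ := exists_sum_primesLE_one_div_le
  filter_upwards [eventually_paramBounds (2000 + 60 * C)] with T hp
  have hP : ∀ p ∈ Nat.primesLE (mollX T), p.Prime := fun p hp => (Nat.mem_primesLE.1 hp).2
  refine (lintegral_cauchy_normSq_zeta_mul_dirichletPoly_le hp.three_le _
    (fun h hh => mollSupport_pos hP hh) (fun h hh d hd => mollSupport_dvd hP hh hd)
    mollCoeff).trans (ENNReal.ofReal_le_ofReal ?_)
  refine (mollified_quadratic_forms_le hp.three_le_X hp.three_le).trans ?_
  have hW := hC _ hp.three_le_X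
  obtain ⟨hT, hL, hexp, hl, hl1, hX, hu1, hu2, hlu, hlogu, hK, hK2⟩ := hp
  set W := ∑ p ∈ Nat.primesLE (mollX T), 1 / (p : ℝ)
  set L := Real.log T with hLdef
  set l := Real.log L with hldef
  set u := Real.log (mollX T) with hu
  have hu0 : 1 ≤ u := by linarith
  have hL0 : 0 < L := by linarith
  have hKu : mollK T * u ≤ L / l := by
    refine (mul_le_mul hK hu2 (by linarith) (by positivity)).trans_eq ?_
    field_simp
  have hLl : L / l ≤ L := div_le_self hL0.le hl1
  have huL : u ≤ L := hu2.trans (div_le_self hL0.le (one_le_pow₀ hl1))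
  have hl3 : 1 ≤ l ^ 3 := one_le_pow₀ hl1
  have a1 : 16 * (1 + L + u) / u ≤ 16 + 64 * l ^ 3 := by
    rw [div_le_iff₀ (by positivity)] at hu1
    rw [div_le_iff₀ (by linarith)]
    nlinarith
  have he2 : Real.exp 2 ≤ 8 := by
    have h1 := Real.exp_one_lt_d9
    have h2 : Real.exp 2 = Real.exp 1 * Real.exp 1 := by rw [← Real.exp_add]; norm_num
    rw [h2]
    nlinarith [Real.exp_pos 1]
  have a2 : 72 * Real.exp 2 * (1 + 2 * mollK T * u) / u ≤ 576 * (1 + 2 * l ^ 2) := by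
    rw [div_le_iff₀ (by linarith)]
    have h1 : 1 + 2 * mollK T * u ≤ (1 + 2 * l ^ 2) * u := by nlinarith
    calc 72 * Real.exp 2 * (1 + 2 * mollK T * u) ≤ 576 * ((1 + 2 * l ^ 2) * u) := by
          refine mul_le_mul (by linarith) h1 (by positivity) (by norm_num)
      _ = _ := by ring
  have a3 : 100 * (1 / 9) ^ mollK T * Real.exp (20 * W) * (2 + L + 2 * mollK T * u) ≤ 500 := by
    have h1 : ((1 : ℝ) / 9) ^ mollK T ≤ Real.exp (-2 * (l ^ 2 - 1)) := by
      have h2 : (1 : ℝ) / 9 ≤ Real.exp (-2) := by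
        rw [Real.exp_neg, one_div]
        exact inv_anti₀ (Real.exp_pos _) (by linarith)
      refine (pow_le_pow_left₀ (by norm_num) h2 _).trans ?_
      rw [← Real.exp_nat_mul]
      exact Real.exp_le_exp.2 (by linarith)
    have h2 : Real.exp (20 * W) ≤ Real.exp (60 * l + 60 * C) := Real.exp_le_exp.2 (by linarith)
    have h3 : 2 + L + 2 * mollK T * u ≤ 5 * Real.exp l := by rw [hexp]; nlinarith
    calc 100 * (1 / 9) ^ mollK T * Real.exp (20 * W) * (2 + L + 2 * mollK T * u)
        ≤ 100 * Real.exp (-2 * (l ^ 2 - 1)) * Real.exp (60 * l + 60 * C) * (5 * Real.exp l) := by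
          gcongr
      _ = 500 * Real.exp (-2 * (l ^ 2 - 1) + (60 * l + 60 * C) + l) := by
          rw [Real.exp_add (_ + _) l, Real.exp_add _ (60 * l + 60 * C)]; ring
      _ ≤ 500 * 1 := by
          refine mul_le_mul_of_nonneg_left (Real.exp_le_one_iff.2 ?_) (by norm_num)
          nlinarith
      _ = 500 := by ring
  have a4 : 32 / T * (mollX T : ℝ) ^ (4 * mollK T) ≤ 32 := by
    have hX0 : (0 : ℝ) < mollX T := by exact_mod_cast (by omega : 0 < mollX T)
    have h1 : (mollX T : ℝ) ^ (4 * mollK T) ≤ T := by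
      refine (Real.log_le_log_iff (by positivity) (by linarith)).1 ?_
      rw [Real.log_pow, ← hLdef, ← hu]
      push_cast
      have h4 : 4 * (L / l) ≤ L := by
        rw [mul_div_assoc', div_le_iff₀ (by linarith)]; nlinarith
      linarith
    rw [div_mul_eq_mul_div, div_le_iff₀ (by linarith)]
    linarith
  have hl2000 : 2000 ≤ l := by linarith
  have hfin : 8 + (16 + 64 * l ^ 3) + 576 * (1 + 2 * l ^ 2) + 500 + 32 ≤ l ^ 4 := by
    have h1 : l ^ 2 ≤ l ^ 3 := pow_le_pow_right₀ hl1 (by norm_num)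
    have h4 : l ^ 4 = l * l ^ 3 := by ring
    have h5 : 2000 * l ^ 3 ≤ l * l ^ 3 := mul_le_mul_of_nonneg_right hl2000 (by positivity)
    have h6 : 2000 ≤ l ^ 3 := by nlinarith
    linarith
  linarith

theorem countable_zeros_of_differentiable {G : ℂ → ℂ} (hG : Differentiable ℂ G) {z₀ : ℂ}
    (hz : G z₀ ≠ 0) : {z | G z = 0}.Countable := by
  have h1 : AnalyticOnNhd ℂ G Set.univ := fun z _ => hG.analyticAt z
  have h2 := h1.preimage_zero_mem_codiscreteWithin (x := z₀) hz (Set.mem_univ _)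
    isConnected_univ
  have h3 : {z | G z = 0}ᶜ ∈ Filter.codiscrete ℂ := h2
  obtain ⟨h4, h5⟩ := compl_mem_codiscrete_iff.1 h3
  exact IsLindelof.countable_of_isDiscrete h4.isLindelof h5

theorem log_norm_le_circleAverage {g : ℂ → ℂ} {r : ℝ} (hr : 0 < r)
    (hg : AnalyticOnNhd ℂ g (Metric.closedBall 0 r)) (h0 : g 0 ≠ 0) :
    Real.log ‖g 0‖ ≤ Real.circleAverage (fun z => Real.log ‖g z‖) 0 r := by
  have hr' : |r| = r := abs_of_pos hr
  rw [← hr'] at hg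
  rw [hg.circleAverage_log_norm hr.ne' h0]
  refine le_add_of_nonneg_left (finsum_nonneg fun u => ?_)
  have h1 : 0 ≤ MeromorphicOn.divisor g (Metric.closedBall 0 |r|) u :=
    (MeromorphicOn.AnalyticOnNhd.divisor_nonneg hg) u
  by_cases hu : u ∈ Metric.closedBall (0 : ℂ) |r|
  · refine mul_nonneg (by exact_mod_cast h1) ?_
    rw [hr', mem_closedBall_zero_iff] at hu
    rw [zero_sub, norm_neg]
    rcases eq_or_ne u 0 with rfl | hu0
    · simp
    · have : 0 < ‖u‖ := norm_pos_iff.2 hu0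
      refine Real.log_nonneg ?_
      rw [← div_eq_mul_inv, le_div_iff₀ this]
      linarith
  · rw [Function.locallyFinsuppWithin.apply_eq_zero_of_notMem _ hu]
    simp

/-- Fatou's lemma turns the mean value inequality on smaller circles into one for the
boundary values of a bounded analytic function. -/
theorem lintegral_sub_log_boundary_le {g : ℂ → ℂ} {b : ℝ → ℂ} {A : ℝ}
    (hg : AnalyticOnNhd ℂ g (Metric.ball 0 1)) (h0 : g 0 ≠ 0)
    (hgA : ∀ z ∈ Metric.ball (0 : ℂ) 1, Real.log ‖g z‖ ≤ A)
    (hb : ∀ θ ∈ Set.Ioo 0 (2 * Real.pi),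
      Tendsto (fun n : ℕ => g (circleMap 0 (1 - 1 / ((n : ℝ) + 2)) θ)) atTop (𝓝 (b θ))) :
    ∫⁻ θ in Set.Ioo 0 (2 * Real.pi), ENNReal.ofReal (A - Real.log ‖b θ‖) ≤
      ENNReal.ofReal (2 * Real.pi * (A - Real.log ‖g 0‖)) := by
  set r : ℕ → ℝ := fun n => 1 - 1 / ((n : ℝ) + 2) with hr
  have hr0 : ∀ n, 0 < r n := fun n => by
    have : 1 / ((n : ℝ) + 2) < 1 := by rw [div_lt_one (by positivity)]; linarith [n.cast_nonneg (α := ℝ)]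
    simp only [hr]; linarith
  have hr1 : ∀ n, r n < 1 := fun n => by
    have : 0 < 1 / ((n : ℝ) + 2) := by positivity
    simp only [hr]; linarith
  have hmem : ∀ n θ, circleMap 0 (r n) θ ∈ Metric.ball (0 : ℂ) 1 := fun n θ => by
    rw [mem_ball_zero_iff, norm_circleMap_zero, abs_of_pos (hr0 n)]; exact hr1 n
  have hcont : ∀ n, Continuous fun θ => g (circleMap 0 (r n) θ) := fun n =>
    hg.continuousOn.comp_continuous (continuous_circleMap _ _) (hmem n)
  have hmeas : ∀ n, Measurable fun θ => ENNReal.ofReal (A - Real.log ‖g (circleMap 0 (r n) θ)‖) :=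
    fun n => (measurable_const.sub (Real.measurable_log.comp (hcont n).norm.measurable)).ennreal_ofReal
  have hcircle : ∀ n, ∫⁻ θ in Set.Ioo 0 (2 * Real.pi),
      ENNReal.ofReal (A - Real.log ‖g (circleMap 0 (r n) θ)‖) ≤
      ENNReal.ofReal (2 * Real.pi * (A - Real.log ‖g 0‖)) := by
    intro n
    have han : AnalyticOnNhd ℂ g (Metric.closedBall 0 (r n)) :=
      hg.mono (Metric.closedBall_subset_ball (hr1 n))
    have h1 := log_norm_le_circleAverage (hr0 n) han h0
    have hci : CircleIntegrable (fun z => Real.log ‖g z‖) 0 (r n) :=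
      MeromorphicOn.circleIntegrable_log_norm_of_nonneg
        (han.mono Metric.sphere_subset_closedBall).meromorphicOn (hr0 n).le
    rw [Real.circleAverage_def, smul_eq_mul, ← div_eq_inv_mul, le_div_iff₀ (by positivity)] at h1
    have hInt : IntegrableOn (fun θ => A - Real.log ‖g (circleMap 0 (r n) θ)‖)
        (Set.Ioo 0 (2 * Real.pi)) := by
      have h2 : IntervalIntegrable (fun θ => A - Real.log ‖g (circleMap 0 (r n) θ)‖) volume 0
        (2 * Real.pi) := intervalIntegrable_const.sub hci
      exact (intervalIntegrable_iff_integrableOn_Ioo_of_le (by positivity)).1 h2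
    rw [← ofReal_integral_eq_lintegral_ofReal hInt
      (ae_of_all _ fun θ => sub_nonneg.2 (hgA _ (hmem n θ)))]
    refine ENNReal.ofReal_le_ofReal ?_
    rw [← integral_Ioc_eq_integral_Ioo, ← intervalIntegral.integral_of_le (by positivity),
      intervalIntegral.integral_sub intervalIntegrable_const hci, intervalIntegral.integral_const,
      smul_eq_mul]
    linarith
  calc ∫⁻ θ in Set.Ioo 0 (2 * Real.pi), ENNReal.ofReal (A - Real.log ‖b θ‖)
      ≤ ∫⁻ θ in Set.Ioo 0 (2 * Real.pi), liminf (fun n =>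
          ENNReal.ofReal (A - Real.log ‖g (circleMap 0 (r n) θ)‖)) atTop := by
        refine setLIntegral_mono (.liminf hmeas) fun θ hθ => ?_
        have h1 := hb θ hθ
        rcases eq_or_ne (b θ) 0 with h2 | h2
        · refine le_liminf_of_le (by isBoundedDefault) ?_
          rw [h2] at h1
          have h2' : ‖(0 : ℂ)‖ < 1 := by simp
          have h3 := h1.norm.eventually_le_const h2'
          filter_upwards [h3] with n hn
          refine ENNReal.ofReal_le_ofReal ?_
          rw [h2, norm_zero, Real.log_zero]
          linarith [Real.log_nonpos (norm_nonneg _) hn]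
        · have h3 : Tendsto (fun n => ENNReal.ofReal (A - Real.log ‖g (circleMap 0 (r n) θ)‖)) atTop
              (𝓝 (ENNReal.ofReal (A - Real.log ‖b θ‖))) :=
            ENNReal.tendsto_ofReal (tendsto_const_nhds.sub (h1.norm.log (norm_ne_zero_iff.2 h2)))
          rw [h3.liminf_eq]
    _ ≤ liminf (fun n => ∫⁻ θ in Set.Ioo 0 (2 * Real.pi),
          ENNReal.ofReal (A - Real.log ‖g (circleMap 0 (r n) θ)‖)) atTop :=
        lintegral_liminf_le hmeas
    _ ≤ _ := liminf_le_of_frequently_le' (Frequently.of_forall hcircle)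

/-- The density of the Cauchy distribution of scale `T`. -/
noncomputable def cauchyDensity (T y : ℝ) : ℝ := T / (Real.pi * (T ^ 2 + y ^ 2))

/-- The point of the unit circle corresponding to `1 / 2 + i y` under the Cayley transform of
scale `T`. -/
noncomputable def cayley (T y : ℝ) : ℂ := (y * Complex.I - T) / (y * Complex.I + T)

theorem mul_I_add_ne_zero {T : ℝ} (hT : 0 < T) (y : ℝ) : (y * Complex.I + T : ℂ) ≠ 0 := by
  intro h
  have := congrArg Complex.re h
  simp at this
  exact hT.ne' this

theorem circleMap_eq_cayley {T : ℝ} (hT : 0 < T) (y : ℝ) :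
    circleMap 0 1 (Real.pi - 2 * Real.arctan (y / T)) = cayley T y := by
  set α := Real.arctan (y / T) with hα
  have hc : (Real.cos α : ℂ) ≠ 0 := by exact_mod_cast (Real.cos_arctan_pos _).ne'
  have hs : (Real.sin α : ℂ) = y / T * Real.cos α := by
    have h1 : Real.tan α = y / T := Real.tan_arctan _
    rw [Real.tan_eq_sin_div_cos, div_eq_iff (Real.cos_arctan_pos _).ne'] at h1
    exact_mod_cast h1
  have he : ∀ β : ℝ, Complex.exp (β * Complex.I) = Real.cos β + Real.sin β * Complex.I := by
    intro β
    rw [Complex.exp_mul_I, Complex.ofReal_cos, Complex.ofReal_sin]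
  have h1 : Complex.exp (α * Complex.I) = Real.cos α * (y * Complex.I + T) / T := by
    rw [he, hs]
    have : (T : ℂ) ≠ 0 := by exact_mod_cast hT.ne'
    field_simp
    ring
  have h2 : Complex.exp ((-α : ℝ) * Complex.I) = Real.cos α * (T - y * Complex.I) / T := by
    rw [he, Real.cos_neg, Real.sin_neg, Complex.ofReal_neg, hs]
    have : (T : ℂ) ≠ 0 := by exact_mod_cast hT.ne'
    field_simp
    ring
  have h3 : circleMap 0 1 (Real.pi - 2 * α) =
      -(Complex.exp ((-α : ℝ) * Complex.I) / Complex.exp (α * Complex.I)) := by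
    rw [← Complex.exp_sub, ← neg_one_mul, ← Complex.exp_pi_mul_I, ← Complex.exp_add,
      circleMap_zero, Complex.ofReal_one, one_mul]
    congr 1
    push_cast
    ring
  have hT' : (T : ℂ) ≠ 0 := by exact_mod_cast hT.ne'
  have h4 := mul_I_add_ne_zero hT y
  rw [h3, h1, h2, cayley, div_div_div_cancel_right₀ hT', mul_div_mul_left _ _ hc, ← neg_div]
  congr 1
  ring

theorem image_sub_arctan {T : ℝ} (hT : 0 < T) :
    (fun y : ℝ => Real.pi - 2 * Real.arctan (y / T)) '' Set.univ = Set.Ioo 0 (2 * Real.pi) := by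
  ext θ
  constructor
  · rintro ⟨y, -, rfl⟩
    have h1 := Real.arctan_lt_pi_div_two (y / T)
    have h2 := Real.neg_pi_div_two_lt_arctan (y / T)
    constructor <;> dsimp only <;> linarith
  · rintro ⟨h1, h2⟩
    refine ⟨T * Real.tan ((Real.pi - θ) / 2), trivial, ?_⟩
    dsimp only
    rw [mul_div_cancel_left₀ _ hT.ne', Real.arctan_tan (by linarith) (by linarith)]
    ring

theorem injective_sub_arctan {T : ℝ} (hT : 0 < T) :
    Function.Injective fun y : ℝ => Real.pi - 2 * Real.arctan (y / T) := by
  intro y y' h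
  have h1 : Real.arctan (y / T) = Real.arctan (y' / T) := by
    dsimp only at h; linarith
  exact (div_left_inj' hT.ne').1 (Real.arctan_injective h1)

theorem hasDerivAt_sub_arctan {T : ℝ} (hT : 0 < T) (y : ℝ) :
    HasDerivAt (fun y : ℝ => Real.pi - 2 * Real.arctan (y / T))
      (-(2 * T / (T ^ 2 + y ^ 2))) y := by
  have h1 := ((hasDerivAt_id y).div_const T).arctan.const_mul 2 |>.const_sub Real.pi
  refine h1.congr_deriv ?_
  simp only [id]
  field_simp

theorem circleAverage_eq_integral_cauchy {T : ℝ} (hT : 0 < T) (F : ℂ → ℝ) :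
    (CircleIntegrable F 0 1 ↔ Integrable fun y => cauchyDensity T y * F (cayley T y)) ∧
    Real.circleAverage F 0 1 = ∫ y, cauchyDensity T y * F (cayley T y) := by
  have hd : ∀ y ∈ (Set.univ : Set ℝ), HasDerivWithinAt
      (fun y : ℝ => Real.pi - 2 * Real.arctan (y / T)) (-(2 * T / (T ^ 2 + y ^ 2))) Set.univ y :=
    fun y _ => (hasDerivAt_sub_arctan hT y).hasDerivWithinAt
  have hinj := (injective_sub_arctan hT).injOn (s := Set.univ)
  have key : ∀ y, |-(2 * T / (T ^ 2 + y ^ 2))| •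
      F (circleMap 0 1 (Real.pi - 2 * Real.arctan (y / T))) =
      (2 * Real.pi) * (cauchyDensity T y * F (cayley T y)) := by
    intro y
    rw [circleMap_eq_cayley hT, smul_eq_mul, abs_neg, abs_of_nonneg (by positivity), cauchyDensity]
    have := Real.pi_pos
    field_simp
  constructor
  · have h1 := integrableOn_image_iff_integrableOn_abs_deriv_smul MeasurableSet.univ hd hinj
      (fun θ => F (circleMap 0 1 θ))
    rw [image_sub_arctan hT, integrableOn_univ] at h1
    simp only [key] at h1
    rw [CircleIntegrable, intervalIntegrable_iff_integrableOn_Ioo_of_le (by positivity), h1]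
    exact integrable_const_mul_iff (by simp [Real.pi_ne_zero]) _
  · have h1 := integral_image_eq_integral_abs_deriv_smul MeasurableSet.univ hd hinj
      (fun θ => F (circleMap 0 1 θ))
    rw [image_sub_arctan hT, setIntegral_univ] at h1
    simp only [key] at h1
    rw [Real.circleAverage_def, intervalIntegral.integral_of_le (by positivity),
      integral_Ioc_eq_integral_Ioo, h1, integral_const_mul, smul_eq_mul,
      inv_mul_cancel_left₀ (by positivity)]

theorem integral_cauchy_log_norm_cayley_sub {T : ℝ} (hT : 0 < T) {a : ℂ} (ha : ‖a‖ ≤ 1) :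
    (Integrable fun y => cauchyDensity T y * Real.log ‖cayley T y - a‖) ∧
    ∫ y, cauchyDensity T y * Real.log ‖cayley T y - a‖ = 0 := by
  obtain ⟨h1, h2⟩ := circleAverage_eq_integral_cauchy hT (fun z => Real.log ‖z - a‖)
  refine ⟨h1.1 (circleIntegrable_log_norm_sub_const 1), ?_⟩
  rw [← h2]
  rcases ha.lt_or_eq with h | h
  · exact circleAverage_log_norm_sub_const₀ h
  · exact circleAverage_log_norm_sub_const₁ h

theorem integrable_cauchyDensity {T : ℝ} (hT : 0 < T) : Integrable (cauchyDensity T) ∧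
    ∫ y, cauchyDensity T y = 1 := by
  obtain ⟨h1, h2⟩ := circleAverage_eq_integral_cauchy hT (fun _ => (1 : ℝ))
  simp only [mul_one] at h1 h2
  refine ⟨h1.1 (circleIntegrable_const _ _ _), ?_⟩
  rw [← h2, Real.circleAverage_const]

/-- The conformal map from the unit disc onto the half-plane `Re s > 1 / 2` sending `0` to
`1 / 2 + T`. -/
noncomputable def toHalfPlane (T : ℝ) (z : ℂ) : ℂ := 1 / 2 + T * ((1 + z) / (1 - z))

theorem half_le_re_toHalfPlane {T : ℝ} (hT : 0 < T) {z : ℂ} (hz : ‖z‖ ≤ 1) :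
    1 / 2 ≤ (toHalfPlane T z).re := by
  have h1 : 0 ≤ ((1 + z) / (1 - z)).re := by
    rw [Complex.div_re, ← add_div]
    refine div_nonneg ?_ (Complex.normSq_nonneg _)
    have h2 : Complex.normSq z ≤ 1 := by
      rw [Complex.normSq_eq_norm_sq]; exact pow_le_one₀ (norm_nonneg _) hz
    rw [Complex.normSq_apply] at h2
    simp
    nlinarith
  rw [toHalfPlane, Complex.add_re, Complex.re_ofReal_mul]
  have : ((1 : ℂ) / 2).re = 1 / 2 := by norm_num
  rw [this]
  have := mul_nonneg hT.le h1
  linarith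

theorem toHalfPlane_cayley {T : ℝ} (hT : 0 < T) (y : ℝ) :
    toHalfPlane T (cayley T y) = 1 / 2 + y * Complex.I := by
  have h := mul_I_add_ne_zero hT y
  have hT' : (T : ℂ) ≠ 0 := by exact_mod_cast hT.ne'
  rw [toHalfPlane, cayley]
  have h1 : 1 + (y * Complex.I - T) / (y * Complex.I + T : ℂ) =
      2 * (y * Complex.I) / (y * Complex.I + T) := by field_simp; ring
  have h2 : 1 - (y * Complex.I - T) / (y * Complex.I + T : ℂ) = 2 * T / (y * Complex.I + T) := by
    field_simp; ring
  rw [h1, h2, div_div_div_cancel_right₀ h]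
  field_simp

theorem one_sub_cayley {T : ℝ} (hT : 0 < T) (y : ℝ) :
    1 - cayley T y = 2 * T / (y * Complex.I + T) := by
  have h := mul_I_add_ne_zero hT y
  rw [cayley]
  field_simp; ring

theorem circleMap_ne_one {θ : ℝ} (hθ : θ ∈ Set.Ioo 0 (2 * Real.pi)) : circleMap 0 1 θ ≠ 1 := by
  rw [← image_sub_arctan one_pos] at hθ
  obtain ⟨y, -, rfl⟩ := hθ
  rw [circleMap_eq_cayley one_pos]
  intro h
  have h1 := one_sub_cayley one_pos y
  rw [h, sub_self, eq_comm, div_eq_zero_iff] at h1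
  rcases h1 with h1 | h1
  · norm_num at h1
  · exact mul_I_add_ne_zero one_pos y h1

/-- Jensen's inequality in the half-plane `Re s > 1 / 2` for an entire function of quadratic
growth. -/
theorem log_norm_le_integral_cauchy {G : ℂ → ℂ} (hG : Differentiable ℂ G) {B T : ℝ} (hB : 1 ≤ B)
    (hT : 0 < T) (hGB : ∀ s : ℂ, 1 / 2 ≤ s.re → ‖G s‖ ≤ B * (1 + ‖s‖) ^ 2)
    (h0 : G (1 / 2 + T) ≠ 0) :
    (Integrable fun y : ℝ => cauchyDensity T y * Real.log ‖G (1 / 2 + y * Complex.I)‖) ∧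
    Real.log ‖G (1 / 2 + T)‖ ≤
      ∫ y : ℝ, cauchyDensity T y * Real.log ‖G (1 / 2 + y * Complex.I)‖ := by
  set g : ℂ → ℂ := fun z => G (toHalfPlane T z) * (1 - z) ^ 2 with hg
  have hg0 : g 0 = G (1 / 2 + T) := by simp [hg, toHalfPlane]
  have hdiff : ∀ z, z ≠ 1 → DifferentiableAt ℂ g z := by
    intro z hz
    have h1 : 1 - z ≠ 0 := sub_ne_zero.2 hz.symm
    have h2 : DifferentiableAt ℂ (toHalfPlane T) z := by
      unfold toHalfPlane
      fun_prop (disch := assumption)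
    exact ((hG _).comp z h2).mul (by fun_prop)
  set A := Real.log (B * (3 + 2 * T) ^ 2) with hA
  have hone : 1 ≤ B * (3 + 2 * T) ^ 2 := by nlinarith
  have hgA : ∀ z, z ≠ 1 → ‖z‖ ≤ 1 → Real.log ‖g z‖ ≤ A := by
    intro z hz hz1
    have h1 : 1 - z ≠ 0 := sub_ne_zero.2 hz.symm
    have h2 : ‖g z‖ ≤ B * (3 + 2 * T) ^ 2 := by
      have h3 : (1 + ‖toHalfPlane T z‖) * ‖1 - z‖ ≤ 3 + 2 * T := by
        have h4 : toHalfPlane T z * (1 - z) = (1 - z) / 2 + T * (1 + z) := by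
          rw [toHalfPlane]; field_simp
        have h5 : ‖1 - z‖ ≤ 2 := (norm_sub_le _ _).trans (by rw [norm_one]; linarith)
        have h6 : ‖1 + z‖ ≤ 2 := (norm_add_le _ _).trans (by rw [norm_one]; linarith)
        rw [add_mul, one_mul, ← norm_mul, h4]
        have h7 : ‖(1 - z) / 2 + T * (1 + z)‖ ≤ 1 + T * 2 := by
          refine (norm_add_le _ _).trans (add_le_add ?_ ?_)
          · rw [norm_div, Complex.norm_ofNat]; linarith
          · rw [norm_mul, Complex.norm_real, Real.norm_of_nonneg hT.le]
            exact mul_le_mul_of_nonneg_left h6 hT.le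
        linarith
      calc ‖g z‖ = ‖G (toHalfPlane T z)‖ * ‖1 - z‖ ^ 2 := by rw [hg]; simp
        _ ≤ B * (1 + ‖toHalfPlane T z‖) ^ 2 * ‖1 - z‖ ^ 2 := by
            gcongr
            exact hGB _ (half_le_re_toHalfPlane hT hz1)
        _ = B * ((1 + ‖toHalfPlane T z‖) * ‖1 - z‖) ^ 2 := by ring
        _ ≤ B * (3 + 2 * T) ^ 2 := by gcongr
    rcases (norm_nonneg (g z)).eq_or_lt with h3 | h3
    · rw [← h3, Real.log_zero]; exact Real.log_nonneg hone
    · exact Real.log_le_log h3 h2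
  have hne : ∀ z ∈ Metric.ball (0 : ℂ) 1, z ≠ 1 := by
    rintro z hz rfl
    simp at hz
  have hF := lintegral_sub_log_boundary_le (g := g) (b := fun θ => g (circleMap 0 1 θ)) (A := A)
    (fun z hz => DifferentiableOn.analyticAt (s := Metric.ball 0 1)
      (fun w hw => (hdiff w (hne w hw)).differentiableWithinAt) (Metric.isOpen_ball.mem_nhds hz))
    (by rwa [hg0]) (fun z hz => hgA z (hne z hz) (mem_ball_zero_iff.1 hz).le)
    (by
      intro θ hθ
      refine ((hdiff _ (circleMap_ne_one hθ)).continuousAt.tendsto).comp ?_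
      have h1 : Tendsto (fun n : ℕ => 1 - 1 / ((n : ℝ) + 2)) atTop (𝓝 (1 - 0)) := by
        refine tendsto_const_nhds.sub ?_
        exact tendsto_const_nhds.div_atTop
          (tendsto_atTop_add_const_right _ _ tendsto_natCast_atTop_atTop)
      rw [sub_zero] at h1
      have h2 : Continuous fun r : ℝ => circleMap 0 r θ := by unfold circleMap; fun_prop
      exact (h2.tendsto 1).comp h1)
  have hmeas : AEStronglyMeasurable (fun θ => A - Real.log ‖g (circleMap 0 1 θ)‖)
      (volume.restrict (Set.Ioo 0 (2 * Real.pi))) := by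
    have h1 : ContinuousOn (fun θ => g (circleMap 0 1 θ)) (Set.Ioo 0 (2 * Real.pi)) :=
      fun θ hθ => ((hdiff _ (circleMap_ne_one hθ)).continuousAt.comp
        (continuous_circleMap 0 1).continuousAt).continuousWithinAt
    exact aestronglyMeasurable_const.sub (Real.measurable_log.comp_aemeasurable
      (h1.norm.aemeasurable measurableSet_Ioo)).aestronglyMeasurable
  have hnonneg : 0 ≤ᵐ[volume.restrict (Set.Ioo 0 (2 * Real.pi))]
      fun θ => A - Real.log ‖g (circleMap 0 1 θ)‖ := by
    refine (ae_restrict_iff' measurableSet_Ioo).2 (ae_of_all _ fun θ hθ => ?_)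
    exact sub_nonneg.2 (hgA _ (circleMap_ne_one hθ) (by simp))
  have hInt : IntegrableOn (fun θ => A - Real.log ‖g (circleMap 0 1 θ)‖)
      (Set.Ioo 0 (2 * Real.pi)) := by
    refine ⟨hmeas, ?_⟩
    rw [hasFiniteIntegral_iff_ofReal hnonneg]
    exact hF.trans_lt ENNReal.ofReal_lt_top
  have hA0 : 0 ≤ 2 * Real.pi * (A - Real.log ‖g 0‖) :=
    mul_nonneg (by positivity) (sub_nonneg.2 (hgA 0 zero_ne_one (by simp)))
  rw [← ofReal_integral_eq_lintegral_ofReal hInt hnonneg, ENNReal.ofReal_le_ofReal_iff hA0] at hF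
  have hconst : IntegrableOn (fun _ : ℝ => A) (Set.Ioo 0 (2 * Real.pi)) :=
    integrableOn_const measure_Ioo_lt_top.ne
  have hlog : IntegrableOn (fun θ => Real.log ‖g (circleMap 0 1 θ)‖) (Set.Ioo 0 (2 * Real.pi)) := by
    refine (hconst.sub hInt).congr (ae_of_all _ fun θ => ?_)
    simp
  have hcirc : CircleIntegrable (fun z => Real.log ‖g z‖) 0 1 := by
    rw [CircleIntegrable, intervalIntegrable_iff_integrableOn_Ioo_of_le (by positivity)]
    exact hlog
  rw [integral_sub hconst hlog, setIntegral_const, smul_eq_mul, Measure.real, Real.volume_Ioo,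
    sub_zero, ENNReal.toReal_ofReal (by positivity), mul_sub, sub_le_sub_iff_left] at hF
  obtain ⟨t1, t2⟩ := circleAverage_eq_integral_cauchy hT (fun z => Real.log ‖g z‖)
  have t1 := t1.1 hcirc
  have t3 : Real.log ‖g 0‖ ≤ Real.circleAverage (fun z => Real.log ‖g z‖) 0 1 := by
    rw [Real.circleAverage_def, smul_eq_mul, ← div_eq_inv_mul, le_div_iff₀ (by positivity),
      intervalIntegral.integral_of_le (by positivity), integral_Ioc_eq_integral_Ioo]
    linarith
  rw [t2] at t3
  obtain ⟨u1, u2⟩ := integral_cauchy_log_norm_cayley_sub hT (a := 1) (by simp)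
  have hae : ∀ᵐ y : ℝ, cauchyDensity T y * Real.log ‖g (cayley T y)‖ =
      cauchyDensity T y * Real.log ‖G (1 / 2 + y * Complex.I)‖ +
        2 * (cauchyDensity T y * Real.log ‖cayley T y - 1‖) := by
    have h1 : {y : ℝ | G (1 / 2 + y * Complex.I) = 0}.Countable := by
      refine (countable_zeros_of_differentiable hG h0).preimage_of_injOn
        (f := fun y : ℝ => 1 / 2 + y * Complex.I) ?_
      intro y _ y' _ h
      simpa using h
    filter_upwards [h1.ae_notMem volume] with y hy
    have hy' : G (1 / 2 + y * Complex.I) ≠ 0 := hy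
    have h2 : cayley T y - 1 ≠ 0 := by
      rw [← neg_ne_zero, neg_sub, one_sub_cayley hT]
      have hT' : (T : ℂ) ≠ 0 := by exact_mod_cast hT.ne'
      exact div_ne_zero (mul_ne_zero two_ne_zero hT') (mul_I_add_ne_zero hT y)
    rw [hg]
    dsimp only
    rw [toHalfPlane_cayley hT, norm_mul, norm_pow, norm_sub_rev 1,
      Real.log_mul (norm_ne_zero_iff.2 hy') (pow_ne_zero _ (norm_ne_zero_iff.2 h2)), Real.log_pow]
    push_cast
    ring
  have hres : Integrable fun y : ℝ => cauchyDensity T y * Real.log ‖G (1 / 2 + y * Complex.I)‖ := by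
    refine (t1.sub (u1.const_mul 2)).congr ?_
    filter_upwards [hae] with y hy
    simp only [Pi.sub_apply]
    linarith
  refine ⟨hres, ?_⟩
  rw [integral_congr_ae hae, integral_add hres (u1.const_mul 2), integral_const_mul, u2, mul_zero,
    add_zero, hg0] at t3
  exact t3

theorem differentiable_dirichletPoly {D : Finset ℕ} (hD : ∀ h ∈ D, 0 < h) (m : ℕ → ℝ) :
    Differentiable ℂ (dirichletPoly D m) := by
  unfold dirichletPoly
  refine Differentiable.fun_sum fun h hh => ?_
  have h0 : (h : ℂ) ≠ 0 := by exact_mod_cast (hD h hh).ne'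
  exact (differentiable_neg.const_cpow (Or.inl h0)).const_mul _

theorem norm_dirichletPoly_le {D : Finset ℕ} (hD : ∀ h ∈ D, 0 < h) (m : ℕ → ℝ) {s : ℂ}
    (hs : 0 ≤ s.re) : ‖dirichletPoly D m s‖ ≤ ∑ h ∈ D, |m h| := by
  refine (norm_sum_le _ _).trans (Finset.sum_le_sum fun h hh => ?_)
  rw [norm_mul, Complex.norm_real, Real.norm_eq_abs, Complex.norm_natCast_cpow_of_pos (hD h hh)]
  refine mul_le_of_le_one_right (abs_nonneg _) ?_
  have : (1 : ℝ) ≤ h := by exact_mod_cast hD h hh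
  exact Real.rpow_le_one_of_one_le_of_nonpos this (by simpa using hs)

/-- To the right of the half-plane of convergence a Dirichlet polynomial with leading coefficient
`1` is close to `1`. -/
theorem norm_dirichletPoly_sub_one_le {D : Finset ℕ} (hD : ∀ h ∈ D, 0 < h) (h1 : 1 ∈ D)
    {m : ℕ → ℝ} (hm1 : m 1 = 1) (hm : ∀ h, |m h| ≤ 1) {σ : ℝ} (hσ : 2 ≤ σ) :
    ‖dirichletPoly D m σ - 1‖ ≤ 2 ^ (2 - σ) * ∑' n : ℕ, 1 / (n : ℝ) ^ 2 := by
  have e1 : dirichletPoly D m σ - 1 = ∑ h ∈ D.erase 1, (m h : ℂ) * (h : ℂ) ^ (-(σ : ℂ)) := by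
    rw [dirichletPoly, ← Finset.add_sum_erase _ _ h1, hm1]
    simp
  have hsum : Summable fun n : ℕ => 1 / (n : ℝ) ^ 2 := Real.summable_one_div_nat_pow.2 (by norm_num)
  rw [e1]
  refine (norm_sum_le _ _).trans ?_
  calc ∑ h ∈ D.erase 1, ‖(m h : ℂ) * (h : ℂ) ^ (-(σ : ℂ))‖
      ≤ ∑ h ∈ D.erase 1, 2 ^ (2 - σ) * (1 / (h : ℝ) ^ 2) := by
        refine Finset.sum_le_sum fun h hh => ?_
        have hh0 := hD h (Finset.mem_of_mem_erase hh)
        have hh2 : 2 ≤ h := by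
          have := Finset.ne_of_mem_erase hh
          omega
        have hh2' : (2 : ℝ) ≤ h := by exact_mod_cast hh2
        rw [norm_mul, Complex.norm_real, Real.norm_eq_abs, Complex.norm_natCast_cpow_of_pos hh0]
        have h3 : (h : ℝ) ^ (-(σ : ℂ)).re = (h : ℝ) ^ (2 - σ) * (1 / (h : ℝ) ^ 2) := by
          rw [Complex.neg_re, Complex.ofReal_re, Real.rpow_sub (by linarith), Real.rpow_neg (by linarith)]
          rw [Real.rpow_two]
          have : (h : ℝ) ^ 2 ≠ 0 := by positivity
          field_simp
        rw [h3, ← mul_assoc]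
        refine mul_le_mul_of_nonneg_right ?_ (by positivity)
        calc |m h| * (h : ℝ) ^ (2 - σ) ≤ 1 * 2 ^ (2 - σ) :=
              mul_le_mul (hm h) (Real.rpow_le_rpow_of_nonpos (by norm_num) hh2' (by linarith))
                (by positivity) zero_le_one
          _ = 2 ^ (2 - σ) := one_mul _
    _ = 2 ^ (2 - σ) * ∑ h ∈ D.erase 1, 1 / (h : ℝ) ^ 2 := by rw [Finset.mul_sum]
    _ ≤ _ := by
        refine mul_le_mul_of_nonneg_left ?_ (by positivity)
        exact hsum.sum_le_tsum _ fun n _ => by positivity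

theorem one_mem_mollSupport (P : Finset ℕ) (K : ℕ) : 1 ∈ mollSupport P K :=
  Finset.mem_image.2 ⟨∅, by simp, by simp⟩

theorem tendsto_riemannZeta_atTop : Tendsto (fun σ : ℝ => riemannZeta σ) atTop (𝓝 1) := by
  have h := LSeries.tendsto_atTop (f := 1) (by rw [LSeries.abscissaOfAbsConv_one]; exact EReal.coe_lt_top 1)
  simp only [Pi.one_apply] at h
  refine h.congr' ?_
  filter_upwards [eventually_gt_atTop 1] with σ hσ
  exact LSeries_one_eq_riemannZeta (by simpa using hσ)

/-- The value of the mollified zeta function far to the right is bounded below. -/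
theorem eventually_log_norm_zeta_moll_ge : ∀ᶠ T : ℝ in atTop,
    riemannZeta (1 / 2 + T) ≠ 0 ∧ moll T (1 / 2 + T) ≠ 0 ∧
    -2 ≤ Real.log ‖riemannZeta (1 / 2 + T)‖ + Real.log ‖moll T (1 / 2 + T)‖ := by
  have hshift : Tendsto (fun T : ℝ => 1 / 2 + T) atTop atTop := tendsto_atTop_add_const_left _ _ tendsto_id
  have h1 := (tendsto_riemannZeta_atTop.comp hshift).norm.eventually_const_lt
    (show (1 / 2 : ℝ) < ‖(1 : ℂ)‖ by norm_num)
  have h2 : Tendsto (fun T : ℝ => (2 : ℝ) ^ (2 - (1 / 2 + T)) * ∑' n : ℕ, 1 / (n : ℝ) ^ 2) atTop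
      (𝓝 (0 * ∑' n : ℕ, 1 / (n : ℝ) ^ 2)) := by
    refine Tendsto.mul_const _ ?_
    have h3 : Tendsto (fun T : ℝ => 2 - (1 / 2 + T)) atTop atBot :=
      tendsto_atBot_add_const_left _ 2 (tendsto_neg_atTop_atBot.comp hshift)
    exact (tendsto_rpow_atBot_of_base_gt_one 2 (by norm_num)).comp h3
  rw [zero_mul] at h2
  have h3 := h2.eventually_le_const (show (0 : ℝ) < 1 / 2 by norm_num)
  filter_upwards [h1, h3, eventually_ge_atTop 2] with T hz hm hT
  have hP : ∀ p ∈ Nat.primesLE (mollX T), p.Prime := fun p hp => (Nat.mem_primesLE.1 hp).2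
  have h4 := norm_dirichletPoly_sub_one_le (fun h hh => mollSupport_pos hP (K := mollK T) hh)
    (one_mem_mollSupport (Nat.primesLE (mollX T)) (mollK T)) (m := mollCoeff)
    (by simp [mollCoeff]) (fun h => by simp [mollCoeff]) (σ := 1 / 2 + T) (by linarith)
  have hcast : (((1 / 2 + T : ℝ)) : ℂ) = 1 / 2 + T := by push_cast; ring
  have h5 : 1 / 2 ≤ ‖moll T (1 / 2 + T)‖ := by
    have h6 : ‖(1 : ℂ)‖ ≤ ‖moll T (1 / 2 + T)‖ + ‖moll T (1 / 2 + T) - 1‖ := by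
      have := norm_sub_le (moll T (1 / 2 + T)) (moll T (1 / 2 + T) - 1)
      rwa [sub_sub_cancel] at this
    rw [norm_one] at h6
    have h7 : ‖moll T (1 / 2 + T) - 1‖ ≤ 1 / 2 := by
      rw [moll, ← hcast]; exact h4.trans hm
    linarith
  simp only [Function.comp_apply, hcast] at hz
  have hlog : ∀ x : ℝ, 1 / 2 ≤ x → -1 ≤ Real.log x := fun x hx => by
    have h8 := Real.log_le_log (by norm_num) hx
    have h9 := Real.log_two_lt_d9
    rw [one_div, Real.log_inv] at h8
    linarith
  refine ⟨norm_pos_iff.1 (by linarith), norm_pos_iff.1 (by linarith), ?_⟩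
  have := hlog _ h5
  have := hlog _ hz.le
  linarith

theorem norm_half_add_mul_I_sub_one {T : ℝ} (hT : 1 ≤ T) (y : ℝ) :
    ‖(1 / 2 + y * Complex.I - 1 : ℂ)‖ * ‖cayley T y - 1‖ =
      (T + 1 / 2) * ‖cayley T y - ((-((T - 1 / 2) / (T + 1 / 2)) : ℝ) : ℂ)‖ := by
  have h := mul_I_add_ne_zero (by linarith : 0 < T) y
  have hT' : ((T + 1 / 2 : ℝ) : ℂ) ≠ 0 := by
    exact_mod_cast (by linarith : (T + 1 / 2 : ℝ) ≠ 0)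
  have h1 : (T + 1 / 2 : ℝ) = ‖((T + 1 / 2 : ℝ) : ℂ)‖ := by
    rw [Complex.norm_real, Real.norm_of_nonneg (by linarith)]
  suffices (1 / 2 + y * Complex.I - 1 : ℂ) * (1 - cayley T y) = ((T + 1 / 2 : ℝ) : ℂ) *
      (cayley T y - ((-((T - 1 / 2) / (T + 1 / 2)) : ℝ) : ℂ)) by
    have h2 := congrArg norm this
    rwa [norm_mul, norm_mul, norm_sub_rev 1, ← h1] at h2
  rw [one_sub_cayley (by linarith), cayley]
  have hm : ((T + 1 / 2 : ℝ) : ℂ) * ((-((T - 1 / 2) / (T + 1 / 2)) : ℝ) : ℂ) = -(T - 1 / 2) := by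
    rw [← Complex.ofReal_mul, mul_neg, mul_div_cancel₀ _ (by linarith : T + 1 / 2 ≠ 0)]
    push_cast
    ring
  rw [mul_sub, hm]
  push_cast
  field_simp
  ring

/-- The mean of the logarithm of the mollified zeta function on the critical line is bounded
below, by Jensen's inequality. -/
theorem eventually_integral_log_zeta_moll_ge : ∀ᶠ T : ℝ in atTop,
    (Integrable fun y : ℝ => cauchyDensity T y *
      Real.log ‖riemannZeta (1 / 2 + y * Complex.I) * moll T (1 / 2 + y * Complex.I)‖) ∧
    -3 ≤ ∫ y : ℝ, cauchyDensity T y *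
      Real.log ‖riemannZeta (1 / 2 + y * Complex.I) * moll T (1 / 2 + y * Complex.I)‖ := by
  filter_upwards [eventually_log_norm_zeta_moll_ge, eventually_ge_atTop 2] with T ⟨hz, hm, hlow⟩ hT
  have hT0 : 0 < T := by linarith
  have hP : ∀ p ∈ Nat.primesLE (mollX T), p.Prime := fun p hp => (Nat.mem_primesLE.1 hp).2
  have hD : ∀ h ∈ mollSupport (Nat.primesLE (mollX T)) (mollK T), 0 < h :=
    fun h hh => mollSupport_pos hP hh
  set G : ℂ → ℂ := fun s => riemannZeta₁ s * moll T s with hGdef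
  have hG : Differentiable ℂ G := differentiable_riemannZeta₁.mul (differentiable_dirichletPoly hD _)
  have hGz : ∀ s, s ≠ 1 → G s = (s - 1) * (riemannZeta s * moll T s) := by
    intro s hs
    rw [hGdef]
    dsimp only
    rw [riemannZeta_eq_inv_sub_mul hs]
    have : s - 1 ≠ 0 := sub_ne_zero.2 hs
    field_simp
  set S := ∑ h ∈ mollSupport (Nat.primesLE (mollX T)) (mollK T), |mollCoeff h|
  have hS : 0 ≤ S := Finset.sum_nonneg fun h _ => abs_nonneg _
  have hTc : (1 / 2 + T : ℂ) - 1 = ((T - 1 / 2 : ℝ) : ℂ) := by push_cast; ring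
  have hT1 : (1 / 2 + T : ℂ) ≠ 1 := by
    rw [← sub_ne_zero, hTc]
    exact_mod_cast (by linarith : (T - 1 / 2 : ℝ) ≠ 0)
  have hG0 : G (1 / 2 + T) ≠ 0 := by
    rw [hGz _ hT1]
    exact mul_ne_zero (sub_ne_zero.2 hT1) (mul_ne_zero hz hm)
  obtain ⟨h1, h2⟩ := log_norm_le_integral_cauchy hG (B := 3 * (1 + S)) (by linarith) hT0 (by
    intro s hs
    rw [hGdef]
    dsimp only
    rw [norm_mul]
    calc ‖riemannZeta₁ s‖ * ‖moll T s‖ ≤ (3 * (1 + ‖s‖) ^ 2) * (1 + S) := by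
          refine mul_le_mul (norm_riemannZeta₁_le hs) ?_ (norm_nonneg _) (by positivity)
          have := norm_dirichletPoly_le hD mollCoeff (s := s) (by linarith)
          rw [moll]
          linarith
      _ = _ := by ring) hG0
  set a : ℂ := ((-((T - 1 / 2) / (T + 1 / 2)) : ℝ) : ℂ) with ha
  have ha1 : ‖a‖ ≤ 1 := by
    rw [ha, Complex.norm_real, norm_neg, Real.norm_of_nonneg (by
      apply div_nonneg <;> linarith), div_le_one (by linarith)]
    linarith
  obtain ⟨u1, u2⟩ := integral_cauchy_log_norm_cayley_sub hT0 (a := 1) (by simp)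
  obtain ⟨v1, v2⟩ := integral_cauchy_log_norm_cayley_sub hT0 ha1
  obtain ⟨w1, w2⟩ := integrable_cauchyDensity hT0
  have hae : ∀ᵐ y : ℝ, cauchyDensity T y *
      Real.log ‖riemannZeta (1 / 2 + y * Complex.I) * moll T (1 / 2 + y * Complex.I)‖ =
      cauchyDensity T y * Real.log ‖G (1 / 2 + y * Complex.I)‖ -
      (Real.log (T + 1 / 2) * cauchyDensity T y +
        cauchyDensity T y * Real.log ‖cayley T y - a‖ -
        cauchyDensity T y * Real.log ‖cayley T y - 1‖) := by
    have hc : {y : ℝ | G (1 / 2 + y * Complex.I) = 0}.Countable := by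
      refine (countable_zeros_of_differentiable hG hG0).preimage_of_injOn
        (f := fun y : ℝ => 1 / 2 + y * Complex.I) ?_
      intro y _ y' _ h
      simpa using h
    filter_upwards [hc.ae_notMem volume] with y hy
    have hy' : G (1 / 2 + y * Complex.I) ≠ 0 := hy
    have hs1 : (1 / 2 + y * Complex.I : ℂ) ≠ 1 := by
      intro h
      have := congrArg Complex.re h
      norm_num at this
    rw [hGz _ hs1] at hy' ⊢
    have e1 := norm_half_add_mul_I_sub_one (by linarith : 1 ≤ T) y
    rw [← ha] at e1
    have e2 : cayley T y - 1 ≠ 0 := by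
      rw [← neg_ne_zero, neg_sub, one_sub_cayley hT0]
      have hT' : (T : ℂ) ≠ 0 := by exact_mod_cast hT0.ne'
      exact div_ne_zero (mul_ne_zero two_ne_zero hT') (mul_I_add_ne_zero hT0 y)
    have e3 := norm_ne_zero_iff.2 e2
    have e4 : ‖(1 / 2 + y * Complex.I - 1 : ℂ)‖ ≠ 0 := norm_ne_zero_iff.2 (sub_ne_zero.2 hs1)
    have e5 : ‖cayley T y - a‖ ≠ 0 := by
      intro h
      rw [h, mul_zero] at e1
      exact mul_ne_zero e4 e3 e1
    have e6 := congrArg Real.log e1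
    rw [Real.log_mul e4 e3, Real.log_mul (by linarith) e5] at e6
    rw [norm_mul (_ - 1), Real.log_mul e4 (norm_ne_zero_iff.2 (right_ne_zero_of_mul hy'))]
    have e7 : Real.log ‖(1 / 2 + y * Complex.I - 1 : ℂ)‖ = Real.log (T + 1 / 2) +
      Real.log ‖cayley T y - a‖ - Real.log ‖cayley T y - 1‖ := by linarith
    rw [e7]
    ring
  have i1 : Integrable fun y => Real.log (T + 1 / 2) * cauchyDensity T y +
      cauchyDensity T y * Real.log ‖cayley T y - a‖ := (w1.const_mul (Real.log (T + 1 / 2))).add v1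
  have i2 : Integrable fun y => Real.log (T + 1 / 2) * cauchyDensity T y +
      cauchyDensity T y * Real.log ‖cayley T y - a‖ -
      cauchyDensity T y * Real.log ‖cayley T y - 1‖ := i1.sub u1
  have hInt := h1.sub i2
  refine ⟨hInt.congr (hae.mono fun y hy => hy.symm), ?_⟩
  rw [integral_congr_ae hae, integral_sub h1 i2, integral_sub i1 u1,
    integral_add (w1.const_mul _) v1, integral_const_mul, w2, u2, v2]
  rw [hGz _ hT1, norm_mul, norm_mul, Real.log_mul (norm_ne_zero_iff.2 (sub_ne_zero.2 hT1))
    (mul_ne_zero (norm_ne_zero_iff.2 hz) (norm_ne_zero_iff.2 hm)),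
    Real.log_mul (norm_ne_zero_iff.2 hz) (norm_ne_zero_iff.2 hm), hTc, Complex.norm_real,
    Real.norm_of_nonneg (by linarith)] at h2
  have h3 : Real.log (T + 1 / 2) - Real.log (T - 1 / 2) ≤ 1 := by
    rw [← Real.log_div (by linarith) (by linarith)]
    have h4 : (T + 1 / 2) / (T - 1 / 2) ≤ 2 := by rw [div_le_iff₀ (by linarith)]; linarith
    have h5 := Real.log_le_log (div_pos (by linarith) (by linarith)) h4
    have h6 := Real.log_two_lt_d9
    linarith
  linarith

/-- The mean of `|log|ζ M||` on the critical line. -/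
theorem eventually_integral_abs_log_zeta_moll_le : ∀ᶠ T : ℝ in atTop,
    (Integrable fun y : ℝ => cauchyDensity T y *
      |Real.log ‖riemannZeta (1 / 2 + y * Complex.I) * moll T (1 / 2 + y * Complex.I)‖|) ∧
    ∫ y : ℝ, cauchyDensity T y *
      |Real.log ‖riemannZeta (1 / 2 + y * Complex.I) * moll T (1 / 2 + y * Complex.I)‖| ≤
      4 * Real.log (Real.log (Real.log T)) + 4 := by
  filter_upwards [eventually_integral_log_zeta_moll_ge, eventually_lintegral_cauchy_moll_le,
    eventually_paramBounds 1] with T ⟨h1, h2⟩ h3 hp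
  have hl := hp.one_le_loglog
  set l := Real.log (Real.log T)
  have hT0 : 0 < T := by linarith [hp.three_le]
  obtain ⟨w1, w2⟩ := integrable_cauchyDensity hT0
  have hw : ∀ y, 0 ≤ cauchyDensity T y := fun y => by unfold cauchyDensity; positivity
  set F : ℝ → ℂ := fun y => riemannZeta (1 / 2 + y * Complex.I) * moll T (1 / 2 + y * Complex.I)
    with hF
  have hP : ∀ p ∈ Nat.primesLE (mollX T), p.Prime := fun p hp => (Nat.mem_primesLE.1 hp).2
  have hFc : Continuous F := by
    have hz : Continuous fun y : ℝ => riemannZeta (1 / 2 + y * Complex.I) := by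
      refine continuous_iff_continuousAt.2 fun y => ?_
      have hs1 : (1 / 2 + y * Complex.I : ℂ) ≠ 1 := by
        intro h
        have := congrArg Complex.re h
        norm_num at this
      exact ContinuousAt.comp (f := fun y : ℝ => (1 / 2 + y * Complex.I : ℂ))
        (differentiableAt_riemannZeta hs1).continuousAt (by fun_prop)
    exact hz.mul ((differentiable_dirichletPoly (fun h hh => mollSupport_pos hP hh)
      mollCoeff).continuous.comp (by fun_prop))
  have hwm : Measurable (cauchyDensity T) := by unfold cauchyDensity; fun_prop
  have hnn : 0 ≤ᵐ[volume] fun y => cauchyDensity T y * ‖F y‖ ^ 2 :=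
    ae_of_all _ fun y => mul_nonneg (hw y) (by positivity)
  have hi : Integrable fun y => cauchyDensity T y * ‖F y‖ ^ 2 := by
    refine ⟨(hwm.mul (hFc.norm.measurable.pow_const 2)).aestronglyMeasurable, ?_⟩
    rw [hasFiniteIntegral_iff_ofReal hnn]
    exact h3.trans_lt ENNReal.ofReal_lt_top
  have hB : ∫ y, cauchyDensity T y * ‖F y‖ ^ 2 ≤ l ^ 4 := by
    have h4 := h3
    change ∫⁻ y : ℝ, ENNReal.ofReal (cauchyDensity T y * ‖F y‖ ^ 2) ≤ _ at h4
    rwa [← ofReal_integral_eq_lintegral_ofReal hi hnn, ENNReal.ofReal_le_ofReal_iff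
      (by positivity)] at h4
  have hl4 : 1 ≤ l ^ 4 := one_le_pow₀ hl
  have hpt : ∀ y, cauchyDensity T y * |Real.log ‖F y‖| ≤ (4 * Real.log l - 1) * cauchyDensity T y +
      (l ^ 4)⁻¹ * (cauchyDensity T y * ‖F y‖ ^ 2) - cauchyDensity T y * Real.log ‖F y‖ +
      cauchyDensity T y := by
    intro y
    have h5 : |Real.log ‖F y‖| ≤ (4 * Real.log l - 1) + (l ^ 4)⁻¹ * ‖F y‖ ^ 2 -
        Real.log ‖F y‖ + 1 := by
      have h0 : 0 ≤ (l ^ 4)⁻¹ * ‖F y‖ ^ 2 := by positivity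
      have hll := Real.log_nonneg hl
      rcases le_or_gt (Real.log ‖F y‖) 0 with h | h
      · rw [abs_of_nonpos h]; linarith
      · rw [abs_of_pos h]
        have hFp : 0 < ‖F y‖ := by
          refine (norm_nonneg _).lt_of_ne fun h' => ?_
          rw [← h', Real.log_zero] at h
          exact h.false
        have h6 := Real.log_le_sub_one_of_pos (show 0 < (l ^ 4)⁻¹ * ‖F y‖ ^ 2 by positivity)
        rw [Real.log_mul (by positivity) (by positivity), Real.log_inv, Real.log_pow,
          Real.log_pow] at h6
        push_cast at h6
        linarith
    have := mul_le_mul_of_nonneg_left h5 (hw y)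
    linarith
  have ha : Integrable fun y => cauchyDensity T y * |Real.log ‖F y‖| := by
    refine h1.norm.congr (ae_of_all _ fun y => ?_)
    dsimp only
    rw [norm_mul, Real.norm_eq_abs, Real.norm_eq_abs, abs_of_nonneg (hw y)]
  refine ⟨ha, ?_⟩
  have i1 : Integrable fun y => (4 * Real.log l - 1) * cauchyDensity T y +
      (l ^ 4)⁻¹ * (cauchyDensity T y * ‖F y‖ ^ 2) :=
    (w1.const_mul (4 * Real.log l - 1)).add (hi.const_mul (l ^ 4)⁻¹)
  have i2 : Integrable fun y => (4 * Real.log l - 1) * cauchyDensity T y +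
      (l ^ 4)⁻¹ * (cauchyDensity T y * ‖F y‖ ^ 2) - cauchyDensity T y * Real.log ‖F y‖ := i1.sub h1
  have i3 : Integrable fun y => (4 * Real.log l - 1) * cauchyDensity T y +
      (l ^ 4)⁻¹ * (cauchyDensity T y * ‖F y‖ ^ 2) - cauchyDensity T y * Real.log ‖F y‖ +
      cauchyDensity T y := i2.add w1
  have h7 := integral_mono ha i3 hpt
  rw [integral_add i2 w1, integral_sub i1 h1, integral_add (w1.const_mul _) (hi.const_mul _),
    integral_const_mul, integral_const_mul, w2] at h7
  have h8 : (l ^ 4)⁻¹ * ∫ y, cauchyDensity T y * ‖F y‖ ^ 2 ≤ 1 := by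
    rw [inv_mul_le_iff₀ (by positivity)]; linarith
  linarith

/-- Cauchy's estimate for the coefficients of a polynomial given as a finite sum of monomials with
repeated exponents. -/
theorem norm_sum_filter_mul_pow_le {ι : Type*} (A : Finset ι) (c : ι → ℂ) (e : ι → ℕ) {R B : ℝ}
    (hR : 0 < R) (hB : ∀ z : ℂ, ‖z‖ = R → ‖∑ i ∈ A, c i * z ^ e i‖ ≤ B) (j : ℕ) :
    ‖∑ i ∈ A with e i = j, c i‖ ≤ B / R ^ j := by
  have h1 := Complex.norm_iteratedDeriv_le_of_forall_mem_sphere_norm_le (c := 0) (R := R) (C := B)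
    (f := fun z : ℂ => ∑ i ∈ A, c i * z ^ e i) j hR
    (Differentiable.diffContOnCl (by fun_prop)) (fun z hz => hB z (by simpa using hz))
  have h2 : iteratedDeriv j (fun z : ℂ => ∑ i ∈ A, c i * z ^ e i) 0 =
      j.factorial * ∑ i ∈ A with e i = j, c i := by
    rw [iteratedDeriv_fun_sum (fun i _ => by fun_prop), Finset.sum_filter, Finset.mul_sum]
    refine Finset.sum_congr rfl fun i _ => ?_
    rw [iteratedDeriv_const_mul _ (by fun_prop), iteratedDeriv_fun_pow_zero]
    by_cases h : e i = j
    · simp [h, mul_comm]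
    · simp [h, Ne.symm h]
  rw [h2, norm_mul, Complex.norm_natCast, mul_div_assoc] at h1
  exact le_of_mul_le_mul_left h1 (by exact_mod_cast Nat.factorial_pos j)

theorem abs_log_norm_one_sub_add_le {w : ℂ} (hw : ‖w‖ ≤ 17 / 20) :
    |Real.log ‖1 - w‖ + w.re + (w ^ 2).re / 2| ≤ 5 / 2 * ‖w‖ ^ 3 := by
  have h1 := Complex.norm_log_sub_logTaylor_le 2 (z := -w) (by rw [norm_neg]; linarith)
  have h2 : Complex.logTaylor (2 + 1) (-w) = -w - w ^ 2 / 2 := by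
    simp only [Complex.logTaylor, Finset.sum_range_succ, Finset.sum_range_zero]
    norm_num
    ring
  rw [h2, norm_neg, ← sub_eq_add_neg] at h1
  have h3 := (Complex.abs_re_le_norm _).trans h1
  have h4 : (Complex.log (1 - w) - (-w - w ^ 2 / 2)).re =
      Real.log ‖1 - w‖ + w.re + (w ^ 2).re / 2 := by
    rw [Complex.sub_re, Complex.log_re, Complex.sub_re, Complex.neg_re, Complex.div_ofNat_re]
    ring
  rw [h4] at h3
  refine h3.trans ?_
  have h5 : (1 - ‖w‖)⁻¹ ≤ 20 / 3 := by
    rw [inv_le_comm₀ (by linarith) (by norm_num)]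
    linarith
  have h6 : 0 ≤ ‖w‖ ^ 3 := by positivity
  norm_num
  nlinarith

section

variable {ι : Type*} {P : Finset ι} {w : ι → ℂ}

theorem abs_log_norm_prod_one_sub_add_le (hw : ∀ i ∈ P, ‖w i‖ ≤ 17 / 24) {z : ℂ}
    (hz : ‖z‖ ≤ 6 / 5) :
    (∏ i ∈ P, (1 - w i * z)) ≠ 0 ∧
    |Real.log ‖∏ i ∈ P, (1 - w i * z)‖ + (z * ∑ i ∈ P, w i).re + (z ^ 2 * ∑ i ∈ P, w i ^ 2).re / 2|
      ≤ 5 * ∑ i ∈ P, ‖w i‖ ^ 3 := by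
  have h1 : ∀ i ∈ P, ‖w i * z‖ ≤ 17 / 20 := by
    intro i hi
    rw [norm_mul]
    nlinarith [hw i hi, norm_nonneg (w i), norm_nonneg z]
  have h2 : ∀ i ∈ P, 1 - w i * z ≠ 0 := by
    intro i hi h
    have h3 := h1 i hi
    rw [← sub_eq_zero.1 h, norm_one] at h3
    norm_num at h3
  refine ⟨Finset.prod_ne_zero_iff.2 h2, ?_⟩
  rw [norm_prod, Real.log_prod (fun i hi => norm_ne_zero_iff.2 (h2 i hi)), Finset.mul_sum,
    Finset.mul_sum, Complex.re_sum, Complex.re_sum, Finset.sum_div, ← Finset.sum_add_distrib,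
    ← Finset.sum_add_distrib, Finset.mul_sum]
  refine (Finset.abs_sum_le_sum_abs _ _).trans (Finset.sum_le_sum fun i hi => ?_)
  have h4 := abs_log_norm_one_sub_add_le (h1 i hi)
  rw [mul_pow, mul_comm (w i ^ 2)] at h4
  rw [mul_comm z (w i)]
  refine h4.trans ?_
  rw [norm_mul, mul_pow]
  have h5 : ‖z‖ ^ 3 ≤ (6 / 5) ^ 3 := by gcongr
  nlinarith [pow_nonneg (norm_nonneg (w i)) 3]

/-- A truncated product over few factors differs from the full product by an exponentially small
tail. -/
theorem abs_log_norm_sum_card_le_prod_add_re_le (hw : ∀ i ∈ P, ‖w i‖ ≤ 17 / 24) {A S : ℝ} {K : ℕ}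
    (h1 : ‖∑ i ∈ P, w i‖ ≤ A) (h2 : ‖∑ i ∈ P, w i ^ 2‖ ≤ A) (hS : ∑ i ∈ P, ‖w i‖ ^ 3 ≤ S)
    (hK : 20 * Real.exp (4 * A + 10 * S) ≤ (6 / 5) ^ K) :
    |Real.log ‖∑ I ∈ P.powerset with I.card ≤ K, ∏ i ∈ I, (-w i)‖ + (∑ i ∈ P, w i).re| ≤
      ‖∑ i ∈ P, w i ^ 2‖ + 5 * S + 1 := by
  set p₁ := ∑ i ∈ P, w i
  set p₂ := ∑ i ∈ P, w i ^ 2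
  have hA : 0 ≤ A := (norm_nonneg _).trans h1
  set F : ℂ → ℂ := fun z => ∏ i ∈ P, (1 - w i * z) with hF
  have hexp : ∀ z, F z = ∑ I ∈ P.powerset, (∏ i ∈ I, (-w i)) * z ^ I.card := by
    intro z
    simp_rw [hF, sub_eq_add_neg, ← neg_mul, Finset.prod_one_add, Finset.prod_mul_distrib,
      Finset.prod_const]
  set B := Real.exp (2 * A + 5 * S) with hB
  have hFB : ∀ z : ℂ, ‖z‖ = 6 / 5 →
      ‖∑ I ∈ P.powerset, (∏ i ∈ I, (-w i)) * z ^ I.card‖ ≤ B := by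
    intro z hz
    rw [← hexp]
    obtain ⟨h3, h4⟩ := abs_log_norm_prod_one_sub_add_le hw hz.le
    rw [hB, ← Real.log_le_iff_le_exp (norm_pos_iff.2 h3)]
    have h5 := (abs_le.1 (Complex.abs_re_le_norm (z * p₁))).1
    have h6 := (abs_le.1 (Complex.abs_re_le_norm (z ^ 2 * p₂))).1
    rw [norm_mul, hz] at h5
    rw [norm_mul, norm_pow, hz] at h6
    have h7 := (abs_le.1 h4).2
    change Real.log ‖F z‖ + (z * p₁).re + (z ^ 2 * p₂).re / 2 ≤ _ at h7
    linarith
  have hcoef := fun j => norm_sum_filter_mul_pow_le P.powerset (fun I => ∏ i ∈ I, (-w i))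
    Finset.card (by norm_num) hFB j
  obtain ⟨h3, h4⟩ := abs_log_norm_prod_one_sub_add_le hw (z := 1) (by norm_num)
  simp only [mul_one, one_mul, one_pow] at h3 h4
  have hF1 : ∏ i ∈ P, (1 - w i) = ∑ I ∈ P.powerset, ∏ i ∈ I, (-w i) := by
    simp_rw [sub_eq_add_neg, Finset.prod_one_add]
  set G := ∏ i ∈ P, (1 - w i)
  set M := ∑ I ∈ P.powerset with I.card ≤ K, ∏ i ∈ I, (-w i)
  have hre1 := abs_le.1 (Complex.abs_re_le_norm p₁)
  have hre2 := abs_le.1 (Complex.abs_re_le_norm p₂)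
  have h4' := abs_le.1 h4
  have htail : ‖M - G‖ ≤ 5 * B / (6 / 5) ^ K := by
    have e1 : G - M = ∑ j ∈ Finset.range P.card,
        ∑ I ∈ P.powerset with I.card = K + 1 + j, ∏ i ∈ I, (-w i) := by
      rw [hF1, ← Finset.sum_filter_add_sum_filter_not P.powerset (fun I => I.card ≤ K),
        add_sub_cancel_left]
      rw [← Finset.sum_fiberwise_of_maps_to (t := Finset.range P.card)
        (g := fun I : Finset ι => I.card - (K + 1))]
      · refine Finset.sum_congr rfl fun j _ => ?_
        rw [Finset.filter_filter]
        refine Finset.sum_congr (Finset.filter_congr fun I _ => ?_) fun _ _ => rfl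
        omega
      · intro I hI
        rw [Finset.mem_filter, Finset.mem_powerset] at hI
        have := Finset.card_le_card hI.1
        rw [Finset.mem_range]
        omega
    rw [norm_sub_rev, e1]
    have e2 : ∀ N : ℕ, ∑ j ∈ Finset.range N, B / (6 / 5 : ℝ) ^ (K + 1 + j) ≤
        5 * B / (6 / 5) ^ K - 5 * B / (6 / 5) ^ (K + N) := by
      intro N
      induction N with
      | zero => simp
      | succ N ih =>
        rw [Finset.sum_range_succ]
        have : B / (6 / 5 : ℝ) ^ (K + 1 + N) =
            5 * B / (6 / 5) ^ (K + N) - 5 * B / (6 / 5) ^ (K + (N + 1)) := by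
          rw [show K + 1 + N = K + N + 1 by ring, show K + (N + 1) = K + N + 1 by ring, pow_succ]
          field_simp
          ring
        linarith
    have e3 : 0 ≤ 5 * B / (6 / 5 : ℝ) ^ (K + P.card) := by positivity
    refine (norm_sum_le _ _).trans ((Finset.sum_le_sum fun j _ => hcoef _).trans ?_)
    linarith [e2 P.card]
  have hG : Real.exp (-(2 * A + 5 * S)) ≤ ‖G‖ := by
    rw [← Real.le_log_iff_exp_le (norm_pos_iff.2 h3)]
    linarith
  have hdiff : ‖M - G‖ ≤ ‖G‖ / 2 := by
    refine htail.trans (le_trans ?_ (div_le_div_of_nonneg_right hG zero_le_two))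
    rw [div_le_div_iff₀ (by positivity) zero_lt_two]
    have e4 : Real.exp (4 * A + 10 * S) * Real.exp (-(2 * A + 5 * S)) = B := by
      rw [← Real.exp_add]
      congr 1
      ring
    have e5 := mul_le_mul_of_nonneg_right hK (Real.exp_pos (-(2 * A + 5 * S))).le
    rw [mul_assoc, e4] at e5
    have : 0 < B := Real.exp_pos _
    linarith
  have hGp : 0 < ‖G‖ := norm_pos_iff.2 h3
  have hu : ‖M‖ ≤ 2 * ‖G‖ := by
    have := norm_sub_norm_le M G
    linarith
  have hl : ‖G‖ / 2 ≤ ‖M‖ := by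
    have := norm_sub_norm_le G M
    rw [norm_sub_rev] at this
    linarith
  have hu' := Real.log_le_log (by linarith) hu
  have hl' := Real.log_le_log (by linarith) hl
  rw [Real.log_mul (by norm_num) hGp.ne'] at hu'
  rw [Real.log_div hGp.ne' (by norm_num)] at hl'
  have hl2 := Real.log_two_lt_d9
  rw [abs_le]
  have hp : 0 ≤ ‖p₂‖ := norm_nonneg _
  constructor <;> linarith

end

/-- The prime Dirichlet polynomial of length `X`. -/
noncomputable def primeSum (X : ℕ) (s : ℂ) : ℂ := ∑ p ∈ Nat.primesLE X, (p : ℂ) ^ (-s)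

theorem natCast_prod_cpow (S : Finset ℕ) (s : ℂ) :
    ((∏ p ∈ S, p : ℕ) : ℂ) ^ s = ∏ p ∈ S, (p : ℂ) ^ s := by
  induction S using Finset.induction_on with
  | empty => simp
  | insert a S ha ih =>
    rw [Finset.prod_insert ha, Finset.prod_insert ha, ← ih, Nat.cast_mul,
      Complex.natCast_mul_natCast_cpow]

theorem moll_eq_sum_powerset (T : ℝ) (s : ℂ) :
    moll T s = ∑ S ∈ (Nat.primesLE (mollX T)).powerset with S.card ≤ mollK T,
      ∏ p ∈ S, (-(p : ℂ) ^ (-s)) := by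
  have hP : ∀ p ∈ Nat.primesLE (mollX T), p.Prime := fun p hp => (Nat.mem_primesLE.1 hp).2
  rw [moll, dirichletPoly, sum_mollSupport hP]
  refine Finset.sum_congr rfl fun S hS => ?_
  have hS' := Finset.mem_powerset.1 (Finset.mem_filter.1 hS).1
  rw [mollCoeff_prod hP hS', natCast_prod_cpow, Complex.ofReal_prod, ← Finset.prod_mul_distrib]
  exact Finset.prod_congr rfl fun p _ => by push_cast; ring

theorem natCast_cpow_neg_sq (p : ℕ) (s : ℂ) : ((p : ℂ) ^ (-s)) ^ 2 = (p : ℂ) ^ (-(2 * s)) := by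
  rw [← Complex.cpow_nat_mul]
  congr 1
  push_cast
  ring

theorem norm_prime_cpow_neg_of_re {p : ℕ} (hp : 0 < p) (s : ℂ) :
    ‖(p : ℂ) ^ (-s)‖ = (p : ℝ) ^ (-s.re) := by
  rw [Complex.norm_natCast_cpow_of_pos hp, Complex.neg_re]

/-- On the critical line the logarithm of the mollifier is minus a prime Dirichlet polynomial, up
to a controlled error. -/
theorem exists_eventually_abs_log_norm_moll_add_le : ∃ C : ℝ, ∀ᶠ T : ℝ in atTop, ∀ s : ℂ,
    s.re = 1 / 2 → ‖primeSum (mollX T) s‖ ≤ Real.log (Real.log T) →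
    ‖primeSum (mollX T) (2 * s)‖ ≤ Real.log (Real.log T) →
    |Real.log ‖moll T s‖ + (primeSum (mollX T) s).re| ≤ ‖primeSum (mollX T) (2 * s)‖ + C := by
  have hsum := summable_prime_rpow_neg (r := 3 / 2) (by norm_num)
  set S := ∑' p : Nat.Primes, (p : ℝ) ^ (-(3 / 2) : ℝ) with hSdef
  refine ⟨5 * S + 1, ?_⟩
  filter_upwards [eventually_paramBounds (100 + 10 * |S|)] with T hp s hs h1 h2
  have h2' : primeSum (mollX T) (2 * s) = ∑ p ∈ Nat.primesLE (mollX T), ((p : ℂ) ^ (-s)) ^ 2 :=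
    Finset.sum_congr rfl fun p _ => (natCast_cpow_neg_sq p s).symm
  set l := Real.log (Real.log T)
  have hl := hp.le_loglog
  have hK := hp.le_K
  rw [h2'] at h2 ⊢
  rw [moll_eq_sum_powerset, ← add_assoc]
  refine abs_log_norm_sum_card_le_prod_add_re_le (A := l) (S := S) ?_ h1 h2 ?_ ?_
  · intro p hp
    have hp2 := (Nat.mem_primesLE.1 hp).2
    rw [norm_prime_cpow_neg_of_re hp2.pos, hs]
    have h3 : ((p : ℝ) ^ (-(1 / 2) : ℝ)) ^ 2 ≤ 1 / 2 := by
      rw [← Real.rpow_natCast, ← Real.rpow_mul (by positivity)]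
      rw [show (-(1 / 2) : ℝ) * (2 : ℕ) = -1 by norm_num, Real.rpow_neg_one]
      have h4 : (2 : ℝ) ≤ p := by exact_mod_cast hp2.two_le
      rw [inv_le_comm₀ (by linarith) (by norm_num)]
      norm_num
      exact hp2.two_le
    nlinarith [Real.rpow_nonneg (Nat.cast_nonneg (α := ℝ) p) (-(1 / 2))]
  · refine le_trans (le_of_eq ?_) (sum_primesLE_le_tsum (mollX T)
      (f := fun p => (p : ℝ) ^ (-(3 / 2) : ℝ)) (fun p => by positivity) hsum)
    refine Finset.sum_congr rfl fun p hp => ?_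
    rw [norm_prime_cpow_neg_of_re (Nat.mem_primesLE.1 hp).2.pos, hs, ← Real.rpow_natCast,
      ← Real.rpow_mul (by positivity)]
    norm_num
  · have h4 : (20 : ℝ) ≤ Real.exp 20 := by linarith [Real.add_one_le_exp (20 : ℝ)]
    have h5 : (1 / 10 : ℝ) ≤ Real.log (6 / 5) := by
      have := Real.one_sub_inv_le_log_of_pos (show (0 : ℝ) < 6 / 5 by norm_num)
      norm_num at this ⊢
      linarith
    have h6 : (6 / 5 : ℝ) ^ mollK T = Real.exp (mollK T * Real.log (6 / 5)) := by
      rw [mul_comm, Real.exp_mul, Real.exp_log (by norm_num), Real.rpow_natCast]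
    rw [h6]
    calc 20 * Real.exp (4 * l + 10 * S) ≤ Real.exp 20 * Real.exp (4 * l + 10 * S) := by gcongr
      _ = Real.exp (20 + (4 * l + 10 * S)) := (Real.exp_add _ _).symm
      _ ≤ _ := Real.exp_le_exp.2 ?_
    have h7 : (0 : ℝ) ≤ mollK T := Nat.cast_nonneg _
    have h8 : (mollK T : ℝ) * (1 / 10) ≤ mollK T * Real.log (6 / 5) := by gcongr
    nlinarith [le_abs_self S, abs_nonneg S]

theorem norm_exp_mul_I_sub_sum_le_of_nonneg (n : ℕ) {x : ℝ} (hx : 0 ≤ x) :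
    ‖Complex.exp (x * Complex.I) - ∑ j ∈ Finset.range n, (x * Complex.I) ^ j / j.factorial‖ ≤
      x ^ n / n.factorial := by
  induction n generalizing x with
  | zero => simp [Complex.norm_exp_ofReal_mul_I]
  | succ n ih =>
    have hd : ∀ t : ℝ, HasDerivAt (fun t : ℝ => Complex.exp (t * Complex.I) -
        ∑ j ∈ Finset.range (n + 1), (t * Complex.I) ^ j / j.factorial)
        (Complex.I * (Complex.exp (t * Complex.I) -
        ∑ j ∈ Finset.range n, (t * Complex.I) ^ j / j.factorial)) t := by
      intro t
      have h0 : HasDerivAt (fun t : ℝ => (t : ℂ) * Complex.I) Complex.I t := by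
        simpa using (Complex.ofRealCLM.hasDerivAt (x := t)).mul_const Complex.I
      have h1 := h0.cexp
      simp_rw [Finset.sum_range_succ', pow_zero]
      have h2 : HasDerivAt (fun t : ℝ => ∑ j ∈ Finset.range n,
          ((t : ℂ) * Complex.I) ^ (j + 1) / ((j + 1).factorial : ℂ))
          (∑ j ∈ Finset.range n, Complex.I * ((t * Complex.I) ^ j / j.factorial)) t := by
        refine HasDerivAt.fun_sum fun j _ => ?_
        refine ((h0.pow (j + 1)).div_const _).congr_deriv ?_
        have h3 : ((j + 1 : ℕ) : ℂ) ≠ 0 := by exact_mod_cast Nat.succ_ne_zero j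
        have h4 : (j.factorial : ℂ) ≠ 0 := by exact_mod_cast Nat.factorial_ne_zero j
        rw [Nat.factorial_succ, Nat.cast_mul, add_tsub_cancel_right]
        field_simp
      refine (h1.fun_sub (h2.add_const _)).congr_deriv ?_
      rw [← Finset.mul_sum]
      ring
    have hB : ∀ t : ℝ, HasDerivAt (fun t : ℝ => t ^ (n + 1) / ((n + 1).factorial : ℝ))
        (t ^ n / n.factorial) t := by
      intro t
      refine ((hasDerivAt_pow (n + 1) t).div_const _).congr_deriv ?_
      have h3 : ((n + 1 : ℕ) : ℝ) ≠ 0 := by positivity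
      have h4 : (n.factorial : ℝ) ≠ 0 := by positivity
      rw [Nat.factorial_succ, Nat.cast_mul, add_tsub_cancel_right]
      field_simp
    refine image_norm_le_of_norm_deriv_right_le_deriv_boundary (a := 0) (b := x)
      (f := fun t : ℝ => Complex.exp (t * Complex.I) -
        ∑ j ∈ Finset.range (n + 1), (t * Complex.I) ^ j / j.factorial)
      (fun t _ => (hd t).continuousAt.continuousWithinAt) (fun t _ => (hd t).hasDerivWithinAt)
      ?_ hB (fun t ht => ?_) ⟨hx, le_rfl⟩
    · simp [Finset.sum_range_succ']
    · rw [norm_mul, Complex.norm_I, one_mul]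
      exact ih ht.1

theorem norm_exp_mul_I_sub_sum_le (n : ℕ) (x : ℝ) :
    ‖Complex.exp (x * Complex.I) - ∑ j ∈ Finset.range n, (x * Complex.I) ^ j / j.factorial‖ ≤
      |x| ^ n / n.factorial := by
  rcases le_total 0 x with hx | hx
  · rw [abs_of_nonneg hx]
    exact norm_exp_mul_I_sub_sum_le_of_nonneg n hx
  · rw [abs_of_nonpos hx]
    have h := norm_exp_mul_I_sub_sum_le_of_nonneg n (neg_nonneg.2 hx)
    rw [← Complex.norm_conj] at h
    simpa [← Complex.exp_conj, map_sum] using h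

/-- The trigonometric polynomial `θ ↦ Re ∑ aᵢ e^{iθᵢ}`. -/
noncomputable def phaseSum {ι : Type*} [Fintype ι] (a : ι → ℂ) (θ : ι → ℝ) : ℝ :=
  ∑ i, (a i * Complex.exp (θ i * Complex.I)).re

/-- The sign attached to a Boolean. -/
def boolSign (b : Bool) : ℤ := if b then 1 else -1

/-- The frequency vector of a monomial in the phases. -/
noncomputable def phaseFreq {ι : Type*} {j : ℕ} (f : Fin j → ι × Bool) (i : ι) : ℤ :=
  ∑ k, if (f k).1 = i then boolSign (f k).2 else 0

/-- The coefficient of a phase. -/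
noncomputable def phaseCoeff {ι : Type*} (a : ι → ℂ) (q : ι × Bool) : ℂ :=
  if q.2 then a q.1 / 2 else (starRingEnd ℂ) (a q.1) / 2

theorem norm_phaseCoeff {ι : Type*} (a : ι → ℂ) (q : ι × Bool) : ‖phaseCoeff a q‖ = ‖a q.1‖ / 2 := by
  rw [phaseCoeff]
  split_ifs <;> simp

section

variable {ι : Type*} [Fintype ι] (a : ι → ℂ)

theorem phaseSum_eq_sum (θ : ι → ℝ) : (phaseSum a θ : ℂ) =
    ∑ q : ι × Bool, phaseCoeff a q * Complex.exp ((boolSign q.2 * θ q.1 : ℝ) * Complex.I) := by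
  rw [phaseSum, Fintype.sum_prod_type, Complex.ofReal_sum]
  refine Finset.sum_congr rfl fun i _ => ?_
  rw [Fintype.sum_bool, Complex.re_eq_add_conj]
  simp only [phaseCoeff, boolSign, map_mul, ← Complex.exp_conj]
  simp
  ring

theorem sum_abs_phaseFreq_le {j : ℕ} (f : Fin j → ι × Bool) : ∑ i, |phaseFreq f i| ≤ j := by
  calc ∑ i, |phaseFreq f i| ≤ ∑ i, ∑ k, (if (f k).1 = i then 1 else 0 : ℤ) := by
        refine Finset.sum_le_sum fun i _ => (Finset.abs_sum_le_sum_abs _ _).trans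
          (Finset.sum_le_sum fun k _ => ?_)
        split_ifs
        · unfold boolSign; split_ifs <;> simp
        · simp
    _ = j := by
        rw [Finset.sum_comm]
        simp

theorem phaseSum_pow_eq_sum (θ : ι → ℝ) (j : ℕ) : (phaseSum a θ : ℂ) ^ j =
    ∑ f : Fin j → ι × Bool, (∏ k, phaseCoeff a (f k)) *
      Complex.exp ((∑ i, (phaseFreq f i : ℝ) * θ i : ℝ) * Complex.I) := by
  have h1 : ∀ f : Fin j → ι × Bool, ∑ i, (phaseFreq f i : ℝ) * θ i =
      ∑ k, (boolSign (f k).2 : ℝ) * θ (f k).1 := by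
    intro f
    simp_rw [phaseFreq, Int.cast_sum, Finset.sum_mul]
    rw [Finset.sum_comm]
    refine Finset.sum_congr rfl fun k _ => ?_
    rw [Finset.sum_eq_single (f k).1]
    · simp
    · intro i _ hi
      simp [hi.symm]
    · simp
  rw [phaseSum_eq_sum, Finset.sum_pow', ← Fintype.piFinset_univ]
  refine Finset.sum_congr rfl fun f _ => ?_
  rw [Finset.prod_mul_distrib, ← Complex.exp_sum, h1, Complex.ofReal_sum, Finset.sum_mul]

theorem sum_norm_prod_phaseCoeff (j : ℕ) :
    ∑ f : Fin j → ι × Bool, ‖∏ k, phaseCoeff a (f k)‖ = (∑ i, ‖a i‖) ^ j := by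
  have h1 : ∑ i, ‖a i‖ = ∑ q : ι × Bool, ‖phaseCoeff a q‖ := by
    rw [Fintype.sum_prod_type]
    refine Finset.sum_congr rfl fun i _ => ?_
    rw [Fintype.sum_bool, norm_phaseCoeff, norm_phaseCoeff]
    ring
  rw [h1, Finset.sum_pow', ← Fintype.piFinset_univ]
  exact Finset.sum_congr rfl fun f _ => norm_prod _ _

end

section

variable {ι : Type*} [Fintype ι] (a : ι → ℂ)

theorem continuous_phaseSum : Continuous (phaseSum a) := by
  unfold phaseSum
  fun_prop

theorem abs_phaseSum_le (θ : ι → ℝ) : |phaseSum a θ| ≤ ∑ i, ‖a i‖ := by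
  refine (Finset.abs_sum_le_sum_abs _ _).trans (Finset.sum_le_sum fun i _ => ?_)
  refine (Complex.abs_re_le_norm _).trans ?_
  rw [norm_mul, Complex.norm_exp_ofReal_mul_I, mul_one]

theorem integrable_of_continuous_of_norm_le {X E : Type*} [TopologicalSpace X] [MeasurableSpace X]
    [OpensMeasurableSpace X] [NormedAddCommGroup E] [SecondCountableTopologyEither X E]
    {μ : Measure X} [IsFiniteMeasure μ] {f : X → E} (hf : Continuous f) {B : ℝ}
    (hB : ∀ x, ‖f x‖ ≤ B) : Integrable f μ :=
  Integrable.of_bound hf.aestronglyMeasurable B (ae_of_all _ hB)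

theorem integrable_phaseSum_pow {μ : Measure (ι → ℝ)} [IsFiniteMeasure μ] (j : ℕ) :
    Integrable (fun θ => phaseSum a θ ^ j) μ := by
  refine integrable_of_continuous_of_norm_le ((continuous_phaseSum a).pow j)
    (B := (∑ i, ‖a i‖) ^ j) fun θ => ?_
  rw [norm_pow, Real.norm_eq_abs]
  exact pow_le_pow_left₀ (abs_nonneg _) (abs_phaseSum_le a θ) j

/-- The Fourier coefficient of a measure on phase space. -/
noncomputable def phaseFourier (μ : Measure (ι → ℝ)) (n : ι → ℤ) : ℂ :=
  ∫ θ, Complex.exp ((∑ i, (n i : ℝ) * θ i : ℝ) * Complex.I) ∂μ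

theorem integral_phaseSum_pow (μ : Measure (ι → ℝ)) [IsFiniteMeasure μ] (j : ℕ) :
    ∫ θ, (phaseSum a θ : ℂ) ^ j ∂μ =
      ∑ f : Fin j → ι × Bool, (∏ k, phaseCoeff a (f k)) * phaseFourier μ (phaseFreq f) := by
  simp_rw [phaseSum_pow_eq_sum]
  rw [integral_finsetSum]
  · exact Finset.sum_congr rfl fun f _ => integral_const_mul _ _
  · intro f _
    refine Integrable.const_mul (integrable_of_continuous_of_norm_le (by fun_prop) (B := 1)
      fun θ => ?_) _
    rw [Complex.norm_exp_ofReal_mul_I]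

variable {μ ν : Measure (ι → ℝ)} [IsProbabilityMeasure μ] [IsProbabilityMeasure ν]

theorem norm_integral_phaseSum_pow_sub_le {ε : ℝ} {j N : ℕ} (hj : j ≤ N)
    (h : ∀ n : ι → ℤ, ∑ i, |n i| ≤ N → ‖phaseFourier μ n - phaseFourier ν n‖ ≤ ε) :
    ‖∫ θ, (phaseSum a θ : ℂ) ^ j ∂μ - ∫ θ, (phaseSum a θ : ℂ) ^ j ∂ν‖ ≤
      ε * (∑ i, ‖a i‖) ^ j := by
  rw [integral_phaseSum_pow, integral_phaseSum_pow, ← Finset.sum_sub_distrib,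
    ← sum_norm_prod_phaseCoeff, Finset.mul_sum]
  refine (norm_sum_le _ _).trans (Finset.sum_le_sum fun f _ => ?_)
  rw [← mul_sub, norm_mul, mul_comm]
  exact mul_le_mul_of_nonneg_right (h _ ((sum_abs_phaseFreq_le f).trans (by exact_mod_cast hj)))
    (norm_nonneg _)

theorem sum_range_succ_pow_le {A : ℝ} (hA : 0 ≤ A) (n : ℕ) :
    ∑ j ∈ Finset.range (n + 1), A ^ j ≤ (1 + A) ^ n := by
  induction n with
  | zero => simp
  | succ n ih =>
    rw [Finset.sum_range_succ]
    have h1 : A ^ (n + 1) ≤ A * (1 + A) ^ n := by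
      rw [pow_succ']
      gcongr
      linarith
    calc _ ≤ (1 + A) ^ n + A * (1 + A) ^ n := add_le_add ih h1
      _ = _ := by ring

theorem integral_exp_phaseSum_sub_taylor_le (J : ℕ) :
    ‖∫ θ, Complex.exp (phaseSum a θ * Complex.I) ∂μ -
      ∑ j ∈ Finset.range (2 * J), (Complex.I ^ j / j.factorial) * ∫ θ, (phaseSum a θ : ℂ) ^ j ∂μ‖ ≤
      (∫ θ, phaseSum a θ ^ (2 * J) ∂μ) / (2 * J).factorial := by
  have hc : ∀ j : ℕ, Integrable (fun θ => (phaseSum a θ : ℂ) ^ j) μ := fun j => by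
    have := (integrable_phaseSum_pow a (μ := μ) j).ofReal (𝕜 := ℂ)
    simpa using this
  have he : Integrable (fun θ => Complex.exp (phaseSum a θ * Complex.I)) μ := by
    refine integrable_of_continuous_of_norm_le (B := 1) ?_ fun θ => ?_
    · have := continuous_phaseSum a
      fun_prop
    · rw [Complex.norm_exp_ofReal_mul_I]
  have h1 : ∑ j ∈ Finset.range (2 * J), (Complex.I ^ j / j.factorial) *
      ∫ θ, (phaseSum a θ : ℂ) ^ j ∂μ =
      ∫ θ, ∑ j ∈ Finset.range (2 * J), (phaseSum a θ * Complex.I) ^ j / j.factorial ∂μ := by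
    rw [integral_finsetSum]
    · refine Finset.sum_congr rfl fun j _ => ?_
      rw [← integral_const_mul]
      refine integral_congr_ae (ae_of_all _ fun θ => ?_)
      dsimp only
      rw [mul_pow]
      ring
    · intro j _
      refine ((hc j).const_mul (Complex.I ^ j / j.factorial)).congr (ae_of_all _ fun θ => ?_)
      dsimp only
      rw [mul_pow]
      ring
  have hs : Integrable (fun θ => ∑ j ∈ Finset.range (2 * J),
      (phaseSum a θ * Complex.I) ^ j / (j.factorial : ℂ)) μ := by
    refine integrable_finsetSum _ fun j _ => ?_
    refine ((hc j).const_mul (Complex.I ^ j / j.factorial)).congr (ae_of_all _ fun θ => ?_)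
    dsimp only
    rw [mul_pow]
    ring
  rw [h1, ← integral_sub he hs, ← integral_div]
  refine norm_integral_le_of_norm_le ((integrable_phaseSum_pow a _).div_const _)
    (ae_of_all _ fun θ => ?_)
  have h2 := norm_exp_mul_I_sub_sum_le (2 * J) (phaseSum a θ)
  rwa [(even_two_mul J).pow_abs] at h2

/-- Two measures on phase space with close Fourier coefficients of low degree give close
characteristic functions of a phase sum. -/
theorem norm_integral_exp_phaseSum_sub_le {ε : ℝ} (J : ℕ)
    (h : ∀ n : ι → ℤ, ∑ i, |n i| ≤ (2 * J : ℕ) → ‖phaseFourier μ n - phaseFourier ν n‖ ≤ ε) :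
    ‖∫ θ, Complex.exp (phaseSum a θ * Complex.I) ∂μ -
      ∫ θ, Complex.exp (phaseSum a θ * Complex.I) ∂ν‖ ≤
      ε * (1 + ∑ i, ‖a i‖) ^ (2 * J) +
        2 * ((∫ θ, phaseSum a θ ^ (2 * J) ∂ν) / (2 * J).factorial) := by
  set A := ∑ i, ‖a i‖
  have hA : 0 ≤ A := Finset.sum_nonneg fun i _ => norm_nonneg _
  have hε : 0 ≤ ε := (norm_nonneg _).trans (h 0 (by simp))
  have hμ := integral_exp_phaseSum_sub_taylor_le a (μ := μ) J
  have hν := integral_exp_phaseSum_sub_taylor_le a (μ := ν) J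
  set Eμ := ∫ θ, Complex.exp (phaseSum a θ * Complex.I) ∂μ
  set Eν := ∫ θ, Complex.exp (phaseSum a θ * Complex.I) ∂ν
  set Sμ := ∑ j ∈ Finset.range (2 * J), (Complex.I ^ j / j.factorial) *
    ∫ θ, (phaseSum a θ : ℂ) ^ j ∂μ with hSμ
  set Sν := ∑ j ∈ Finset.range (2 * J), (Complex.I ^ j / j.factorial) *
    ∫ θ, (phaseSum a θ : ℂ) ^ j ∂ν with hSν
  have hS : ‖Sμ - Sν‖ ≤ ∑ j ∈ Finset.range (2 * J), ε * A ^ j := by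
    rw [hSμ, hSν, ← Finset.sum_sub_distrib]
    refine (norm_sum_le _ _).trans (Finset.sum_le_sum fun j hj => ?_)
    rw [← mul_sub, norm_mul, norm_div, norm_pow, Complex.norm_I, one_pow, Complex.norm_natCast]
    have h1 := norm_integral_phaseSum_pow_sub_le a (Finset.mem_range.1 hj).le h
    have h2 : 1 / (j.factorial : ℝ) ≤ 1 := by
      rw [div_le_one (by positivity)]
      exact_mod_cast Nat.one_le_iff_ne_zero.2 (Nat.factorial_ne_zero j)
    calc _ ≤ 1 * (ε * A ^ j) := mul_le_mul h2 h1 (norm_nonneg _) zero_le_one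
      _ = _ := one_mul _
  have hQ : (∫ θ, phaseSum a θ ^ (2 * J) ∂μ) / (2 * J).factorial ≤
      (∫ θ, phaseSum a θ ^ (2 * J) ∂ν) / (2 * J).factorial + ε * A ^ (2 * J) := by
    have h1 := norm_integral_phaseSum_pow_sub_le a le_rfl h
    have h2 : ∀ κ : Measure (ι → ℝ), ∫ θ, (phaseSum a θ : ℂ) ^ (2 * J) ∂κ =
        ((∫ θ, phaseSum a θ ^ (2 * J) ∂κ : ℝ) : ℂ) := by
      intro κ
      rw [← integral_complex_ofReal]
      exact integral_congr_ae (ae_of_all _ fun θ => by push_cast; rfl)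
    rw [h2, h2, ← Complex.ofReal_sub, Complex.norm_real, Real.norm_eq_abs] at h1
    have h3 := (abs_le.1 h1).2
    have hf : (1 : ℝ) ≤ (2 * J).factorial := by
      exact_mod_cast Nat.one_le_iff_ne_zero.2 (Nat.factorial_ne_zero _)
    have h4 : ε * A ^ (2 * J) / (2 * J).factorial ≤ ε * A ^ (2 * J) :=
      div_le_self (by positivity) hf
    have h5 : (∫ θ, phaseSum a θ ^ (2 * J) ∂μ) / (2 * J).factorial ≤
        ((∫ θ, phaseSum a θ ^ (2 * J) ∂ν) + ε * A ^ (2 * J)) / (2 * J).factorial := by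
      gcongr
      linarith
    rw [add_div] at h5
    linarith
  have hsum : ∑ j ∈ Finset.range (2 * J), ε * A ^ j + ε * A ^ (2 * J) ≤
      ε * (1 + A) ^ (2 * J) := by
    rw [← Finset.sum_range_succ, ← Finset.mul_sum]
    exact mul_le_mul_of_nonneg_left (sum_range_succ_pow_le hA _) hε
  have h3 : Eμ - Eν = (Eμ - Sμ) + (Sμ - Sν) - (Eν - Sν) := by ring
  rw [h3]
  have h4 := norm_sub_le ((Eμ - Sμ) + (Sμ - Sν)) (Eν - Sν)
  have h5 := norm_add_le (Eμ - Sμ) (Sμ - Sν)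
  linarith

end

/-- The uniform law on `(0, 2π]`. -/
noncomputable def uniformPhase : Measure ℝ :=
  (volume.restrict (Set.Ioc (0:ℝ) 1)).map (fun ω => 2 * Real.pi * ω)

instance isProbabilityMeasure_uniformPhase : IsProbabilityMeasure uniformPhase := by
  have : IsProbabilityMeasure (volume.restrict (Set.Ioc (0:ℝ) 1)) := ⟨by simp⟩
  exact Measure.isProbabilityMeasure_map (by fun_prop)

theorem integral_uniformPhase {E : Type*} [NormedAddCommGroup E] [NormedSpace ℝ E] {f : ℝ → E}
    (hf : Continuous f) :
    ∫ θ, f θ ∂uniformPhase = ∫ ω in (0:ℝ)..1, f (2 * Real.pi * ω) := by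
  rw [uniformPhase, integral_map (by fun_prop) hf.aestronglyMeasurable,
    intervalIntegral.integral_of_le zero_le_one]

theorem integral_exp_uniformPhase (n : ℤ) :
    ∫ θ, Complex.exp (((n : ℝ) * θ : ℝ) * Complex.I) ∂uniformPhase = if n = 0 then 1 else 0 := by
  split_ifs with hn
  · simp [hn]
  · rw [integral_uniformPhase (by fun_prop)]
    have hc : (n : ℂ) * (2 * Real.pi * Complex.I) ≠ 0 :=
      mul_ne_zero (by exact_mod_cast hn) Complex.two_pi_I_ne_zero
    have h1 : ∀ ω : ℝ, Complex.exp (((n : ℝ) * (2 * Real.pi * ω) : ℝ) * Complex.I) =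
        Complex.exp ((n : ℂ) * (2 * Real.pi * Complex.I) * ω) := by
      intro ω
      congr 1
      push_cast
      ring
    simp_rw [h1]
    rw [integral_exp_mul_complex hc, Complex.ofReal_one, mul_one, Complex.exp_int_mul_two_pi_mul_I]
    simp

theorem abs_re_mul_exp_le (a : ℂ) (θ : ℝ) : |(a * Complex.exp (θ * Complex.I)).re| ≤ ‖a‖ := by
  refine (Complex.abs_re_le_norm _).trans ?_
  rw [norm_mul, Complex.norm_exp_ofReal_mul_I, mul_one]

theorem integral_re_uniformPhase (a : ℂ) :
    ∫ θ, (a * Complex.exp (θ * Complex.I)).re ∂uniformPhase = 0 := by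
  have hi : Integrable (fun θ : ℝ => a * Complex.exp (θ * Complex.I)) uniformPhase :=
    integrable_of_continuous_of_norm_le (B := ‖a‖) (by fun_prop) fun θ => by
      rw [norm_mul, Complex.norm_exp_ofReal_mul_I, mul_one]
  have h1 := integral_exp_uniformPhase 1
  simp only [Int.cast_one, one_mul, one_ne_zero, if_false] at h1
  have h2 := integral_re hi
  simp only [RCLike.re_eq_complex_re] at h2
  rw [h2, integral_const_mul, h1, mul_zero, Complex.zero_re]

theorem integral_re_sq_uniformPhase (a : ℂ) :
    ∫ θ, (a * Complex.exp (θ * Complex.I)).re ^ 2 ∂uniformPhase = ‖a‖ ^ 2 / 2 := by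
  have h1 : ∀ θ : ℝ, (a * Complex.exp (θ * Complex.I)).re ^ 2 =
      ‖a‖ ^ 2 / 2 + (a ^ 2 / 2 * Complex.exp ((((2 : ℤ) : ℝ) * θ : ℝ) * Complex.I)).re := by
    intro θ
    have hz : (a ^ 2 / 2 * Complex.exp ((((2 : ℤ) : ℝ) * θ : ℝ) * Complex.I)) =
        (a * Complex.exp (θ * Complex.I)) ^ 2 / 2 := by
      rw [mul_pow, ← Complex.exp_nat_mul]
      push_cast
      ring_nf
    have hn : ‖a‖ ^ 2 = ‖a * Complex.exp (θ * Complex.I)‖ ^ 2 := by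
      rw [norm_mul, Complex.norm_exp_ofReal_mul_I, mul_one]
    rw [hz, hn, ← Complex.normSq_eq_norm_sq, Complex.normSq_apply]
    simp only [Complex.div_ofNat_re, sq, Complex.mul_re]
    ring
  have hi : Integrable (fun θ : ℝ => a ^ 2 / 2 * Complex.exp ((((2 : ℤ) : ℝ) * θ : ℝ) * Complex.I))
      uniformPhase :=
    integrable_of_continuous_of_norm_le (B := ‖a ^ 2 / 2‖) (by fun_prop) fun θ => by
      rw [norm_mul, Complex.norm_exp_ofReal_mul_I, mul_one]
  have h2 := integral_re hi
  simp only [RCLike.re_eq_complex_re] at h2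
  have hir : Integrable (fun θ : ℝ =>
      (a ^ 2 / 2 * Complex.exp ((((2 : ℤ) : ℝ) * θ : ℝ) * Complex.I)).re) uniformPhase := hi.re
  simp_rw [h1]
  rw [integral_add (integrable_const _) hir, integral_const, probReal_univ, one_smul, h2,
    integral_const_mul, integral_exp_uniformPhase]
  simp

theorem norm_integral_exp_re_sub_le {a : ℂ} (ha : ‖a‖ ≤ 1) :
    ‖∫ θ, Complex.exp ((a * Complex.exp (θ * Complex.I)).re * Complex.I) ∂uniformPhase -
      (Real.exp (-(‖a‖ ^ 2 / 4)) : ℝ)‖ ≤ ‖a‖ ^ 3 := by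
  set r : ℝ → ℝ := fun θ => (a * Complex.exp (θ * Complex.I)).re with hr
  have hrc : Continuous r := by fun_prop
  have hrb : ∀ θ, |r θ| ≤ ‖a‖ := abs_re_mul_exp_le a
  have hr1 : Integrable (fun θ => ((r θ : ℝ) : ℂ)) uniformPhase :=
    integrable_of_continuous_of_norm_le (B := ‖a‖) (by fun_prop) fun θ => by
      rw [Complex.norm_real]; exact hrb θ
  have hr2 : Integrable (fun θ => ((r θ ^ 2 : ℝ) : ℂ)) uniformPhase :=
    integrable_of_continuous_of_norm_le (B := ‖a‖ ^ 2) (by fun_prop) fun θ => by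
      rw [Complex.norm_real, norm_pow]; exact pow_le_pow_left₀ (abs_nonneg _) (hrb θ) 2
  have hre : Integrable (fun θ => Complex.exp (r θ * Complex.I)) uniformPhase :=
    integrable_of_continuous_of_norm_le (B := 1) (by fun_prop) fun θ => by
      rw [Complex.norm_exp_ofReal_mul_I]
  have hT : ∫ θ, (1 + Complex.I * ((r θ : ℝ) : ℂ) - 1 / 2 * ((r θ ^ 2 : ℝ) : ℂ)) ∂uniformPhase =
      ((1 - ‖a‖ ^ 2 / 4 : ℝ) : ℂ) := by
    have h1 : Integrable (fun θ => 1 + Complex.I * ((r θ : ℝ) : ℂ)) uniformPhase :=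
      (integrable_const _).add (hr1.const_mul _)
    rw [integral_sub h1 (hr2.const_mul _), integral_add (integrable_const _) (hr1.const_mul _),
      integral_const_mul, integral_const_mul, integral_complex_ofReal, integral_complex_ofReal,
      integral_re_uniformPhase, integral_re_sq_uniformPhase]
    simp
    ring
  have h3 : ‖∫ θ, Complex.exp (r θ * Complex.I) ∂uniformPhase - ((1 - ‖a‖ ^ 2 / 4 : ℝ) : ℂ)‖ ≤
      ‖a‖ ^ 3 / 6 := by
    have h1 : Integrable (fun θ => 1 + Complex.I * ((r θ : ℝ) : ℂ)) uniformPhase :=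
      (integrable_const _).add (hr1.const_mul _)
    have h2 : Integrable (fun θ => 1 + Complex.I * ((r θ : ℝ) : ℂ) -
      1 / 2 * ((r θ ^ 2 : ℝ) : ℂ)) uniformPhase := h1.sub (hr2.const_mul _)
    rw [← hT, ← integral_sub hre h2]
    refine (norm_integral_le_of_norm_le_const (C := ‖a‖ ^ 3 / 6) (ae_of_all _ fun θ => ?_)).trans
      (by simp)
    have h4 := norm_exp_mul_I_sub_sum_le 3 (r θ)
    have h5 : ∑ j ∈ Finset.range 3, ((r θ : ℂ) * Complex.I) ^ j / j.factorial =
        1 + Complex.I * ((r θ : ℝ) : ℂ) - 1 / 2 * ((r θ ^ 2 : ℝ) : ℂ) := by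
      simp only [Finset.sum_range_succ, Finset.sum_range_zero, Nat.factorial, mul_pow,
        Complex.I_sq]
      push_cast
      ring
    rw [h5] at h4
    refine h4.trans ?_
    have h6 : ((Nat.factorial 3 : ℕ) : ℝ) = 6 := by norm_num [Nat.factorial]
    rw [h6]
    have := pow_le_pow_left₀ (abs_nonneg _) (hrb θ) 3
    linarith
  have hn := norm_nonneg a
  have h7 : |Real.exp (-(‖a‖ ^ 2 / 4)) - 1 - -(‖a‖ ^ 2 / 4)| ≤ (-(‖a‖ ^ 2 / 4)) ^ 2 := by
    refine Real.abs_exp_sub_one_sub_id_le ?_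
    rw [abs_neg, abs_of_nonneg (by positivity)]
    nlinarith
  have h8 : ‖((1 - ‖a‖ ^ 2 / 4 : ℝ) : ℂ) - (Real.exp (-(‖a‖ ^ 2 / 4)) : ℝ)‖ ≤ ‖a‖ ^ 3 / 16 := by
    rw [← Complex.ofReal_sub, Complex.norm_real, Real.norm_eq_abs, abs_sub_comm]
    have h9 : Real.exp (-(‖a‖ ^ 2 / 4)) - (1 - ‖a‖ ^ 2 / 4) =
      Real.exp (-(‖a‖ ^ 2 / 4)) - 1 - -(‖a‖ ^ 2 / 4) := by ring
    rw [h9]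
    refine h7.trans ?_
    have : ‖a‖ ^ 3 * ‖a‖ ≤ ‖a‖ ^ 3 * 1 := by gcongr
    nlinarith
  refine (norm_sub_le_norm_sub_add_norm_sub _ ((1 - ‖a‖ ^ 2 / 4 : ℝ) : ℂ) _).trans ?_
  have : 0 ≤ ‖a‖ ^ 3 := by positivity
  linarith

theorem integral_exp_two_re_le {a : ℂ} (ha : ‖a‖ ≤ 1 / 2) :
    ∫ θ, Real.exp (2 * (a * Complex.exp (θ * Complex.I)).re) ∂uniformPhase ≤
      Real.exp (2 * ‖a‖ ^ 2) := by
  set r : ℝ → ℝ := fun θ => (a * Complex.exp (θ * Complex.I)).re with hr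
  have hrc : Continuous r := by fun_prop
  have hrb : ∀ θ, |r θ| ≤ ‖a‖ := abs_re_mul_exp_le a
  have hr1 : Integrable (fun θ => r θ) uniformPhase :=
    integrable_of_continuous_of_norm_le (B := ‖a‖) (by fun_prop) hrb
  have hr2 : Integrable (fun θ => r θ ^ 2) uniformPhase :=
    integrable_of_continuous_of_norm_le (B := ‖a‖ ^ 2) (by fun_prop) fun θ => by
      rw [norm_pow]; exact pow_le_pow_left₀ (abs_nonneg _) (hrb θ) 2
  have hre : Integrable (fun θ => Real.exp (2 * r θ)) uniformPhase :=
    integrable_of_continuous_of_norm_le (B := Real.exp 1) (by fun_prop) fun θ => by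
      rw [Real.norm_eq_abs, abs_of_pos (Real.exp_pos _)]
      refine Real.exp_le_exp.2 ?_
      have := (abs_le.1 (hrb θ)).2
      linarith
  have h1 : Integrable (fun θ => 1 + 2 * r θ) uniformPhase :=
    (integrable_const _).add (hr1.const_mul _)
  have h2 : Integrable (fun θ => 1 + 2 * r θ + 4 * r θ ^ 2) uniformPhase :=
    h1.add (hr2.const_mul _)
  have h3 : ∫ θ, (1 + 2 * r θ + 4 * r θ ^ 2) ∂uniformPhase = 1 + 2 * ‖a‖ ^ 2 := by
    rw [integral_add h1 (hr2.const_mul _), integral_add (integrable_const _) (hr1.const_mul _),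
      integral_const_mul, integral_const_mul, integral_re_uniformPhase,
      integral_re_sq_uniformPhase]
    simp
    ring
  calc ∫ θ, Real.exp (2 * r θ) ∂uniformPhase ≤ ∫ θ, (1 + 2 * r θ + 4 * r θ ^ 2) ∂uniformPhase := by
        refine integral_mono hre h2 fun θ => ?_
        have h4 : |2 * r θ| ≤ 1 := by
          rw [abs_mul, abs_two]
          linarith [hrb θ]
        have h5 := (abs_le.1 (Real.abs_exp_sub_one_sub_id_le h4)).2
        show Real.exp (2 * r θ) ≤ 1 + 2 * r θ + 4 * r θ ^ 2
        linarith
    _ ≤ Real.exp (2 * ‖a‖ ^ 2) := by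
        rw [h3]
        linarith [Real.add_one_le_exp (2 * ‖a‖ ^ 2)]

theorem norm_prod_sub_prod_le {ι : Type*} (s : Finset ι) {f g : ι → ℂ}
    (hf : ∀ i ∈ s, ‖f i‖ ≤ 1) (hg : ∀ i ∈ s, ‖g i‖ ≤ 1) :
    ‖∏ i ∈ s, f i - ∏ i ∈ s, g i‖ ≤ ∑ i ∈ s, ‖f i - g i‖ := by
  induction s using Finset.induction_on with
  | empty => simp
  | insert i s hi ih =>
    rw [Finset.prod_insert hi, Finset.prod_insert hi, Finset.sum_insert hi]
    have h1 : f i * ∏ j ∈ s, f j - g i * ∏ j ∈ s, g j =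
        (f i - g i) * ∏ j ∈ s, f j + g i * (∏ j ∈ s, f j - ∏ j ∈ s, g j) := by ring
    rw [h1]
    refine (norm_add_le _ _).trans ?_
    rw [norm_mul, norm_mul]
    have h2 : ‖∏ j ∈ s, f j‖ ≤ 1 := by
      rw [norm_prod]
      exact Finset.prod_le_one (fun _ _ => norm_nonneg _)
        fun j hj => hf j (Finset.mem_insert_of_mem hj)
    have h3 := ih (fun j hj => hf j (Finset.mem_insert_of_mem hj))
      (fun j hj => hg j (Finset.mem_insert_of_mem hj))
    have h4 := hg i (Finset.mem_insert_self i s)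
    refine add_le_add (mul_le_of_le_one_right (norm_nonneg _) h2) ?_
    exact (mul_le_of_le_one_left (norm_nonneg _) h4).trans h3

section

variable {ι : Type*} [Fintype ι]

/-- The law of independent uniform phases. -/
noncomputable def uniformPhases (ι : Type*) [Fintype ι] : Measure (ι → ℝ) :=
  Measure.pi fun _ => uniformPhase

instance isProbabilityMeasure_uniformPhases : IsProbabilityMeasure (uniformPhases ι) := by
  unfold uniformPhases
  infer_instance

theorem phaseFourier_uniformPhases (n : ι → ℤ) :
    phaseFourier (uniformPhases ι) n = if n = 0 then 1 else 0 := by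
  have h1 : ∀ θ : ι → ℝ, Complex.exp ((∑ i, (n i : ℝ) * θ i : ℝ) * Complex.I) =
      ∏ i, Complex.exp (((n i : ℝ) * θ i : ℝ) * Complex.I) := by
    intro θ
    rw [← Complex.exp_sum, Complex.ofReal_sum, Finset.sum_mul]
  simp_rw [phaseFourier, h1, uniformPhases]
  rw [integral_fintype_prod_eq_prod
    (fun i (t : ℝ) => Complex.exp (((n i : ℝ) * t : ℝ) * Complex.I))]
  simp_rw [integral_exp_uniformPhase]
  rw [Finset.prod_ite_zero]
  simp [funext_iff]

theorem norm_integral_exp_phaseSum_uniformPhases_sub_le {a : ι → ℂ} (ha : ∀ i, ‖a i‖ ≤ 1) :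
    ‖∫ θ, Complex.exp (phaseSum a θ * Complex.I) ∂uniformPhases ι -
      (Real.exp (-(∑ i, ‖a i‖ ^ 2) / 4) : ℝ)‖ ≤ ∑ i, ‖a i‖ ^ 3 := by
  have h1 : ∀ θ : ι → ℝ, Complex.exp (phaseSum a θ * Complex.I) =
      ∏ i, Complex.exp ((a i * Complex.exp (θ i * Complex.I)).re * Complex.I) := by
    intro θ
    rw [← Complex.exp_sum, phaseSum, Complex.ofReal_sum, Finset.sum_mul]
  have h2 : ((Real.exp (-(∑ i, ‖a i‖ ^ 2) / 4) : ℝ) : ℂ) =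
      ∏ i, ((Real.exp (-(‖a i‖ ^ 2 / 4)) : ℝ) : ℂ) := by
    rw [← Complex.ofReal_prod, ← Real.exp_sum, Finset.sum_neg_distrib, ← Finset.sum_div, neg_div]
  simp_rw [h1, uniformPhases]
  rw [integral_fintype_prod_eq_prod
    (fun i (t : ℝ) => Complex.exp ((a i * Complex.exp (t * Complex.I)).re * Complex.I)), h2]
  refine (norm_prod_sub_prod_le _ (fun i _ => ?_) fun i _ => ?_).trans
    (Finset.sum_le_sum fun i _ => norm_integral_exp_re_sub_le (ha i))
  · refine (norm_integral_le_of_norm_le_const (C := 1) (ae_of_all _ fun θ => ?_)).trans (by simp)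
    rw [Complex.norm_exp_ofReal_mul_I]
  · rw [Complex.norm_real, Real.norm_eq_abs, abs_of_pos (Real.exp_pos _)]
    exact Real.exp_le_one_iff.2 (by have := sq_nonneg ‖a i‖; linarith)

theorem integral_exp_two_phaseSum_le {a : ι → ℂ} (ha : ∀ i, ‖a i‖ ≤ 1 / 2) :
    ∫ θ, Real.exp (2 * phaseSum a θ) ∂uniformPhases ι ≤ Real.exp (2 * ∑ i, ‖a i‖ ^ 2) := by
  have h1 : ∀ θ : ι → ℝ, Real.exp (2 * phaseSum a θ) =
      ∏ i, Real.exp (2 * (a i * Complex.exp (θ i * Complex.I)).re) := by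
    intro θ
    rw [← Real.exp_sum, phaseSum, Finset.mul_sum]
  simp_rw [h1, uniformPhases]
  rw [integral_fintype_prod_eq_prod
    (fun i (t : ℝ) => Real.exp (2 * (a i * Complex.exp (t * Complex.I)).re)), Finset.mul_sum,
    Real.exp_sum]
  exact Finset.prod_le_prod (fun i _ => integral_nonneg fun θ => (Real.exp_pos _).le)
    fun i _ => integral_exp_two_re_le (ha i)

theorem integral_phaseSum_pow_uniformPhases_le {a : ι → ℂ} (ha : ∀ i, ‖a i‖ ≤ 1 / 2) (J : ℕ) :
    (∫ θ, phaseSum a θ ^ (2 * J) ∂uniformPhases ι) / (2 * J).factorial ≤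
      (1 / 4) ^ J * Real.exp (2 * ∑ i, ‖a i‖ ^ 2) := by
  have hneg : ∀ θ, phaseSum (fun i => -a i) θ = -phaseSum a θ := by
    intro θ
    simp [phaseSum]
  have h1 := integral_exp_two_phaseSum_le ha
  have h2 := integral_exp_two_phaseSum_le (a := fun i => -a i) (by simpa using ha)
  simp_rw [hneg, norm_neg] at h2
  have hInt : ∀ c : ℝ, Integrable (fun θ => Real.exp (c * phaseSum a θ)) (uniformPhases ι) := by
    intro c
    refine integrable_of_continuous_of_norm_le (B := Real.exp (|c| * ∑ i, ‖a i‖))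
      (Real.continuous_exp.comp ((continuous_phaseSum a).const_mul c)) fun θ => ?_
    rw [Real.norm_eq_abs, abs_of_pos (Real.exp_pos _)]
    refine Real.exp_le_exp.2 ((le_abs_self _).trans ?_)
    rw [abs_mul]
    exact mul_le_mul_of_nonneg_left (abs_phaseSum_le a θ) (abs_nonneg _)
  have hi1 := hInt 2
  have hi2 : Integrable (fun θ => Real.exp (2 * -phaseSum a θ)) (uniformPhases ι) := by
    refine (hInt (-2)).congr (ae_of_all _ fun θ => ?_)
    show Real.exp (-2 * phaseSum a θ) = Real.exp (2 * -phaseSum a θ)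
    congr 1
    ring
  have hpt : ∀ θ, phaseSum a θ ^ (2 * J) / (2 * J).factorial ≤
      (1 / 4) ^ J * ((Real.exp (2 * phaseSum a θ) + Real.exp (2 * -phaseSum a θ)) / 2) := by
    intro θ
    have h3 := Real.hasSum_cosh (2 * phaseSum a θ)
    have h4 := le_hasSum h3 J fun j _ => by
      rw [pow_mul]; positivity
    rw [Real.cosh_eq, mul_pow, pow_mul 2 2 J] at h4
    norm_num at h4
    have h5 : (1 / 4 : ℝ) ^ J * 4 ^ J = 1 := by rw [← mul_pow]; norm_num
    calc phaseSum a θ ^ (2 * J) / (2 * J).factorial =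
        (1 / 4) ^ J * (4 ^ J * phaseSum a θ ^ (2 * J) / (2 * J).factorial) := by
          rw [mul_div_assoc, ← mul_assoc, h5, one_mul]
      _ ≤ _ := by
          rw [mul_neg]
          exact mul_le_mul_of_nonneg_left h4 (by positivity)
  rw [← integral_div]
  refine (integral_mono ((integrable_phaseSum_pow a _).div_const _)
    (((hi1.add hi2).div_const 2).const_mul _) hpt).trans ?_
  rw [integral_const_mul]
  refine mul_le_mul_of_nonneg_left ?_ (by positivity)
  rw [integral_div, integral_add' hi1 hi2]
  linarith

end

theorem norm_integral_exp_mul_I_le {c : ℝ} (hc : c ≠ 0) :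
    ‖∫ ω in Set.Ioo (0:ℝ) 1, Complex.exp ((c * ω : ℝ) * Complex.I)‖ ≤ 2 / |c| := by
  have hc' : (c : ℂ) * Complex.I ≠ 0 := mul_ne_zero (by exact_mod_cast hc) Complex.I_ne_zero
  have h1 : ∀ ω : ℝ, Complex.exp ((c * ω : ℝ) * Complex.I) =
      Complex.exp ((c : ℂ) * Complex.I * ω) := by
    intro ω
    congr 1
    push_cast
    ring
  simp_rw [h1]
  rw [← integral_Ioc_eq_integral_Ioo, ← intervalIntegral.integral_of_le zero_le_one,
    integral_exp_mul_complex hc', norm_div, norm_mul, Complex.norm_I, mul_one, Complex.norm_real,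
    Real.norm_eq_abs]
  refine div_le_div_of_nonneg_right ((norm_sub_le _ _).trans ?_) (abs_nonneg _)
  rw [← h1, ← h1, Complex.norm_exp_ofReal_mul_I, Complex.norm_exp_ofReal_mul_I]
  norm_num

theorem one_div_le_abs_log_sub_log {A B : ℕ} (hA : 0 < A) (hB : 0 < B) (hAB : A ≠ B) {R : ℝ}
    (hAR : (A : ℝ) ≤ R) (hBR : (B : ℝ) ≤ R) : 1 / R ≤ |Real.log A - Real.log B| := by
  wlog h : B < A generalizing A B
  · rw [abs_sub_comm]
    exact this hB hA hAB.symm hBR hAR (lt_of_le_of_ne (not_lt.1 h) hAB)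
  have hA' : (0:ℝ) < A := by exact_mod_cast hA
  have hB' : (0:ℝ) < B := by exact_mod_cast hB
  have h1 : (B:ℝ) + 1 ≤ A := by exact_mod_cast h
  have h2 := Real.one_sub_inv_le_log_of_pos (div_pos hA' hB')
  rw [Real.log_div hA'.ne' hB'.ne', inv_div] at h2
  refine le_trans ?_ (le_abs_self _)
  refine le_trans ?_ h2
  calc 1 / R ≤ 1 / A := one_div_le_one_div_of_le hA' hAR
    _ ≤ 1 - B / A := by
        rw [le_sub_iff_add_le, ← add_div, div_le_one hA']
        linarith

section

variable {ι : Type*} [Fintype ι]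

theorem pow_card_inv_le_abs_sum_mul_log {p : ι → ℕ} (hp : ∀ i, (p i).Prime)
    (hinj : Function.Injective p) {X : ℕ} (hX : ∀ i, p i ≤ X) (hX1 : 1 ≤ X) {n : ι → ℤ} (hn : n ≠ 0)
    {N : ℕ} (hN : ∑ i, |n i| ≤ N) : 1 / (X : ℝ) ^ N ≤ |∑ i, (n i : ℝ) * Real.log (p i)| := by
  have hfac : ∀ (e : ι → ℕ) (j : ι), (∏ i, p i ^ e i).factorization (p j) = e j := by
    intro e j
    rw [Nat.factorization_prod fun i _ => pow_ne_zero _ (hp i).ne_zero, Finsupp.finsetSum_apply,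
      Finset.sum_eq_single j]
    · simp [(hp j).factorization_self]
    · intro i _ hij
      rw [Nat.factorization_pow, (hp i).factorization]
      simp [hinj.ne hij]
    · simp
  have hlog : ∀ e : ι → ℕ, Real.log ((∏ i, p i ^ e i : ℕ) : ℝ) = ∑ i, (e i : ℝ) * Real.log (p i) := by
    intro e
    rw [Nat.cast_prod, Real.log_prod fun i _ => by
      exact_mod_cast pow_ne_zero _ (hp i).ne_zero]
    simp
  have hle : ∀ e : ι → ℕ, (∑ i, e i) ≤ N → ((∏ i, p i ^ e i : ℕ) : ℝ) ≤ (X : ℝ) ^ N := by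
    intro e he
    have h1 : ∏ i, p i ^ e i ≤ X ^ N := by
      calc ∏ i, p i ^ e i ≤ ∏ i, X ^ e i := Finset.prod_le_prod' fun i _ =>
            Nat.pow_le_pow_left (hX i) _
        _ = X ^ (∑ i, e i) := Finset.prod_pow_eq_pow_sum _ _ _
        _ ≤ X ^ N := Nat.pow_le_pow_right hX1 he
    exact_mod_cast h1
  have hpos : ∀ e : ι → ℕ, 0 < ∏ i, p i ^ e i := fun e =>
    Finset.prod_pos fun i _ => pow_pos (hp i).pos _
  have hsum : ∑ i, (n i : ℝ) * Real.log (p i) =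
      Real.log ((∏ i, p i ^ (n i).toNat : ℕ) : ℝ) - Real.log ((∏ i, p i ^ (-n i).toNat : ℕ) : ℝ) := by
    rw [hlog, hlog, ← Finset.sum_sub_distrib]
    refine Finset.sum_congr rfl fun i _ => ?_
    rw [← sub_mul]
    congr 1
    have : n i = ((n i).toNat : ℤ) - ((-n i).toNat : ℤ) := by omega
    exact_mod_cast congrArg (Int.cast (R := ℝ)) this
  rw [hsum]
  have hb : ∀ (e : ι → ℕ), (∀ i, (e i : ℤ) ≤ |n i|) → ∑ i, e i ≤ N := by
    intro e he
    have : ((∑ i, e i : ℕ) : ℤ) ≤ N := by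
      push_cast
      exact (Finset.sum_le_sum fun i _ => he i).trans hN
    exact_mod_cast this
  refine one_div_le_abs_log_sub_log (hpos _) (hpos _) (fun h => hn ?_) (hle _ (hb _ fun i => ?_))
    (hle _ (hb _ fun i => ?_))
  · funext j
    have h1 := hfac (fun i => (n i).toNat) j
    rw [h, hfac] at h1
    simp only [Pi.zero_apply]
    omega
  · have := le_abs_self (n i)
    have := abs_nonneg (n i)
    omega
  · have := neg_le_abs (n i)
    have := abs_nonneg (n i)
    omega

/-- The law of the phases `-ω T λᵢ` for `ω` uniform on `(0, 1)`. -/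
noncomputable def flowPhases (T : ℝ) (lam : ι → ℝ) : Measure (ι → ℝ) :=
  (volume.restrict (Set.Ioo (0:ℝ) 1)).map (fun ω i => -(ω * T) * lam i)

instance isProbabilityMeasure_flowPhases (T : ℝ) (lam : ι → ℝ) :
    IsProbabilityMeasure (flowPhases T lam) := by
  have : IsProbabilityMeasure (volume.restrict (Set.Ioo (0:ℝ) 1)) := ⟨by simp⟩
  exact Measure.isProbabilityMeasure_map (by fun_prop)

theorem integral_flowPhases (T : ℝ) (lam : ι → ℝ) {f : (ι → ℝ) → ℂ} (hf : Continuous f) :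
    ∫ θ, f θ ∂flowPhases T lam = ∫ ω in Set.Ioo (0:ℝ) 1, f (fun i => -(ω * T) * lam i) := by
  rw [flowPhases, integral_map (by fun_prop) hf.aestronglyMeasurable]

theorem norm_phaseFourier_flowPhases_le {T : ℝ} (hT : 0 < T) (lam : ι → ℝ) {n : ι → ℤ} {η : ℝ}
    (hη : 0 < η) (h : η ≤ |∑ i, (n i : ℝ) * lam i|) :
    ‖phaseFourier (flowPhases T lam) n‖ ≤ 2 / (T * η) := by
  set S := ∑ i, (n i : ℝ) * lam i
  have hS : 0 < |S| := hη.trans_le h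
  have h1 : ∀ ω : ℝ, ∑ i, (n i : ℝ) * (-(ω * T) * lam i) = -(T * S) * ω := by
    intro ω
    simp only [S, Finset.mul_sum, Finset.sum_mul, ← Finset.sum_neg_distrib]
    exact Finset.sum_congr rfl fun i _ => by ring
  rw [phaseFourier, integral_flowPhases T lam (by fun_prop)]
  simp_rw [h1]
  refine (norm_integral_exp_mul_I_le (neg_ne_zero.2 (mul_ne_zero hT.ne' (abs_pos.1 hS)))).trans ?_
  rw [abs_neg, abs_mul, abs_of_pos hT]
  gcongr

end

theorem norm_integral_exp_re_sum_primesLE_sub_le {T : ℝ} (hT : 0 < T) {X : ℕ} (hX : 1 ≤ X)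
    (J : ℕ) {a : ℕ → ℂ} (ha : ∀ p ∈ Nat.primesLE X, ‖a p‖ ≤ 1 / 2) :
    ‖(∫ ω in Set.Ioo (0:ℝ) 1, Complex.exp (((∑ p ∈ Nat.primesLE X,
        a p * Complex.exp ((-(ω * T) * Real.log p : ℝ) * Complex.I)).re : ℝ) * Complex.I)) -
      (Real.exp (-(∑ p ∈ Nat.primesLE X, ‖a p‖ ^ 2) / 4) : ℝ)‖ ≤
      2 * (X : ℝ) ^ (2 * J) / T * (1 + ∑ p ∈ Nat.primesLE X, ‖a p‖) ^ (2 * J) +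
        2 * ((1 / 4) ^ J * Real.exp (2 * ∑ p ∈ Nat.primesLE X, ‖a p‖ ^ 2)) +
        ∑ p ∈ Nat.primesLE X, ‖a p‖ ^ 3 := by
  set b : {p // p ∈ Nat.primesLE X} → ℂ := fun p => a p with hb
  set lam : {p // p ∈ Nat.primesLE X} → ℝ := fun p => Real.log (p : ℕ) with hlam
  have hs : ∀ f : ℕ → ℝ, ∑ p ∈ Nat.primesLE X, f p = ∑ p : {p // p ∈ Nat.primesLE X}, f p :=
    fun f => (Finset.sum_coe_sort _ _).symm
  have hb2 : ∀ i, ‖b i‖ ≤ 1 / 2 := fun i => ha i i.2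
  have h0 : ∫ ω in Set.Ioo (0:ℝ) 1, Complex.exp (((∑ p ∈ Nat.primesLE X,
        a p * Complex.exp ((-(ω * T) * Real.log p : ℝ) * Complex.I)).re : ℝ) * Complex.I) =
      ∫ θ, Complex.exp (phaseSum b θ * Complex.I) ∂flowPhases T lam := by
    have := continuous_phaseSum b
    rw [integral_flowPhases T lam (by fun_prop)]
    congr 1
    funext ω
    rw [phaseSum, ← Finset.sum_coe_sort, Complex.re_sum]
  have hpw : (0:ℝ) < (X : ℝ) ^ (2 * J) := by
    have : (0:ℝ) < X := by exact_mod_cast hX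
    positivity
  have h1 := norm_integral_exp_phaseSum_sub_le b (μ := flowPhases T lam)
    (ν := uniformPhases {p // p ∈ Nat.primesLE X}) (ε := 2 * (X : ℝ) ^ (2 * J) / T) J
    (fun n hn => by
      rw [phaseFourier_uniformPhases]
      split_ifs with hn0
      · subst hn0
        have : phaseFourier (flowPhases T lam) 0 = 1 := by simp [phaseFourier]
        rw [this, sub_self, norm_zero]
        positivity
      · rw [sub_zero]
        refine (norm_phaseFourier_flowPhases_le hT lam (η := 1 / (X : ℝ) ^ (2 * J)) (by positivity)
          (pow_card_inv_le_abs_sum_mul_log (fun i => (Nat.mem_primesLE.1 i.2).2)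
            Subtype.val_injective (fun i => (Nat.mem_primesLE.1 i.2).1) hX hn0 hn)).trans
          (le_of_eq ?_)
        field_simp)
  have h2 := norm_integral_exp_phaseSum_uniformPhases_sub_le (a := b)
    fun i => (hb2 i).trans (by norm_num)
  have h3 := integral_phaseSum_pow_uniformPhases_le hb2 J
  rw [h0, hs, hs, hs]
  refine (norm_sub_le_norm_sub_add_norm_sub _ _ _).trans (add_le_add (h1.trans ?_) h2)
  refine add_le_add le_rfl ?_
  exact mul_le_mul_of_nonneg_left h3 zero_le_two

theorem integral_norm_sum_exp_sq_le {ι : Type*} (s : Finset ι) {T : ℝ} (hT : 0 < T) (c : ι → ℂ)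
    {lam : ι → ℝ} {η : ℝ} (hη : 0 < η) (h : ∀ i ∈ s, ∀ j ∈ s, i ≠ j → η ≤ |lam i - lam j|) :
    ∫ ω in Set.Ioo (0:ℝ) 1,
      ‖∑ i ∈ s, c i * Complex.exp ((-(ω * T) * lam i : ℝ) * Complex.I)‖ ^ 2 ≤
      ∑ i ∈ s, ‖c i‖ ^ 2 + 2 / (T * η) * (∑ i ∈ s, ‖c i‖) ^ 2 := by
  have : IsProbabilityMeasure (volume.restrict (Set.Ioo (0:ℝ) 1)) := ⟨by simp⟩
  have h1 : ∀ ω : ℝ, ((‖∑ i ∈ s, c i * Complex.exp ((-(ω * T) * lam i : ℝ) * Complex.I)‖ ^ 2 : ℝ) : ℂ)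
      = ∑ i ∈ s, ∑ j ∈ s, c i * (starRingEnd ℂ) (c j) *
        Complex.exp ((-(T * (lam i - lam j)) * ω : ℝ) * Complex.I) := by
    intro ω
    rw [Complex.ofReal_pow, ← Complex.mul_conj', map_sum, Finset.sum_mul_sum]
    refine Finset.sum_congr rfl fun i _ => Finset.sum_congr rfl fun j _ => ?_
    rw [map_mul, ← Complex.exp_conj, mul_mul_mul_comm, ← Complex.exp_add, map_mul,
      Complex.conj_ofReal, Complex.conj_I]
    congr 2
    push_cast
    ring
  have h2 : ((∫ ω in Set.Ioo (0:ℝ) 1,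
      ‖∑ i ∈ s, c i * Complex.exp ((-(ω * T) * lam i : ℝ) * Complex.I)‖ ^ 2 : ℝ) : ℂ) =
      ∑ i ∈ s, ∑ j ∈ s, c i * (starRingEnd ℂ) (c j) * ∫ ω in Set.Ioo (0:ℝ) 1,
        Complex.exp ((-(T * (lam i - lam j)) * ω : ℝ) * Complex.I) := by
    have hi : ∀ i j, Integrable (fun ω : ℝ => c i * (starRingEnd ℂ) (c j) *
        Complex.exp ((-(T * (lam i - lam j)) * ω : ℝ) * Complex.I))
        (volume.restrict (Set.Ioo (0:ℝ) 1)) := fun i j =>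
      (integrable_of_continuous_of_norm_le (B := 1) (by fun_prop) fun θ => by
        rw [Complex.norm_exp_ofReal_mul_I]).const_mul _
    rw [← integral_complex_ofReal]
    simp_rw [h1]
    rw [integral_finsetSum _ fun i _ => integrable_finsetSum _ fun j _ => hi i j]
    refine Finset.sum_congr rfl fun i _ => ?_
    rw [integral_finsetSum _ fun j _ => hi i j]
    exact Finset.sum_congr rfl fun j _ => integral_const_mul _ _
  have h3 : ∀ i ∈ s, ∀ j ∈ s, ‖c i * (starRingEnd ℂ) (c j) * ∫ ω in Set.Ioo (0:ℝ) 1,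
        Complex.exp ((-(T * (lam i - lam j)) * ω : ℝ) * Complex.I)‖ ≤
      (if i = j then ‖c i‖ ^ 2 else 0) + 2 / (T * η) * (‖c i‖ * ‖c j‖) := by
    intro i hi j hj
    rw [norm_mul, norm_mul, RCLike.norm_conj]
    split_ifs with hij
    · subst hij
      have : 0 ≤ 2 / (T * η) * (‖c i‖ * ‖c i‖) := by positivity
      simp
      nlinarith
    · rw [zero_add, mul_comm (2 / (T * η))]
      have hd := h i hi j hj hij
      have hd0 : 0 < |lam i - lam j| := hη.trans_le hd
      refine mul_le_mul_of_nonneg_left ((norm_integral_exp_mul_I_le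
        (neg_ne_zero.2 (mul_ne_zero hT.ne' (abs_pos.1 hd0)))).trans ?_) (by positivity)
      rw [abs_neg, abs_mul, abs_of_pos hT]
      gcongr
  refine (le_abs_self _).trans ?_
  rw [← Real.norm_eq_abs, ← Complex.norm_real, h2]
  refine (norm_sum_le_of_le _ fun i hi => norm_sum_le_of_le _ fun j hj => h3 i hi j hj).trans
    (le_of_eq ?_)
  simp_rw [Finset.sum_add_distrib, ← Finset.mul_sum, ← Finset.sum_mul]
  rw [← sq]
  congr 1
  exact Finset.sum_congr rfl fun i hi => by simp [hi]

theorem tendsto_mollX_pow_div (n : ℕ) :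
    Tendsto (fun T : ℝ => (mollX T : ℝ) ^ n / T) atTop (𝓝 0) := by
  have h0 : Tendsto (fun T : ℝ => Real.exp (-(Real.log T / 2))) atTop (𝓝 0) :=
    Real.tendsto_exp_neg_atTop_nhds_zero.comp (Real.tendsto_log_atTop.atTop_div_const two_pos)
  refine squeeze_zero' (eventually_atTop.2 ⟨0, fun T hT => by positivity⟩) ?_ h0
  filter_upwards [eventually_paramBounds (2 * n)] with T hp
  have hT : 0 < T := by linarith [hp.three_le]
  have hX : (0:ℝ) < mollX T := by
    have := hp.three_le_X
    exact_mod_cast (by omega : 0 < mollX T)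
  set l := Real.log (Real.log T)
  have hl : 1 ≤ l := hp.one_le_loglog
  have hL : 1 ≤ Real.log T := hp.log_pos
  rw [div_le_iff₀ hT]
  nth_rewrite 3 [← Real.exp_log hT]
  rw [← Real.exp_add, ← Real.exp_log hX, ← Real.exp_nat_mul]
  refine Real.exp_le_exp.2 ?_
  have h1 : (n : ℝ) * Real.log (mollX T) ≤ n * (Real.log T / l ^ 3) :=
    mul_le_mul_of_nonneg_left hp.logX_le (Nat.cast_nonneg _)
  have h2 : (n : ℝ) * (Real.log T / l ^ 3) ≤ Real.log T / 2 := by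
    rw [← mul_div_assoc, div_le_div_iff₀ (by positivity) two_pos]
    have h3 : l ≤ l ^ 3 := le_self_pow₀ hl (by norm_num)
    have h4 := hp.le_loglog
    nlinarith
  linarith

theorem natCast_cpow_neg_add_mul_I {p : ℕ} (hp : 0 < p) (s : ℂ) (κ t : ℝ) :
    (p : ℂ) ^ (-(s + (κ * t : ℝ) * Complex.I)) =
      (p : ℂ) ^ (-s) * Complex.exp ((-t * (κ * Real.log p) : ℝ) * Complex.I) := by
  have h0 : (p : ℂ) ≠ 0 := by exact_mod_cast hp.ne'
  rw [neg_add, Complex.cpow_add _ _ h0]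
  congr 1
  rw [Complex.cpow_def_of_ne_zero h0, Complex.natCast_log.symm]
  congr 1
  push_cast
  ring

theorem card_primesLE_le (X : ℕ) : (Nat.primesLE X).card ≤ X := by
  have h : Nat.primesLE X ⊆ Finset.Icc 1 X := fun p hp => by
    have := Nat.mem_primesLE.1 hp
    exact Finset.mem_Icc.2 ⟨this.2.pos, this.1⟩
  simpa using Finset.card_le_card h

theorem integral_norm_primeSum_sq_le {T : ℝ} (hT : 0 < T) {X : ℕ} (hX : 1 ≤ X) {κ r : ℝ}
    (hκ : 1 ≤ κ) (hr : 0 ≤ r) (h : ℝ) :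
    ∫ ω in Set.Ioo (0:ℝ) 1, ‖primeSum X (r + (κ * (ω * T + h) : ℝ) * Complex.I)‖ ^ 2 ≤
      ∑ p ∈ Nat.primesLE X, (p : ℝ) ^ (-(2 * r)) + 2 * ((X : ℝ) ^ 3 / T) := by
  set c : ℕ → ℂ := fun p => (p : ℂ) ^ (-((r : ℂ) + (κ * h : ℝ) * Complex.I)) with hc
  have hX0 : (0:ℝ) < X := by exact_mod_cast hX
  have hpos : ∀ p ∈ Nat.primesLE X, 0 < p := fun p hp => (Nat.mem_primesLE.1 hp).2.pos
  have hcn : ∀ p ∈ Nat.primesLE X, ‖c p‖ = (p : ℝ) ^ (-r) := by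
    intro p hp
    rw [hc]
    rw [norm_prime_cpow_neg_of_re (hpos p hp)]
    simp
  have h1 : ∀ ω : ℝ, primeSum X (r + (κ * (ω * T + h) : ℝ) * Complex.I) =
      ∑ p ∈ Nat.primesLE X, c p * Complex.exp ((-(ω * T) * (κ * Real.log p) : ℝ) * Complex.I) := by
    intro ω
    refine Finset.sum_congr rfl fun p hp => ?_
    rw [← natCast_cpow_neg_add_mul_I (hpos p hp)]
    congr 2
    push_cast
    ring
  simp_rw [h1]
  have h2 := integral_norm_sum_exp_sq_le (Nat.primesLE X) hT c (lam := fun p => κ * Real.log p)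
    (η := 1 / X) (by positivity) (fun i hi j hj hij => by
      rw [← mul_sub, abs_mul, abs_of_nonneg (by linarith)]
      have hi' := Nat.mem_primesLE.1 hi
      have hj' := Nat.mem_primesLE.1 hj
      have h3 := one_div_le_abs_log_sub_log hi'.2.pos hj'.2.pos hij (R := X)
        (by exact_mod_cast hi'.1) (by exact_mod_cast hj'.1)
      have h4 := abs_nonneg (Real.log i - Real.log j)
      nlinarith)
  refine h2.trans ?_
  have h3 : ∑ p ∈ Nat.primesLE X, ‖c p‖ ^ 2 = ∑ p ∈ Nat.primesLE X, (p : ℝ) ^ (-(2 * r)) := by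
    refine Finset.sum_congr rfl fun p hp => ?_
    rw [hcn p hp, ← Real.rpow_natCast, ← Real.rpow_mul (Nat.cast_nonneg _)]
    congr 1
    push_cast
    ring
  have h4 : ∑ p ∈ Nat.primesLE X, ‖c p‖ ≤ X := by
    calc ∑ p ∈ Nat.primesLE X, ‖c p‖ ≤ ∑ p ∈ Nat.primesLE X, (1:ℝ) := by
          refine Finset.sum_le_sum fun p hp => ?_
          rw [hcn p hp]
          exact Real.rpow_le_one_of_one_le_of_nonpos (by exact_mod_cast hpos p hp) (by linarith)
      _ ≤ X := by
          rw [Finset.sum_const, nsmul_eq_mul, mul_one]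
          exact_mod_cast card_primesLE_le X
  rw [h3]
  refine add_le_add le_rfl ?_
  have h5 : (∑ p ∈ Nat.primesLE X, ‖c p‖) ^ 2 ≤ (X:ℝ) ^ 2 :=
    pow_le_pow_left₀ (Finset.sum_nonneg fun _ _ => norm_nonneg _) h4 2
  calc 2 / (T * (1 / X)) * (∑ p ∈ Nat.primesLE X, ‖c p‖) ^ 2 ≤ 2 / (T * (1 / X)) * (X:ℝ) ^ 2 := by
        gcongr
    _ = 2 * ((X : ℝ) ^ 3 / T) := by
        field_simp

/-- The value of the Cauchy density dominates the uniform density on `[0, 2T]`. -/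
theorem integral_comp_mul_add_le {T h : ℝ} (hT : 1 ≤ T) (hh : h ∈ Set.Icc (0:ℝ) 1) {f : ℝ → ℝ}
    (hf0 : ∀ y, 0 ≤ f y) (hf : Integrable fun y => cauchyDensity T y * f y) :
    Integrable (fun ω : ℝ => f (ω * T + h)) (volume.restrict (Set.Ioo (0:ℝ) 1)) ∧
    ∫ ω in Set.Ioo (0:ℝ) 1, f (ω * T + h) ≤ 5 * Real.pi * ∫ y, cauchyDensity T y * f y := by
  have hT0 : 0 < T := by linarith
  have hw : ∀ y, 0 < cauchyDensity T y := fun y => by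
    unfold cauchyDensity; have := Real.pi_pos; positivity
  have h1 : Integrable (fun ω : ℝ => cauchyDensity T (ω * T + h) * f (ω * T + h)) := by
    have := (hf.comp_add_right h).comp_mul_right' hT0.ne'
    exact this
  have h2 : ∫ ω, cauchyDensity T (ω * T + h) * f (ω * T + h) =
      T⁻¹ * ∫ y, cauchyDensity T y * f y := by
    rw [Measure.integral_comp_mul_right (fun y => cauchyDensity T (y + h) * f (y + h)) T,
      integral_add_right_eq_self (fun y => cauchyDensity T y * f y) h, abs_of_pos (inv_pos.2 hT0),
      smul_eq_mul]
  have h3 : ∀ ω ∈ Set.Ioo (0:ℝ) 1, f (ω * T + h) ≤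
      5 * Real.pi * T * (cauchyDensity T (ω * T + h) * f (ω * T + h)) := by
    intro ω hω
    have h4 : 1 ≤ 5 * Real.pi * T * cauchyDensity T (ω * T + h) := by
      have hy0 : 0 ≤ ω * T + h := by have := hω.1; have := hh.1; positivity
      have hy : ω * T + h ≤ 2 * T := by nlinarith [hω.2, hh.2]
      have hpi := Real.pi_pos
      rw [cauchyDensity, ← mul_div_assoc, le_div_iff₀ (by positivity)]
      have : (ω * T + h) ^ 2 ≤ (2 * T) ^ 2 := pow_le_pow_left₀ hy0 hy 2
      nlinarith
    have := mul_le_mul_of_nonneg_right h4 (hf0 (ω * T + h))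
    linarith
  have hmeas : AEStronglyMeasurable (fun ω : ℝ => f (ω * T + h)) := by
    have hwm : Continuous fun ω : ℝ => (cauchyDensity T (ω * T + h))⁻¹ := by
      refine Continuous.inv₀ ?_ fun ω => (hw _).ne'
      unfold cauchyDensity
      refine Continuous.div (by fun_prop) (by fun_prop) fun ω => ?_
      have := Real.pi_pos
      positivity
    refine (hwm.aestronglyMeasurable.mul h1.aestronglyMeasurable).congr (ae_of_all _ fun ω => ?_)
    simp only [Pi.mul_apply]
    rw [inv_mul_cancel_left₀ (hw _).ne']
  have hI : Integrable (fun ω : ℝ => 5 * Real.pi * T *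
      (cauchyDensity T (ω * T + h) * f (ω * T + h))) := h1.const_mul _
  have hInt : Integrable (fun ω : ℝ => f (ω * T + h)) (volume.restrict (Set.Ioo (0:ℝ) 1)) := by
    refine Integrable.mono' hI.integrableOn hmeas.restrict ?_
    filter_upwards [ae_restrict_mem measurableSet_Ioo] with ω hω
    rw [Real.norm_eq_abs, abs_of_nonneg (hf0 _)]
    exact h3 ω hω
  refine ⟨hInt, (setIntegral_mono_on hInt hI.integrableOn measurableSet_Ioo h3).trans ?_⟩
  have hpi := Real.pi_pos
  refine (setIntegral_le_integral hI (ae_of_all _ fun ω =>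
    mul_nonneg (by positivity) (mul_nonneg (hw _).le (hf0 _)))).trans (le_of_eq ?_)
  rw [integral_const_mul, h2]
  field_simp

theorem tendsto_approximation_bound (a b c d : ℝ) :
    Tendsto (fun x : ℝ => (a * Real.log x + b) / Real.sqrt x + (c * x + d) / x ^ 2) atTop (𝓝 0) := by
  have hs : Tendsto (fun x : ℝ => (Real.sqrt x)⁻¹) atTop (𝓝 0) :=
    tendsto_inv_atTop_zero.comp Real.tendsto_sqrt_atTop
  have hl : Tendsto (fun x : ℝ => Real.log x / Real.sqrt x) atTop (𝓝 0) := by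
    have := (isLittleO_log_rpow_atTop (r := 1 / 2) (by norm_num)).tendsto_div_nhds_zero
    simpa [Real.sqrt_eq_rpow] using this
  have hi : Tendsto (fun x : ℝ => x⁻¹) atTop (𝓝 0) := tendsto_inv_atTop_zero
  have h := ((hl.const_mul a).add (hs.const_mul b)).add
    ((hi.const_mul c).add ((hi.mul hi).const_mul d))
  simp only [mul_zero, add_zero] at h
  refine h.congr' ?_
  filter_upwards [eventually_gt_atTop 0] with x hx
  have := Real.sqrt_pos.2 hx
  field_simp

theorem countable_setOf_riemannZeta_eq_zero : {s : ℂ | riemannZeta s = 0}.Countable := by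
  have h : {s : ℂ | riemannZeta s = 0} ⊆ {s | riemannZeta₁ s = 0} ∪ {1} := by
    intro s hs
    by_cases h1 : s = 1
    · exact Or.inr h1
    · left
      have h2 := riemannZeta_eq_inv_sub_mul h1
      rw [Set.mem_ofPred_eq] at hs
      rw [hs, eq_comm, mul_eq_zero] at h2
      exact h2.resolve_left (inv_ne_zero (sub_ne_zero.2 h1))
  refine ((countable_zeros_of_differentiable differentiable_riemannZeta₁ (z₀ := 1) ?_).union
    (Set.countable_singleton 1)).mono h
  rw [riemannZeta₁_one]
  exact one_ne_zero

theorem ae_affine_notMem {S : Set ℂ} (hS : S.Countable) {T : ℝ} (hT : T ≠ 0) (h : ℝ) :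
    ∀ᵐ ω : ℝ, (1 / 2 + ((ω * T + h : ℝ) : ℂ) * Complex.I) ∉ S := by
  have hinj : Function.Injective fun ω : ℝ => (1 / 2 + ((ω * T + h : ℝ) : ℂ) * Complex.I) := by
    intro x y hxy
    have := congrArg Complex.im hxy
    simp at this
    exact this.resolve_right hT
  have := (hS.preimage_of_injOn hinj.injOn).ae_notMem volume
  exact this

theorem exists_tendsto_integral_min_le : ∃ β : ℝ → ℝ, Tendsto β atTop (𝓝 0) ∧
    ∀ᶠ T : ℝ in atTop, ∀ h ∈ Set.Icc (0:ℝ) 1, ∫ ω in Set.Ioo (0:ℝ) 1,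
      min 1 (|Real.log ‖riemannZeta (1 / 2 + ((ω * T + h : ℝ) : ℂ) * Complex.I)‖ -
        (primeSum (mollX T) (1 / 2 + ((ω * T + h : ℝ) : ℂ) * Complex.I)).re| /
        Real.sqrt (Real.log (Real.log T))) ≤ β T := by
  obtain ⟨C, hC⟩ := exists_eventually_abs_log_norm_moll_add_le
  obtain ⟨C0, hC0, hC1⟩ := exists_sum_primesLE_one_div_le
  refine ⟨fun T => (fun x : ℝ => (20 * Real.pi * Real.log x + (20 * Real.pi + 5 + |C|)) /
    Real.sqrt x + (3 * x + (3 * C0 + 2 + 4)) / x ^ 2) (Real.log (Real.log T)),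
    (tendsto_approximation_bound _ _ _ _).comp tendsto_log_log, ?_⟩
  filter_upwards [hC, eventually_integral_abs_log_zeta_moll_le, eventually_log_norm_zeta_moll_ge,
    eventually_paramBounds 1, (tendsto_mollX_pow_div 3).eventually_le_const one_pos]
    with T hM hF hm hp hX3 h hh
  have : IsProbabilityMeasure (volume.restrict (Set.Ioo (0:ℝ) 1)) := ⟨by simp⟩
  have hT : 0 < T := by linarith [hp.three_le]
  have hX : 1 ≤ mollX T := by have := hp.three_le_X; omega
  set X := mollX T
  set l := Real.log (Real.log T)
  have hl : 1 ≤ l := hp.one_le_loglog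
  have hsl : 0 < Real.sqrt l := Real.sqrt_pos.2 (by linarith)
  set s : ℝ → ℂ := fun ω => 1 / 2 + ((ω * T + h : ℝ) : ℂ) * Complex.I with hs
  set F : ℝ → ℝ := fun y => |Real.log ‖riemannZeta (1 / 2 + y * Complex.I) *
    moll T (1 / 2 + y * Complex.I)‖| with hFdef
  obtain ⟨hFi, hFb⟩ := integral_comp_mul_add_le (by linarith [hp.three_le]) hh
    (f := F) (fun y => abs_nonneg _) hF.1
  have hFb2 : ∫ ω in Set.Ioo (0:ℝ) 1, F (ω * T + h) ≤ 5 * Real.pi * (4 * Real.log l + 4) :=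
    hFb.trans (mul_le_mul_of_nonneg_left hF.2 (by have := Real.pi_pos; positivity))
  have hp1 : ∫ ω in Set.Ioo (0:ℝ) 1, ‖primeSum X (s ω)‖ ^ 2 ≤ 3 * (l + C0) + 2 := by
    have h1 := integral_norm_primeSum_sq_le hT hX (κ := 1) (r := 1 / 2) le_rfl (by norm_num) h
    have h2 : ∀ ω : ℝ, (((1 / 2 : ℝ) : ℂ) + (1 * (ω * T + h) : ℝ) * Complex.I) = s ω := by
      intro ω
      rw [one_mul, hs]
      push_cast
      ring
    simp_rw [h2] at h1
    refine h1.trans ?_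
    have h3 := hC1 X hp.three_le_X
    have h4 : ∑ p ∈ Nat.primesLE X, (p : ℝ) ^ (-(2 * (1 / 2)) : ℝ) = ∑ p ∈ Nat.primesLE X, 1 / (p:ℝ) := by
      refine Finset.sum_congr rfl fun p _ => ?_
      rw [mul_one_div_cancel two_ne_zero, Real.rpow_neg_one, one_div]
    rw [h4]
    have := hp.loglogX_le
    linarith
  have hp2 : ∫ ω in Set.Ioo (0:ℝ) 1, ‖primeSum X (2 * s ω)‖ ^ 2 ≤ 4 := by
    have h1 := integral_norm_primeSum_sq_le hT hX (κ := 2) (r := 1) one_le_two zero_le_one h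
    have h2 : ∀ ω : ℝ, (((1 : ℝ) : ℂ) + (2 * (ω * T + h) : ℝ) * Complex.I) = 2 * s ω := by
      intro ω
      rw [hs]
      push_cast
      ring
    simp_rw [h2] at h1
    refine h1.trans ?_
    have h4 : ∑ p ∈ Nat.primesLE X, (p : ℝ) ^ (-(2 * 1) : ℝ) ≤
        ∑ p ∈ Nat.primesLE X, 2 / ((p:ℝ) * (p - 1)) := by
      refine Finset.sum_le_sum fun p hp => ?_
      have h5 : (2:ℝ) ≤ p := by exact_mod_cast (Nat.mem_primesLE.1 hp).2.two_le
      rw [mul_one, Real.rpow_neg (by linarith), Real.rpow_two, ← one_div,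
        div_le_div_iff₀ (by positivity) (by nlinarith)]
      nlinarith
    have h6 := sum_primesLE_two_div_le X
    linarith
  have hsc : Continuous s := by fun_prop
  have hpc : ∀ k : ℂ, Continuous fun ω => primeSum X (k * s ω) := by
    intro k
    refine continuous_finsetSum _ fun p hp => ?_
    have h0 : (p : ℂ) ≠ 0 := by exact_mod_cast (Nat.mem_primesLE.1 hp).2.ne_zero
    exact Continuous.const_cpow (by fun_prop) (Or.inl h0)
  have hbdd : ∀ k : ℂ, Integrable (fun ω => ‖primeSum X (k * s ω)‖ ^ 2)
      (volume.restrict (Set.Ioo (0:ℝ) 1)) := fun k =>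
    (((hpc k).norm.pow 2).integrableOn_Icc (a := 0) (b := 1)).mono_set Set.Ioo_subset_Icc_self
  have hb1 : Integrable (fun ω => ‖primeSum X (s ω)‖ ^ 2) (volume.restrict (Set.Ioo (0:ℝ) 1)) := by
    simpa using hbdd 1
  have hb2 := hbdd 2
  have hpt : ∀ᵐ ω ∂(volume.restrict (Set.Ioo (0:ℝ) 1)),
      min 1 (|Real.log ‖riemannZeta (s ω)‖ - (primeSum X (s ω)).re| / Real.sqrt l) ≤
      ((Real.sqrt l)⁻¹ * F (ω * T + h) + (Real.sqrt l)⁻¹ * (‖primeSum X (2 * s ω)‖ ^ 2 + (1 + |C|))) +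
        ((l ^ 2)⁻¹ * ‖primeSum X (s ω)‖ ^ 2 + (l ^ 2)⁻¹ * ‖primeSum X (2 * s ω)‖ ^ 2) := by
    have hMd : Differentiable ℂ (moll T) :=
      differentiable_dirichletPoly (fun k hk => mollSupport_pos
        (fun p hp => (Nat.mem_primesLE.1 hp).2) hk) mollCoeff
    refine ae_restrict_of_ae ?_
    filter_upwards [ae_affine_notMem countable_setOf_riemannZeta_eq_zero hT.ne' h,
      ae_affine_notMem (countable_zeros_of_differentiable hMd hm.2.1) hT.ne' h] with ω h1 h2
    have hF0 : 0 ≤ F (ω * T + h) := abs_nonneg _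
    have hc0 := abs_nonneg C
    have hil : ∀ {q : ℝ}, l < q → 1 ≤ (l ^ 2)⁻¹ * q ^ 2 := by
      intro q hq
      rw [inv_mul_eq_div, le_div_iff₀ (by positivity), one_mul]
      exact pow_le_pow_left₀ (by linarith) hq.le 2
    by_cases hq1 : ‖primeSum X (s ω)‖ ≤ l
    swap
    · refine (min_le_left _ _).trans ((hil (not_le.1 hq1)).trans ?_)
      have e1 : 0 ≤ (Real.sqrt l)⁻¹ * F (ω * T + h) := by positivity
      have e2 : 0 ≤ (Real.sqrt l)⁻¹ * (‖primeSum X (2 * s ω)‖ ^ 2 + (1 + |C|)) := by positivity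
      have e3 : 0 ≤ (l ^ 2)⁻¹ * ‖primeSum X (2 * s ω)‖ ^ 2 := by positivity
      linarith
    by_cases hq2 : ‖primeSum X (2 * s ω)‖ ≤ l
    swap
    · refine (min_le_left _ _).trans ((hil (not_le.1 hq2)).trans ?_)
      have e1 : 0 ≤ (Real.sqrt l)⁻¹ * F (ω * T + h) := by positivity
      have e2 : 0 ≤ (Real.sqrt l)⁻¹ * (‖primeSum X (2 * s ω)‖ ^ 2 + (1 + |C|)) := by positivity
      have e3 : 0 ≤ (l ^ 2)⁻¹ * ‖primeSum X (s ω)‖ ^ 2 := by positivity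
      linarith
    refine (min_le_right _ _).trans ?_
    have h3 := hM (s ω) (by simp [hs]) hq1 hq2
    have h4 : Real.log ‖riemannZeta (s ω) * moll T (s ω)‖ =
        Real.log ‖riemannZeta (s ω)‖ + Real.log ‖moll T (s ω)‖ := by
      rw [norm_mul, Real.log_mul (norm_ne_zero_iff.2 h1) (norm_ne_zero_iff.2 h2)]
    have h5 : F (ω * T + h) = |Real.log ‖riemannZeta (s ω) * moll T (s ω)‖| := rfl
    have h6 : |Real.log ‖riemannZeta (s ω)‖ - (primeSum X (s ω)).re| ≤
        F (ω * T + h) + (‖primeSum X (2 * s ω)‖ ^ 2 + (1 + |C|)) := by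
      have h7 : Real.log ‖riemannZeta (s ω)‖ - (primeSum X (s ω)).re =
          Real.log ‖riemannZeta (s ω) * moll T (s ω)‖ -
          (Real.log ‖moll T (s ω)‖ + (primeSum X (s ω)).re) := by rw [h4]; ring
      rw [h7, h5]
      refine (abs_sub _ _).trans (add_le_add le_rfl (h3.trans ?_))
      have h8 := le_abs_self C
      nlinarith [sq_nonneg (‖primeSum X (2 * s ω)‖ - 1)]
    have e3 : 0 ≤ (l ^ 2)⁻¹ * ‖primeSum X (s ω)‖ ^ 2 := by positivity
    have e4 : 0 ≤ (l ^ 2)⁻¹ * ‖primeSum X (2 * s ω)‖ ^ 2 := by positivity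
    rw [div_eq_inv_mul, ← mul_add]
    have := mul_le_mul_of_nonneg_left h6 (inv_nonneg.2 hsl.le)
    linarith
  have i1 : Integrable (fun ω => (Real.sqrt l)⁻¹ * F (ω * T + h))
    (volume.restrict (Set.Ioo (0:ℝ) 1)) := hFi.const_mul _
  have i2 : Integrable (fun ω => ‖primeSum X (2 * s ω)‖ ^ 2 + (1 + |C|))
    (volume.restrict (Set.Ioo (0:ℝ) 1)) := hb2.add (integrable_const _)
  have i3 : Integrable (fun ω => (Real.sqrt l)⁻¹ * F (ω * T + h) +
    (Real.sqrt l)⁻¹ * (‖primeSum X (2 * s ω)‖ ^ 2 + (1 + |C|)))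
    (volume.restrict (Set.Ioo (0:ℝ) 1)) := i1.add (i2.const_mul _)
  have i4 : Integrable (fun ω => (l ^ 2)⁻¹ * ‖primeSum X (s ω)‖ ^ 2 +
    (l ^ 2)⁻¹ * ‖primeSum X (2 * s ω)‖ ^ 2)
    (volume.restrict (Set.Ioo (0:ℝ) 1)) := (hb1.const_mul _).add (hb2.const_mul _)
  refine (integral_mono_of_nonneg (ae_of_all _ fun ω => ?_) (i3.add i4) hpt).trans ?_
  · exact le_min zero_le_one (by positivity)
  rw [integral_add' i3 i4, integral_add i1 (i2.const_mul _), integral_const_mul,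
    integral_const_mul, integral_add hb2 (integrable_const _), integral_const, probReal_univ,
    one_smul, integral_add (hb1.const_mul _) (hb2.const_mul _), integral_const_mul,
    integral_const_mul]
  rw [div_eq_inv_mul, div_eq_inv_mul, ← mul_add, ← mul_add]
  refine add_le_add (mul_le_mul_of_nonneg_left ?_ (inv_nonneg.2 hsl.le))
    (mul_le_mul_of_nonneg_left ?_ (by positivity))
  · linarith
  · linarith

/-- The covariance of the prime sums at the shifts `(log T)^(-γ)` and `(log T)^(-δ)`. -/
theorem exists_eventually_abs_sum_cos_sub_le : ∃ C : ℝ, ∀ γ ∈ Set.Icc (0:ℝ) 1, ∀ δ ∈ Set.Icc (0:ℝ) 1,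
    ∀ᶠ T : ℝ in atTop, |∑ p ∈ Nat.primesLE (mollX T),
      Real.cos ((Real.log T ^ (-γ) - Real.log T ^ (-δ)) * Real.log p) / p -
      (if γ = δ then 1 else min γ δ) * Real.log (Real.log T)| ≤
      C + 6 * Real.log (Real.log (Real.log T)) := by
  obtain ⟨C, hC0, hC⟩ := exists_abs_sum_primesLE_cos_add_log_le
  refine ⟨C + 3, fun γ hγ δ hδ => ?_⟩
  wlog hle : γ ≤ δ generalizing γ δ
  · filter_upwards [this δ hδ γ hγ (not_le.1 hle).le] with T h
    have h1 : ∀ p : ℕ, Real.cos ((Real.log T ^ (-γ) - Real.log T ^ (-δ)) * Real.log p) =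
        Real.cos ((Real.log T ^ (-δ) - Real.log T ^ (-γ)) * Real.log p) := by
      intro p
      rw [← Real.cos_neg]
      congr 1
      ring
    simp_rw [h1, min_comm γ δ, eq_comm (a := γ)]
    exact h
  have hlog3 : Real.log 3 ≤ 3 := (Real.log_le_sub_one_of_pos (by norm_num)).trans (by norm_num)
  have hlog2 : Real.log 2 ≤ 1 := (Real.log_le_sub_one_of_pos (by norm_num)).trans (by norm_num)
  filter_upwards [eventually_paramBounds 1, tendsto_log_log.eventually_ge_atTop (1 / (δ - γ))]
    with T hp hgap
  set L := Real.log T with hL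
  set l := Real.log L with hl
  set v := Real.log (mollX T) with hv
  have hL1 : 1 ≤ L := hp.log_pos
  have hl1 : 1 ≤ l := hp.one_le_loglog
  have hv1 : l ≤ v := hp.loglog_le_logX
  have hv0 : 0 < v := by linarith
  have hll : 0 ≤ Real.log l := Real.log_nonneg hl1
  have hpow : ∀ x : ℝ, L ^ (-x) = Real.exp (-(x * l)) := by
    intro x
    rw [Real.rpow_def_of_pos (by linarith), ← hl]
    congr 1
    ring
  have hX := hp.three_le_X
  have hlv : l - 1 - 3 * Real.log l ≤ Real.log v := by
    have h1 := Real.log_le_log (by positivity) hp.le_logX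
    rw [Real.log_div (by positivity) (by positivity), Real.log_mul two_ne_zero (by positivity),
      Real.log_pow] at h1
    push_cast at h1
    linarith
  have hlv2 : Real.log v ≤ l := hp.loglogX_le
  set h := L ^ (-γ) - L ^ (-δ) with hh
  have hLg : L ^ (-γ) ≤ 1 := Real.rpow_le_one_of_one_le_of_nonpos hL1 (by linarith [hγ.1])
  have hLd : 0 < L ^ (-δ) := Real.rpow_pos_of_pos (by linarith) _
  have hmono : L ^ (-δ) ≤ L ^ (-γ) := Real.rpow_le_rpow_of_exponent_le hL1 (by linarith)
  have hmain := hC (mollX T) l hX hl1 hv1 hp.loglogX_le h ⟨by linarith, by linarith⟩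
  rw [← hv] at hmain
  have hε : 0 < 1 / (l * v) := by positivity
  set N := ‖((1 / (l * v) : ℝ) : ℂ) + h * Complex.I‖ with hN
  suffices hs : |Real.log N + (if γ = δ then 1 else min γ δ) * l| ≤ 3 + 4 * Real.log l by
    have h3 := abs_sub _ _ |>.trans (add_le_add hmain hs)
    refine le_trans (le_of_eq ?_) (h3.trans (by linarith))
    congr 1
    ring
  split_ifs with hγδ
  · have h0 : h = 0 := by rw [hh, hγδ, sub_self]
    have h1 : Real.log N = -Real.log l - Real.log v := by
      rw [hN, h0, Complex.ofReal_zero, zero_mul, add_zero, Complex.norm_real, Real.norm_eq_abs,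
        abs_of_pos hε, one_div, Real.log_inv, Real.log_mul (by positivity) (by positivity)]
      ring
    rw [h1, abs_le]
    constructor <;> linarith
  · have hlt : γ < δ := lt_of_le_of_ne hle hγδ
    rw [min_eq_left hle]
    have hh0 : 0 ≤ h := by linarith
    have hgap2 : 1 ≤ (δ - γ) * l := by
      have := (div_le_iff₀ (by linarith)).1 hgap
      linarith
    have hexp : Real.exp (-1) ≤ 1 / 2 := by
      rw [Real.exp_neg, inv_eq_one_div]
      have := Real.add_one_le_exp (1:ℝ)
      exact one_div_le_one_div_of_le two_pos (by linarith)
    have hhl : L ^ (-γ) / 2 ≤ h := by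
      have h2 : L ^ (-δ) = L ^ (-γ) * Real.exp (-((δ - γ) * l)) := by
        rw [hpow, hpow, ← Real.exp_add]
        congr 1
        ring
      have h3 : Real.exp (-((δ - γ) * l)) ≤ 1 / 2 :=
        (Real.exp_le_exp.2 (by linarith)).trans hexp
      have h4 : L ^ (-δ) ≤ L ^ (-γ) * (1 / 2) := by
        rw [h2]
        exact mul_le_mul_of_nonneg_left h3 (Real.rpow_nonneg (by linarith) _)
      linarith
    have hg0 : 0 < L ^ (-γ) := Real.rpow_pos_of_pos (by linarith) _
    have hNl : L ^ (-γ) / 2 ≤ N := by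
      have := Complex.abs_im_le_norm (((1 / (l * v) : ℝ) : ℂ) + h * Complex.I)
      rw [← hN] at this
      simp only [Complex.add_im, Complex.ofReal_im, Complex.mul_im, Complex.ofReal_re,
        Complex.I_im, Complex.I_re, mul_one, mul_zero, zero_add, add_zero] at this
      rw [abs_of_nonneg hh0] at this
      linarith
    have hNu : N ≤ 3 * l ^ 2 * L ^ (-γ) := by
      have h5 : N ≤ 1 / (l * v) + h := by
        refine (norm_add_le _ _).trans ?_
        rw [norm_mul, Complex.norm_I, mul_one, Complex.norm_real, Complex.norm_real,
          Real.norm_eq_abs, Real.norm_eq_abs, abs_of_pos hε, abs_of_nonneg hh0]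
      have h6 : 1 / (l * v) ≤ 2 * l ^ 2 * L ^ (-γ) := by
        have h7 : L ^ (-(1:ℝ)) ≤ L ^ (-γ) :=
          Real.rpow_le_rpow_of_exponent_le hL1 (by linarith [hγ.2])
        rw [Real.rpow_neg_one] at h7
        have h8 : 1 / (l * v) ≤ 2 * l ^ 2 * L⁻¹ := by
          have h9 := hp.le_logX
          rw [div_le_iff₀ (by positivity)] at h9
          rw [div_le_iff₀ (by positivity), ← div_eq_mul_inv, div_mul_eq_mul_div,
            le_div_iff₀ (by linarith), one_mul]
          calc L ≤ v * (2 * l ^ 3) := h9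
            _ = 2 * l ^ 2 * (l * v) := by ring
        exact h8.trans (mul_le_mul_of_nonneg_left h7 (by positivity))
      have h10 : 1 ≤ l ^ 2 := one_le_pow₀ hl1
      nlinarith
    have hN0 : 0 < N := by linarith
    have hlogg : Real.log (L ^ (-γ)) = -(γ * l) := by rw [hpow, Real.log_exp]
    have e1 := Real.log_le_log (by positivity) hNl
    have e2 := Real.log_le_log hN0 hNu
    rw [Real.log_div hg0.ne' two_ne_zero, hlogg] at e1
    rw [Real.log_mul (by positivity) hg0.ne', Real.log_mul (by norm_num) (by positivity),
      Real.log_pow, hlogg] at e2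
    push_cast at e2
    rw [abs_le]
    constructor <;> linarith

theorem tendsto_sum_cos_div {γ δ : ℝ} (hγ : γ ∈ Set.Icc (0:ℝ) 1) (hδ : δ ∈ Set.Icc (0:ℝ) 1) :
    Tendsto (fun T : ℝ => (∑ p ∈ Nat.primesLE (mollX T),
      Real.cos ((Real.log T ^ (-γ) - Real.log T ^ (-δ)) * Real.log p) / p) / Real.log (Real.log T))
      atTop (𝓝 (if γ = δ then 1 else min γ δ)) := by
  obtain ⟨C, hC⟩ := exists_eventually_abs_sum_cos_sub_le
  have h0 : Tendsto (fun x : ℝ => (C + 6 * Real.log x) / x) atTop (𝓝 0) := by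
    have h1 : Tendsto (fun x : ℝ => Real.log x / x) atTop (𝓝 0) := by
      simpa using Real.isLittleO_log_id_atTop.tendsto_div_nhds_zero
    have h2 := (tendsto_inv_atTop_zero.const_mul C).add (h1.const_mul 6)
    simp only [mul_zero, add_zero] at h2
    refine h2.congr fun x => ?_
    ring
  rw [tendsto_iff_norm_sub_tendsto_zero]
  refine squeeze_zero' (Eventually.of_forall fun _ => norm_nonneg _) ?_ (h0.comp tendsto_log_log)
  filter_upwards [hC γ hγ δ hδ, eventually_paramBounds 1] with T h hp
  have hl : 0 < Real.log (Real.log T) := by linarith [hp.one_le_loglog]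
  rw [Function.comp, Real.norm_eq_abs, le_div_iff₀ hl]
  nth_rewrite 2 [← abs_of_pos hl]
  rw [← abs_mul, sub_mul, div_mul_cancel₀ _ hl.ne']
  exact h

/-- The coefficients of a linear combination of shifted prime sums. -/
noncomputable def shiftCoeff {m : ℕ} (μ h : Fin m → ℝ) (c : ℝ) (p : ℕ) : ℂ :=
  c * ∑ k, μ k * (p : ℂ) ^ (-(1 / 2 + (h k : ℂ) * Complex.I))

section

variable {m : ℕ} (μ h : Fin m → ℝ) (c : ℝ)

theorem norm_shiftCoeff_le {p : ℕ} (hp : 0 < p) (hc : 0 ≤ c) :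
    ‖shiftCoeff μ h c p‖ ≤ c * ∑ k, |μ k| := by
  rw [shiftCoeff, norm_mul, Complex.norm_real, Real.norm_eq_abs, abs_of_nonneg hc]
  refine mul_le_mul_of_nonneg_left ((norm_sum_le _ _).trans (Finset.sum_le_sum fun k _ => ?_)) hc
  rw [norm_mul, Complex.norm_real, Real.norm_eq_abs, norm_prime_cpow_neg_of_re hp]
  refine mul_le_of_le_one_right (abs_nonneg _) ?_
  exact Real.rpow_le_one_of_one_le_of_nonpos (by exact_mod_cast hp) (by simp)

theorem norm_shiftCoeff_sq {p : ℕ} (hp : 0 < p) : ‖shiftCoeff μ h c p‖ ^ 2 =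
    c ^ 2 * ∑ k, ∑ j, μ k * μ j * (Real.cos ((h k - h j) * Real.log p) / p) := by
  have hp0 : (p : ℂ) ≠ 0 := by exact_mod_cast hp.ne'
  have h1 : ∀ k, (p : ℂ) ^ (-(1 / 2 + (h k : ℂ) * Complex.I)) =
      (p : ℂ) ^ (-(1 / 2 : ℂ)) * Complex.exp ((-h k * Real.log p : ℝ) * Complex.I) := by
    intro k
    have := natCast_cpow_neg_add_mul_I hp (1 / 2) 1 (h k)
    rw [one_mul, one_mul] at this
    exact this
  have h2 : ‖(p : ℂ) ^ (-(1 / 2 : ℂ))‖ ^ 2 = 1 / p := by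
    rw [norm_prime_cpow_neg_of_re hp, ← Real.rpow_natCast, ← Real.rpow_mul (Nat.cast_nonneg _),
      one_div (p : ℝ), ← Real.rpow_neg_one]
    congr 1
    norm_num
  have h3 : shiftCoeff μ h c p = c * (p : ℂ) ^ (-(1 / 2 : ℂ)) *
      ∑ k, μ k * Complex.exp ((-h k * Real.log p : ℝ) * Complex.I) := by
    rw [shiftCoeff, mul_assoc]
    congr 1
    rw [Finset.mul_sum]
    refine Finset.sum_congr rfl fun k _ => ?_
    rw [h1]
    ring
  have h4 : ‖∑ k, (μ k : ℂ) * Complex.exp ((-h k * Real.log p : ℝ) * Complex.I)‖ ^ 2 =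
      ∑ k, ∑ j, μ k * μ j * Real.cos ((h k - h j) * Real.log p) := by
    have hc2 : ∀ z : ℂ, ‖z‖ ^ 2 = (z * (starRingEnd ℂ) z).re := by
      intro z
      rw [Complex.mul_conj, Complex.ofReal_re, Complex.normSq_eq_norm_sq]
    rw [hc2, map_sum, Finset.sum_mul_sum, Complex.re_sum]
    refine Finset.sum_congr rfl fun k _ => ?_
    rw [Complex.re_sum]
    refine Finset.sum_congr rfl fun j _ => ?_
    rw [map_mul, Complex.conj_ofReal, ← Complex.exp_conj, map_mul, Complex.conj_ofReal,
      Complex.conj_I, mul_mul_mul_comm, ← Complex.exp_add, ← Complex.ofReal_mul,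
      Complex.re_ofReal_mul, mul_neg, ← sub_eq_add_neg, ← sub_mul, ← Complex.ofReal_sub,
      Complex.exp_ofReal_mul_I_re]
    congr 1
    rw [← Real.cos_neg]
    congr 1
    ring
  rw [h3, norm_mul, norm_mul, mul_pow, mul_pow, h2, h4, Complex.norm_real, Real.norm_eq_abs, sq_abs,
    mul_assoc, Finset.mul_sum]
  congr 1
  refine Finset.sum_congr rfl fun k _ => ?_
  rw [Finset.mul_sum]
  refine Finset.sum_congr rfl fun j _ => ?_
  ring

theorem sum_primesLE_norm_shiftCoeff_sq (X : ℕ) : ∑ p ∈ Nat.primesLE X, ‖shiftCoeff μ h c p‖ ^ 2 =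
    c ^ 2 * ∑ k, ∑ j, μ k * μ j *
      ∑ p ∈ Nat.primesLE X, Real.cos ((h k - h j) * Real.log p) / p := by
  rw [Finset.sum_congr rfl fun p hp => norm_shiftCoeff_sq μ h c (Nat.mem_primesLE.1 hp).2.pos,
    ← Finset.mul_sum, Finset.sum_comm]
  congr 1
  refine Finset.sum_congr rfl fun k _ => ?_
  rw [Finset.sum_comm]
  exact Finset.sum_congr rfl fun j _ => (Finset.mul_sum _ _ _).symm

theorem re_sum_shiftCoeff_mul_exp (X : ℕ) (t : ℝ) :
    (∑ p ∈ Nat.primesLE X, shiftCoeff μ h c p *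
      Complex.exp ((-t * Real.log p : ℝ) * Complex.I)).re =
    ∑ k, μ k * (c * (primeSum X (1 / 2 + ((t + h k : ℝ) : ℂ) * Complex.I)).re) := by
  have h1 : ∑ p ∈ Nat.primesLE X, shiftCoeff μ h c p *
      Complex.exp ((-t * Real.log p : ℝ) * Complex.I) =
      ∑ k, (μ k * c : ℝ) * primeSum X (1 / 2 + ((t + h k : ℝ) : ℂ) * Complex.I) := by
    simp_rw [shiftCoeff, primeSum, Finset.mul_sum, Finset.sum_mul]
    rw [Finset.sum_comm]
    refine Finset.sum_congr rfl fun k _ => Finset.sum_congr rfl fun p hp => ?_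
    have h2 := natCast_cpow_neg_add_mul_I (Nat.mem_primesLE.1 hp).2.pos
      (1 / 2 + (h k : ℂ) * Complex.I) 1 t
    rw [one_mul, one_mul] at h2
    have h3 : (1 / 2 + ((t + h k : ℝ) : ℂ) * Complex.I) =
        1 / 2 + (h k : ℂ) * Complex.I + t * Complex.I := by
      push_cast
      ring
    rw [h3, h2]
    push_cast
    ring
  rw [h1, Complex.re_sum]
  refine Finset.sum_congr rfl fun k _ => ?_
  rw [Complex.re_ofReal_mul]
  ring

end

theorem tendsto_integral_exp_primeSum {m : ℕ} (μ : Fin m → ℝ) {δ : Fin m → ℝ}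
    (hδ : ∀ k, δ k ∈ Set.Icc (0:ℝ) 1) :
    Tendsto (fun T : ℝ => ∫ ω in Set.Ioo (0:ℝ) 1, Complex.exp ((∑ k, μ k *
      ((Real.sqrt (1 / 2 * Real.log (Real.log T)))⁻¹ * (primeSum (mollX T)
        (1 / 2 + ((ω * T + Real.log T ^ (-(δ k)) : ℝ) : ℂ) * Complex.I)).re) : ℝ) * Complex.I))
      atTop (𝓝 ((Real.exp (-(∑ k, ∑ j, μ k * μ j * (if δ k = δ j then 1 else min (δ k) (δ j))) / 2)
        : ℝ) : ℂ)) := by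
  set S := ∑ k, ∑ j, μ k * μ j * (if δ k = δ j then 1 else min (δ k) (δ j)) with hS
  set c : ℝ → ℝ := fun T => (Real.sqrt (1 / 2 * Real.log (Real.log T)))⁻¹ with hc
  set M := ∑ k, |μ k| with hM
  have hM0 : 0 ≤ M := Finset.sum_nonneg fun _ _ => abs_nonneg _
  set a : ℝ → ℕ → ℂ := fun T => shiftCoeff μ (fun k => Real.log T ^ (-(δ k))) (c T) with ha
  have hc0 : ∀ T, 0 ≤ c T := fun T => inv_nonneg.2 (Real.sqrt_nonneg _)
  have hclim : Tendsto c atTop (𝓝 0) := by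
    refine tendsto_inv_atTop_zero.comp (Real.tendsto_sqrt_atTop.comp ?_)
    exact tendsto_log_log.const_mul_atTop (by norm_num)
  set V : ℝ → ℝ := fun T => ∑ p ∈ Nat.primesLE (mollX T), ‖a T p‖ ^ 2 with hV
  have hVlim : Tendsto V atTop (𝓝 (2 * S)) := by
    have h1 : Tendsto (fun T : ℝ => 2 * ∑ k, ∑ j, μ k * μ j * ((∑ p ∈ Nat.primesLE (mollX T),
        Real.cos ((Real.log T ^ (-(δ k)) - Real.log T ^ (-(δ j))) * Real.log p) / p) /
        Real.log (Real.log T))) atTop (𝓝 (2 * S)) :=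
      (tendsto_finsetSum _ fun k _ => tendsto_finsetSum _ fun j _ =>
        (tendsto_sum_cos_div (hδ k) (hδ j)).const_mul _).const_mul 2
    refine h1.congr' ?_
    filter_upwards [eventually_paramBounds 1] with T hp
    have hl : 0 < Real.log (Real.log T) := by linarith [hp.one_le_loglog]
    have hc2 : c T ^ 2 = 2 / Real.log (Real.log T) := by
      rw [hc]
      simp only [inv_pow]
      rw [Real.sq_sqrt (by positivity)]
      field_simp
    simp only [hV, ha]
    rw [sum_primesLE_norm_shiftCoeff_sq, hc2, div_mul_eq_mul_div, mul_div_assoc]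
    congr 1
    rw [Finset.sum_div]
    refine Finset.sum_congr rfl fun k _ => ?_
    rw [Finset.sum_div]
    exact Finset.sum_congr rfl fun j _ => (mul_div_assoc _ _ _).symm
  have hElim : Tendsto (fun T => ((Real.exp (-V T / 4) : ℝ) : ℂ)) atTop
      (𝓝 ((Real.exp (-S / 2) : ℝ) : ℂ)) := by
    have h1 : -S / 2 = -(2 * S) / 4 := by ring
    rw [h1]
    exact (Complex.continuous_ofReal.tendsto _).comp
      ((Real.continuous_exp.tendsto _).comp (hVlim.neg.div_const 4))
  have hI : ∀ T, (∫ ω in Set.Ioo (0:ℝ) 1, Complex.exp ((∑ k, μ k *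
      ((Real.sqrt (1 / 2 * Real.log (Real.log T)))⁻¹ * (primeSum (mollX T)
        (1 / 2 + ((ω * T + Real.log T ^ (-(δ k)) : ℝ) : ℂ) * Complex.I)).re) : ℝ) * Complex.I)) =
      ∫ ω in Set.Ioo (0:ℝ) 1, Complex.exp (((∑ p ∈ Nat.primesLE (mollX T),
        a T p * Complex.exp ((-(ω * T) * Real.log p : ℝ) * Complex.I)).re : ℝ) * Complex.I) := by
    intro T
    simp only [ha]
    simp_rw [re_sum_shiftCoeff_mul_exp]
    rfl
  simp_rw [hI]
  have hdiff : Tendsto (fun T : ℝ => (∫ ω in Set.Ioo (0:ℝ) 1, Complex.exp (((∑ p ∈ Nat.primesLE (mollX T),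
        a T p * Complex.exp ((-(ω * T) * Real.log p : ℝ) * Complex.I)).re : ℝ) * Complex.I)) -
        ((Real.exp (-V T / 4) : ℝ) : ℂ)) atTop (𝓝 0) := by
    rw [Metric.tendsto_nhds]
    intro ε hε
    obtain ⟨J, hJ⟩ : ∃ J : ℕ, 2 * ((1 / 4 : ℝ) ^ J * Real.exp (2 * (2 * S + 1))) < ε / 2 := by
      have h1 : Tendsto (fun J : ℕ => 2 * ((1 / 4 : ℝ) ^ J * Real.exp (2 * (2 * S + 1)))) atTop (𝓝 0) := by
        have := ((tendsto_pow_atTop_nhds_zero_of_lt_one (r := (1 / 4 : ℝ)) (by norm_num)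
          (by norm_num)).mul_const (Real.exp (2 * (2 * S + 1)))).const_mul 2
        simpa using this
      exact (h1.eventually_lt_const (half_pos hε)).exists
    have hA : Tendsto (fun T : ℝ => 2 * (1 + M) ^ (2 * J) * ((mollX T : ℝ) ^ (4 * J) / T) +
        c T * M * V T) atTop (𝓝 0) := by
      have := ((tendsto_mollX_pow_div (4 * J)).const_mul (2 * (1 + M) ^ (2 * J))).add
        ((hclim.mul_const M).mul hVlim)
      simpa using this
    filter_upwards [hA.eventually_lt_const (half_pos hε), eventually_paramBounds 1,
      hVlim.eventually_le_const (show 2 * S < 2 * S + 1 by linarith),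
      (hclim.mul_const M).eventually_le_const (show 0 * M < 1 / 2 by norm_num),
      hclim.eventually_le_const one_pos] with T hAT hp hVT hcM hc1
    have hT : 0 < T := by linarith [hp.three_le]
    have hX : 1 ≤ mollX T := by have := hp.three_le_X; omega
    have hX' : (1:ℝ) ≤ mollX T := by exact_mod_cast hX
    have han : ∀ p ∈ Nat.primesLE (mollX T), ‖a T p‖ ≤ c T * M := fun p hp =>
      norm_shiftCoeff_le μ _ (c T) (Nat.mem_primesLE.1 hp).2.pos (hc0 T)
    rw [dist_zero_right]
    refine (norm_integral_exp_re_sum_primesLE_sub_le hT hX J fun p hp =>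
      (han p hp).trans hcM).trans_lt ?_
    have e1 : ∑ p ∈ Nat.primesLE (mollX T), ‖a T p‖ ^ 3 ≤ c T * M * V T := by
      rw [hV, Finset.mul_sum]
      refine Finset.sum_le_sum fun p hp => ?_
      rw [pow_succ']
      exact mul_le_mul_of_nonneg_right (han p hp) (by positivity)
    have e2 : ∑ p ∈ Nat.primesLE (mollX T), ‖a T p‖ ≤ M * mollX T := by
      calc ∑ p ∈ Nat.primesLE (mollX T), ‖a T p‖ ≤ ∑ p ∈ Nat.primesLE (mollX T), M := by
            refine Finset.sum_le_sum fun p hp => (han p hp).trans ?_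
            exact mul_le_of_le_one_left hM0 hc1
        _ ≤ M * mollX T := by
            rw [Finset.sum_const, nsmul_eq_mul, mul_comm]
            refine mul_le_mul_of_nonneg_left ?_ hM0
            exact_mod_cast card_primesLE_le _
    have e3 : 2 * (mollX T : ℝ) ^ (2 * J) / T *
        (1 + ∑ p ∈ Nat.primesLE (mollX T), ‖a T p‖) ^ (2 * J) ≤
        2 * (1 + M) ^ (2 * J) * ((mollX T : ℝ) ^ (4 * J) / T) := by
      have e4 : (1 + ∑ p ∈ Nat.primesLE (mollX T), ‖a T p‖) ^ (2 * J) ≤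
          ((1 + M) * mollX T) ^ (2 * J) := by
        refine pow_le_pow_left₀ (add_nonneg zero_le_one
          (Finset.sum_nonneg fun _ _ => norm_nonneg _)) ?_ _
        nlinarith
      refine (mul_le_mul_of_nonneg_left e4 (by positivity)).trans (le_of_eq ?_)
      rw [mul_pow, show 4 * J = 2 * J + 2 * J by ring, pow_add]
      ring
    have e5 : 2 * ((1 / 4 : ℝ) ^ J * Real.exp (2 * ∑ p ∈ Nat.primesLE (mollX T), ‖a T p‖ ^ 2)) ≤
        2 * ((1 / 4 : ℝ) ^ J * Real.exp (2 * (2 * S + 1))) := by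
      have : ∑ p ∈ Nat.primesLE (mollX T), ‖a T p‖ ^ 2 ≤ 2 * S + 1 := hVT
      gcongr
    linarith
  have := hdiff.add hElim
  simpa using this

theorem exists_norm_LSeries_le {f : ℕ → ℂ} (hf1 : f 1 = 0) (hf : LSeriesSummable f 2) :
    ∃ C : ℝ, 0 ≤ C ∧ ∀ s : ℂ, 2 ≤ s.re → ‖LSeries f s‖ ≤ C * Real.exp (-Real.log 2 * s.re) := by
  have hf' : Summable fun n => ‖LSeries.term f 2 n‖ := summable_norm_iff.2 hf
  refine ⟨Real.exp (Real.log 2 * 2) * ∑' n, ‖LSeries.term f 2 n‖,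
    mul_nonneg (Real.exp_pos _).le (tsum_nonneg fun _ => norm_nonneg _), fun s hs => ?_⟩
  have h1 : ∀ n, ‖LSeries.term f s n‖ ≤
      Real.exp (-(Real.log 2 * (s.re - 2))) * ‖LSeries.term f 2 n‖ := by
    intro n
    rcases Nat.lt_or_ge n 2 with hn | hn
    · interval_cases n
      · simp
      · simp [LSeries.term, hf1]
    · have hn0 : n ≠ 0 := by omega
      have hnp : (0:ℝ) < n := by positivity
      rw [LSeries.norm_term_eq, LSeries.norm_term_eq, if_neg hn0, if_neg hn0, Complex.re_ofNat]
      have h2 : (n:ℝ) ^ s.re = n ^ (2:ℝ) * n ^ (s.re - 2) := by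
        rw [← Real.rpow_add hnp]
        congr 1
        ring
      have h3 : Real.exp (Real.log 2 * (s.re - 2)) ≤ (n:ℝ) ^ (s.re - 2) := by
        rw [← Real.rpow_def_of_pos two_pos]
        exact Real.rpow_le_rpow two_pos.le (by exact_mod_cast hn) (by linarith)
      rw [h2, Real.exp_neg, ← div_div, div_eq_mul_inv _ ((n:ℝ) ^ (s.re - 2)), mul_comm]
      gcongr
  refine (tsum_of_norm_bounded (hf'.hasSum.mul_left _) h1).trans (le_of_eq ?_)
  rw [mul_right_comm, ← Real.exp_add]
  congr 2
  ring

theorem tendsto_riemannZeta_add_mul_I (t : ℝ) :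
    Tendsto (fun x : ℝ => riemannZeta (x + t * Complex.I)) atTop (𝓝 1) := by
  have h1s : ∀ s : ℂ, 2 ≤ s.re → LSeriesSummable 1 s := fun s hs =>
    LSeriesSummable_one_iff.2 (by linarith)
  have hds : ∀ s : ℂ, LSeriesSummable LSeries.delta s := fun s =>
    summable_of_ne_finset_zero (s := {1}) fun n hn => by
      rw [LSeries.term_delta, if_neg (by simpa using hn)]
  obtain ⟨C, hC0, hC⟩ := exists_norm_LSeries_le (f := 1 - LSeries.delta) (by simp [LSeries.delta])
    ((h1s 2 (by simp)).sub (hds 2))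
  rw [tendsto_iff_norm_sub_tendsto_zero]
  have h0 : Tendsto (fun x : ℝ => C * Real.exp (-Real.log 2 * x)) atTop (𝓝 0) := by
    have h := (Real.tendsto_exp_atBot.comp (tendsto_id.const_mul_atTop_of_neg
      (neg_lt_zero.2 (Real.log_pos one_lt_two)))).const_mul C
    rw [mul_zero] at h
    exact h
  refine squeeze_zero' (Eventually.of_forall fun _ => norm_nonneg _) ?_ h0
  filter_upwards [eventually_ge_atTop 2] with x hx
  have hre : ((x:ℂ) + t * Complex.I).re = x := by simp
  have h := hC (x + t * Complex.I) (by rw [hre]; exact hx)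
  rwa [LSeries_sub (h1s _ (by rw [hre]; exact hx)) (hds _), LSeries_delta, hre,
    LSeries_one_eq_riemannZeta (by rw [hre]; linarith)] at h

theorem exists_norm_logDeriv_riemannZeta_le : ∃ C : ℝ, ∀ s : ℂ, 2 ≤ s.re →
    ‖deriv riemannZeta s / riemannZeta s‖ ≤ C * Real.exp (-Real.log 2 * s.re) := by
  obtain ⟨C, -, hC⟩ := exists_norm_LSeries_le
    (f := fun n => (ArithmeticFunction.vonMangoldt n : ℂ)) (by simp)
    (ArithmeticFunction.LSeriesSummable_vonMangoldt (by simp))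
  refine ⟨C, fun s hs => ?_⟩
  have h := hC s hs
  rwa [ArithmeticFunction.LSeries_vonMangoldt_eq_deriv_riemannZeta_div (by linarith), neg_div,
    norm_neg] at h

section

variable {t : ℝ}

theorem ne_zero_of_forall_im_ne
    (ht : ∀ ρ : ℂ, riemannZeta ρ = 0 → ρ.im ≠ t) : t ≠ 0 := by
  have := ht (-2 * (0 + 1)) (by exact_mod_cast riemannZeta_neg_two_mul_nat_add_one 0)
  simpa using this.symm

theorem differentiableAt_riemannZeta_add_mul_I
    (ht : ∀ ρ : ℂ, riemannZeta ρ = 0 → ρ.im ≠ t) (x : ℝ) :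
    DifferentiableAt ℂ riemannZeta (x + t * Complex.I) := by
  refine differentiableAt_riemannZeta fun h => ne_zero_of_forall_im_ne ht ?_
  simpa using congrArg Complex.im h

theorem riemannZeta_add_mul_I_ne_zero
    (ht : ∀ ρ : ℂ, riemannZeta ρ = 0 → ρ.im ≠ t) (x : ℝ) : riemannZeta (x + t * Complex.I) ≠ 0 :=
  fun h => ht _ h (by simp)

theorem continuous_logDeriv_riemannZeta_add_mul_I
    (ht : ∀ ρ : ℂ, riemannZeta ρ = 0 → ρ.im ≠ t) : Continuous fun x : ℝ =>
    deriv riemannZeta (x + t * Complex.I) / riemannZeta (x + t * Complex.I) := by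
  rw [continuous_iff_continuousAt]
  intro x
  have hne : (x + t * Complex.I : ℂ) ≠ 1 := fun h =>
    ne_zero_of_forall_im_ne ht (by simpa using congrArg Complex.im h)
  have hline : ContinuousAt (fun x : ℝ => (x + t * Complex.I : ℂ)) x := by fun_prop
  have hd : ContinuousAt (deriv riemannZeta) (x + t * Complex.I) :=
    (analyticOn_riemannZeta.deriv_of_isOpen isOpen_compl_singleton _ hne).continuousAt
  exact (hd.comp (f := fun x : ℝ => (x + t * Complex.I : ℂ)) hline).div
    ((differentiableAt_riemannZeta_add_mul_I ht x).continuousAt.comp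
      (f := fun x : ℝ => (x + t * Complex.I : ℂ)) hline) (riemannZeta_add_mul_I_ne_zero ht x)

theorem integrableOn_logDeriv_riemannZeta_add_mul_I
    (ht : ∀ ρ : ℂ, riemannZeta ρ = 0 → ρ.im ≠ t) (a : ℝ) : IntegrableOn (fun x : ℝ =>
    deriv riemannZeta (x + t * Complex.I) / riemannZeta (x + t * Complex.I)) (Set.Ioi a) := by
  have hc := continuous_logDeriv_riemannZeta_add_mul_I ht
  obtain ⟨C, hC⟩ := exists_norm_logDeriv_riemannZeta_le
  have h2 : IntegrableOn (fun x : ℝ =>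
      deriv riemannZeta (x + t * Complex.I) / riemannZeta (x + t * Complex.I)) (Set.Ioi 2) := by
    refine ((integrableOn_exp_mul_Ioi (neg_lt_zero.2 (Real.log_pos one_lt_two)) 2).const_mul
      C).mono' hc.aestronglyMeasurable ?_
    filter_upwards [ae_restrict_mem measurableSet_Ioi] with x hx
    have hre : ((x:ℂ) + t * Complex.I).re = x := by simp
    have h := hC (x + t * Complex.I) (by rw [hre]; exact (Set.mem_Ioi.1 hx).le)
    rwa [hre] at h
  refine ((hc.integrableOn_Icc (a := a) (b := 2)).union h2).mono_set fun x hx => ?_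
  rcases le_or_gt x 2 with h | h
  · exact Or.inl ⟨(Set.mem_Ioi.1 hx).le, h⟩
  · exact Or.inr h

theorem neg_integral_Ioi_logDeriv_riemannZeta_eq
    (ht : ∀ ρ : ℂ, riemannZeta ρ = 0 → ρ.im ≠ t) (a σ : ℝ) :
    (-∫ x in Set.Ioi σ, deriv riemannZeta (x + t * Complex.I) / riemannZeta (x + t * Complex.I)) =
    (∫ x in a..σ, deriv riemannZeta (x + t * Complex.I) / riemannZeta (x + t * Complex.I)) -
    ∫ x in Set.Ioi a, deriv riemannZeta (x + t * Complex.I) / riemannZeta (x + t * Complex.I) := by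
  have h := intervalIntegral.integral_interval_add_Ioi
    (integrableOn_logDeriv_riemannZeta_add_mul_I ht a)
    (integrableOn_logDeriv_riemannZeta_add_mul_I ht σ)
  rw [← h]
  ring

/-- The logarithm of zeta obtained by integrating the logarithmic derivative. -/
theorem exp_neg_integral_Ioi_logDeriv_riemannZeta
    (ht : ∀ ρ : ℂ, riemannZeta ρ = 0 → ρ.im ≠ t) (σ : ℝ) : Complex.exp (-∫ x in Set.Ioi σ,
    deriv riemannZeta (x + t * Complex.I) / riemannZeta (x + t * Complex.I)) =
    riemannZeta (σ + t * Complex.I) := by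
  set g : ℝ → ℂ := fun x =>
    deriv riemannZeta (x + t * Complex.I) / riemannZeta (x + t * Complex.I) with hg
  have hgc : Continuous g := continuous_logDeriv_riemannZeta_add_mul_I ht
  set F : ℝ → ℂ := fun σ => (∫ x in (0:ℝ)..σ, g x) - ∫ x in Set.Ioi (0:ℝ), g x with hF
  have hFd : ∀ x, HasDerivAt F (g x) x := fun x =>
    (hgc.integral_hasStrictDerivAt 0 x).hasDerivAt.sub_const _
  have hF0 : Tendsto F atTop (𝓝 0) := by
    have h := (intervalIntegral_tendsto_integral_Ioi 0
      (integrableOn_logDeriv_riemannZeta_add_mul_I ht 0) tendsto_id).sub_const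
      (∫ x in Set.Ioi (0:ℝ), g x)
    rwa [sub_self] at h
  have hζd : ∀ x : ℝ, HasDerivAt (fun x : ℝ => riemannZeta (x + t * Complex.I))
      (deriv riemannZeta (x + t * Complex.I)) x := fun x =>
    ((differentiableAt_riemannZeta_add_mul_I ht x).hasDerivAt.comp_add_const (x : ℂ) _).comp_ofReal
  set H : ℝ → ℂ := fun x => Complex.exp (-F x) * riemannZeta (x + t * Complex.I) with hH
  have hHd : ∀ x, HasDerivAt H 0 x := by
    intro x
    have h := (hFd x).fun_neg.cexp.fun_mul (hζd x)
    have h0 : Complex.exp (-F x) * -g x * riemannZeta (x + t * Complex.I) +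
        Complex.exp (-F x) * deriv riemannZeta (x + t * Complex.I) = 0 := by
      rw [show deriv riemannZeta (x + t * Complex.I) = g x * riemannZeta (x + t * Complex.I) from
        (div_mul_cancel₀ _ (riemannZeta_add_mul_I_ne_zero ht x)).symm]
      ring
    rwa [h0] at h
  have hconst : ∀ x, H x = H σ := fun x =>
    is_const_of_deriv_eq_zero (fun y => (hHd y).differentiableAt) (fun y => (hHd y).deriv) x σ
  have hlim : Tendsto H atTop (𝓝 1) := by
    have h := ((Complex.continuous_exp.tendsto _).comp hF0.neg).mul
      (tendsto_riemannZeta_add_mul_I t)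
    simpa using h
  have h1 : H σ = 1 :=
    tendsto_nhds_unique (tendsto_const_nhds.congr fun x => (hconst x).symm) hlim
  rw [neg_integral_Ioi_logDeriv_riemannZeta_eq ht 0 σ]
  change Complex.exp (F σ) = _
  simp only [hH] at h1
  rw [Complex.exp_neg, inv_mul_eq_one₀ (Complex.exp_ne_zero _)] at h1
  exact h1

theorem logZeta_half_re
    (ht : ∀ ρ : ℂ, riemannZeta ρ = 0 → ρ.im ≠ t) : (logZeta (1 / 2) t).re =
    Real.log ‖riemannZeta (1 / 2 + t * Complex.I)‖ := by
  have hc : Continuous fun σ : ℝ => (-∫ x in Set.Ioi σ,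
      deriv riemannZeta (x + t * Complex.I) / riemannZeta (x + t * Complex.I)) := by
    simp_rw [neg_integral_Ioi_logDeriv_riemannZeta_eq ht 0]
    exact (intervalIntegral.continuous_primitive (fun a b =>
      (continuous_logDeriv_riemannZeta_add_mul_I ht).intervalIntegrable a b) 0).sub
        continuous_const
  have h1 : logZeta (1 / 2) t = -∫ x in Set.Ioi (1 / 2 : ℝ),
      deriv riemannZeta (x + t * Complex.I) / riemannZeta (x + t * Complex.I) := by
    rw [logZeta, if_neg (lt_irrefl _)]
    simp only [logZetaAux, if_pos ht]
    exact ((hc.tendsto _).mono_left nhdsWithin_le_nhds).limUnder_eq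
  have h2 := exp_neg_integral_Ioi_logDeriv_riemannZeta ht (1 / 2)
  rw [← h1] at h2
  rw [← Real.log_exp (logZeta (1 / 2) t).re, ← Complex.norm_exp, h2]
  push_cast
  rfl

end

theorem norm_exp_mul_I_sub_exp_mul_I_le_sum {m : ℕ} (x u : Fin m → ℝ) (hu : ∀ k, 0 ≤ u k) {a b : ℝ}
    (hab : |a - b| ≤ ∑ k, 2 * |x k| * u k) :
    ‖Complex.exp (a * Complex.I) - Complex.exp (b * Complex.I)‖ ≤
      ∑ k, (2 + 2 * |x k|) * min 1 (u k) := by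
  have hnn : ∀ k, 0 ≤ (2 + 2 * |x k|) * min 1 (u k) := fun k =>
    mul_nonneg (by positivity) (le_min zero_le_one (hu k))
  by_cases h : ∃ k, 1 ≤ u k
  · obtain ⟨k, hk⟩ := h
    calc ‖Complex.exp (a * Complex.I) - Complex.exp (b * Complex.I)‖ ≤ 1 + 1 := by
          refine (norm_sub_le _ _).trans (le_of_eq ?_)
          rw [Complex.norm_exp_ofReal_mul_I, Complex.norm_exp_ofReal_mul_I]
      _ ≤ (2 + 2 * |x k|) * min 1 (u k) := by
          rw [min_eq_left hk]
          linarith [abs_nonneg (x k)]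
      _ ≤ _ := Finset.single_le_sum (f := fun k => (2 + 2 * |x k|) * min 1 (u k))
          (fun k _ => hnn k) (Finset.mem_univ k)
  · push Not at h
    have h1 : Complex.exp (a * Complex.I) - Complex.exp (b * Complex.I) =
        Complex.exp (b * Complex.I) * (Complex.exp (Complex.I * (a - b : ℝ)) - 1) := by
      rw [mul_sub, ← Complex.exp_add, mul_one]
      congr 2
      push_cast
      ring
    rw [h1, norm_mul, Complex.norm_exp_ofReal_mul_I, one_mul]
    refine (Real.norm_exp_I_mul_ofReal_sub_one_le.trans hab).trans (Finset.sum_le_sum fun k _ => ?_)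
    rw [min_eq_right (h k).le]
    exact mul_le_mul_of_nonneg_right (by linarith) (hu k)

/-- The normalized values of `log |ζ|` at shifts of the points `1/2 + iωT`. -/
noncomputable def shiftedLogZeta {m : ℕ} (δ : Fin m → ℝ) (T ω : ℝ) (k : Fin m) : ℝ :=
  (Real.sqrt (1 / 2 * Real.log (Real.log T)))⁻¹ *
    Real.log ‖riemannZeta (1 / 2 + ((ω * T + Real.log T ^ (-(δ k)) : ℝ) : ℂ) * Complex.I)‖

theorem continuous_riemannZeta_half_add (T h : ℝ) : Continuous fun ω : ℝ =>
    riemannZeta (1 / 2 + ((ω * T + h : ℝ) : ℂ) * Complex.I) := by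
  rw [continuous_iff_continuousAt]
  intro ω
  have hne : (1 / 2 + ((ω * T + h : ℝ) : ℂ) * Complex.I) ≠ 1 := by
    intro h
    have := congrArg Complex.re h
    norm_num at this
  have hline : Continuous fun ω : ℝ => (1 / 2 + ((ω * T + h : ℝ) : ℂ) * Complex.I) := by fun_prop
  exact (differentiableAt_riemannZeta hne).continuousAt.comp
    (f := fun ω : ℝ => (1 / 2 + ((ω * T + h : ℝ) : ℂ) * Complex.I)) hline.continuousAt

theorem measurable_log_norm_riemannZeta_half_add (T h : ℝ) : Measurable fun ω : ℝ =>
    Real.log ‖riemannZeta (1 / 2 + ((ω * T + h : ℝ) : ℂ) * Complex.I)‖ :=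
  (continuous_riemannZeta_half_add T h).norm.measurable.log

section

variable {m : ℕ} (δ : Fin m → ℝ)

theorem measurable_shiftedLogZeta (T : ℝ) : Measurable (shiftedLogZeta δ T) :=
  measurable_pi_lambda _ fun _ => (measurable_log_norm_riemannZeta_half_add T _).const_mul _

theorem ae_logZeta_half_re_eq {T : ℝ} (hT : T ≠ 0) : ∀ᵐ ω : ℝ, (fun k =>
    (Real.sqrt ((1/2) * Real.log (Real.log T)))⁻¹ *
      (logZeta (1/2) (ω * T + (Real.log T) ^ (-(δ k)))).re) = shiftedLogZeta δ T ω := by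
  have hS : (Complex.im '' {s | riemannZeta s = 0}).Countable :=
    countable_setOf_riemannZeta_eq_zero.image _
  have hS2 : ((fun y : ℝ => (1 / 2 + (y : ℂ) * Complex.I)) ''
      (Complex.im '' {s | riemannZeta s = 0})).Countable := hS.image _
  have h1 : ∀ᵐ ω : ℝ, ∀ k, (1 / 2 + ((ω * T + Real.log T ^ (-(δ k)) : ℝ) : ℂ) * Complex.I) ∉
      (fun y : ℝ => (1 / 2 + (y : ℂ) * Complex.I)) '' (Complex.im '' {s | riemannZeta s = 0}) :=
    ae_all_iff.2 fun k => ae_affine_notMem hS2 hT _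
  filter_upwards [h1] with ω hω
  funext k
  rw [shiftedLogZeta, logZeta_half_re]
  intro ρ hρ him
  exact hω k ⟨_, ⟨ρ, hρ, rfl⟩, by rw [him]⟩

/-- The law of the normalized vector of shifted values of `log |ζ|`. -/
noncomputable def shiftedLogZetaLaw (T : ℝ) : ProbabilityMeasure (EuclideanSpace ℝ (Fin m)) :=
  ⟨(volume.restrict (Set.Ioo (0:ℝ) 1)).map fun ω => WithLp.toLp 2 (shiftedLogZeta δ T ω), by
    have : IsProbabilityMeasure (volume.restrict (Set.Ioo (0:ℝ) 1)) := ⟨by simp⟩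
    exact Measure.isProbabilityMeasure_map
      ((WithLp.measurable_toLp 2 _).comp (measurable_shiftedLogZeta δ T)).aemeasurable⟩

theorem integral_shiftedLogZetaLaw {E : Type*} [NormedAddCommGroup E] [NormedSpace ℝ E] (T : ℝ)
    {f : EuclideanSpace ℝ (Fin m) → E} (hf : StronglyMeasurable f) :
    ∫ x, f x ∂(shiftedLogZetaLaw δ T : Measure (EuclideanSpace ℝ (Fin m))) =
      ∫ ω in Set.Ioo (0:ℝ) 1, f (WithLp.toLp 2 (shiftedLogZeta δ T ω)) :=
  integral_map ((WithLp.measurable_toLp 2 _).comp (measurable_shiftedLogZeta δ T)).aemeasurable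
    hf.aestronglyMeasurable

theorem charFun_shiftedLogZetaLaw (T : ℝ) (x : EuclideanSpace ℝ (Fin m)) :
    charFun (shiftedLogZetaLaw δ T : Measure (EuclideanSpace ℝ (Fin m))) x =
      ∫ ω in Set.Ioo (0:ℝ) 1, Complex.exp ((∑ k, x k * shiftedLogZeta δ T ω k : ℝ) * Complex.I) := by
  rw [charFun_apply, integral_shiftedLogZetaLaw δ T (by fun_prop)]
  simp [PiLp.inner_apply]

variable {δ}

theorem tendsto_charFun_shiftedLogZetaLaw (hδ : ∀ k, δ k ∈ Set.Icc (0:ℝ) 1)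
    (x : EuclideanSpace ℝ (Fin m)) :
    Tendsto (fun T => charFun (shiftedLogZetaLaw δ T : Measure (EuclideanSpace ℝ (Fin m))) x)
      atTop (𝓝 ((Real.exp (-(∑ k, ∑ j, x k * x j *
        (if δ k = δ j then 1 else min (δ k) (δ j))) / 2) : ℝ) : ℂ)) := by
  have : IsProbabilityMeasure (volume.restrict (Set.Ioo (0:ℝ) 1)) := ⟨by simp⟩
  obtain ⟨β, hβ, hle⟩ := exists_tendsto_integral_min_le
  have hdiff : Tendsto (fun T : ℝ =>
      charFun (shiftedLogZetaLaw δ T : Measure (EuclideanSpace ℝ (Fin m))) x -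
      ∫ ω in Set.Ioo (0:ℝ) 1, Complex.exp ((∑ k, x k *
      ((Real.sqrt (1 / 2 * Real.log (Real.log T)))⁻¹ * (primeSum (mollX T)
        (1 / 2 + ((ω * T + Real.log T ^ (-(δ k)) : ℝ) : ℂ) * Complex.I)).re) : ℝ) * Complex.I))
      atTop (𝓝 0) := by
    have h0 : Tendsto (fun T => ∑ k, (2 + 2 * |x k|) * β T) atTop (𝓝 0) := by
      have := tendsto_finsetSum Finset.univ fun k _ => hβ.const_mul (2 + 2 * |x k|)
      simpa using this
    refine squeeze_zero_norm' ?_ h0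
    filter_upwards [hle, eventually_paramBounds 1] with T hT hp
    have hl : 1 ≤ Real.log (Real.log T) := hp.one_le_loglog
    have hL : 1 ≤ Real.log T := by
      by_contra h
      push Not at h
      have h2 : 0 ≤ Real.log T := Real.log_nonneg (by linarith [hp.three_le])
      linarith [Real.log_nonpos h2 h.le]
    have hpc : ∀ h : ℝ, Continuous fun ω : ℝ =>
        (primeSum (mollX T) (1 / 2 + ((ω * T + h : ℝ) : ℂ) * Complex.I)).re := by
      intro h
      simp only [primeSum]
      refine Complex.continuous_re.comp (continuous_finsetSum _ fun p hp => ?_)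
      have hp0 : (p : ℂ) ≠ 0 := by exact_mod_cast (Nat.mem_primesLE.1 hp).2.ne_zero
      exact Continuous.const_cpow (by fun_prop) (Or.inl hp0)
    set u : Fin m → ℝ → ℝ := fun k ω => |Real.log ‖riemannZeta (1 / 2 +
        ((ω * T + Real.log T ^ (-(δ k)) : ℝ) : ℂ) * Complex.I)‖ - (primeSum (mollX T)
          (1 / 2 + ((ω * T + Real.log T ^ (-(δ k)) : ℝ) : ℂ) * Complex.I)).re| /
        Real.sqrt (Real.log (Real.log T)) with hu
    have hum : ∀ k, Measurable (u k) := fun k =>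
      (((measurable_log_norm_riemannZeta_half_add T _).sub (hpc _).measurable).abs).div_const _
    have hu0 : ∀ k ω, 0 ≤ u k ω := fun k ω => by positivity
    have humi : ∀ k, Integrable (fun ω => min 1 (u k ω)) (volume.restrict (Set.Ioo (0:ℝ) 1)) := by
      intro k
      refine (integrable_const (1:ℝ)).mono' (measurable_const.min (hum k)).aestronglyMeasurable
        (Eventually.of_forall fun ω => ?_)
      rw [Real.norm_eq_abs, abs_of_nonneg (le_min zero_le_one (hu0 k ω))]
      exact min_le_left _ _
    have hexp : ∀ F : ℝ → ℝ, Measurable F → Integrable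
        (fun ω => Complex.exp ((F ω : ℝ) * Complex.I)) (volume.restrict (Set.Ioo (0:ℝ) 1)) := by
      intro F hF
      refine (integrable_const (1:ℝ)).mono' (by fun_prop) (Eventually.of_forall fun ω => ?_)
      rw [Complex.norm_exp_ofReal_mul_I]
    rw [charFun_shiftedLogZetaLaw, ← integral_sub
      (hexp _ (Finset.measurable_fun_sum _ fun k _ =>
        (measurable_pi_iff.1 (measurable_shiftedLogZeta δ T) k).const_mul _))
      (hexp _ (Finset.measurable_fun_sum _ fun k _ =>
        ((hpc _).measurable.const_mul _).const_mul _))]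
    calc _ ≤ ∫ ω in Set.Ioo (0:ℝ) 1, ∑ k, (2 + 2 * |x k|) * min 1 (u k ω) := by
          refine norm_integral_le_of_norm_le
            (integrable_finsetSum _ fun k _ => (humi k).const_mul _) (Eventually.of_forall fun ω => ?_)
          refine norm_exp_mul_I_sub_exp_mul_I_le_sum _ (fun k => u k ω) (fun k => hu0 k ω) ?_
          rw [← Finset.sum_sub_distrib]
          refine (Finset.abs_sum_le_sum_abs _ _).trans (Finset.sum_le_sum fun k _ => ?_)
          rw [shiftedLogZeta, ← mul_sub, ← mul_sub, abs_mul, abs_mul, abs_of_nonneg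
            (inv_nonneg.2 (Real.sqrt_nonneg _)), mul_comm 2 |x k|, mul_assoc]
          refine mul_le_mul_of_nonneg_left ?_ (abs_nonneg _)
          rw [hu]
          simp only
          rw [mul_div_assoc', mul_div_right_comm]
          refine mul_le_mul_of_nonneg_right ?_ (abs_nonneg _)
          rw [inv_le_iff_one_le_mul₀ (by positivity), div_mul_eq_mul_div,
            le_div_iff₀ (by positivity), one_mul, ← Real.sqrt_sq (show (0:ℝ) ≤ 2 by norm_num),
            ← Real.sqrt_mul (by norm_num)]
          exact Real.sqrt_le_sqrt (by linarith)
      _ = ∑ k, (2 + 2 * |x k|) * ∫ ω in Set.Ioo (0:ℝ) 1, min 1 (u k ω) := by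
          rw [integral_finsetSum _ fun k _ => (humi k).const_mul _]
          exact Finset.sum_congr rfl fun k _ => integral_const_mul _ _
      _ ≤ _ := Finset.sum_le_sum fun k _ => mul_le_mul_of_nonneg_left
          (hT _ ⟨by positivity, Real.rpow_le_one_of_one_le_of_nonpos hL (by linarith [(hδ k).1])⟩)
          (by positivity)
  have := hdiff.add (tendsto_integral_exp_primeSum x hδ)
  simpa using this

theorem covariance_quadratic_nonneg (hδ : ∀ k, δ k ∈ Set.Icc (0:ℝ) 1) (x : Fin m → ℝ) :
    0 ≤ ∑ k, ∑ j, x k * x j * (if δ k = δ j then 1 else min (δ k) (δ j)) := by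
  have h := (tendsto_charFun_shiftedLogZetaLaw hδ (WithLp.toLp 2 x)).norm
  have h1 := le_of_tendsto h (Eventually.of_forall fun T => norm_charFun_le_one _)
  rw [Complex.norm_real, Real.norm_eq_abs, Real.abs_exp, Real.exp_le_one_iff] at h1
  simp only at h1
  linarith

end

theorem dotProduct_of_mulVec {m : ℕ} (C : Fin m → Fin m → ℝ) (x : Fin m → ℝ) :
    dotProduct x (Matrix.mulVec (Matrix.of C) x) = ∑ i, ∑ j, x i * x j * C i j := by
  simp only [dotProduct, Matrix.mulVec, Matrix.of_apply, Finset.mul_sum]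
  refine Finset.sum_congr rfl fun i _ => Finset.sum_congr rfl fun j _ => ?_
  ring

theorem isCenteredRealGaussianVector_map_multivariateGaussian {m : ℕ} {C : Fin m → Fin m → ℝ}
    (hC : (Matrix.of C).PosSemidef) : IsCenteredRealGaussianVector
      ((ProbabilityTheory.multivariateGaussian 0 (Matrix.of C)).map WithLp.ofLp) C := by
  have hm : Measurable (WithLp.ofLp : EuclideanSpace ℝ (Fin m) → Fin m → ℝ) :=
    WithLp.measurable_ofLp 2 _
  refine ⟨Measure.isProbabilityMeasure_map hm.aemeasurable, fun μ => ?_⟩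
  have hl : Measurable fun x : Fin m → ℝ => ∑ i, μ i * x i := by fun_prop
  have hS : 0 ≤ ∑ i, ∑ j, μ i * μ j * C i j := by
    rw [← dotProduct_of_mulVec]
    exact hC.dotProduct_mulVec_nonneg μ
  have : IsProbabilityMeasure ((((ProbabilityTheory.multivariateGaussian 0 (Matrix.of C)).map
      WithLp.ofLp)).map fun x => ∑ i, μ i * x i) := by
    have := Measure.isProbabilityMeasure_map
      (μ := ProbabilityTheory.multivariateGaussian 0 (Matrix.of C)) hm.aemeasurable
    exact Measure.isProbabilityMeasure_map hl.aemeasurable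
  refine Measure.ext_of_charFun (funext fun s => ?_)
  rw [ProbabilityTheory.charFun_gaussianReal, charFun_apply_real, Measure.map_map hl hm,
    integral_map (hl.comp hm).aemeasurable (by fun_prop)]
  have h1 := ProbabilityTheory.charFun_multivariateGaussian (μ := 0) hC (WithLp.toLp 2 (s • μ))
  rw [charFun_apply] at h1
  have h2 : ∀ x : EuclideanSpace ℝ (Fin m), inner ℝ x (WithLp.toLp 2 (s • μ)) =
      s * ∑ i, μ i * x i := by
    intro x
    rw [PiLp.inner_apply, Finset.mul_sum]
    refine Finset.sum_congr rfl fun i _ => ?_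
    simp
    ring
  simp_rw [h2] at h1
  simp only [Function.comp, ← Complex.ofReal_mul]
  rw [h1, inner_zero_right, dotProduct_of_mulVec, Real.coe_toNNReal _ hS]
  congr 1
  have h3 : ∑ i, ∑ j, (s • μ) i * (s • μ) j * C i j =
      (∑ i, ∑ j, μ i * μ j * C i j) * s ^ 2 := by
    simp only [Finset.sum_mul, Pi.smul_apply, smul_eq_mul]
    refine Finset.sum_congr rfl fun i _ => Finset.sum_congr rfl fun j _ => ?_
    ring
  rw [h3]
  push_cast
  ring

/-- Finite dimensional distributions of
`δ ↦ (log log t)^{-1/2} log |ζ(1/2 + iωt + i (log t)^{-δ})|` converge to those of a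
centered Gaussian process with covariance `Γ_{γ,δ} = γ ∧ δ` off the diagonal and `1` on it. -/
theorem zeta_mesoscopic_process_clt
    (m : ℕ) (hm : 1 ≤ m) (δ : Fin m → ℝ)
    (hδmem : ∀ k, δ k ∈ Set.Icc (0:ℝ) 1)
    (hδdist : Function.Injective δ) :
    ∃ γ : Measure (Fin m → ℝ),
      IsCenteredRealGaussianVector γ
        (fun k l => if k = l then 1 else min (δ k) (δ l)) ∧
      ∀ g : BoundedContinuousFunction (Fin m → ℝ) ℝ,
        Tendsto (fun t => ∫ ω in Set.Ioo (0:ℝ) 1,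
            g (fun k => (Real.sqrt ((1/2) * Real.log (Real.log t)))⁻¹ *
              (logZeta (1/2) (ω * t + (Real.log t) ^ (-(δ k)))).re))
          atTop (𝓝 (∫ x, g x ∂γ)) := by
  set C : Fin m → Fin m → ℝ := fun k l => if k = l then 1 else min (δ k) (δ l) with hCdef
  have hCeq : ∀ x : Fin m → ℝ, ∑ k, ∑ j, x k * x j * (if δ k = δ j then 1 else min (δ k) (δ j)) =
      ∑ k, ∑ j, x k * x j * C k j := by
    intro x
    simp only [hCdef, hδdist.eq_iff]
  have hC : (Matrix.of C).PosSemidef := by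
    refine Matrix.PosSemidef.of_dotProduct_mulVec_nonneg ?_ fun x => ?_
    · ext k l
      simp only [hCdef, Matrix.conjTranspose_apply, Matrix.of_apply, star_trivial, eq_comm (a := l),
        min_comm (δ l)]
    · rw [star_trivial, dotProduct_of_mulVec, ← hCeq]
      exact covariance_quadratic_nonneg hδmem x
  refine ⟨_, isCenteredRealGaussianVector_map_multivariateGaussian hC, fun g => ?_⟩
  refine tendsto_of_seq_tendsto fun T hT => ?_
  have hlaw : Tendsto (fun n => shiftedLogZetaLaw δ (T n)) atTop
      (𝓝 ⟨ProbabilityTheory.multivariateGaussian 0 (Matrix.of C), inferInstance⟩) := by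
    refine ProbabilityMeasure.tendsto_iff_tendsto_charFun.2 fun x => ?_
    have h1 := (tendsto_charFun_shiftedLogZetaLaw hδmem x).comp hT
    have h2 : charFun (ProbabilityTheory.multivariateGaussian 0 (Matrix.of C)) x =
        ((Real.exp (-(∑ k, ∑ j, x k * x j *
          (if δ k = δ j then 1 else min (δ k) (δ j))) / 2) : ℝ) : ℂ) := by
      rw [ProbabilityTheory.charFun_multivariateGaussian hC, inner_zero_right,
        dotProduct_of_mulVec, hCeq]
      push_cast
      congr 1
      ring
    rw [← h2] at h1
    exact h1
  have hcont : Continuous (WithLp.ofLp : EuclideanSpace ℝ (Fin m) → Fin m → ℝ) :=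
    PiLp.continuous_ofLp 2 _
  have h2 := ProbabilityMeasure.tendsto_iff_forall_integral_tendsto.1 hlaw
    (g.compContinuous ⟨_, hcont⟩)
  rw [integral_map (WithLp.measurable_ofLp 2 _).aemeasurable
    g.continuous.measurable.aestronglyMeasurable]
  refine h2.congr' ?_
  filter_upwards [hT.eventually_gt_atTop 0] with n hn
  rw [integral_shiftedLogZetaLaw δ (T n)
    (g.compContinuous ⟨_, hcont⟩).continuous.stronglyMeasurable]
  refine integral_congr_ae (ae_restrict_of_ae ?_)
  filter_upwards [ae_logZeta_half_re_eq δ hn.ne'] with ω hω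
  rw [hω]
  rfl
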